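/- Under assumptions (A1)-(A3), the semigroup P_t of the segment process has a unique invariant probability measure μ∞, and μ∞ has finite polynomial moments of all orders: μ∞(‖·‖_∞^p) < ∞ for every p ≥ 1. -/

import Mathlib

open MeasureTheory ProbabilityTheory Filter Set
open scoped RealInnerProductSpace ENNReal NNReal Topology

noncomputable section

/-- Euclidean state space `ℝ^d`. -/
abbrev EucSp (d : ℕ) := EuclideanSpace ℝ (Fin d)

/-- The path (segment) space `𝒞 = C([-r₀,0];ℝ^d)` with the uniform norm. -/
abbrev Seg (d : ℕ) (r₀ : ℝ) := C(Set.Icc (-r₀) (0:ℝ), EucSp d)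

instance (d : ℕ) (r₀ : ℝ) : MeasurableSpace (Seg d r₀) := borel _
instance (d : ℕ) (r₀ : ℝ) : BorelSpace (Seg d r₀) := ⟨rfl⟩

/-- Evaluation of a segment at time `0`. -/
def ev0 {d : ℕ} {r₀ : ℝ} (h : 0 < r₀) (ξ : Seg d r₀) : EucSp d :=
  ξ ⟨0, ⟨neg_nonpos.mpr h.le, le_rfl⟩⟩

/-- The setting of the path-dependent SDE `dX(t) = b(X_t)dt + σ(X_t)dW(t)` under
assumptions (A1) (continuity), (A2) (dissipativity) and (A3) (invertibility).
`Y ξ` is the real-time solution path started from the initial segment `ξ`, `X ξ t` is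
the associated segment (window) process, adapted to the filtration `ℱ`.  The SDE itself
is encoded through the Stroock–Varadhan martingale-problem formulation (`hSDE₁`,
`hSDE₂`), which characterizes (weak) solutions driven by a `d`-dimensional Brownian
motion, and `hMarkov` is the Markov (Chapman–Kolmogorov) property of the segment
process. -/
structure PathSDE (d : ℕ) (r₀ : ℝ) (Ω : Type) [mΩ : MeasurableSpace Ω]
    (P : Measure Ω) where
  hr₀ : 0 < r₀
  hP : IsProbabilityMeasure P
  b : Seg d r₀ → EucSp d
  σ : Seg d r₀ → (EucSp d →L[ℝ] EucSp d)
  ℱ : Filtration ℝ mΩ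
  Y : Seg d r₀ → Ω → ℝ → EucSp d
  X : Seg d r₀ → ℝ → Ω → Seg d r₀
  hYcont : ∀ ξ ω, Continuous (Y ξ ω)
  hY0 : ∀ (ξ : Seg d r₀) (ω : Ω) (θ : Set.Icc (-r₀) (0:ℝ)), Y ξ ω θ.1 = ξ θ
  hX : ∀ (ξ : Seg d r₀), ∀ t ≥ (0:ℝ), ∀ (ω : Ω) (θ : Set.Icc (-r₀) (0:ℝ)),
    X ξ t ω θ = Y ξ ω (t + θ.1)
  hXadapted : ∀ (ξ : Seg d r₀), ∀ t ≥ (0:ℝ),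
    @MeasureTheory.StronglyMeasurable Ω (Seg d r₀) _ (ℱ t) (X ξ t)
  -- (A1) continuity assumptions
  hA1σ : ∃ L : ℝ≥0, LipschitzWith L σ
  hA1bcont : Continuous b
  hA1bbdd : ∀ R : ℝ, ∃ C : ℝ, ∀ ξ : Seg d r₀, ‖ξ‖ ≤ R → ‖b ξ‖ ≤ C
  -- (A2) dissipativity
  hA2 : ∃ l₁ l₂ : ℝ, 0 < l₁ ∧ 0 < l₂ ∧ l₂ * Real.exp (l₁ * r₀) < l₁ ∧
    ∀ ξ η : Seg d r₀,
      2 * ⟪ev0 hr₀ ξ - ev0 hr₀ η, b ξ - b η⟫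
        ≤ -l₁ * ‖ev0 hr₀ ξ - ev0 hr₀ η‖ ^ 2 + l₂ * ‖ξ - η‖ ^ 2
  -- (A3) invertibility and boundedness of σ
  σinv : Seg d r₀ → (EucSp d →L[ℝ] EucSp d)
  hσinv : ∀ ξ, (σ ξ).comp (σinv ξ) = ContinuousLinearMap.id ℝ (EucSp d) ∧
      (σinv ξ).comp (σ ξ) = ContinuousLinearMap.id ℝ (EucSp d)
  hA3 : ∃ C : ℝ, ∀ ξ, ‖σ ξ‖ + ‖σinv ξ‖ ≤ C
  -- martingale problem formulation of the SDE (weak solution)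
  hSDE₁ : ∀ (ξ : Seg d r₀) (u : EucSp d),
    Martingale (fun t ω =>
      ⟪u, Y ξ ω (max t 0)⟫ - ⟪u, ev0 hr₀ ξ⟫
        - ∫ s in (0:ℝ)..(max t 0), ⟪u, b (X ξ s ω)⟫) ℱ P
  hSDE₂ : ∀ (ξ : Seg d r₀) (u v : EucSp d),
    Martingale (fun t ω =>
      (⟪u, Y ξ ω (max t 0)⟫ - ⟪u, ev0 hr₀ ξ⟫
        - ∫ s in (0:ℝ)..(max t 0), ⟪u, b (X ξ s ω)⟫) *
      (⟪v, Y ξ ω (max t 0)⟫ - ⟪v, ev0 hr₀ ξ⟫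
        - ∫ s in (0:ℝ)..(max t 0), ⟪v, b (X ξ s ω)⟫)
      - ∫ s in (0:ℝ)..(max t 0),
          ⟪(ContinuousLinearMap.adjoint (σ (X ξ s ω))) u,
            (ContinuousLinearMap.adjoint (σ (X ξ s ω))) v⟫) ℱ P
  -- Markov property (Chapman–Kolmogorov) of the segment process
  hMarkov : ∀ (f : Seg d r₀ → ℝ), Measurable f → (∃ C, ∀ ζ, |f ζ| ≤ C) →
    ∀ s ≥ (0:ℝ), ∀ t ≥ (0:ℝ), ∀ ξ,
      (∫ ω, f (X ξ (s + t) ω) ∂P) = ∫ ω, ∫ ω', f (X (X ξ s ω) t ω') ∂P ∂P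

variable {d : ℕ} {r₀ : ℝ} {Ω : Type} [mΩ : MeasurableSpace Ω] {P : Measure Ω}

/-- The Markov semigroup `P_t f(ξ) = E f(X_t^ξ)`. -/
def PathSDE.Pt (S : PathSDE d r₀ Ω P) (t : ℝ) (f : Seg d r₀ → ℝ) (ξ : Seg d r₀) : ℝ :=
  ∫ ω, f (S.X ξ t ω) ∂P

/-- `μ` is an invariant probability measure of the semigroup `P_t`. -/
def PathSDE.Invariant (S : PathSDE d r₀ Ω P) (μ : Measure (Seg d r₀)) : Prop :=
  IsProbabilityMeasure μ ∧
  ∀ (f : Seg d r₀ → ℝ), Measurable f → (∃ C, ∀ ζ, |f ζ| ≤ C) →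
    ∀ t ≥ (0:ℝ), ∫ ξ, S.Pt t f ξ ∂μ = ∫ ξ, f ξ ∂μ

/-- The quasi-metric `ρ_{p,γ}(ξ,η) = (1 ∧ ‖ξ-η‖_∞^γ) √(1+‖ξ‖_∞^p+‖η‖_∞^p)`. -/
def qdist (p γ : ℝ) (ξ η : Seg d r₀) : ℝ :=
  min 1 (‖ξ - η‖ ^ γ) * Real.sqrt (1 + ‖ξ‖ ^ p + ‖η‖ ^ p)

/-- The norm `‖f‖_{p,γ}` on the class `C_{p,γ}(𝒞)` (with the convention `x/0 = 0`,
so that the diagonal does not contribute to the second supremum). -/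
def pgNorm (p γ : ℝ) (f : Seg d r₀ → ℝ) : ℝ :=
  (⨆ ξ : Seg d r₀, |f ξ| / (1 + ‖ξ‖ ^ (p / 2))) +
  ⨆ q : Seg d r₀ × Seg d r₀, |f q.1 - f q.2| / qdist p γ q.1 q.2

/-- Membership in the class `C_{p,γ}(𝒞)`: continuity together with finiteness of the
two suprema defining `‖f‖_{p,γ}`. -/
def MemCpg (p γ : ℝ) (f : Seg d r₀ → ℝ) : Prop :=
  Continuous f ∧
  BddAbove (Set.range fun ξ : Seg d r₀ => |f ξ| / (1 + ‖ξ‖ ^ (p / 2))) ∧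
  BddAbove (Set.range fun q : Seg d r₀ × Seg d r₀ => |f q.1 - f q.2| / qdist p γ q.1 q.2)

/-- The additive functional `A_t^f(ξ) = (1/t)∫₀^t f(X_s^ξ) ds`. -/
def timeAvg (S : PathSDE d r₀ Ω P) (f : Seg d r₀ → ℝ) (ξ : Seg d r₀) (t : ℝ) (ω : Ω) : ℝ :=
  (∫ s in (0:ℝ)..t, f (S.X ξ s ω)) / t

/-- `π` is a coupling of `μ` and `ν`. -/
def IsCoupling (μ ν : Measure (Seg d r₀)) (π : Measure (Seg d r₀ × Seg d r₀)) : Prop :=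
  π.map Prod.fst = μ ∧ π.map Prod.snd = ν

/-- Membership in `𝒫_{p,γ}(𝒞)`: probability measures with `(μ×μ)(ρ_{p,γ}) < ∞`. -/
def MemPpg (p γ : ℝ) (μ : Measure (Seg d r₀)) : Prop :=
  IsProbabilityMeasure μ ∧
    Integrable (fun q : Seg d r₀ × Seg d r₀ => qdist p γ q.1 q.2) (μ.prod μ)

/-- The Wasserstein "distance" `W_{p,γ}` associated with the quasi-metric `ρ_{p,γ}`. -/
def Wpg (p γ : ℝ) (μ ν : Measure (Seg d r₀)) : ℝ :=
  sInf {r : ℝ | ∃ π : Measure (Seg d r₀ × Seg d r₀),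
    IsCoupling μ ν π ∧ r = ∫ q, qdist p γ q.1 q.2 ∂π}

/-- `μ P_t`: the law of the segment `X_t` when `X_0` is distributed as `μ`. -/
def PathSDE.lawAt (S : PathSDE d r₀ Ω P) (μ : Measure (Seg d r₀)) (t : ℝ) :
    Measure (Seg d r₀) :=
  μ.bind fun ξ => P.map (S.X ξ t)

/-- The corrector `R_f(ξ) = ∫₀^∞ {P_t f(ξ) − μ∞(f)} dt`. -/
def Rcorr (S : PathSDE d r₀ Ω P) (μinf : Measure (Seg d r₀)) (f : Seg d r₀ → ℝ)
    (ξ : Seg d r₀) : ℝ :=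
  ∫ t in Set.Ioi (0:ℝ), (S.Pt t f ξ - ∫ η, f η ∂μinf)

/-- `φ_f(ξ) = E|∫₀¹ f(X_r^ξ)dr + R_f(X_1^ξ) − R_f(ξ)|²`. -/
def phiF (S : PathSDE d r₀ Ω P) (μinf : Measure (Seg d r₀)) (f : Seg d r₀ → ℝ)
    (ξ : Seg d r₀) : ℝ :=
  ∫ ω, ((∫ r in (0:ℝ)..1, f (S.X ξ r ω))
      + Rcorr S μinf f (S.X ξ 1 ω) - Rcorr S μinf f ξ) ^ 2 ∂P

/-- `D_f = √(μ∞(φ_f))`. -/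
def DF (S : PathSDE d r₀ Ω P) (μinf : Measure (Seg d r₀)) (f : Seg d r₀ → ℝ) : ℝ :=
  Real.sqrt (∫ ξ, phiF S μinf f ξ ∂μinf)

/-- `Φ_D`: distribution function of the centered normal law with variance `D`
(`Φ_0 = 1_{[0,∞)}`). -/
def PhiD (D : ℝ) (z : ℝ) : ℝ :=
  if D = 0 then (if 0 ≤ z then 1 else 0)
  else (gaussianReal 0 D.toNNReal (Set.Iic z)).toReal

/-- `R̂_f(ξ) = Σ_{k=0}^∞ P_k f(ξ)` (discrete corrector, for `μ∞(f) = 0`). -/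
def Rhat (S : PathSDE d r₀ Ω P) (f : Seg d r₀ → ℝ) (ξ : Seg d r₀) : ℝ :=
  ∑' k : ℕ, S.Pt (k : ℝ) f ξ

/-- `φ̂_f(ξ) = E|f(ξ) + R̂_f(X_1^ξ) − R̂_f(ξ)|²`. -/
def phiHat (S : PathSDE d r₀ Ω P) (f : Seg d r₀ → ℝ) (ξ : Seg d r₀) : ℝ :=
  ∫ ω, (f ξ + Rhat S f (S.X ξ 1 ω) - Rhat S f ξ) ^ 2 ∂P

/-- `D̂_f = √(μ∞(φ̂_f))`. -/
def Dhat (S : PathSDE d r₀ Ω P) (μinf : Measure (Seg d r₀)) (f : Seg d r₀ → ℝ) : ℝ :=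
  Real.sqrt (∫ ξ, phiHat S f ξ ∂μinf)

set_option linter.unusedSectionVars false

/-- A continuous square-integrable real process `N` on `[s, ∞)` which is a martingale whose bracket
is `∫ q` with a continuous density `0 ≤ q ≤ C`. The two martingale properties are expressed against
bounded test variables known at the earlier time. -/
structure IsBracketMart {Ω : Type*} [mΩ : MeasurableSpace Ω] (P : Measure Ω)
    (𝒢 : Filtration ℝ mΩ) (s C : ℝ) (N q : ℝ → Ω → ℝ) : Prop where
  cont : ∀ ω, Continuous fun r => N r ω
  meas : ∀ r, s ≤ r → StronglyMeasurable[𝒢 r] (N r)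
  memLp : ∀ r, s ≤ r → MemLp (N r) 2 P
  qcont : ∀ ω, Continuous fun r => q r ω
  qmeas : ∀ r, StronglyMeasurable (q r)
  qnonneg : ∀ r ω, 0 ≤ q r ω
  qle : ∀ r ω, q r ω ≤ C
  mart : ∀ r₁ r₂, s ≤ r₁ → r₁ ≤ r₂ → ∀ g : Ω → ℝ, StronglyMeasurable[𝒢 r₁] g →
    (∃ c, ∀ ω, |g ω| ≤ c) → ∫ ω, g ω * (N r₂ ω - N r₁ ω) ∂P = 0
  quad : ∀ r₁ r₂, s ≤ r₁ → r₁ ≤ r₂ → ∀ g : Ω → ℝ, StronglyMeasurable[𝒢 r₁] g →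
    (∃ c, ∀ ω, |g ω| ≤ c) →
    ∫ ω, g ω * (N r₂ ω - N r₁ ω) ^ 2 ∂P = ∫ ω, g ω * (∫ u in r₁..r₂, q u ω) ∂P

namespace IsBracketMart

variable {Ω : Type*} [mΩ : MeasurableSpace Ω] {P : Measure Ω} [IsProbabilityMeasure P]
  {𝒢 : Filtration ℝ mΩ} {s C : ℝ} {N q : ℝ → Ω → ℝ}

lemma C_nonneg (h : IsBracketMart P 𝒢 s C N q) : 0 ≤ C := by
  have : Nonempty Ω := P.nonempty_of_neZero
  obtain ⟨ω⟩ := this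
  exact (h.qnonneg 0 ω).trans (h.qle 0 ω)

lemma stronglyMeasurable (h : IsBracketMart P 𝒢 s C N q) {r : ℝ} (hr : s ≤ r) :
    StronglyMeasurable (N r) := (h.meas r hr).mono (𝒢.le r)

lemma stronglyMeasurable_q_uncurry (h : IsBracketMart P 𝒢 s C N q) :
    StronglyMeasurable (fun p : Ω × ℝ => q p.2 p.1) := by
  have := stronglyMeasurable_uncurry_of_continuous_of_stronglyMeasurable
    (u := fun (r : ℝ) (ω : Ω) => q r ω) (fun ω => h.qcont ω) h.qmeas
  exact this.comp_measurable measurable_swap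

lemma stronglyMeasurable_integral_q (h : IsBracketMart P 𝒢 s C N q) (a b : ℝ) :
    StronglyMeasurable (fun ω => ∫ u in a..b, q u ω) := by
  simp only [intervalIntegral]
  exact (h.stronglyMeasurable_q_uncurry.integral_prod_right).sub
    (h.stronglyMeasurable_q_uncurry.integral_prod_right)

lemma integral_q_nonneg (h : IsBracketMart P 𝒢 s C N q) {a b : ℝ} (hab : a ≤ b) (ω : Ω) :
    0 ≤ ∫ u in a..b, q u ω :=
  intervalIntegral.integral_nonneg hab fun u _ => h.qnonneg u ω

lemma integral_q_le (h : IsBracketMart P 𝒢 s C N q) {a b : ℝ} (hab : a ≤ b) (ω : Ω) :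
    ∫ u in a..b, q u ω ≤ C * (b - a) := by
  calc ∫ u in a..b, q u ω ≤ ∫ u in a..b, C :=
        intervalIntegral.integral_mono_on hab ((h.qcont ω).intervalIntegrable _ _)
          (by simp) fun u _ => h.qle u ω
    _ = C * (b - a) := by simp [mul_comm]

lemma integrable_sq (h : IsBracketMart P 𝒢 s C N q) {r : ℝ} (hr : s ≤ r) :
    Integrable (fun ω => N r ω ^ 2) P := (h.memLp r hr).integrable_sq

lemma integrable_sub_sq (h : IsBracketMart P 𝒢 s C N q) {r₁ r₂ : ℝ} (h₁ : s ≤ r₁) (h₂ : s ≤ r₂) :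
    Integrable (fun ω => (N r₂ ω - N r₁ ω) ^ 2) P :=
  ((h.memLp r₂ h₂).sub (h.memLp r₁ h₁)).integrable_sq

lemma integral_mul_sub_sq_le (h : IsBracketMart P 𝒢 s C N q) {r₁ r₂ : ℝ} (h₁ : s ≤ r₁)
    (h₁₂ : r₁ ≤ r₂) {g : Ω → ℝ} (hg : StronglyMeasurable[𝒢 r₁] g) {c : ℝ} (hgc : ∀ ω, |g ω| ≤ c)
    (hg0 : ∀ ω, 0 ≤ g ω) :
    ∫ ω, g ω * (N r₂ ω - N r₁ ω) ^ 2 ∂P ≤ C * (r₂ - r₁) * ∫ ω, g ω ∂P := by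
  rw [h.quad r₁ r₂ h₁ h₁₂ g hg ⟨c, hgc⟩, ← integral_const_mul]
  have hgi : Integrable g P := by
    refine Integrable.of_bound (hg.mono (𝒢.le _)).aestronglyMeasurable c (ae_of_all _ ?_)
    simpa using hgc
  refine integral_mono ?_ (hgi.const_mul _) fun ω => ?_
  · refine hgi.mul_bdd (c := C * (r₂ - r₁))
      (h.stronglyMeasurable_integral_q _ _).aestronglyMeasurable (ae_of_all _ fun ω => ?_)
    rw [Real.norm_eq_abs, abs_of_nonneg (h.integral_q_nonneg h₁₂ ω)]
    exact h.integral_q_le h₁₂ ω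
  · have := h.integral_q_le h₁₂ ω
    have := hg0 ω
    simp only
    nlinarith

lemma setIntegral_sub_sq_le (h : IsBracketMart P 𝒢 s C N q) {r₁ r₂ : ℝ} (h₁ : s ≤ r₁)
    (h₁₂ : r₁ ≤ r₂) {A : Set Ω} (hA : MeasurableSet[𝒢 r₁] A) :
    ∫ ω in A, (N r₂ ω - N r₁ ω) ^ 2 ∂P ≤ C * (r₂ - r₁) * P.real A := by
  have hA' : MeasurableSet A := 𝒢.le _ _ hA
  have := h.integral_mul_sub_sq_le h₁ h₁₂ (g := A.indicator fun _ => (1:ℝ)) (c := 1)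
    (stronglyMeasurable_const.indicator hA)
    (fun ω => by by_cases hω : ω ∈ A <;> simp [hω]) (fun ω => by by_cases hω : ω ∈ A <;> simp [hω])
  rw [integral_indicator_const _ hA', smul_eq_mul, mul_one] at this
  rw [← integral_indicator hA']
  refine le_of_eq_of_le (integral_congr_ae (ae_of_all _ fun ω => ?_)) this
  by_cases hω : ω ∈ A <;> simp [hω]

lemma setIntegral_sq_le (h : IsBracketMart P 𝒢 s C N q) {r₁ r₂ : ℝ} (h₁ : s ≤ r₁)
    (h₁₂ : r₁ ≤ r₂) {A : Set Ω} (hA : MeasurableSet[𝒢 r₁] A) :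
    ∫ ω in A, N r₁ ω ^ 2 ∂P
      ≤ 2 * ∫ ω in A, N r₂ ω ^ 2 ∂P + 2 * (C * (r₂ - r₁) * P.real A) := by
  have hi := (h.integrable_sq (h₁.trans h₁₂)).integrableOn (s := A)
  have hi' := (h.integrable_sub_sq h₁ (h₁.trans h₁₂)).integrableOn (s := A)
  calc ∫ ω in A, N r₁ ω ^ 2 ∂P
      ≤ ∫ ω in A, (2 * N r₂ ω ^ 2 + 2 * (N r₂ ω - N r₁ ω) ^ 2) ∂P := by
        refine setIntegral_mono (h.integrable_sq h₁).integrableOn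
          ((hi.const_mul 2).add (hi'.const_mul 2)) fun ω => ?_
        simp only
        nlinarith [sq_nonneg (2 * N r₂ ω - N r₁ ω)]
    _ = 2 * ∫ ω in A, N r₂ ω ^ 2 ∂P + 2 * ∫ ω in A, (N r₂ ω - N r₁ ω) ^ 2 ∂P := by
        rw [integral_add (hi.const_mul 2) (hi'.const_mul 2), integral_const_mul,
          integral_const_mul]
    _ ≤ _ := by
        gcongr
        exact h.setIntegral_sub_sq_le h₁ h₁₂ hA

end IsBracketMart

/-- The `j`-th point of the uniform partition of `[s, t]` into `m` pieces. -/
def unifPt (s t : ℝ) (m j : ℕ) : ℝ := s + (t - s) * (j / m)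

lemma unifPt_zero (s t : ℝ) (m : ℕ) : unifPt s t m 0 = s := by simp [unifPt]

lemma unifPt_self (s t : ℝ) {m : ℕ} (hm : m ≠ 0) : unifPt s t m m = t := by
  simp [unifPt, hm]

lemma unifPt_succ_sub (s t : ℝ) (m j : ℕ) :
    unifPt s t m (j + 1) - unifPt s t m j = (t - s) / m := by
  simp only [unifPt]; push_cast; ring

lemma unifPt_mono {s t : ℝ} (hst : s ≤ t) (m : ℕ) : Monotone (unifPt s t m) := by
  intro i j hij
  have : 0 ≤ t - s := by linarith
  simp only [unifPt]
  gcongr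

lemma le_unifPt {s t : ℝ} (hst : s ≤ t) (m j : ℕ) : s ≤ unifPt s t m j := by
  have := unifPt_mono hst m (Nat.zero_le j)
  rwa [unifPt_zero] at this

lemma unifPt_le {s t : ℝ} (hst : s ≤ t) {m j : ℕ} (hj : j ≤ m) (hm : m ≠ 0) :
    unifPt s t m j ≤ t := by
  have := unifPt_mono hst m hj
  rwa [unifPt_self s t hm] at this

lemma tendsto_mesh (s t : ℝ) : Tendsto (fun m : ℕ => (t - s) / m) atTop (𝓝 0) :=
  tendsto_const_div_atTop_nhds_zero_nat _

/-- A continuous function has uniformly small increments along fine uniform partitions. -/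
lemma eventually_unifPt_dist_lt {E : Type*} [PseudoMetricSpace E] {f : ℝ → E} {s t : ℝ}
    (hst : s ≤ t) (hf : ContinuousOn f (Icc s t)) {ε : ℝ} (hε : 0 < ε) :
    ∀ᶠ m : ℕ in atTop, ∀ j < m, ∀ r ∈ Icc (unifPt s t m j) (unifPt s t m (j + 1)),
      dist (f r) (f (unifPt s t m j)) < ε := by
  have huc := isCompact_Icc.uniformContinuousOn_of_continuous hf
  rw [Metric.uniformContinuousOn_iff] at huc
  obtain ⟨δ, hδ, h⟩ := huc ε hε
  filter_upwards [(tendsto_mesh s t).eventually (gt_mem_nhds hδ), eventually_gt_atTop 0]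
    with m hm hm0 j hj r hr
  have h1 := le_unifPt hst m j
  have h2 := unifPt_le hst (Nat.succ_le_of_lt hj) hm0.ne'
  have h3 := unifPt_succ_sub s t m j
  refine h r ⟨h1.trans hr.1, hr.2.trans h2⟩ _ ⟨h1, (hr.1.trans hr.2).trans h2⟩ ?_
  rw [Real.dist_eq, abs_of_nonneg (by linarith [hr.1])]
  linarith [hr.2]

namespace IsBracketMart

variable {Ω : Type*} [mΩ : MeasurableSpace Ω] {P : Measure Ω} [IsProbabilityMeasure P]
  {𝒢 : Filtration ℝ mΩ} {s C : ℝ} {N q : ℝ → Ω → ℝ}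

/-- The increments of `N` along the first `j` steps of the partition are at most `ε`. -/
def smallIncr (N : ℝ → Ω → ℝ) (s t ε : ℝ) (m j : ℕ) : Set Ω :=
  {ω | ∀ i < j, |N (unifPt s t m (i + 1)) ω - N (unifPt s t m i) ω| ≤ ε}

lemma measurableSet_smallIncr (h : IsBracketMart P 𝒢 s C N q) {t : ℝ} (hst : s ≤ t) (ε : ℝ)
    (m j : ℕ) : MeasurableSet[𝒢 (unifPt s t m j)] (smallIncr N s t ε m j) := by
  have : smallIncr N s t ε m j = ⋂ i ∈ Finset.range j,
      {ω | |N (unifPt s t m (i + 1)) ω - N (unifPt s t m i) ω| ≤ ε} := by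
    ext ω; simp [smallIncr]
  rw [this]
  refine Finset.measurableSet_biInter _ fun i hi => ?_
  have hi' : i + 1 ≤ j := by simpa using hi
  have h1 : StronglyMeasurable[𝒢 (unifPt s t m j)] (N (unifPt s t m (i + 1))) :=
    (h.meas _ (le_unifPt hst _ _)).mono (𝒢.mono (unifPt_mono hst m hi'))
  have h2 : StronglyMeasurable[𝒢 (unifPt s t m j)] (N (unifPt s t m i)) :=
    (h.meas _ (le_unifPt hst _ _)).mono (𝒢.mono (unifPt_mono hst m (by omega)))
  have h3 := (h1.sub h2).norm
  exact h3.measurable measurableSet_Iic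

lemma integral_sq_le (h : IsBracketMart P 𝒢 s C N q) {r t : ℝ} (h₁ : s ≤ r) (h₂ : r ≤ t) :
    ∫ ω, N r ω ^ 2 ∂P ≤ 2 * ∫ ω, N t ω ^ 2 ∂P + 2 * (C * (t - s)) := by
  have := h.setIntegral_sq_le h₁ h₂ (MeasurableSet.univ)
  have hC := h.C_nonneg
  simp at this
  nlinarith

lemma measure_abs_gt_le (h : IsBracketMart P 𝒢 s C N q) {r t K : ℝ} (h₁ : s ≤ r) (h₂ : r ≤ t)
    (hK : 0 < K) : P.real {ω | K < |N r ω|}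
      ≤ (2 * ∫ ω, N t ω ^ 2 ∂P + 2 * (C * (t - s))) / K ^ 2 := by
  rw [le_div_iff₀ (by positivity), mul_comm]
  refine le_trans ?_ (h.integral_sq_le h₁ h₂)
  refine le_trans ?_ (mul_meas_ge_le_integral_of_nonneg (ae_of_all _ fun ω => sq_nonneg (N r ω))
    (h.integrable_sq h₁) (K ^ 2))
  refine mul_le_mul_of_nonneg_left
    (measureReal_mono (fun ω hω => ?_) (measure_ne_top _ _)) (by positivity)
  simp only [mem_setOf_eq] at hω ⊢
  rw [← sq_abs (N r ω)]
  gcongr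

/-- Bound for the contribution of large increments along a partition. -/
lemma sum_integral_sq_min_le (h : IsBracketMart P 𝒢 s C N q) {t : ℝ} (hst : s ≤ t) {ε K : ℝ}
    (hε : 0 < ε) (hK : 0 < K) {m : ℕ} (hm : m ≠ 0) :
    ∑ j ∈ Finset.range m, ∫ ω, (N (unifPt s t m (j + 1)) ω - N (unifPt s t m j) ω) ^ 2 *
        min 1 |N (unifPt s t m (j + 1)) ω - N (unifPt s t m j) ω| ∂P
      ≤ ε * (C * (t - s)) + C * (t - s) * P.real (smallIncr N s t ε m m)ᶜ
        + C * (t - s) * ((2 * ∫ ω, N t ω ^ 2 ∂P + 2 * (C * (t - s))) / K ^ 2)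
        + (4 * (∫ ω in (smallIncr N s t ε m m)ᶜ, N t ω ^ 2 ∂P)
          + 4 * (C * (t - s)) * P.real (smallIncr N s t ε m m)ᶜ
          + 2 * K ^ 2 * P.real (smallIncr N s t ε m m)ᶜ) := by
  have hC := h.C_nonneg
  set u := unifPt s t m with hu
  have hum : Monotone u := unifPt_mono hst m
  have hus : ∀ j, s ≤ u j := le_unifPt hst m
  have hut : ∀ j ≤ m, u j ≤ t := fun j hj => unifPt_le hst hj hm
  have hΔ : ∀ j, u (j + 1) - u j = (t - s) / m := unifPt_succ_sub s t m
  have hm' : (0:ℝ) < m := by positivity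
  set B := smallIncr N s t ε m with hB
  have hBm : ∀ j, MeasurableSet[𝒢 (u j)] (B j) := h.measurableSet_smallIncr hst ε m
  have hBm' : ∀ j, MeasurableSet (B j) := fun j => 𝒢.le _ _ (hBm j)
  have hBanti : ∀ i j, i ≤ j → B j ⊆ B i := fun i j hij ω hω k hk => hω k (by omega)
  set J : ℕ → Set Ω := fun j => B j \ B (j + 1) with hJ
  have hJm : ∀ j, MeasurableSet[𝒢 (u (j + 1))] (J j) := fun j =>
    (𝒢.mono (hum (Nat.le_succ j)) _ (hBm j)).diff (hBm (j + 1))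
  have hJm' : ∀ j, MeasurableSet (J j) := fun j => 𝒢.le _ _ (hJm j)
  have hJdisj : Pairwise (Function.onFun Disjoint J) := by
    intro i j hij
    wlog hlt : i < j generalizing i j
    · exact (this hij.symm (by omega)).symm
    refine Set.disjoint_left.2 fun ω hi hj => hi.2 (hBanti _ _ (by omega) hj.1)
  have hJsub : (⋃ j ∈ Finset.range m, J j) ⊆ (B m)ᶜ := by
    intro ω hω
    simp only [mem_iUnion, Finset.mem_range] at hω
    obtain ⟨j, hj, hω⟩ := hω
    exact fun hc => hω.2 (hBanti _ _ (by omega) hc)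
  have hsumJ : ∀ F : Ω → ℝ, (∀ ω, 0 ≤ F ω) → Integrable F P →
      ∑ j ∈ Finset.range m, ∫ ω in J j, F ω ∂P ≤ ∫ ω in (B m)ᶜ, F ω ∂P := by
    intro F hF hFi
    rw [← integral_biUnion_finset _ (fun j _ => hJm' j) (fun i _ j _ hij => hJdisj hij)
      (fun j _ => hFi.integrableOn)]
    exact setIntegral_mono_set hFi.integrableOn (ae_of_all _ hF) hJsub.eventuallyLE
  set D := (2 * ∫ ω, N t ω ^ 2 ∂P + 2 * (C * (t - s))) / K ^ 2 with hD
  have key : ∀ j ∈ Finset.range m,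
      ∫ ω, (N (u (j + 1)) ω - N (u j) ω) ^ 2 * min 1 |N (u (j + 1)) ω - N (u j) ω| ∂P
      ≤ ε * (C * ((t - s) / m)) + C * ((t - s) / m) * P.real (B m)ᶜ
        + C * ((t - s) / m) * D
        + (4 * (∫ ω in J j, N t ω ^ 2 ∂P) + 4 * (C * (t - s)) * (∫ ω in J j, (1:ℝ) ∂P)
          + 2 * K ^ 2 * (∫ ω in J j, (1:ℝ) ∂P)) := by
    intro j hj
    rw [Finset.mem_range] at hj
    have hsq := h.integrable_sub_sq (hus j) (hus (j + 1))
    have hKm : MeasurableSet[𝒢 (u j)] {ω | K < |N (u j) ω|} :=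
      (h.meas _ (hus j)).norm.measurable measurableSet_Ioi
    have hKm' := 𝒢.le _ _ hKm
    have i1 : Integrable (fun ω => ε * (N (u (j + 1)) ω - N (u j) ω) ^ 2) P := hsq.const_mul _
    have i2 := hsq.indicator (hBm' j).compl
    have i3 := hsq.indicator hKm'
    have i4 : Integrable ((J j).indicator fun ω => 2 * N (u (j + 1)) ω ^ 2 + 2 * K ^ 2) P :=
      (((h.integrable_sq (hus (j + 1))).const_mul 2).add (integrable_const _)).indicator (hJm' j)
    calc _ ≤ ∫ ω, (ε * (N (u (j + 1)) ω - N (u j) ω) ^ 2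
          + (B j)ᶜ.indicator (fun ω => (N (u (j + 1)) ω - N (u j) ω) ^ 2) ω
          + {ω | K < |N (u j) ω|}.indicator (fun ω => (N (u (j + 1)) ω - N (u j) ω) ^ 2) ω
          + (J j).indicator (fun ω => 2 * N (u (j + 1)) ω ^ 2 + 2 * K ^ 2) ω) ∂P := by
          refine integral_mono_of_nonneg (ae_of_all _ fun ω => by positivity)
            (((i1.add i2).add i3).add i4) (ae_of_all _ fun ω => ?_)
          have p1 : 0 ≤ (N (u (j + 1)) ω - N (u j) ω) ^ 2 := sq_nonneg _
          have n2 : 0 ≤ (B j)ᶜ.indicator (fun ω => (N (u (j + 1)) ω - N (u j) ω) ^ 2) ω :=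
            indicator_nonneg (fun _ _ => sq_nonneg _) _
          have n3 : 0 ≤ {ω | K < |N (u j) ω|}.indicator
              (fun ω => (N (u (j + 1)) ω - N (u j) ω) ^ 2) ω :=
            indicator_nonneg (fun _ _ => sq_nonneg _) _
          have n4 : 0 ≤ (J j).indicator (fun ω => 2 * N (u (j + 1)) ω ^ 2 + 2 * K ^ 2) ω :=
            indicator_nonneg (fun _ _ => by positivity) _
          have hp := mul_nonneg hε.le p1
          by_cases hsm : |N (u (j + 1)) ω - N (u j) ω| ≤ ε
          · have : (N (u (j + 1)) ω - N (u j) ω) ^ 2 * min 1 |N (u (j + 1)) ω - N (u j) ω|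
                ≤ (N (u (j + 1)) ω - N (u j) ω) ^ 2 * ε := by
              gcongr
              exact (min_le_right _ _).trans hsm
            simp only
            linarith
          · have hle : (N (u (j + 1)) ω - N (u j) ω) ^ 2 * min 1 |N (u (j + 1)) ω - N (u j) ω|
                ≤ (N (u (j + 1)) ω - N (u j) ω) ^ 2 :=
              mul_le_of_le_one_right p1 (min_le_left _ _)
            by_cases hBj : ω ∈ B j
            · by_cases hKj : K < |N (u j) ω|
              · have : {ω | K < |N (u j) ω|}.indicator
                  (fun ω => (N (u (j + 1)) ω - N (u j) ω) ^ 2) ω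
                    = (N (u (j + 1)) ω - N (u j) ω) ^ 2 := indicator_of_mem (by exact hKj) _
                simp only
                linarith
              · have hJω : ω ∈ J j := ⟨hBj, fun hc => hsm (hc j (Nat.lt_succ_self j))⟩
                have hJ' : (J j).indicator (fun ω => 2 * N (u (j + 1)) ω ^ 2 + 2 * K ^ 2) ω
                    = 2 * N (u (j + 1)) ω ^ 2 + 2 * K ^ 2 := indicator_of_mem hJω _
                have : N (u j) ω ^ 2 ≤ K ^ 2 := by
                  rw [← sq_abs]; gcongr; exact not_lt.1 hKj
                simp only
                nlinarith [sq_nonneg (N (u (j + 1)) ω + N (u j) ω)]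
            · have : (B j)ᶜ.indicator (fun ω => (N (u (j + 1)) ω - N (u j) ω) ^ 2) ω
                    = (N (u (j + 1)) ω - N (u j) ω) ^ 2 := indicator_of_mem (by exact hBj) _
              simp only
              linarith
      _ = ε * (∫ ω, (N (u (j + 1)) ω - N (u j) ω) ^ 2 ∂P)
          + (∫ ω in (B j)ᶜ, (N (u (j + 1)) ω - N (u j) ω) ^ 2 ∂P)
          + (∫ ω in {ω | K < |N (u j) ω|}, (N (u (j + 1)) ω - N (u j) ω) ^ 2 ∂P)
          + (2 * (∫ ω in J j, N (u (j + 1)) ω ^ 2 ∂P) + 2 * K ^ 2 * ∫ ω in J j, (1:ℝ) ∂P) := by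
          rw [integral_add (by exact (i1.add i2).add i3) i4, integral_add (by exact i1.add i2) i3,
            integral_add i1 i2, integral_const_mul, integral_indicator (hBm' j).compl,
            integral_indicator hKm', integral_indicator (hJm' j), integral_add
            ((h.integrable_sq (hus (j + 1))).const_mul 2).integrableOn
            (integrable_const _).integrableOn, integral_const_mul]
          simp [mul_comm]
      _ ≤ _ := by
          have e1 := h.setIntegral_sub_sq_le (hus j) (hum (Nat.le_succ j)) MeasurableSet.univ
          have e2 := h.setIntegral_sub_sq_le (hus j) (hum (Nat.le_succ j)) (hBm j).compl
          have e3 := h.setIntegral_sub_sq_le (hus j) (hum (Nat.le_succ j)) hKm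
          have e4 := h.setIntegral_sq_le (hus (j + 1)) (hut (j + 1) hj) (hJm j)
          have e5 := h.measure_abs_gt_le (hus j) (hut j hj.le) hK
          have e6 : P.real (B j)ᶜ ≤ P.real (B m)ᶜ :=
            measureReal_mono (compl_subset_compl.2 (hBanti _ _ hj.le)) (by finiteness)
          rw [hΔ] at e1 e2 e3
          simp only [setIntegral_univ, probReal_univ, mul_one] at e1
          have e7 : (∫ ω in J j, (1:ℝ) ∂P) = P.real (J j) := by simp
          rw [e7]
          have hh : 0 ≤ C * ((t - s) / m) := by
            have : 0 ≤ t - s := by linarith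
            positivity
          have e8 : C * ((t - s) / m) * P.real (B j)ᶜ ≤ C * ((t - s) / m) * P.real (B m)ᶜ := by
            gcongr
          have e9 : C * ((t - s) / m) * P.real {ω | K < |N (u j) ω|} ≤ C * ((t - s) / m) * D := by
            gcongr
          have e10 : C * (t - u (j + 1)) * P.real (J j) ≤ C * (t - s) * P.real (J j) := by
            gcongr; exact hus _
          have e11 := mul_le_mul_of_nonneg_left e1 hε.le
          linarith
  refine (Finset.sum_le_sum key).trans ?_
  rw [Finset.sum_add_distrib, Finset.sum_add_distrib, Finset.sum_add_distrib, Finset.sum_add_distrib,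
    Finset.sum_add_distrib]
  simp only [Finset.sum_const, Finset.card_range, nsmul_eq_mul, ← Finset.mul_sum]
  have s1 := hsumJ (fun ω => N t ω ^ 2) (fun ω => sq_nonneg _) (h.integrable_sq hst)
  have s2 := hsumJ (fun _ => 1) (fun ω => zero_le_one) (integrable_const _)
  have s3 : (∫ ω in (B m)ᶜ, (1:ℝ) ∂P) = P.real (B m)ᶜ := by simp
  rw [s3] at s2
  have hCt : 0 ≤ C * (t - s) := mul_nonneg hC (by linarith)
  have e : (m:ℝ) * ((t - s) / m) = t - s := by field_simp
  have r1 : (m:ℝ) * (ε * (C * ((t - s) / m))) = ε * (C * (t - s)) := by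
    rw [← e]; field_simp
  have r2 : (m:ℝ) * (C * ((t - s) / m) * P.real (B m)ᶜ) = C * (t - s) * P.real (B m)ᶜ := by
    field_simp
  have r3 : (m:ℝ) * (C * ((t - s) / m) * D) = C * (t - s) * D := by
    field_simp
  rw [r1, r2, r3]
  gcongr

/-- The cubic variation of `N` along uniform partitions vanishes. -/
lemma tendsto_sum_integral_sq_min (h : IsBracketMart P 𝒢 s C N q) {t : ℝ} (hst : s ≤ t) :
    Tendsto (fun m : ℕ => ∑ j ∈ Finset.range m,
      ∫ ω, (N (unifPt s t m (j + 1)) ω - N (unifPt s t m j) ω) ^ 2 *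
        min 1 |N (unifPt s t m (j + 1)) ω - N (unifPt s t m j) ω| ∂P) atTop (𝓝 0) := by
  have hC := h.C_nonneg
  have hCt : 0 ≤ C * (t - s) := mul_nonneg hC (by linarith)
  have hbad : ∀ ε > 0, ∀ F : Ω → ℝ, Integrable F P →
      Tendsto (fun m : ℕ => ∫ ω in (smallIncr N s t ε m m)ᶜ, F ω ∂P) atTop (𝓝 0) := by
    intro ε hε F hF
    have hm' : ∀ m, MeasurableSet (smallIncr N s t ε m m)ᶜ := fun m =>
      (𝒢.le _ _ (h.measurableSet_smallIncr hst ε m m)).compl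
    simp_rw [← integral_indicator (hm' _)]
    have : (0:ℝ) = ∫ ω, (0:ℝ) ∂P := by simp
    rw [this]
    refine tendsto_integral_of_dominated_convergence (fun ω => |F ω|)
      (fun m => (hF.indicator (hm' m)).aestronglyMeasurable) hF.abs
      (fun m => ae_of_all _ fun ω => ?_) (ae_of_all _ fun ω => ?_)
    · rw [Real.norm_eq_abs]
      by_cases hω : ω ∈ (smallIncr N s t ε m m)ᶜ <;> simp [hω]
    · refine tendsto_const_nhds.congr' ?_
      filter_upwards [eventually_unifPt_dist_lt hst (h.cont ω).continuousOn hε] with m hm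
      have : ω ∈ smallIncr N s t ε m m := fun i hi => by
        have := hm i hi (unifPt s t m (i + 1)) ⟨unifPt_mono hst m (Nat.le_succ i), le_rfl⟩
        rw [Real.dist_eq] at this
        exact this.le
      simp [this]
  rw [Metric.tendsto_atTop']
  intro η hη
  set A := 2 * ∫ ω, N t ω ^ 2 ∂P + 2 * (C * (t - s)) with hA
  have hA0 : 0 ≤ A := by
    have : 0 ≤ ∫ ω, N t ω ^ 2 ∂P := integral_nonneg fun ω => sq_nonneg _
    positivity
  obtain ⟨ε, hε, hε'⟩ : ∃ ε > 0, ε * (C * (t - s)) < η / 3 := by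
    refine ⟨η / 3 / (C * (t - s) + 1), by positivity, ?_⟩
    rw [div_mul_eq_mul_div, div_lt_iff₀ (by positivity)]
    nlinarith
  obtain ⟨K, hK, hK'⟩ : ∃ K > 0, C * (t - s) * (A / K ^ 2) < η / 3 := by
    have : Tendsto (fun K : ℝ => C * (t - s) * (A / K ^ 2)) atTop (𝓝 (C * (t - s) * 0)) :=
      (tendsto_const_nhds.div_atTop (tendsto_pow_atTop two_ne_zero)).const_mul _
    rw [mul_zero] at this
    obtain ⟨K, h1, h2⟩ :=
      ((this.eventually (gt_mem_nhds (by positivity : 0 < η / 3))).and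
        (eventually_gt_atTop 0)).exists
    exact ⟨K, h2, h1⟩
  have l1 := hbad ε hε (fun _ => 1) (integrable_const _)
  have l1' : Tendsto (fun m : ℕ => P.real (smallIncr N s t ε m m)ᶜ) atTop (𝓝 0) := by
    refine l1.congr fun m => ?_
    simp
  have l2 := hbad ε hε _ (h.integrable_sq hst)
  have l3 : Tendsto (fun m : ℕ => C * (t - s) * P.real (smallIncr N s t ε m m)ᶜ +
      (4 * (∫ ω in (smallIncr N s t ε m m)ᶜ, N t ω ^ 2 ∂P)
          + 4 * (C * (t - s)) * P.real (smallIncr N s t ε m m)ᶜ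
          + 2 * K ^ 2 * P.real (smallIncr N s t ε m m)ᶜ)) atTop (𝓝 0) := by
    have := (l1'.const_mul (C * (t - s))).add (((l2.const_mul 4).add
      (l1'.const_mul (4 * (C * (t - s))))).add (l1'.const_mul (2 * K ^ 2)))
    simpa using this
  obtain ⟨M, hM⟩ := eventually_atTop.1 (l3.eventually (gt_mem_nhds (by positivity : 0 < η / 3)))
  refine ⟨max M 1, fun m hm => ?_⟩
  have hmM := hM m (le_trans (le_max_left _ _) hm.le)
  have hm0 : m ≠ 0 := by
    have := lt_of_le_of_lt (le_max_right M 1) hm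
    omega
  have hle := h.sum_integral_sq_min_le hst hε hK hm0
  rw [Real.dist_eq, sub_zero, abs_of_nonneg]
  · linarith
  · exact Finset.sum_nonneg fun j _ => integral_nonneg fun ω => by positivity

end IsBracketMart

namespace IsBracketMart

variable {Ω : Type*} [mΩ : MeasurableSpace Ω] {P : Measure Ω} [IsProbabilityMeasure P]
  {𝒢 : Filtration ℝ mΩ} {s C : ℝ} {N q : ℝ → Ω → ℝ}

lemma sum_sub_integral_le (h : IsBracketMart P 𝒢 s C N q) {t : ℝ} (hst : s ≤ t)
    {F : ℝ → ℝ} (hF : Continuous F) {m : ℕ} (hm : m ≠ 0) {ε : ℝ} (ω : Ω)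
    (hε : ∀ j < m, ∀ r ∈ Icc (unifPt s t m j) (unifPt s t m (j + 1)),
      |F (N r ω) - F (N (unifPt s t m j) ω)| ≤ ε) :
    |∑ j ∈ Finset.range m, F (N (unifPt s t m j) ω) *
        (∫ u in unifPt s t m j..unifPt s t m (j + 1), q u ω) - ∫ u in s..t, F (N u ω) * q u ω|
      ≤ ε * (C * (t - s)) := by
  have hc : Continuous fun u => F (N u ω) * q u ω := (hF.comp (h.cont ω)).mul (h.qcont ω)
  have hsum : ∫ u in s..t, F (N u ω) * q u ω = ∑ j ∈ Finset.range m,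
      ∫ u in unifPt s t m j..unifPt s t m (j + 1), F (N u ω) * q u ω := by
    rw [intervalIntegral.sum_integral_adjacent_intervals (fun k _ => hc.intervalIntegrable _ _),
      unifPt_zero, unifPt_self s t hm]
  rw [hsum, ← Finset.sum_sub_distrib]
  refine (Finset.abs_sum_le_sum_abs _ _).trans ?_
  have hj : ∀ j ∈ Finset.range m, |F (N (unifPt s t m j) ω) *
        (∫ u in unifPt s t m j..unifPt s t m (j + 1), q u ω)
        - ∫ u in unifPt s t m j..unifPt s t m (j + 1), F (N u ω) * q u ω|
        ≤ ε * C * ((t - s) / m) := by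
    intro j hj
    rw [Finset.mem_range] at hj
    rw [← intervalIntegral.integral_const_mul, ← intervalIntegral.integral_sub
      (((h.qcont ω).const_mul _).intervalIntegrable _ _) (hc.intervalIntegrable _ _),
      ← Real.norm_eq_abs]
    have := intervalIntegral.norm_integral_le_of_norm_le_const (C := ε * C)
      (a := unifPt s t m j) (b := unifPt s t m (j + 1))
      (f := fun u => F (N (unifPt s t m j) ω) * q u ω - F (N u ω) * q u ω) ?_
    · refine this.trans (le_of_eq ?_)
      rw [unifPt_succ_sub, abs_of_nonneg]
      have : 0 ≤ t - s := by linarith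
      positivity
    · intro u hu
      rw [uIoc_of_le (unifPt_mono hst m (Nat.le_succ j))] at hu
      have h1 := hε j hj u ⟨hu.1.le, hu.2⟩
      rw [Real.norm_eq_abs, ← sub_mul, abs_mul, abs_of_nonneg (h.qnonneg u ω), abs_sub_comm]
      exact mul_le_mul h1 (h.qle u ω) (h.qnonneg u ω) ((abs_nonneg _).trans h1)
  refine (Finset.sum_le_sum hj).trans (le_of_eq ?_)
  have : (m:ℝ) ≠ 0 := by exact_mod_cast hm
  simp only [Finset.sum_const, Finset.card_range, nsmul_eq_mul]
  field_simp

lemma tendsto_sum_integral_comp (h : IsBracketMart P 𝒢 s C N q) {t : ℝ} (hst : s ≤ t)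
    {F : ℝ → ℝ} (hF : Continuous F) (ω : Ω) :
    Tendsto (fun m : ℕ => ∑ j ∈ Finset.range m, F (N (unifPt s t m j) ω) *
        (∫ u in unifPt s t m j..unifPt s t m (j + 1), q u ω)) atTop
      (𝓝 (∫ u in s..t, F (N u ω) * q u ω)) := by
  rw [Metric.tendsto_nhds]
  intro η hη
  have hCt : 0 ≤ C * (t - s) := mul_nonneg h.C_nonneg (by linarith)
  have hε : 0 < η / (C * (t - s) + 1) := by positivity
  filter_upwards [eventually_unifPt_dist_lt hst (hF.comp (h.cont ω)).continuousOn hε,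
    eventually_ne_atTop 0] with m hm hm0
  rw [Real.dist_eq]
  refine lt_of_le_of_lt (h.sum_sub_integral_le hst hF hm0 ω
    (fun j hj r hr => by simpa [Real.dist_eq] using (hm j hj r hr).le)) ?_
  rw [div_mul_eq_mul_div, div_lt_iff₀ (by positivity)]
  nlinarith

lemma stronglyMeasurable_comp (h : IsBracketMart P 𝒢 s C N q) {F : ℝ → ℝ} (hF : Continuous F)
    {r : ℝ} (hr : s ≤ r) : StronglyMeasurable[𝒢 r] fun ω => F (N r ω) :=
  hF.comp_stronglyMeasurable (h.meas r hr)

/-- Itô's formula in expectation. -/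
theorem integral_mul_comp_sub (h : IsBracketMart P 𝒢 s C N q) {t : ℝ} (hst : s ≤ t)
    {f f1 f2 : ℝ → ℝ} (hf : Continuous f) (hf1 : Continuous f1) (hf2 : Continuous f2)
    {c K : ℝ} (hfc : ∀ x, |f x| ≤ c) (hf1c : ∀ x, |f1 x| ≤ c) (hf2c : ∀ x, |f2 x| ≤ c)
    (hK : ∀ x y, |f y - f x - f1 x * (y - x) - f2 x * (y - x) ^ 2 / 2|
      ≤ K * ((y - x) ^ 2 * min 1 |y - x|))
    {g : Ω → ℝ} (hg : StronglyMeasurable[𝒢 s] g) {cg : ℝ} (hgc : ∀ ω, |g ω| ≤ cg) :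
    ∫ ω, g ω * (f (N t ω) - f (N s ω)) ∂P
      = 1 / 2 * ∫ ω, g ω * (∫ u in s..t, f2 (N u ω) * q u ω) ∂P := by
  have hc0 : 0 ≤ c := (abs_nonneg _).trans (hfc 0)
  have hΩ : Nonempty Ω := P.nonempty_of_neZero
  have hcg0 : 0 ≤ cg := (abs_nonneg _).trans (hgc hΩ.some)
  have hgm : StronglyMeasurable g := hg.mono (𝒢.le _)
  have hgi : Integrable g P :=
    Integrable.of_bound hgm.aestronglyMeasurable cg (ae_of_all _ (by simpa using hgc))
  set u := unifPt s t with hu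
  have hus : ∀ m j, s ≤ u m j := fun m j => le_unifPt hst m j
  have hum : ∀ m, Monotone (u m) := fun m => unifPt_mono hst m
  -- integrability of the three pieces
  have mN : ∀ r, s ≤ r → StronglyMeasurable (N r) := fun r hr => h.stronglyMeasurable hr
  have iF : ∀ F : ℝ → ℝ, Continuous F → (∀ x, |F x| ≤ c) → ∀ r, s ≤ r →
      StronglyMeasurable[𝒢 r] (fun ω => g ω * F (N r ω)) ∧ ∀ ω, |g ω * F (N r ω)| ≤ cg * c := by
    intro F hF hFc r hr
    refine ⟨(hg.mono (𝒢.mono hr)).mul (h.stronglyMeasurable_comp hF hr), fun ω => ?_⟩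
    rw [abs_mul]
    exact mul_le_mul (hgc ω) (hFc _) (abs_nonneg _) hcg0
  have bddmul : ∀ (G H : Ω → ℝ) (B : ℝ), StronglyMeasurable G → (∀ ω, |G ω| ≤ B) →
      Integrable H P → Integrable (fun ω => G ω * H ω) P := by
    intro G H B hG hGB hH
    exact hH.bdd_mul hG.aestronglyMeasurable (ae_of_all _ (by simpa using hGB))
  have hqi : ∀ a b, s ≤ a → a ≤ b → Integrable (fun ω => ∫ u in a..b, q u ω) P := by
    intro a b _ hab
    refine Integrable.of_bound (h.stronglyMeasurable_integral_q a b).aestronglyMeasurable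
      (C * (b - a)) (ae_of_all _ fun ω => ?_)
    rw [Real.norm_eq_abs, abs_of_nonneg (h.integral_q_nonneg hab ω)]
    exact h.integral_q_le hab ω
  set S : ℕ → Ω → ℝ := fun m ω => ∑ j ∈ Finset.range m, f2 (N (u m j) ω) *
        (∫ r in u m j..u m (j + 1), q r ω) with hS
  have hlim : Tendsto (fun m => 1 / 2 * ∫ ω, g ω * S m ω ∂P) atTop
      (𝓝 (1 / 2 * ∫ ω, g ω * (∫ u in s..t, f2 (N u ω) * q u ω) ∂P)) := by
    refine Tendsto.const_mul _ ?_
    refine tendsto_integral_filter_of_dominated_convergence (fun _ => cg * (c * (C * (t - s)))) ?_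
      ?_ (integrable_const _) (ae_of_all _ fun ω =>
        (h.tendsto_sum_integral_comp hst hf2 ω).const_mul _)
    · refine Eventually.of_forall fun m => ?_
      refine (hgm.mul (Finset.stronglyMeasurable_fun_sum _ fun j _ => ?_)).aestronglyMeasurable
      exact (hf2.comp_stronglyMeasurable (mN _ (hus m j))).mul (h.stronglyMeasurable_integral_q _ _)
    · filter_upwards [eventually_ne_atTop 0] with m hm
      refine ae_of_all _ fun ω => ?_
      rw [Real.norm_eq_abs, abs_mul]
      refine mul_le_mul (hgc ω) ?_ (abs_nonneg _) hcg0
      refine (Finset.abs_sum_le_sum_abs _ _).trans ?_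
      have : ∀ j ∈ Finset.range m, |f2 (N (u m j) ω) * (∫ r in u m j..u m (j + 1), q r ω)|
          ≤ c * (C * ((t - s) / m)) := by
        intro j _
        rw [abs_mul, abs_of_nonneg (h.integral_q_nonneg (hum m (Nat.le_succ j)) ω)]
        refine mul_le_mul (hf2c _) ?_ (h.integral_q_nonneg (hum m (Nat.le_succ j)) ω) hc0
        have := h.integral_q_le (hum m (Nat.le_succ j)) ω
        rwa [unifPt_succ_sub] at this
      refine (Finset.sum_le_sum this).trans (le_of_eq ?_)
      have : (m:ℝ) ≠ 0 := by exact_mod_cast hm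
      simp only [Finset.sum_const, Finset.card_range, nsmul_eq_mul]
      field_simp
  have hrem : Tendsto (fun m => ∫ ω, g ω * (f (N t ω) - f (N s ω)) ∂P
      - 1 / 2 * ∫ ω, g ω * S m ω ∂P) atTop (𝓝 0) := by
    have hA0 := (h.tendsto_sum_integral_sq_min hst).const_mul (cg * K)
    rw [mul_zero] at hA0
    refine squeeze_zero_norm' ?_ hA0
    filter_upwards [eventually_ne_atTop 0] with m hm
    have tel : ∀ ω, g ω * (f (N t ω) - f (N s ω)) = ∑ j ∈ Finset.range m,
        g ω * (f (N (u m (j + 1)) ω) - f (N (u m j) ω)) := by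
      intro ω
      rw [← Finset.mul_sum, Finset.sum_range_sub (fun j => f (N (u m j) ω)), hu, unifPt_zero,
        unifPt_self s t hm]
    have i1 : ∀ j, Integrable (fun ω => g ω * (f (N (u m (j + 1)) ω) - f (N (u m j) ω))) P := by
      intro j
      have a := (iF f hf hfc _ (hus m (j + 1)))
      have b := (iF f hf hfc _ (hus m j))
      have := (Integrable.of_bound (a.1.mono (𝒢.le _)).aestronglyMeasurable (cg * c)
        (ae_of_all P (by simpa using a.2))).sub
        (Integrable.of_bound (b.1.mono (𝒢.le _)).aestronglyMeasurable (cg * c)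
        (ae_of_all P (by simpa using b.2)))
      refine this.congr (ae_of_all _ fun ω => ?_)
      simp [mul_sub]
    have i2 : ∀ j, Integrable (fun ω => g ω * (f2 (N (u m j) ω) *
        (∫ r in u m j..u m (j + 1), q r ω))) P := by
      intro j
      have a := (iF f2 hf2 hf2c _ (hus m j))
      have := bddmul _ _ _ (a.1.mono (𝒢.le _)) a.2 (hqi _ _ (hus m j) (hum m (Nat.le_succ j)))
      simpa [mul_assoc] using this
    have i3 : ∀ j, Integrable (fun ω => (N (u m (j + 1)) ω - N (u m j) ω) ^ 2 *
        min 1 |N (u m (j + 1)) ω - N (u m j) ω|) P := by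
      intro j
      refine (h.integrable_sub_sq (hus m j) (hus m (j + 1))).mono' ?_ (ae_of_all _ fun ω => ?_)
      · have := ((mN _ (hus m (j + 1))).sub (mN _ (hus m j)))
        exact ((this.pow 2).mul (stronglyMeasurable_const.inf this.norm)).aestronglyMeasurable
      · rw [Real.norm_eq_abs, abs_of_nonneg (by positivity)]
        exact mul_le_of_le_one_right (sq_nonneg _) (min_le_left _ _)
    simp_rw [tel, hS, Finset.mul_sum]
    rw [integral_finsetSum _ fun j _ => i1 j, integral_finsetSum _ fun j _ => i2 j,
      Finset.mul_sum, ← Finset.sum_sub_distrib]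
    refine (norm_sum_le _ _).trans ?_
    refine Finset.sum_le_sum fun j _ => ?_
    have a1 := (iF f1 hf1 hf1c _ (hus m j))
    have a2 := (iF f2 hf2 hf2c _ (hus m j))
    have m1 := h.mart (u m j) (u m (j + 1)) (hus m j) (hum m (Nat.le_succ j)) _ a1.1 ⟨_, a1.2⟩
    have m2 := h.quad (u m j) (u m (j + 1)) (hus m j) (hum m (Nat.le_succ j)) _ a2.1 ⟨_, a2.2⟩
    have j1 : Integrable (fun ω => g ω * f1 (N (u m j) ω) *
        (N (u m (j + 1)) ω - N (u m j) ω)) P := bddmul _ _ _ (a1.1.mono (𝒢.le _)) a1.2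
      (((h.memLp _ (hus m (j + 1))).integrable one_le_two).sub
        ((h.memLp _ (hus m j)).integrable one_le_two))
    have j2 := bddmul _ _ _ (a2.1.mono (𝒢.le _)) a2.2
      (h.integrable_sub_sq (hus m j) (hus m (j + 1)))
    have m2' : ∫ ω, g ω * (f2 (N (u m j) ω) * (∫ r in u m j..u m (j + 1), q r ω)) ∂P
        = ∫ ω, g ω * f2 (N (u m j) ω) * (N (u m (j + 1)) ω - N (u m j) ω) ^ 2 ∂P := by
      rw [m2]; simp [mul_assoc]
    have e : ∫ ω, g ω * (f (N (u m (j + 1)) ω) - f (N (u m j) ω)) ∂P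
        - 1 / 2 * ∫ ω, g ω * (f2 (N (u m j) ω) * (∫ r in u m j..u m (j + 1), q r ω)) ∂P
        = ∫ ω, (g ω * (f (N (u m (j + 1)) ω) - f (N (u m j) ω))
          - g ω * f1 (N (u m j) ω) * (N (u m (j + 1)) ω - N (u m j) ω)
          - 1 / 2 * (g ω * f2 (N (u m j) ω) * (N (u m (j + 1)) ω - N (u m j) ω) ^ 2)) ∂P := by
      rw [m2', integral_sub (by exact (i1 j).sub j1) (j2.const_mul _),
        integral_sub (i1 j) j1, integral_const_mul, m1, sub_zero]
    rw [e, ← integral_const_mul]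
    refine norm_integral_le_of_norm_le ((i3 j).const_mul _) (ae_of_all _ fun ω => ?_)
    have hk := hK (N (u m j) ω) (N (u m (j + 1)) ω)
    have : g ω * (f (N (u m (j + 1)) ω) - f (N (u m j) ω))
          - g ω * f1 (N (u m j) ω) * (N (u m (j + 1)) ω - N (u m j) ω)
          - 1 / 2 * (g ω * f2 (N (u m j) ω) * (N (u m (j + 1)) ω - N (u m j) ω) ^ 2)
        = g ω * (f (N (u m (j + 1)) ω) - f (N (u m j) ω)
          - f1 (N (u m j) ω) * (N (u m (j + 1)) ω - N (u m j) ω)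
          - f2 (N (u m j) ω) * (N (u m (j + 1)) ω - N (u m j) ω) ^ 2 / 2) := by ring
    rw [this, Real.norm_eq_abs, abs_mul, mul_assoc]
    exact mul_le_mul (hgc ω) hk (abs_nonneg _) hcg0
  have := hrem.add hlim
  simp only [sub_add_cancel, zero_add] at this
  exact tendsto_nhds_unique tendsto_const_nhds this

end IsBracketMart

/-- Fatou's lemma for Bochner integrals of nonnegative functions. -/
lemma integrable_and_integral_le_of_tendsto {α : Type*} [MeasurableSpace α] {μ : Measure α}
    {F : ℕ → α → ℝ} {f : α → ℝ} {B : ℝ} (hF : ∀ n, Integrable (F n) μ)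
    (hF0 : ∀ n x, 0 ≤ F n x) (hlim : ∀ x, Tendsto (fun n => F n x) atTop (𝓝 (f x)))
    (hB : ∀ᶠ n in atTop, ∫ x, F n x ∂μ ≤ B) : Integrable f μ ∧ ∫ x, f x ∂μ ≤ B := by
  have hf0 : ∀ x, 0 ≤ f x := fun x => ge_of_tendsto' (hlim x) fun n => hF0 n x
  have hfm : AEStronglyMeasurable f μ :=
    aestronglyMeasurable_of_tendsto_ae atTop (fun n => (hF n).aestronglyMeasurable)
      (ae_of_all _ hlim)
  have hB0 : 0 ≤ B := by
    obtain ⟨n, hn⟩ := hB.exists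
    exact (integral_nonneg (hF0 n)).trans hn
  have key : ∫⁻ x, ENNReal.ofReal (f x) ∂μ ≤ ENNReal.ofReal B := by
    calc ∫⁻ x, ENNReal.ofReal (f x) ∂μ
        = ∫⁻ x, liminf (fun n => ENNReal.ofReal (F n x)) atTop ∂μ := by
          refine lintegral_congr fun x => ?_
          exact ((ENNReal.continuous_ofReal.tendsto _).comp (hlim x)).liminf_eq.symm
      _ ≤ liminf (fun n => ∫⁻ x, ENNReal.ofReal (F n x) ∂μ) atTop :=
          lintegral_liminf_le' fun n => (hF n).aestronglyMeasurable.aemeasurable.ennreal_ofReal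
      _ ≤ ENNReal.ofReal B := by
          refine liminf_le_of_frequently_le' (hB.mono fun n hn => ?_).frequently
          rw [← ofReal_integral_eq_lintegral_ofReal (hF n) (ae_of_all _ (hF0 n))]
          exact ENNReal.ofReal_le_ofReal hn
  have hfi : Integrable f μ := by
    refine ⟨hfm, ?_⟩
    rw [hasFiniteIntegral_iff_ofReal (ae_of_all _ hf0)]
    exact key.trans_lt ENNReal.ofReal_lt_top
  refine ⟨hfi, ?_⟩
  rw [← ofReal_integral_eq_lintegral_ofReal hfi (ae_of_all _ hf0)] at key
  exact (ENNReal.ofReal_le_ofReal_iff hB0).1 key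

/-- Second-order Taylor bound with a remainder that is both quadratic and cubic. -/
lemma abs_taylor_two_le {f f1 f2 f3 : ℝ → ℝ} (h1 : ∀ x, HasDerivAt f (f1 x) x)
    (h2 : ∀ x, HasDerivAt f1 (f2 x) x) (h3 : ∀ x, HasDerivAt f2 (f3 x) x) {c : ℝ}
    (hc2 : ∀ x, |f2 x| ≤ c) (hc3 : ∀ x, |f3 x| ≤ c) (x y : ℝ) :
    |f y - f x - f1 x * (y - x) - f2 x * (y - x) ^ 2 / 2|
      ≤ 2 * c * ((y - x) ^ 2 * min 1 |y - x|) := by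
  have hc0 : 0 ≤ c := (abs_nonneg _).trans (hc2 0)
  set B := 2 * c * min 1 |y - x| with hB
  have hxs : x ∈ uIcc x y := left_mem_uIcc
  have hys : y ∈ uIcc x y := right_mem_uIcc
  have hdist : ∀ z ∈ uIcc x y, |z - x| ≤ |y - x| := fun z hz => abs_sub_left_of_mem_uIcc hz
  have b2 : ∀ z ∈ uIcc x y, ‖f2 z - f2 x‖ ≤ B := by
    intro z hz
    have e1 : ‖f2 z - f2 x‖ ≤ c * ‖z - x‖ :=
      Convex.norm_image_sub_le_of_norm_hasDerivWithin_le (s := univ)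
        (fun w _ => (h3 w).hasDerivWithinAt) (fun w _ => hc3 w) convex_univ (mem_univ _)
        (mem_univ _)
    have e2 : ‖f2 z - f2 x‖ ≤ 2 * c := by
      refine (norm_sub_le _ _).trans ?_
      have := hc2 z; have := hc2 x
      simp only [Real.norm_eq_abs]; linarith
    rw [hB, mul_min_of_nonneg _ _ (by positivity)]
    refine le_min (by linarith) ?_
    have := hdist z hz
    rw [Real.norm_eq_abs (z - x)] at e1
    nlinarith [abs_nonneg (y - x)]
  have d1 : ∀ z, HasDerivAt (fun z => f1 z - f1 x - f2 x * (z - x)) (f2 z - f2 x) z := by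
    intro z
    have := ((h2 z).sub_const (f1 x)).sub (((hasDerivAt_id z).sub_const x).const_mul (f2 x))
    exact this.congr_deriv (by simp)
  have b1 : ∀ z ∈ uIcc x y, ‖f1 z - f1 x - f2 x * (z - x)‖ ≤ B * |y - x| := by
    intro z hz
    have := Convex.norm_image_sub_le_of_norm_hasDerivWithin_le (s := uIcc x y)
      (fun w _ => (d1 w).hasDerivWithinAt) b2 (convex_uIcc x y) hxs hz
    simp only [sub_self, mul_zero, sub_zero] at this
    refine this.trans ?_
    have hB0 : 0 ≤ B := (norm_nonneg _).trans (b2 x hxs)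
    gcongr
    exact hdist z hz
  have d0 : ∀ z, HasDerivAt (fun z => f z - f x - f1 x * (z - x) - f2 x * (z - x) ^ 2 / 2)
      (f1 z - f1 x - f2 x * (z - x)) z := by
    intro z
    have := (((h1 z).sub_const (f x)).sub (((hasDerivAt_id z).sub_const x).const_mul (f1 x))).sub
      (((((hasDerivAt_id z).sub_const x).pow 2).const_mul (f2 x)).div_const 2)
    refine this.congr_deriv ?_
    simp only [id]
    push_cast
    ring
  have := Convex.norm_image_sub_le_of_norm_hasDerivWithin_le (s := uIcc x y)
      (fun w _ => (d0 w).hasDerivWithinAt) b1 (convex_uIcc x y) hxs hys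
  simp only [sub_self, mul_zero] at this
  norm_num at this
  refine this.trans (le_of_eq ?_)
  rw [hB, ← sq_abs (y - x)]
  ring

/-- A continuous periodic function is bounded. -/
lemma exists_abs_le_of_periodic {f : ℝ → ℝ} (hf : Continuous f) {T : ℝ} (hT : 0 < T)
    (hp : Function.Periodic f T) : ∃ c, ∀ x, |f x| ≤ c := by
  obtain ⟨c, hc⟩ := hp.isBounded_of_continuous hT.ne' hf |>.exists_norm_le
  exact ⟨c, fun x => hc _ ⟨x, rfl⟩⟩

/-- A bounded smooth substitute for the identity. -/
def sinTrunc (l x : ℝ) : ℝ := 2 / l * Real.sin (l / 2 * x)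

lemma hasDerivAt_sinTrunc {l : ℝ} (hl : l ≠ 0) (x : ℝ) :
    HasDerivAt (sinTrunc l) (Real.cos (l / 2 * x)) x := by
  have := (((hasDerivAt_id x).const_mul (l / 2)).sin).const_mul (2 / l)
  refine this.congr_deriv ?_
  simp only [id]
  field_simp

lemma hasDerivAt_cos_scaled {l : ℝ} (hl : l ≠ 0) (x : ℝ) :
    HasDerivAt (fun x => Real.cos (l / 2 * x)) (-(l ^ 2 / 4) * sinTrunc l x) x := by
  have := ((hasDerivAt_id x).const_mul (l / 2)).cos
  refine this.congr_deriv ?_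
  simp only [id, sinTrunc]
  field_simp
  ring

lemma tendsto_sinTrunc (x : ℝ) :
    Tendsto (fun n : ℕ => sinTrunc (1 / ((n:ℝ) + 1)) x) atTop (𝓝 x) := by
  have hd : HasDerivAt (fun y => Real.sin (y * x)) x 0 := by
    have := ((hasDerivAt_id (0:ℝ)).mul_const x).sin
    simpa using this
  have h1 := hd.tendsto_slope_zero_right
  have h2 : Tendsto (fun n : ℕ => 1 / ((n:ℝ) + 1) / 2) atTop (𝓝[>] 0) := by
    refine tendsto_nhdsWithin_iff.2 ⟨?_, Eventually.of_forall fun n => ?_⟩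
    · have := (tendsto_one_div_add_atTop_nhds_zero_nat (𝕜 := ℝ)).div_const 2
      simpa using this
    · show (0:ℝ) < _
      positivity
  refine (h1.comp h2).congr fun n => ?_
  simp [sinTrunc]

namespace IsBracketMart

variable {Ω : Type*} [mΩ : MeasurableSpace Ω] {P : Measure Ω} [IsProbabilityMeasure P]
  {𝒢 : Filtration ℝ mΩ} {s C : ℝ} {N q : ℝ → Ω → ℝ}

lemma stronglyMeasurable_uncurry_max (h : IsBracketMart P 𝒢 s C N q) :
    StronglyMeasurable (fun p : ℝ × Ω => N (max p.1 s) p.2) :=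
  stronglyMeasurable_uncurry_of_continuous_of_stronglyMeasurable
    (u := fun (r : ℝ) (ω : Ω) => N (max r s) ω)
    (fun ω => (h.cont ω).comp (continuous_id.max continuous_const))
    (fun _ => h.stronglyMeasurable (le_max_right _ _))

/-- Fubini bound for the time integral of a bounded function of `N` against `q`. -/
lemma integral_mul_integral_comp_le (h : IsBracketMart P 𝒢 s C N q) {t : ℝ} (hst : s ≤ t)
    {F : ℝ → ℝ} (hF : Continuous F) (hF0 : ∀ x, 0 ≤ F x) {c : ℝ} (hFc : ∀ x, |F x| ≤ c)
    {g : Ω → ℝ} (hg : StronglyMeasurable g) {cg : ℝ} (hgc : ∀ ω, |g ω| ≤ cg)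
    (hg0 : ∀ ω, 0 ≤ g ω) {D : ℝ} (hD : ∀ r, s ≤ r → r ≤ t → ∫ ω, g ω * F (N r ω) ∂P ≤ D) :
    ∫ ω, g ω * (∫ u in s..t, F (N u ω) * q u ω) ∂P ≤ C * (t - s) * D := by
  have hc0 : 0 ≤ c := (abs_nonneg _).trans (hFc 0)
  have hΩ : Nonempty Ω := P.nonempty_of_neZero
  have hcg0 : 0 ≤ cg := (abs_nonneg _).trans (hgc hΩ.some)
  have hC := h.C_nonneg
  have hm : StronglyMeasurable (fun p : ℝ × Ω => g p.2 * F (N (max p.1 s) p.2)) :=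
    (hg.comp_measurable measurable_snd).mul
      (hF.comp_stronglyMeasurable h.stronglyMeasurable_uncurry_max)
  have hi : Integrable (fun p : ℝ × Ω => g p.2 * F (N (max p.1 s) p.2))
      ((volume.restrict (Ioc s t)).prod P) := by
    refine Integrable.of_bound hm.aestronglyMeasurable (cg * c) (ae_of_all _ fun p => ?_)
    rw [Real.norm_eq_abs, abs_mul]
    exact mul_le_mul (hgc _) (hFc _) (abs_nonneg _) hcg0
  have e1 : ∀ ω, g ω * (∫ u in s..t, F (N u ω) * q u ω)
      ≤ C * ∫ u in Ioc s t, g ω * F (N (max u s) ω) := by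
    intro ω
    rw [integral_const_mul, mul_left_comm]
    refine mul_le_mul_of_nonneg_left ?_ (hg0 ω)
    rw [← intervalIntegral.integral_of_le hst, ← intervalIntegral.integral_const_mul]
    refine intervalIntegral.integral_mono_on hst
      (((hF.comp (h.cont ω)).mul (h.qcont ω)).intervalIntegrable _ _)
      ((continuous_const.mul (hF.comp ((h.cont ω).comp
        (continuous_id.max continuous_const)))).intervalIntegrable _ _) fun u hu => ?_
    rw [max_eq_left hu.1, mul_comm]
    exact mul_le_mul_of_nonneg_right (h.qle u ω) (hF0 _)
  have i2 : Integrable (fun ω => ∫ u in Ioc s t, g ω * F (N (max u s) ω)) P :=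
    hi.swap.integral_prod_left
  calc ∫ ω, g ω * (∫ u in s..t, F (N u ω) * q u ω) ∂P
      ≤ ∫ ω, C * (∫ u in Ioc s t, g ω * F (N (max u s) ω)) ∂P := by
        refine integral_mono_of_nonneg (ae_of_all _ fun ω => ?_) (i2.const_mul C)
          (ae_of_all _ e1)
        exact mul_nonneg (hg0 ω) (intervalIntegral.integral_nonneg hst fun u _ =>
          mul_nonneg (hF0 _) (h.qnonneg _ _))
    _ = C * ∫ u in Ioc s t, (∫ ω, g ω * F (N (max u s) ω) ∂P) := by
        rw [integral_const_mul, integral_integral_swap (by exact hi.swap)]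
    _ ≤ C * ∫ u in Ioc s t, D := by
        gcongr 1
        refine setIntegral_mono_on hi.integral_prod_left (by simp) measurableSet_Ioc fun u hu => ?_
        rw [max_eq_left hu.1.le]
        exact hD u hu.1.le hu.2
    _ = C * (t - s) * D := by
        simp [hst]; ring

/-- The constants in the even-moment bounds. -/
def momentConst : ℕ → ℝ
  | 0 => 1
  | k + 1 => (k + 1) * (2 * k + 1) * momentConst k

lemma momentConst_nonneg (k : ℕ) : 0 ≤ momentConst k := by
  induction k with
  | zero => simp [momentConst]
  | succ k ih => simp only [momentConst]; positivity

lemma integral_sinTrunc_pow_le (h : IsBracketMart P 𝒢 s C N q) (hN0 : ∀ ω, N s ω = 0)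
    {g : Ω → ℝ} (hg : StronglyMeasurable[𝒢 s] g) {cg : ℝ} (hgc : ∀ ω, |g ω| ≤ cg)
    (hg0 : ∀ ω, 0 ≤ g ω) {l : ℝ} (hl : 0 < l) (k : ℕ) {t : ℝ} (hst : s ≤ t) :
    ∫ ω, g ω * sinTrunc l (N t ω) ^ (2 * k) ∂P
      ≤ momentConst k * (C * (t - s)) ^ k * ∫ ω, g ω ∂P := by
  have hC := h.C_nonneg
  have hgI : 0 ≤ ∫ ω, g ω ∂P := integral_nonneg hg0
  induction k generalizing t with
  | zero => simp [momentConst]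
  | succ k ih =>
    set G := sinTrunc l with hG
    set H := fun x => Real.cos (l / 2 * x) with hH
    have hGd : ∀ x, HasDerivAt G (H x) x := hasDerivAt_sinTrunc hl.ne'
    have hHd : ∀ x, HasDerivAt H (-(l ^ 2 / 4) * G x) x := hasDerivAt_cos_scaled hl.ne'
    have hGc : ContDiff ℝ ⊤ G := by unfold G sinTrunc; fun_prop
    have hHc : ContDiff ℝ ⊤ H := by unfold H; fun_prop
    have hT : 0 < 4 * Real.pi / l := by have := Real.pi_pos; positivity
    have hGp : Function.Periodic G (4 * Real.pi / l) := by
      intro x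
      simp only [hG, sinTrunc]
      rw [show l / 2 * (x + 4 * Real.pi / l) = l / 2 * x + 2 * Real.pi by field_simp; ring,
        Real.sin_add_two_pi]
    have hHp : Function.Periodic H (4 * Real.pi / l) := by
      intro x
      simp only [hH]
      rw [show l / 2 * (x + 4 * Real.pi / l) = l / 2 * x + 2 * Real.pi by field_simp; ring,
        Real.cos_add_two_pi]
    set f : ℝ → ℝ := fun x => G x ^ (2 * (k + 1)) with hf
    set f1 : ℝ → ℝ := fun x => (2 * (k + 1)) * (G x ^ (2 * k + 1) * H x) with hf1
    set f2 : ℝ → ℝ := fun x => (2 * (k + 1)) * ((2 * k + 1) * (G x ^ (2 * k) * H x ^ 2)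
      - l ^ 2 / 4 * G x ^ (2 * (k + 1))) with hf2
    have d1 : ∀ x, HasDerivAt f (f1 x) x := by
      intro x
      refine ((hGd x).pow (2 * (k + 1))).congr_deriv ?_
      simp only [hf1]
      rw [show 2 * (k + 1) - 1 = 2 * k + 1 by omega]
      push_cast; ring
    have d2 : ∀ x, HasDerivAt f1 (f2 x) x := by
      intro x
      refine ((((hGd x).pow (2 * k + 1)).mul (hHd x)).const_mul _).congr_deriv ?_
      simp only [hf2, Pi.pow_apply]
      rw [show 2 * k + 1 - 1 = 2 * k by omega]
      push_cast; ring
    have c2 : ContDiff ℝ ⊤ f2 := by unfold f2; fun_prop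
    have c1 : ContDiff ℝ ⊤ f1 := by unfold f1; fun_prop
    have c0 : ContDiff ℝ ⊤ f := by unfold f; fun_prop
    have p0 : Function.Periodic f (4 * Real.pi / l) := fun x => by simp only [hf, hGp x]
    have p1 : Function.Periodic f1 (4 * Real.pi / l) := fun x => by simp only [hf1, hGp x, hHp x]
    have p2 : Function.Periodic f2 (4 * Real.pi / l) := fun x => by simp only [hf2, hGp x, hHp x]
    have p3 : Function.Periodic (deriv f2) (4 * Real.pi / l) := by
      intro x
      rw [← deriv_comp_add_const]
      congr 1
      exact funext p2
    have d3 : ∀ x, HasDerivAt f2 (deriv f2 x) x := fun x =>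
      (c2.differentiable (by simp) x).hasDerivAt
    have c3 : Continuous (deriv f2) := c2.continuous_deriv (by simp)
    obtain ⟨b0, hb0⟩ := exists_abs_le_of_periodic c0.continuous hT p0
    obtain ⟨b1, hb1⟩ := exists_abs_le_of_periodic c1.continuous hT p1
    obtain ⟨b2, hb2⟩ := exists_abs_le_of_periodic c2.continuous hT p2
    obtain ⟨b3, hb3⟩ := exists_abs_le_of_periodic c3 hT p3
    have hFc : Continuous fun x => G x ^ (2 * k) := hGc.continuous.pow _
    obtain ⟨b4, hb4⟩ := exists_abs_le_of_periodic hFc hT (fun x => by simp only [hGp x])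
    set c := max (max b0 b1) (max b2 b3) with hc
    have ito := h.integral_mul_comp_sub hst c0.continuous c1.continuous c2.continuous (c := c)
      (K := 2 * c) (fun x => (hb0 x).trans (by simp [hc]))
      (fun x => (hb1 x).trans (by simp [hc])) (fun x => (hb2 x).trans (by simp [hc]))
      (abs_taylor_two_le d1 d2 d3 (fun x => (hb2 x).trans (by simp [hc]))
        (fun x => (hb3 x).trans (by simp [hc]))) hg hgc
    have hGs : ∀ ω, f (N s ω) = 0 := by
      intro ω
      simp [hf, hG, hN0 ω, sinTrunc]
    simp only [hGs, sub_zero] at ito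
    have fub := h.integral_mul_integral_comp_le hst hFc (fun x => by rw [pow_mul]; positivity) hb4
      (hg.mono (𝒢.le _)) hgc hg0 (D := momentConst k * (C * (t - s)) ^ k * ∫ ω, g ω ∂P)
      (fun r hr hrt => (ih hr).trans (by
        have := momentConst_nonneg k
        have h0 : 0 ≤ r - s := by linarith
        gcongr))
    have hgm := hg.mono (𝒢.le _)
    have cmp : ∫ ω, g ω * (∫ u in s..t, f2 (N u ω) * q u ω) ∂P
        ≤ (2 * (k + 1) * (2 * k + 1)) *
          ∫ ω, g ω * (∫ u in s..t, G (N u ω) ^ (2 * k) * q u ω) ∂P := by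
      rw [← integral_const_mul]
      have im : ∀ F : ℝ → ℝ, Continuous F → ∀ b, (∀ x, |F x| ≤ b) →
          Integrable (fun ω => g ω * (∫ u in s..t, F (N u ω) * q u ω)) P := by
        intro F hF b hb
        have hb0 : 0 ≤ b := (abs_nonneg _).trans (hb 0)
        have sm : StronglyMeasurable fun ω => ∫ u in s..t, F (N u ω) * q u ω := by
          have e : ∀ ω, ∫ u in s..t, F (N u ω) * q u ω
              = ∫ u in Ioc s t, F (N (max u s) ω) * q u ω := by
            intro ω
            rw [intervalIntegral.integral_of_le hst]
            refine setIntegral_congr_fun measurableSet_Ioc fun u hu => ?_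
            simp only [max_eq_left hu.1.le]
          simp_rw [e]
          have : StronglyMeasurable fun p : Ω × ℝ => F (N (max p.2 s) p.1) * q p.2 p.1 :=
            (hF.comp_stronglyMeasurable (h.stronglyMeasurable_uncurry_max.comp_measurable
              measurable_swap)).mul h.stronglyMeasurable_q_uncurry
          exact this.integral_prod_right
        refine Integrable.of_bound (hgm.mul sm).aestronglyMeasurable (cg * (b * C * |t - s|))
          (ae_of_all _ fun ω => ?_)
        rw [norm_mul]
        refine mul_le_mul (hgc ω) ?_ (norm_nonneg _) ((abs_nonneg _).trans (hgc ω))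
        refine intervalIntegral.norm_integral_le_of_norm_le_const fun u _ => ?_
        rw [Real.norm_eq_abs, abs_mul, abs_of_nonneg (h.qnonneg u ω)]
        exact mul_le_mul (hb _) (h.qle _ _) (h.qnonneg _ _) hb0
      refine integral_mono (im f2 c2.continuous b2 hb2)
        ((im _ hFc b4 hb4).const_mul _) fun ω => ?_
      simp only
      rw [mul_left_comm]
      refine mul_le_mul_of_nonneg_left ?_ (hg0 ω)
      rw [← intervalIntegral.integral_const_mul]
      refine intervalIntegral.integral_mono_on hst
        (((c2.continuous.comp (h.cont ω)).mul (h.qcont ω)).intervalIntegrable _ _)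
        ((continuous_const.mul ((hFc.comp (h.cont ω)).mul (h.qcont ω))).intervalIntegrable _ _)
        fun u _ => ?_
      rw [← mul_assoc]
      refine mul_le_mul_of_nonneg_right ?_ (h.qnonneg u ω)
      simp only [hf2]
      have hH1 : H (N u ω) ^ 2 ≤ 1 := by
        simp only [hH]; exact Real.cos_sq_le_one _
      have hp : 0 ≤ G (N u ω) ^ (2 * k) := by rw [pow_mul]; positivity
      have hp' : 0 ≤ G (N u ω) ^ (2 * (k + 1)) := by
        rw [pow_mul]; positivity
      have hp2 : 0 ≤ l ^ 2 / 4 * G (N u ω) ^ (2 * (k + 1)) := by positivity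
      have : G (N u ω) ^ (2 * k) * H (N u ω) ^ 2 ≤ G (N u ω) ^ (2 * k) :=
        mul_le_of_le_one_right hp hH1
      have hk : (0:ℝ) ≤ k := by positivity
      calc _ ≤ 2 * ((k:ℝ) + 1) * ((2 * k + 1) * G (N u ω) ^ (2 * k)) := by
            gcongr
            nlinarith
        _ = _ := by ring
    rw [ito]
    simp only [momentConst]
    calc _ ≤ 1 / 2 * ((2 * (k + 1) * (2 * k + 1)) *
          (C * (t - s) * (momentConst k * (C * (t - s)) ^ k * ∫ ω, g ω ∂P))) := by
          gcongr
          exact cmp.trans (by gcongr)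
      _ = _ := by ring

/-- Even moments of a martingale with bounded bracket density, conditionally on the past. -/
theorem integral_pow_le (h : IsBracketMart P 𝒢 s C N q) (hN0 : ∀ ω, N s ω = 0)
    {g : Ω → ℝ} (hg : StronglyMeasurable[𝒢 s] g) {cg : ℝ} (hgc : ∀ ω, |g ω| ≤ cg)
    (hg0 : ∀ ω, 0 ≤ g ω) (k : ℕ) {t : ℝ} (hst : s ≤ t) :
    Integrable (fun ω => g ω * N t ω ^ (2 * k)) P ∧
    ∫ ω, g ω * N t ω ^ (2 * k) ∂P ≤ momentConst k * (C * (t - s)) ^ k * ∫ ω, g ω ∂P := by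
  refine integrable_and_integral_le_of_tendsto
    (F := fun n ω => g ω * sinTrunc (1 / ((n:ℝ) + 1)) (N t ω) ^ (2 * k)) (fun n => ?_)
    (fun n ω => ?_) (fun ω => ((tendsto_sinTrunc (N t ω)).pow _).const_mul _)
    (Eventually.of_forall fun n => h.integral_sinTrunc_pow_le hN0 hg hgc hg0 (by positivity) k hst)
  · have hc : Continuous (sinTrunc (1 / ((n:ℝ) + 1))) := by unfold sinTrunc; fun_prop
    refine Integrable.of_bound (((hg.mono (𝒢.le _)).mul ((hc.comp_stronglyMeasurable
      (h.stronglyMeasurable hst)).pow _)).aestronglyMeasurable)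
      (cg * (2 / (1 / ((n:ℝ) + 1))) ^ (2 * k)) (ae_of_all _ fun ω => ?_)
    rw [norm_mul]
    refine mul_le_mul (hgc ω) ?_ (norm_nonneg _) ((abs_nonneg _).trans (hgc ω))
    rw [norm_pow]
    gcongr
    rw [sinTrunc, norm_mul, Real.norm_eq_abs, Real.norm_eq_abs, abs_of_pos (by positivity)]
    exact mul_le_of_le_one_right (by positivity) (Real.abs_sin_le_one _)
  · exact mul_nonneg (hg0 ω) (by rw [pow_mul]; positivity)

end IsBracketMart

namespace IsBracketMart

variable {Ω : Type*} [mΩ : MeasurableSpace Ω] {P : Measure Ω} [IsProbabilityMeasure P]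
  {𝒢 : Filtration ℝ mΩ} {s C : ℝ} {N q : ℝ → Ω → ℝ}

/-- If the bracket density is close to the constant `q₀`, then trigonometric expectations of `N`
decay almost like those of a Gaussian process. -/
theorem abs_integral_trig_sub_le (h : IsBracketMart P 𝒢 s C N q) {t : ℝ} (hst : s ≤ t)
    {f f1 : ℝ → ℝ} (d1 : ∀ x, HasDerivAt f (f1 x) x) (d2 : ∀ x, HasDerivAt f1 (-f x) x)
    (hfc : ∀ x, |f x| ≤ 1) (hf1c : ∀ x, |f1 x| ≤ 1)
    {g : Ω → ℝ} (hg : StronglyMeasurable[𝒢 s] g) {cg : ℝ} (hgc : ∀ ω, |g ω| ≤ cg)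
    {q₀ : ℝ} (hq₀ : 0 ≤ q₀) {w : Ω → ℝ} (hw : Integrable w P)
    (hqw : ∀ r ∈ Icc s t, ∀ ω, |q r ω - q₀| ≤ w ω) :
    |∫ ω, g ω * f (N t ω) ∂P - Real.exp (-(q₀ * (t - s) / 2)) * ∫ ω, g ω * f (N s ω) ∂P|
      ≤ (t - s) / 2 * ∫ ω, |g ω| * w ω ∂P := by
  have hC := h.C_nonneg
  have hΩ : Nonempty Ω := P.nonempty_of_neZero
  have hcg0 : 0 ≤ cg := (abs_nonneg _).trans (hgc hΩ.some)
  have hgm : StronglyMeasurable g := hg.mono (𝒢.le _)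
  have cf : Continuous f := continuous_iff_continuousAt.2 fun x => (d1 x).continuousAt
  have cf1 : Continuous f1 := continuous_iff_continuousAt.2 fun x => (d2 x).continuousAt
  have hNm : ∀ r, StronglyMeasurable fun ω => f (N (max r s) ω) := fun r =>
    cf.comp_stronglyMeasurable (h.stronglyMeasurable (le_max_right _ _))
  set φ : ℝ → ℝ := fun r => ∫ ω, g ω * (f (N (max r s) ω) * q r ω) ∂P with hφ
  have hb : ∀ r ω, |g ω * (f (N (max r s) ω) * q r ω)| ≤ cg * C := by
    intro r ω
    rw [abs_mul, abs_mul, abs_of_nonneg (h.qnonneg r ω)]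
    refine mul_le_mul (hgc ω) ?_ (by have := h.qnonneg r ω; positivity) hcg0
    calc _ ≤ 1 * C := mul_le_mul (hfc _) (h.qle _ _) (h.qnonneg _ _) zero_le_one
      _ = C := one_mul C
  have hφc : Continuous φ := by
    refine continuous_of_dominated (bound := fun _ => cg * C)
      (fun r => (hgm.mul ((hNm r).mul (h.qmeas r))).aestronglyMeasurable)
      (fun r => ae_of_all _ fun ω => hb r ω) (integrable_const _) (ae_of_all _ fun ω => ?_)
    exact continuous_const.mul ((cf.comp ((h.cont ω).comp
      (continuous_id.max continuous_const))).mul (h.qcont ω))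
  set u : ℝ → ℝ := fun r => (∫ ω, g ω * f (N s ω) ∂P) - 1 / 2 * ∫ v in s..r, φ v with hu
  have gi : ∀ r, s ≤ r → Integrable (fun ω => g ω * f (N r ω)) P := by
    intro r hr
    refine Integrable.of_bound (hgm.mul (cf.comp_stronglyMeasurable
      (h.stronglyMeasurable hr))).aestronglyMeasurable (cg * 1) (ae_of_all _ fun ω => ?_)
    rw [norm_mul]
    exact mul_le_mul (hgc ω) (hfc _) (norm_nonneg _) hcg0
  have hueq : ∀ r, s ≤ r → ∫ ω, g ω * f (N r ω) ∂P = u r := by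
    intro r hr
    have ito := h.integral_mul_comp_sub hr cf cf1 cf.neg (c := 1) (K := 2 * 1) hfc hf1c
      (fun x => by simpa using hfc x)
      (abs_taylor_two_le d1 d2 (fun x => (d1 x).neg) (fun x => by simpa using hfc x)
        (fun x => by simpa using hf1c x)) hg hgc
    have e1 : ∫ ω, g ω * (f (N r ω) - f (N s ω)) ∂P
        = ∫ ω, g ω * f (N r ω) ∂P - ∫ ω, g ω * f (N s ω) ∂P := by
      rw [← integral_sub (gi r hr) (gi s le_rfl)]
      simp only [mul_sub]
    have hi : Integrable (fun p : ℝ × Ω => g p.2 * (f (N (max p.1 s) p.2) * q p.1 p.2))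
        ((volume.restrict (Ioc s r)).prod P) := by
      have hm : StronglyMeasurable
          (fun p : ℝ × Ω => g p.2 * (f (N (max p.1 s) p.2) * q p.1 p.2)) :=
        (hgm.comp_measurable measurable_snd).mul
          ((cf.comp_stronglyMeasurable h.stronglyMeasurable_uncurry_max).mul
            (h.stronglyMeasurable_q_uncurry.comp_measurable measurable_swap))
      exact Integrable.of_bound hm.aestronglyMeasurable (cg * C) (ae_of_all _ fun p => hb _ _)
    have e2 : ∫ v in s..r, φ v = ∫ ω, g ω * (∫ v in s..r, f (N v ω) * q v ω) ∂P := by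
      rw [intervalIntegral.integral_of_le hr, hφ, integral_integral_swap hi]
      refine integral_congr_ae (ae_of_all _ fun ω => ?_)
      simp only
      rw [integral_const_mul, intervalIntegral.integral_of_le hr]
      congr 1
      refine setIntegral_congr_fun measurableSet_Ioc fun v hv => ?_
      simp only [max_eq_left hv.1.le]
    have e3 : ∫ ω, g ω * (∫ v in s..r, -f (N v ω) * q v ω) ∂P
        = - ∫ ω, g ω * (∫ v in s..r, f (N v ω) * q v ω) ∂P := by
      rw [← integral_neg]
      simp [intervalIntegral.integral_neg]
    simp only [Pi.neg_apply] at ito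
    rw [e1, e3, ← e2] at ito
    simp only [hu]
    linarith
  have hud : ∀ r, HasDerivAt u (-(1 / 2 * φ r)) r := by
    intro r
    exact ((((hφc.integral_hasStrictDerivAt s r).hasDerivAt).const_mul (1 / 2)).const_sub _)
  set I := ∫ ω, |g ω| * w ω ∂P with hI
  have gwi : Integrable (fun ω => |g ω| * w ω) P :=
    hw.bdd_mul hgm.norm.aestronglyMeasurable (c := cg)
      (ae_of_all _ fun ω => by simpa using hgc ω)
  have hbd : ∀ r ∈ Icc s t, |q₀ * u r - φ r| ≤ I := by
    intro r hr
    have i1 := (gi r hr.1).const_mul q₀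
    have i2 : Integrable (fun ω => g ω * (f (N (max r s) ω) * q r ω)) P :=
      Integrable.of_bound (hgm.mul ((hNm r).mul (h.qmeas r))).aestronglyMeasurable (cg * C)
        (ae_of_all _ fun ω => hb r ω)
    rw [← hueq r hr.1, hφ, ← integral_const_mul, ← integral_sub i1 i2, ← Real.norm_eq_abs]
    refine norm_integral_le_of_norm_le gwi (ae_of_all _ fun ω => ?_)
    rw [max_eq_left hr.1, Real.norm_eq_abs,
      show q₀ * (g ω * f (N r ω)) - g ω * (f (N r ω) * q r ω)
        = g ω * (f (N r ω) * (q₀ - q r ω)) by ring, abs_mul, abs_mul]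
    refine mul_le_mul_of_nonneg_left ?_ (abs_nonneg _)
    rw [abs_sub_comm]
    calc _ ≤ 1 * w ω := mul_le_mul (hfc _) (hqw r hr ω) (abs_nonneg _) zero_le_one
      _ = w ω := one_mul _
  have hI0 : 0 ≤ I := (abs_nonneg _).trans (hbd s ⟨le_rfl, hst⟩)
  -- derivative of the rescaled function, run backwards from `t`
  set W : ℝ → ℝ := fun r => Real.exp (q₀ * (r - t) / 2) * u r with hW
  have hWd : ∀ r, HasDerivAt W (Real.exp (q₀ * (r - t) / 2) * (1 / 2 * (q₀ * u r - φ r))) r := by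
    intro r
    have e := ((((hasDerivAt_id r).sub_const t).const_mul q₀).div_const 2).exp
    refine (e.mul (hud r)).congr_deriv ?_
    simp only [id]; ring
  have hWle : ‖W t - W s‖ ≤ I / 2 * ‖t - s‖ := by
    refine Convex.norm_image_sub_le_of_norm_hasDerivWithin_le (s := Icc s t)
      (fun r _ => (hWd r).hasDerivWithinAt) (fun r hr => ?_) (convex_Icc s t)
      (left_mem_Icc.2 hst) (right_mem_Icc.2 hst)
    have e1 : Real.exp (q₀ * (r - t) / 2) ≤ 1 := by
      rw [Real.exp_le_one_iff]
      have := mul_nonneg hq₀ (sub_nonneg.2 hr.2)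
      linarith
    rw [norm_mul, norm_mul, Real.norm_eq_abs, Real.norm_eq_abs, Real.norm_eq_abs, Real.abs_exp]
    calc _ ≤ 1 * (|1 / 2| * I) := by
          gcongr
          exact hbd r hr
      _ = I / 2 := by rw [abs_of_pos (by norm_num)]; ring
  have eW : W t - W s = ∫ ω, g ω * f (N t ω) ∂P
      - Real.exp (-(q₀ * (t - s) / 2)) * ∫ ω, g ω * f (N s ω) ∂P := by
    rw [hueq t hst, hueq s le_rfl]
    simp only [hW, sub_self, mul_zero, zero_div, Real.exp_zero, one_mul]
    congr 3
    ring
  rw [← eW, ← Real.norm_eq_abs]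
  refine hWle.trans (le_of_eq ?_)
  rw [Real.norm_eq_abs, abs_of_nonneg (sub_nonneg.2 hst)]
  ring

end IsBracketMart

/-- Orthogonality of martingale increments to variables known at the earlier time. -/
lemma MeasureTheory.Martingale.integral_mul_sub_eq_zero {Ω : Type*} [mΩ : MeasurableSpace Ω]
    {P : Measure Ω} [IsFiniteMeasure P] {𝒢 : Filtration ℝ mΩ} {f : ℝ → Ω → ℝ}
    (hf : Martingale f 𝒢 P) {r₁ r₂ : ℝ} (h : r₁ ≤ r₂) {g : Ω → ℝ} (hg : StronglyMeasurable[𝒢 r₁] g)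
    (h1 : Integrable (fun ω => g ω * f r₁ ω) P) (h2 : Integrable (fun ω => g ω * f r₂ ω) P) :
    ∫ ω, g ω * (f r₂ ω - f r₁ ω) ∂P = 0 := by
  have e : ∫ ω, g ω * f r₂ ω ∂P = ∫ ω, g ω * f r₁ ω ∂P := by
    rw [← integral_condExp (𝒢.le r₁)]
    refine integral_congr_ae ?_
    have := condExp_mul_of_stronglyMeasurable_left (μ := P) (f := g) (g := f r₂) hg h2
      (hf.integrable r₂)
    filter_upwards [this, hf.condExp_ae_eq h] with ω hω hω'
    change (P[g * f r₂|𝒢 r₁]) ω = _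
    rw [hω, Pi.mul_apply, hω']
  simp only [mul_sub]
  rw [integral_sub h2 h1, e, sub_self]

lemma MeasureTheory.integrable_bdd_mul' {Ω : Type*} [MeasurableSpace Ω] {P : Measure Ω}
    {g f : Ω → ℝ} (hg : StronglyMeasurable g) {c : ℝ} (hgc : ∀ ω, |g ω| ≤ c)
    (hf : Integrable f P) : Integrable (fun ω => g ω * f ω) P :=
  hf.bdd_mul hg.aestronglyMeasurable (c := c) (ae_of_all _ fun ω => by simpa using hgc ω)

namespace PathSDE

/-- The segment process, frozen before time `0`. -/
def seg (S : PathSDE d r₀ Ω P) (ξ : Seg d r₀) (t : ℝ) (ω : Ω) : Seg d r₀ := S.X ξ (max t 0) ω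

/-- The accumulated drift. -/
def dr (S : PathSDE d r₀ Ω P) (ξ : Seg d r₀) (t : ℝ) (ω : Ω) : EucSp d :=
  ∫ s in (0:ℝ)..(max t 0), S.b (S.seg ξ s ω)

/-- The martingale part of the solution. -/
def mg (S : PathSDE d r₀ Ω P) (ξ : Seg d r₀) (t : ℝ) (ω : Ω) : EucSp d :=
  S.Y ξ ω (max t 0) - ev0 S.hr₀ ξ - S.dr ξ t ω

/-- The bilinear diffusion form. -/
def diff (S : PathSDE d r₀ Ω P) (η : Seg d r₀) (u v : EucSp d) : ℝ :=
  ⟪(ContinuousLinearMap.adjoint (S.σ η)) u, (ContinuousLinearMap.adjoint (S.σ η)) v⟫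

variable (S : PathSDE d r₀ Ω P) (ξ : Seg d r₀)

lemma seg_of_nonneg {t : ℝ} (ht : 0 ≤ t) (ω : Ω) : S.seg ξ t ω = S.X ξ t ω := by
  rw [seg, max_eq_left ht]

lemma seg_apply (t : ℝ) (ω : Ω) (θ : Icc (-r₀) (0:ℝ)) :
    S.seg ξ t ω θ = S.Y ξ ω (max t 0 + θ) := S.hX ξ _ (le_max_right _ _) ω θ

lemma ev0_seg (t : ℝ) (ω : Ω) : ev0 S.hr₀ (S.seg ξ t ω) = S.Y ξ ω (max t 0) := by
  rw [ev0, seg_apply, add_zero]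

lemma seg_zero (ω : Ω) : S.seg ξ 0 ω = ξ := by
  ext1 θ
  rw [seg_apply, max_self, zero_add, S.hY0]

lemma continuous_seg (ω : Ω) : Continuous fun t => S.seg ξ t ω := by
  let F : C(ℝ × Icc (-r₀) (0:ℝ), EucSp d) :=
    ⟨fun p => S.Y ξ ω (max p.1 0 + p.2.1), (S.hYcont ξ ω).comp (by fun_prop)⟩
  have : (fun t => S.seg ξ t ω) = F.curry := by
    funext t
    ext1 θ
    rw [seg_apply]; rfl
  rw [this]
  exact F.curry.continuous

lemma continuous_b_seg (ω : Ω) : Continuous fun t => S.b (S.seg ξ t ω) :=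
  S.hA1bcont.comp (S.continuous_seg ξ ω)

lemma continuous_dr (ω : Ω) : Continuous fun t => S.dr ξ t ω := by
  have : Continuous fun t : ℝ => ∫ s in (0:ℝ)..t, S.b (S.seg ξ s ω) :=
    intervalIntegral.continuous_primitive (fun _ _ => (S.continuous_b_seg ξ ω).intervalIntegrable _ _) 0
  exact this.comp (continuous_id.max continuous_const)

lemma dr_sub (ω : Ω) {s t : ℝ} (hs : 0 ≤ s) (ht : 0 ≤ t) :
    S.dr ξ t ω - S.dr ξ s ω = ∫ r in s..t, S.b (S.seg ξ r ω) := by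
  rw [dr, dr, max_eq_left hs, max_eq_left ht]
  exact intervalIntegral.integral_interval_sub_left ((S.continuous_b_seg ξ ω).intervalIntegrable _ _)
    ((S.continuous_b_seg ξ ω).intervalIntegrable _ _)

lemma continuous_mg (ω : Ω) : Continuous fun t => S.mg ξ t ω :=
  (((S.hYcont ξ ω).comp (continuous_id.max continuous_const)).sub continuous_const).sub
    (S.continuous_dr ξ ω)

lemma Y_eq {s t : ℝ} (hs : 0 ≤ s) (ht : 0 ≤ t) (ω : Ω) :
    S.Y ξ ω t = S.Y ξ ω s + (S.dr ξ t ω - S.dr ξ s ω) + (S.mg ξ t ω - S.mg ξ s ω) := by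
  simp only [mg, max_eq_left hs, max_eq_left ht]
  abel

lemma stronglyMeasurable_seg (t : ℝ) : StronglyMeasurable[S.ℱ (max t 0)] (S.seg ξ t) :=
  S.hXadapted ξ _ (le_max_right _ _)

lemma stronglyMeasurable_seg' (t : ℝ) : StronglyMeasurable (S.seg ξ t) :=
  (S.stronglyMeasurable_seg ξ t).mono (S.ℱ.le _)

lemma inner_mg (u : EucSp d) (t : ℝ) (ω : Ω) :
    ⟪u, S.mg ξ t ω⟫ = ⟪u, S.Y ξ ω (max t 0)⟫ - ⟪u, ev0 S.hr₀ ξ⟫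
        - ∫ s in (0:ℝ)..(max t 0), ⟪u, S.b (S.X ξ s ω)⟫ := by
  rw [mg, inner_sub_right, inner_sub_right, dr]
  congr 1
  have h1 := (innerSL ℝ u).intervalIntegral_comp_comm
    ((S.continuous_b_seg ξ ω).intervalIntegrable (μ := volume) 0 (max t 0))
  simp only [innerSL_apply_apply] at h1
  rw [← h1]
  refine intervalIntegral.integral_congr fun s hs => ?_
  rw [uIcc_of_le (le_max_right _ _)] at hs
  simp only [S.seg_of_nonneg ξ hs.1]

lemma martingale_inner_mg (u : EucSp d) : Martingale (fun t ω => ⟪u, S.mg ξ t ω⟫) S.ℱ P := by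
  have := S.hSDE₁ ξ u
  simp only [← inner_mg] at this
  exact this

lemma martingale_inner_mul_inner (u v : EucSp d) :
    Martingale (fun t ω => ⟪u, S.mg ξ t ω⟫ * ⟪v, S.mg ξ t ω⟫
      - ∫ s in (0:ℝ)..(max t 0), S.diff (S.seg ξ s ω) u v) S.ℱ P := by
  have := S.hSDE₂ ξ u v
  simp only [← inner_mg] at this
  convert this using 4 with t ω
  refine intervalIntegral.integral_congr fun s hs => ?_
  rw [uIcc_of_le (le_max_right _ _)] at hs
  simp only [S.seg_of_nonneg ξ hs.1, diff]

/-- A common bound for `σ` and its inverse. -/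
def bd (S : PathSDE d r₀ Ω P) : ℝ := max 1 S.hA3.choose

lemma one_le_bd : 1 ≤ S.bd := le_max_left _ _

lemma norm_σ_le (η : Seg d r₀) : ‖S.σ η‖ ≤ S.bd := by
  have := S.hA3.choose_spec η
  have h2 := norm_nonneg (S.σinv η)
  exact le_trans (by linarith) (le_max_right _ _)

lemma norm_σinv_le (η : Seg d r₀) : ‖S.σinv η‖ ≤ S.bd := by
  have := S.hA3.choose_spec η
  have h2 := norm_nonneg (S.σ η)
  exact le_trans (by linarith) (le_max_right _ _)

lemma norm_adjoint_σ_le (η : Seg d r₀) (u : EucSp d) :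
    ‖(ContinuousLinearMap.adjoint (S.σ η)) u‖ ≤ S.bd * ‖u‖ := by
  refine (ContinuousLinearMap.le_opNorm _ _).trans ?_
  rw [LinearIsometryEquiv.norm_map]
  gcongr
  exact S.norm_σ_le η

lemma abs_diff_le (η : Seg d r₀) (u v : EucSp d) : |S.diff η u v| ≤ S.bd ^ 2 * (‖u‖ * ‖v‖) := by
  refine (abs_real_inner_le_norm _ _).trans ?_
  calc _ ≤ (S.bd * ‖u‖) * (S.bd * ‖v‖) := by
        exact mul_le_mul (S.norm_adjoint_σ_le η u) (S.norm_adjoint_σ_le η v) (norm_nonneg _)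
          (by have := S.one_le_bd; positivity)
    _ = _ := by ring

lemma diff_self_nonneg (η : Seg d r₀) (u : EucSp d) : 0 ≤ S.diff η u u := real_inner_self_nonneg

lemma continuous_σ : Continuous S.σ := S.hA1σ.choose_spec.continuous

lemma continuous_diff (u v : EucSp d) : Continuous fun η => S.diff η u v := by
  unfold diff
  have : Continuous fun η => ContinuousLinearMap.adjoint (S.σ η) :=
    (LinearIsometryEquiv.continuous _).comp S.continuous_σ
  exact (this.clm_apply continuous_const).inner (this.clm_apply continuous_const)

lemma continuous_diff_prod : Continuous fun p : Seg d r₀ × EucSp d => S.diff p.1 p.2 p.2 := by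
  unfold diff
  have : Continuous fun p : Seg d r₀ × EucSp d => ContinuousLinearMap.adjoint (S.σ p.1) :=
    (LinearIsometryEquiv.continuous _).comp (S.continuous_σ.comp continuous_fst)
  exact (this.clm_apply continuous_snd).inner (this.clm_apply continuous_snd)

lemma stronglyMeasurable_mg (t : ℝ) : StronglyMeasurable[S.ℱ t] (S.mg ξ t) := by
  have h : ∀ i, StronglyMeasurable[S.ℱ t] fun ω =>
      ⟪EuclideanSpace.single i (1:ℝ), S.mg ξ t ω⟫ • (EuclideanSpace.single i (1:ℝ) : EucSp d) :=
    fun i => ((S.martingale_inner_mg ξ (EuclideanSpace.single i 1)).1 t).smul_const _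
  have e : S.mg ξ t = fun ω => ∑ i,
      ⟪EuclideanSpace.single i (1:ℝ), S.mg ξ t ω⟫ • (EuclideanSpace.single i (1:ℝ) : EucSp d) := by
    funext ω
    ext j
    simp [EuclideanSpace.inner_single_left, Pi.single_apply]
  rw [e]
  exact Finset.stronglyMeasurable_fun_sum _ fun i _ => h i

attribute [irreducible] seg dr mg diff

lemma stronglyMeasurable_diff_uncurry (u v : EucSp d) :
    StronglyMeasurable fun p : Ω × ℝ => S.diff (S.seg ξ p.2 p.1) u v := by
  have h1 : ∀ ω, Continuous fun r : ℝ => S.diff (S.seg ξ r ω) u v := fun ω =>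
    (S.continuous_diff u v).comp (S.continuous_seg ξ ω)
  have h2 : ∀ r : ℝ, StronglyMeasurable fun ω => S.diff (S.seg ξ r ω) u v := fun r =>
    (S.continuous_diff u v).comp_stronglyMeasurable (S.stronglyMeasurable_seg' ξ r)
  have h3 := stronglyMeasurable_uncurry_of_continuous_of_stronglyMeasurable
    (u := fun (r : ℝ) (ω : Ω) => S.diff (S.seg ξ r ω) u v) h1 h2
  exact h3.comp_measurable measurable_swap

lemma integrable_integral_diff (u v : EucSp d) (a b : ℝ) :
    Integrable (fun ω => ∫ s in a..b, S.diff (S.seg ξ s ω) u v) P := by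
  have := S.hP
  have hm : StronglyMeasurable fun ω => ∫ s in a..b, S.diff (S.seg ξ s ω) u v := by
    simp only [intervalIntegral]
    exact ((S.stronglyMeasurable_diff_uncurry ξ u v).integral_prod_right).sub
      ((S.stronglyMeasurable_diff_uncurry ξ u v).integral_prod_right)
  refine Integrable.of_bound hm.aestronglyMeasurable (S.bd ^ 2 * (‖u‖ * ‖v‖) * |b - a|)
    (ae_of_all _ fun ω => ?_)
  exact intervalIntegral.norm_integral_le_of_norm_le_const fun s _ => S.abs_diff_le _ u v

lemma integrable_inner_mul_inner (u v : EucSp d) (t : ℝ) :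
    Integrable (fun ω => ⟪u, S.mg ξ t ω⟫ * ⟪v, S.mg ξ t ω⟫) P := by
  have := ((S.martingale_inner_mul_inner ξ u v).integrable t).add
    (S.integrable_integral_diff ξ u v 0 (max t 0))
  refine this.congr (ae_of_all _ fun ω => ?_)
  simp

lemma memLp_inner_mg (u : EucSp d) (t : ℝ) : MemLp (fun ω => ⟪u, S.mg ξ t ω⟫) 2 P := by
  rw [memLp_two_iff_integrable_sq]
  · simpa [sq] using S.integrable_inner_mul_inner ξ u u t
  · exact ((S.martingale_inner_mg ξ u).integrable t).aestronglyMeasurable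

/-- Bracket identity for two coordinates against a bounded variable known at the earlier time. -/
lemma integral_mul_inner_sub_mul (u v : EucSp d) {r₁ r₂ : ℝ} (h₁ : 0 ≤ r₁) (h₁₂ : r₁ ≤ r₂)
    {g : Ω → ℝ} (hg : StronglyMeasurable[S.ℱ r₁] g) {c : ℝ} (hgc : ∀ ω, |g ω| ≤ c) :
    ∫ ω, g ω * (⟪u, S.mg ξ r₂ ω - S.mg ξ r₁ ω⟫ * ⟪v, S.mg ξ r₂ ω - S.mg ξ r₁ ω⟫) ∂P
      = ∫ ω, g ω * (∫ s in r₁..r₂, S.diff (S.seg ξ s ω) u v) ∂P := by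
  have := S.hP
  have hgm := hg.mono (S.ℱ.le _)
  have h2 : 0 ≤ r₂ := h₁.trans h₁₂
  have mu := S.martingale_inner_mg ξ u
  have mv := S.martingale_inner_mg ξ v
  have muv := S.martingale_inner_mul_inner ξ u v
  have crossi : ∀ (a b : EucSp d) (p r : ℝ),
      Integrable (fun ω => g ω * (⟪a, S.mg ξ p ω⟫ * ⟪b, S.mg ξ r ω⟫)) P := fun a b p r =>
    integrable_bdd_mul' hgm hgc ((S.memLp_inner_mg ξ a p).integrable_mul (S.memLp_inner_mg ξ b r))
  have z1 : ∫ ω, (g ω * ⟪u, S.mg ξ r₁ ω⟫) * (⟪v, S.mg ξ r₂ ω⟫ - ⟪v, S.mg ξ r₁ ω⟫) ∂P = 0 :=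
    mv.integral_mul_sub_eq_zero h₁₂ (hg.mul (mu.1 r₁))
      (by simpa [mul_assoc] using crossi u v r₁ r₁) (by simpa [mul_assoc] using crossi u v r₁ r₂)
  have z2 : ∫ ω, (g ω * ⟪v, S.mg ξ r₁ ω⟫) * (⟪u, S.mg ξ r₂ ω⟫ - ⟪u, S.mg ξ r₁ ω⟫) ∂P = 0 :=
    mu.integral_mul_sub_eq_zero h₁₂ (hg.mul (mv.1 r₁))
      (by simpa [mul_assoc] using crossi v u r₁ r₁) (by simpa [mul_assoc] using crossi v u r₁ r₂)
  have z3 := muv.integral_mul_sub_eq_zero h₁₂ hg (integrable_bdd_mul' hgm hgc (muv.integrable _))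
    (integrable_bdd_mul' hgm hgc (muv.integrable _))
  have hsub : ∀ ω, (∫ s in (0:ℝ)..(max r₂ 0), S.diff (S.seg ξ s ω) u v)
      - (∫ s in (0:ℝ)..(max r₁ 0), S.diff (S.seg ξ s ω) u v)
      = ∫ s in r₁..r₂, S.diff (S.seg ξ s ω) u v := by
    intro ω
    have hc : Continuous fun s => S.diff (S.seg ξ s ω) u v :=
      (S.continuous_diff u v).comp (S.continuous_seg ξ ω)
    rw [max_eq_left h₁, max_eq_left h2]
    exact intervalIntegral.integral_interval_sub_left (hc.intervalIntegrable _ _)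
      (hc.intervalIntegrable _ _)
  have iq := integrable_bdd_mul' hgm hgc (S.integrable_integral_diff ξ u v r₁ r₂)
  have i1 : Integrable (fun ω => (g ω * ⟪u, S.mg ξ r₁ ω⟫) *
      (⟪v, S.mg ξ r₂ ω⟫ - ⟪v, S.mg ξ r₁ ω⟫)) P := by
    refine ((crossi u v r₁ r₂).sub (crossi u v r₁ r₁)).congr (ae_of_all _ fun ω => ?_)
    simp only [Pi.sub_apply]; ring
  have i2 : Integrable (fun ω => (g ω * ⟪v, S.mg ξ r₁ ω⟫) *
      (⟪u, S.mg ξ r₂ ω⟫ - ⟪u, S.mg ξ r₁ ω⟫)) P := by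
    refine ((crossi v u r₁ r₂).sub (crossi v u r₁ r₁)).congr (ae_of_all _ fun ω => ?_)
    simp only [Pi.sub_apply]; ring
  have i3 := integrable_bdd_mul' hgm hgc ((muv.integrable r₂).sub (muv.integrable r₁))
  have e : ∀ ω, g ω * (⟪u, S.mg ξ r₂ ω - S.mg ξ r₁ ω⟫ * ⟪v, S.mg ξ r₂ ω - S.mg ξ r₁ ω⟫)
      = g ω * ((⟪u, S.mg ξ r₂ ω⟫ * ⟪v, S.mg ξ r₂ ω⟫
        - ∫ s in (0:ℝ)..(max r₂ 0), S.diff (S.seg ξ s ω) u v)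
        - (⟪u, S.mg ξ r₁ ω⟫ * ⟪v, S.mg ξ r₁ ω⟫
        - ∫ s in (0:ℝ)..(max r₁ 0), S.diff (S.seg ξ s ω) u v))
        + g ω * (∫ s in r₁..r₂, S.diff (S.seg ξ s ω) u v)
        - (g ω * ⟪u, S.mg ξ r₁ ω⟫) * (⟪v, S.mg ξ r₂ ω⟫ - ⟪v, S.mg ξ r₁ ω⟫)
        - (g ω * ⟪v, S.mg ξ r₁ ω⟫) * (⟪u, S.mg ξ r₂ ω⟫ - ⟪u, S.mg ξ r₁ ω⟫) := by
    intro ω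
    rw [← hsub ω]
    simp only [inner_sub_right]
    ring
  simp_rw [e]
  rw [integral_sub (by exact (i3.add iq).sub i1) i2, integral_sub (by exact i3.add iq) i1,
    integral_add (by exact i3) iq, z1, z2, z3]
  ring

/-- Scalar projections of the martingale part, along directions known at time `s`, have bounded
bracket density. -/
theorem isBracketMart {s : ℝ} (hs : 0 ≤ s) {v : Ω → EucSp d} (hv : StronglyMeasurable[S.ℱ s] v)
    {c : ℝ} (hvc : ∀ ω, ‖v ω‖ ≤ c) :
    IsBracketMart P S.ℱ s (S.bd ^ 2 * c ^ 2)
      (fun r ω => ⟪v ω, S.mg ξ (max r s) ω - S.mg ξ s ω⟫)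
      (fun r ω => S.diff (S.seg ξ r ω) (v ω) (v ω)) := by
  have := S.hP
  have hΩ : Nonempty Ω := P.nonempty_of_neZero
  have hc0 : 0 ≤ c := (norm_nonneg _).trans (hvc hΩ.some)
  have hvm : StronglyMeasurable v := hv.mono (S.ℱ.le _)
  have hvi : ∀ i, StronglyMeasurable[S.ℱ s] fun ω => v ω i := fun i =>
    (EuclideanSpace.proj (𝕜 := ℝ) i).continuous.comp_stronglyMeasurable hv
  have hvic : ∀ i ω, |v ω i| ≤ c := fun i ω => (EuclideanSpace.norm_eq (v ω) ▸ hvc ω |> fun _ =>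
    (PiLp.norm_apply_le (v ω) i).trans (hvc ω))
  set e : Fin d → EucSp d := fun i => EuclideanSpace.single i 1 with he
  have hinner : ∀ ω (w : EucSp d), ⟪v ω, w⟫ = ∑ i, v ω i * ⟪e i, w⟫ := by
    intro ω w
    simp [he, EuclideanSpace.inner_single_left, PiLp.inner_apply, mul_comm]
  have hvsum : ∀ ω, v ω = ∑ i, v ω i • e i := by
    intro ω
    ext j
    simp [he, Finset.sum_apply, Pi.single_apply]
  have hdiff : ∀ η ω, S.diff η (v ω) (v ω) = ∑ i, ∑ j, v ω i * v ω j * S.diff η (e i) (e j) := by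
    intro η ω
    conv_lhs => rw [hvsum ω]
    simp only [diff, map_sum, map_smul, sum_inner, inner_sum, real_inner_smul_left,
      real_inner_smul_right]
    rw [Finset.sum_comm]
    refine Finset.sum_congr rfl fun i _ => Finset.sum_congr rfl fun j _ => by ring
  have smM : ∀ r, s ≤ r → StronglyMeasurable[S.ℱ r]
      fun ω => ⟪v ω, S.mg ξ (max r s) ω - S.mg ξ s ω⟫ := by
    intro r hr
    rw [max_eq_left hr]
    exact (hv.mono (S.ℱ.mono hr)).inner ((S.stronglyMeasurable_mg ξ _).sub
      ((S.stronglyMeasurable_mg ξ _).mono (S.ℱ.mono hr)))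
  refine ⟨fun ω => ?_, smM, fun r hr => ?_, fun ω => ?_, fun r => ?_, fun r ω => ?_, fun r ω => ?_,
    fun r₁ r₂ h1 h12 g hg hgc => ?_, fun r₁ r₂ h1 h12 g hg hgc => ?_⟩
  · exact continuous_const.inner (((S.continuous_mg ξ ω).comp
      (continuous_id.max continuous_const)).sub continuous_const)
  · simp_rw [hinner]
    refine memLp_finsetSum _ fun i _ => ?_
    have h1 : MemLp (fun ω => ⟪e i, S.mg ξ (max r s) ω - S.mg ξ s ω⟫) 2 P := by
      simp_rw [inner_sub_right]
      exact (S.memLp_inner_mg ξ (e i) _).sub (S.memLp_inner_mg ξ (e i) _)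
    refine (h1.const_mul c).mono ((((hvi i).mono (S.ℱ.le _)).aestronglyMeasurable).mul h1.1)
      (ae_of_all _ fun ω => ?_)
    rw [norm_mul, norm_mul, Real.norm_of_nonneg hc0]
    exact mul_le_mul_of_nonneg_right (hvic i ω) (norm_nonneg _)
  · exact S.continuous_diff_prod.comp ((S.continuous_seg ξ ω).prodMk continuous_const)
  · exact S.continuous_diff_prod.comp_stronglyMeasurable
      ((S.stronglyMeasurable_seg' ξ r).prodMk hvm)
  · exact S.diff_self_nonneg _ _
  · refine (le_abs_self _).trans ((S.abs_diff_le _ _ _).trans ?_)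
    rw [← sq]
    gcongr
    exact hvc ω
  · obtain ⟨cg, hcg⟩ := hgc
    have hcg0 : 0 ≤ cg := (abs_nonneg _).trans (hcg hΩ.some)
    rw [max_eq_left h1, max_eq_left (h1.trans h12)]
    have eq : ∀ ω, g ω * (⟪v ω, S.mg ξ r₂ ω - S.mg ξ s ω⟫ - ⟪v ω, S.mg ξ r₁ ω - S.mg ξ s ω⟫)
        = ∑ i, (g ω * v ω i) * (⟪e i, S.mg ξ r₂ ω⟫ - ⟪e i, S.mg ξ r₁ ω⟫) := by
      intro ω
      rw [hinner, hinner, ← Finset.sum_sub_distrib, Finset.mul_sum]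
      refine Finset.sum_congr rfl fun i _ => ?_
      simp only [inner_sub_right]; ring
    have gm : ∀ i, StronglyMeasurable[S.ℱ r₁] fun ω => g ω * v ω i := fun i =>
      hg.mul ((hvi i).mono (S.ℱ.mono h1))
    have gb : ∀ i ω, |g ω * v ω i| ≤ cg * c := fun i ω => by
      rw [abs_mul]; exact mul_le_mul (hcg ω) (hvic i ω) (abs_nonneg _) hcg0
    have gi : ∀ i r, Integrable (fun ω => (g ω * v ω i) * ⟪e i, S.mg ξ r ω⟫) P := fun i r =>
      integrable_bdd_mul' ((gm i).mono (S.ℱ.le _)) (gb i)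
        ((S.martingale_inner_mg ξ (e i)).integrable r)
    simp_rw [eq]
    rw [integral_finsetSum]
    · refine Finset.sum_eq_zero fun i _ => ?_
      exact (S.martingale_inner_mg ξ (e i)).integral_mul_sub_eq_zero h12 (gm i) (gi i r₁) (gi i r₂)
    · intro i _
      refine ((gi i r₂).sub (gi i r₁)).congr (ae_of_all _ fun ω => ?_)
      simp only [Pi.sub_apply]; ring
  · obtain ⟨cg, hcg⟩ := hgc
    have hcg0 : 0 ≤ cg := (abs_nonneg _).trans (hcg hΩ.some)
    rw [max_eq_left h1, max_eq_left (h1.trans h12)]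
    have gm : ∀ i j, StronglyMeasurable[S.ℱ r₁] fun ω => g ω * (v ω i * v ω j) := fun i j =>
      hg.mul (((hvi i).mul (hvi j)).mono (S.ℱ.mono h1))
    have gb : ∀ i j ω, |g ω * (v ω i * v ω j)| ≤ cg * (c * c) := fun i j ω => by
      rw [abs_mul, abs_mul]
      exact mul_le_mul (hcg ω) (mul_le_mul (hvic i ω) (hvic j ω) (abs_nonneg _) hc0)
        (by positivity) hcg0
    have e1 : ∀ ω, g ω * (⟪v ω, S.mg ξ r₂ ω - S.mg ξ s ω⟫ - ⟪v ω, S.mg ξ r₁ ω - S.mg ξ s ω⟫) ^ 2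
        = ∑ i, ∑ j, (g ω * (v ω i * v ω j)) * (⟪e i, S.mg ξ r₂ ω - S.mg ξ r₁ ω⟫ *
          ⟪e j, S.mg ξ r₂ ω - S.mg ξ r₁ ω⟫) := by
      intro ω
      rw [← inner_sub_right, sub_sub_sub_cancel_right, hinner, sq, Finset.sum_mul_sum,
        Finset.mul_sum]
      refine Finset.sum_congr rfl fun i _ => ?_
      rw [Finset.mul_sum]
      refine Finset.sum_congr rfl fun j _ => by ring
    have e2 : ∀ ω, g ω * (∫ u in r₁..r₂, S.diff (S.seg ξ u ω) (v ω) (v ω))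
        = ∑ i, ∑ j, (g ω * (v ω i * v ω j)) *
          (∫ u in r₁..r₂, S.diff (S.seg ξ u ω) (e i) (e j)) := by
      intro ω
      have hc : ∀ i j, Continuous fun u => S.diff (S.seg ξ u ω) (e i) (e j) := fun i j =>
        (S.continuous_diff _ _).comp (S.continuous_seg ξ ω)
      simp_rw [hdiff]
      rw [intervalIntegral.integral_finsetSum, Finset.mul_sum]
      · refine Finset.sum_congr rfl fun i _ => ?_
        rw [intervalIntegral.integral_finsetSum, Finset.mul_sum]
        · refine Finset.sum_congr rfl fun j _ => ?_
          rw [intervalIntegral.integral_const_mul]; ring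
        · exact fun j _ => ((hc i j).const_mul _).intervalIntegrable _ _
      · exact fun i _ => (continuous_finsetSum _ fun j _ =>
          (hc i j).const_mul _).intervalIntegrable _ _
    have Ii : ∀ i j, Integrable (fun ω => (g ω * (v ω i * v ω j)) *
        (⟪e i, S.mg ξ r₂ ω - S.mg ξ r₁ ω⟫ * ⟪e j, S.mg ξ r₂ ω - S.mg ξ r₁ ω⟫)) P := by
      intro i j
      refine integrable_bdd_mul' ((gm i j).mono (S.ℱ.le _)) (gb i j) ?_
      have hL : ∀ i, MemLp (fun ω => ⟪e i, S.mg ξ r₂ ω - S.mg ξ r₁ ω⟫) 2 P := fun i => by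
        simp_rw [inner_sub_right]
        exact (S.memLp_inner_mg ξ (e i) _).sub (S.memLp_inner_mg ξ (e i) _)
      exact (hL i).integrable_mul (hL j)
    have Ij : ∀ i j, Integrable (fun ω => (g ω * (v ω i * v ω j)) *
        (∫ u in r₁..r₂, S.diff (S.seg ξ u ω) (e i) (e j))) P := fun i j =>
      integrable_bdd_mul' ((gm i j).mono (S.ℱ.le _)) (gb i j)
        (S.integrable_integral_diff ξ _ _ _ _)
    simp_rw [e1, e2]
    rw [integral_finsetSum _ fun i _ => integrable_finsetSum _ fun j _ => Ii i j,
      integral_finsetSum _ fun i _ => integrable_finsetSum _ fun j _ => Ij i j]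
    refine Finset.sum_congr rfl fun i _ => ?_
    rw [integral_finsetSum _ fun j _ => Ii i j, integral_finsetSum _ fun j _ => Ij i j]
    refine Finset.sum_congr rfl fun j _ => ?_
    exact S.integral_mul_inner_sub_mul ξ _ _ (hs.trans h1) h12 (gm i j) (gb i j)

end PathSDE

/-- Pairs of times in `[0, T]` at distance at most `τ`. -/
def closePairs (T τ : ℝ) : Set (ℝ × ℝ) := {p | p.1 ∈ Icc 0 T ∧ p.2 ∈ Icc 0 T ∧ |p.1 - p.2| ≤ τ}

/-- The modulus of continuity on `[0, T]` at scale `τ` of a process, truncated at `1`. -/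
def modulus {Ω E : Type*} [PseudoMetricSpace E] (Z : ℝ → Ω → E) (T τ : ℝ) (ω : Ω) : ℝ :=
  ⨆ p : closePairs T τ, min 1 (dist (Z p.1.1 ω) (Z p.1.2 ω))

section modulus

variable {Ω E : Type*} [PseudoMetricSpace E] {Z : ℝ → Ω → E} {T τ : ℝ}

lemma bddAbove_modulus (ω : Ω) :
    BddAbove (range fun p : closePairs T τ => min 1 (dist (Z p.1.1 ω) (Z p.1.2 ω))) :=
  ⟨1, by rintro _ ⟨p, rfl⟩; exact min_le_left _ _⟩

lemma modulus_nonneg (ω : Ω) : 0 ≤ modulus Z T τ ω :=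
  Real.iSup_nonneg fun _ => le_min zero_le_one dist_nonneg

lemma modulus_le_one (ω : Ω) : modulus Z T τ ω ≤ 1 :=
  Real.iSup_le (fun _ => min_le_left _ _) zero_le_one

lemma abs_modulus_le_one (ω : Ω) : |modulus Z T τ ω| ≤ 1 := by
  rw [abs_of_nonneg (modulus_nonneg ω)]; exact modulus_le_one ω

lemma min_dist_le_modulus {s t : ℝ} (hs : s ∈ Icc 0 T) (ht : t ∈ Icc 0 T) (h : |s - t| ≤ τ)
    (ω : Ω) : min 1 (dist (Z s ω) (Z t ω)) ≤ modulus Z T τ ω :=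
  le_ciSup (bddAbove_modulus (Z := Z) (T := T) (τ := τ) ω) ⟨(s, t), hs, ht, h⟩

lemma dist_le_mul_modulus {s t : ℝ} (hs : s ∈ Icc 0 T) (ht : t ∈ Icc 0 T) (h : |s - t| ≤ τ)
    (ω : Ω) {c : ℝ} (hc : 1 ≤ c) (hd : dist (Z s ω) (Z t ω) ≤ c) :
    dist (Z s ω) (Z t ω) ≤ c * modulus Z T τ ω := by
  refine le_trans ?_ (mul_le_mul_of_nonneg_left (min_dist_le_modulus hs ht h ω) (by linarith))
  rcases le_total 1 (dist (Z s ω) (Z t ω)) with h1 | h1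
  · rw [min_eq_left h1]; linarith
  · rw [min_eq_right h1]; exact le_mul_of_one_le_left dist_nonneg hc

lemma measurable_modulus [MeasurableSpace Ω] (hc : ∀ ω, Continuous fun t => Z t ω)
    (hm : ∀ t, StronglyMeasurable (Z t)) (T τ : ℝ) : Measurable (modulus Z T τ) := by
  rcases isEmpty_or_nonempty (closePairs T τ) with he | he
  · have : modulus Z T τ = fun _ => 0 := by
      funext ω
      exact Real.iSup_of_isEmpty _
    rw [this]
    exact measurable_const
  · have : modulus Z T τ = fun ω => ⨆ n : ℕ,
        min 1 (dist (Z (TopologicalSpace.denseSeq (closePairs T τ) n).1.1 ω)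
          (Z (TopologicalSpace.denseSeq (closePairs T τ) n).1.2 ω)) := by
      funext ω
      have hcont : Continuous fun p : closePairs T τ => min 1 (dist (Z p.1.1 ω) (Z p.1.2 ω)) :=
        continuous_const.min (((hc ω).comp (continuous_fst.comp continuous_subtype_val)).dist
          ((hc ω).comp (continuous_snd.comp continuous_subtype_val)))
      have hb : BddAbove (range fun n : ℕ =>
          min 1 (dist (Z (TopologicalSpace.denseSeq (closePairs T τ) n).1.1 ω)
          (Z (TopologicalSpace.denseSeq (closePairs T τ) n).1.2 ω))) :=
        ⟨1, by rintro _ ⟨p, rfl⟩; exact min_le_left _ _⟩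
      refine le_antisymm (ciSup_le fun p => ?_) (ciSup_le fun n => le_ciSup
        (bddAbove_modulus (Z := Z) (T := T) (τ := τ) ω) (TopologicalSpace.denseSeq _ n))
      have hcl := isClosed_le hcont (continuous_const (y := ⨆ n : ℕ,
        min 1 (dist (Z (TopologicalSpace.denseSeq (closePairs T τ) n).1.1 ω)
          (Z (TopologicalSpace.denseSeq (closePairs T τ) n).1.2 ω))))
      have hd := TopologicalSpace.denseRange_denseSeq (closePairs T τ)
      exact hd.induction_on p hcl fun n => le_ciSup hb n
    rw [this]
    refine Measurable.iSup fun n => ?_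
    exact measurable_const.min ((hm _).dist (hm _)).measurable

lemma tendsto_modulus (hc : ∀ ω, Continuous fun t => Z t ω) (T : ℝ) {τ : ℕ → ℝ}
    (hτ : Tendsto τ atTop (𝓝 0)) (ω : Ω) :
    Tendsto (fun n => modulus Z T (τ n) ω) atTop (𝓝 0) := by
  have hu : UniformContinuousOn (fun t => Z t ω) (Icc 0 T) :=
    isCompact_Icc.uniformContinuousOn_of_continuous (hc ω).continuousOn
  rw [Metric.uniformContinuousOn_iff] at hu
  rw [Metric.tendsto_nhds]
  intro ε hε
  obtain ⟨δ, hδ, h⟩ := hu (ε / 2) (half_pos hε)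
  filter_upwards [hτ.eventually (gt_mem_nhds hδ)] with n hn
  rw [Real.dist_eq, sub_zero, abs_of_nonneg (modulus_nonneg ω)]
  refine lt_of_le_of_lt (Real.iSup_le (fun p => ?_) (half_pos hε).le) (half_lt_self hε)
  exact (min_le_right _ _).trans (h _ p.2.1 _ p.2.2.1
    (by rw [Real.dist_eq]; exact p.2.2.2.trans_lt hn)).le

lemma integrable_modulus [MeasurableSpace Ω] {P : Measure Ω} [IsFiniteMeasure P]
    (hc : ∀ ω, Continuous fun t => Z t ω) (hm : ∀ t, StronglyMeasurable (Z t)) (T τ : ℝ) :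
    Integrable (modulus Z T τ) P :=
  Integrable.of_bound (measurable_modulus hc hm T τ).aestronglyMeasurable 1
    (ae_of_all _ abs_modulus_le_one)

lemma tendsto_integral_modulus [MeasurableSpace Ω] {P : Measure Ω} [IsFiniteMeasure P]
    (hc : ∀ ω, Continuous fun t => Z t ω)
    (hm : ∀ t, StronglyMeasurable (Z t)) (T : ℝ) {τ : ℕ → ℝ} (hτ : Tendsto τ atTop (𝓝 0)) :
    Tendsto (fun n => ∫ ω, modulus Z T (τ n) ω ∂P) atTop (𝓝 0) := by
  have := tendsto_integral_of_dominated_convergence (μ := P) (F := fun n => modulus Z T (τ n))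
    (f := fun _ => 0) (fun _ => (1:ℝ))
    (fun n => (measurable_modulus hc hm T (τ n)).aestronglyMeasurable) (integrable_const _)
    (fun n => ae_of_all _ abs_modulus_le_one) (ae_of_all _ fun ω => tendsto_modulus hc T hτ ω)
  simpa using this

end modulus

namespace PathSDE

variable (S : PathSDE d r₀ Ω P) (ξ : Seg d r₀)

lemma norm_pow_le_sum (k : ℕ) (x : EucSp d) :
    ‖x‖ ^ (2 * (k + 1))
      ≤ (d : ℝ) ^ k * ∑ i, ⟪EuclideanSpace.single i (1:ℝ), x⟫ ^ (2 * (k + 1)) := by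
  have := pow_sum_le_card_mul_sum_pow (s := Finset.univ) (f := fun i : Fin d => x i ^ 2)
    (fun i _ => sq_nonneg _) k
  rw [pow_mul, EuclideanSpace.real_norm_sq_eq]
  simpa [EuclideanSpace.inner_single_left, pow_mul] using this

/-- Constant in the moment bounds of increments of the martingale part. -/
def momC (S : PathSDE d r₀ Ω P) (k : ℕ) : ℝ :=
  (d : ℝ) ^ k * (d * (IsBracketMart.momentConst (k + 1) * (S.bd ^ 2) ^ (k + 1)))

lemma momC_nonneg (k : ℕ) : 0 ≤ S.momC k := by
  have := IsBracketMart.momentConst_nonneg (k + 1)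
  unfold momC; positivity

/-- Conditional moment bounds for increments of the martingale part. -/
theorem integral_mul_norm_pow_le (k : ℕ) {s t : ℝ} (hs : 0 ≤ s) (hst : s ≤ t) {g : Ω → ℝ}
    (hg : StronglyMeasurable[S.ℱ s] g) {cg : ℝ} (hgc : ∀ ω, |g ω| ≤ cg) (hg0 : ∀ ω, 0 ≤ g ω) :
    Integrable (fun ω => g ω * ‖S.mg ξ t ω - S.mg ξ s ω‖ ^ (2 * (k + 1))) P ∧
    ∫ ω, g ω * ‖S.mg ξ t ω - S.mg ξ s ω‖ ^ (2 * (k + 1)) ∂P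
      ≤ S.momC k * (t - s) ^ (k + 1) * ∫ ω, g ω ∂P := by
  have := S.hP
  have key : ∀ i : Fin d, _ := fun i => (S.isBracketMart ξ hs (v := fun _ =>
    EuclideanSpace.single i (1:ℝ)) stronglyMeasurable_const (c := 1) (by simp)).integral_pow_le
    (by simp) hg hgc hg0 (k + 1) hst
  simp only [max_eq_left hst] at key
  have hI : Integrable (fun ω => (d : ℝ) ^ k * ∑ i : Fin d, g ω *
      ⟪EuclideanSpace.single i (1:ℝ), S.mg ξ t ω - S.mg ξ s ω⟫ ^ (2 * (k + 1))) P :=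
    (integrable_finsetSum _ fun i _ => (key i).1).const_mul _
  have hle : ∀ ω, g ω * ‖S.mg ξ t ω - S.mg ξ s ω‖ ^ (2 * (k + 1)) ≤ (d : ℝ) ^ k * ∑ i : Fin d,
      g ω * ⟪EuclideanSpace.single i (1:ℝ), S.mg ξ t ω - S.mg ξ s ω⟫ ^ (2 * (k + 1)) := by
    intro ω
    rw [← Finset.mul_sum, mul_left_comm]
    exact mul_le_mul_of_nonneg_left (norm_pow_le_sum k _) (hg0 ω)
  have hnn : ∀ ω, 0 ≤ g ω * ‖S.mg ξ t ω - S.mg ξ s ω‖ ^ (2 * (k + 1)) := fun ω =>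
    mul_nonneg (hg0 ω) (by positivity)
  have hJ : Integrable (fun ω => g ω * ‖S.mg ξ t ω - S.mg ξ s ω‖ ^ (2 * (k + 1))) P := by
    refine hI.mono' (((hg.mono (S.ℱ.le _)).mul ((((S.stronglyMeasurable_mg ξ t).mono
      (S.ℱ.le _)).sub ((S.stronglyMeasurable_mg ξ s).mono (S.ℱ.le _))).norm.pow _)).aestronglyMeasurable)
      (ae_of_all _ fun ω => ?_)
    rw [Real.norm_of_nonneg (hnn ω)]
    exact hle ω
  refine ⟨hJ, (integral_mono hJ hI hle).trans ?_⟩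
  rw [integral_const_mul, integral_finsetSum _ fun i _ => (key i).1]
  calc _ ≤ (d : ℝ) ^ k * ∑ i : Fin d, IsBracketMart.momentConst (k + 1) *
        (S.bd ^ 2 * 1 ^ 2 * (t - s)) ^ (k + 1) * ∫ ω, g ω ∂P :=
        mul_le_mul_of_nonneg_left (Finset.sum_le_sum fun i _ => (key i).2) (by positivity)
    _ = _ := by
      rw [Finset.sum_const, Finset.card_univ, Fintype.card_fin, nsmul_eq_mul, momC, mul_pow,
        mul_pow]
      ring

lemma integrable_norm_pow (k : ℕ) {s t : ℝ} (hs : 0 ≤ s) (hst : s ≤ t) :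
    Integrable (fun ω => ‖S.mg ξ t ω - S.mg ξ s ω‖ ^ (2 * (k + 1))) P := by
  simpa using (S.integral_mul_norm_pow_le ξ k hs hst (g := fun _ => 1) stronglyMeasurable_const
    (cg := 1) (by simp) (by simp)).1

/-- Increments of the martingale part are centred given the past. -/
theorem integral_inner_sub_eq_zero {s t : ℝ} (hs : 0 ≤ s) (hst : s ≤ t) {v : Ω → EucSp d}
    (hv : StronglyMeasurable[S.ℱ s] v) {c : ℝ} (hvc : ∀ ω, ‖v ω‖ ≤ c) :
    ∫ ω, ⟪v ω, S.mg ξ t ω - S.mg ξ s ω⟫ ∂P = 0 := by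
  have := (S.isBracketMart ξ hs hv hvc).mart s t le_rfl hst (fun _ => 1) stronglyMeasurable_const
    ⟨1, by simp⟩
  simpa [max_eq_left hst] using this

lemma adjoint_σ_adjoint_σinv (η : Seg d r₀) (u : EucSp d) :
    (ContinuousLinearMap.adjoint (S.σ η)) ((ContinuousLinearMap.adjoint (S.σinv η)) u) = u := by
  have := congrArg ContinuousLinearMap.adjoint (S.hσinv η).2
  rw [ContinuousLinearMap.adjoint_comp, ContinuousLinearMap.adjoint_id] at this
  exact congrArg (fun f => f u) this

lemma norm_adjoint_σinv_le (η : Seg d r₀) (u : EucSp d) :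
    ‖(ContinuousLinearMap.adjoint (S.σinv η)) u‖ ≤ S.bd * ‖u‖ := by
  refine (ContinuousLinearMap.le_opNorm _ _).trans ?_
  rw [LinearIsometryEquiv.norm_map]
  exact mul_le_mul_of_nonneg_right (S.norm_σinv_le η) (norm_nonneg _)

lemma diff_self (η : Seg d r₀) (u : EucSp d) :
    S.diff η u u = ‖(ContinuousLinearMap.adjoint (S.σ η)) u‖ ^ 2 := by
  rw [diff, real_inner_self_eq_norm_sq]

/-- Lipschitz constant of `σ` with respect to the truncated distance. -/
def lipσ (S : PathSDE d r₀ Ω P) : ℝ := max (2 * S.bd) S.hA1σ.choose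

lemma lipσ_nonneg : 0 ≤ S.lipσ := by
  have := S.one_le_bd
  exact le_max_of_le_left (by linarith)

lemma norm_σ_sub_le_lipσ (η ζ : Seg d r₀) : ‖S.σ η - S.σ ζ‖ ≤ S.lipσ * min 1 (dist η ζ) := by
  rcases le_total 1 (dist η ζ) with h | h
  · rw [min_eq_left h, mul_one]
    refine (norm_sub_le _ _).trans (le_trans ?_ (le_max_left _ _))
    have := S.norm_σ_le η; have := S.norm_σ_le ζ; linarith
  · rw [min_eq_right h, ← dist_eq_norm]
    refine (S.hA1σ.choose_spec.dist_le_mul η ζ).trans ?_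
    exact mul_le_mul_of_nonneg_right (le_max_right _ _) dist_nonneg

lemma abs_diff_sub_le (η ζ : Seg d r₀) (v : EucSp d) :
    |S.diff η v v - S.diff ζ v v| ≤ 2 * S.bd * ‖v‖ ^ 2 * (S.lipσ * min 1 (dist η ζ)) := by
  have hb := S.one_le_bd
  rw [diff_self, diff_self]
  set a := (ContinuousLinearMap.adjoint (S.σ η)) v
  set c := (ContinuousLinearMap.adjoint (S.σ ζ)) v
  have ha : ‖a‖ ≤ S.bd * ‖v‖ := S.norm_adjoint_σ_le η v
  have hc : ‖c‖ ≤ S.bd * ‖v‖ := S.norm_adjoint_σ_le ζ v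
  have hac : ‖a - c‖ ≤ S.lipσ * min 1 (dist η ζ) * ‖v‖ := by
    have : a - c = (ContinuousLinearMap.adjoint (S.σ η - S.σ ζ)) v := by
      simp [a, c, map_sub]
    rw [this]
    refine (ContinuousLinearMap.le_opNorm _ _).trans ?_
    rw [LinearIsometryEquiv.norm_map]
    exact mul_le_mul_of_nonneg_right (S.norm_σ_sub_le_lipσ η ζ) (norm_nonneg _)
  have h1 : |‖a‖ - ‖c‖| ≤ ‖a - c‖ := abs_norm_sub_norm_le a c
  have h2 : ‖a‖ ^ 2 - ‖c‖ ^ 2 = (‖a‖ + ‖c‖) * (‖a‖ - ‖c‖) := by ring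
  rw [h2, abs_mul, abs_of_nonneg (by positivity)]
  calc _ ≤ (S.bd * ‖v‖ + S.bd * ‖v‖) * (S.lipσ * min 1 (dist η ζ) * ‖v‖) :=
        mul_le_mul (add_le_add ha hc) (h1.trans hac) (abs_nonneg _) (by positivity)
    _ = _ := by ring

lemma continuous_σinv : Continuous S.σinv := by
  have : S.σinv = fun η => Ring.inverse (S.σ η) := by
    funext η
    have h1 := (S.hσinv η).1
    have h2 := (S.hσinv η).2
    exact (Ring.inverse_unit (⟨S.σ η, S.σinv η, h1, h2⟩ : (EucSp d →L[ℝ] EucSp d)ˣ)).symm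
  rw [this, continuous_iff_continuousAt]
  intro η
  have h3 := NormedRing.inverse_continuousAt
    (⟨S.σ η, S.σinv η, (S.hσinv η).1, (S.hσinv η).2⟩ : (EucSp d →L[ℝ] EucSp d)ˣ)
  exact ContinuousAt.comp (f := S.σ) (g := Ring.inverse) h3 S.continuous_σ.continuousAt

/-- The increment of the martingale part over `[s, t]`, normalised by the diffusion coefficient
at time `s`. -/
def nmg (S : PathSDE d r₀ Ω P) (ξ : Seg d r₀) (s t : ℝ) (ω : Ω) : EucSp d :=
  (√(t - s))⁻¹ • S.σinv (S.seg ξ s ω) (S.mg ξ t ω - S.mg ξ s ω)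

/-- Normalised increments are close to standard Gaussian given the past, in the sense of
characteristic functions. -/
theorem abs_integral_trig_nmg_le {T τ s t : ℝ} (hs : 0 ≤ s) (hst : s < t) (htT : t ≤ T)
    (hτ : t - s ≤ τ) {f f1 : ℝ → ℝ} (d1 : ∀ x, HasDerivAt f (f1 x) x)
    (d2 : ∀ x, HasDerivAt f1 (-f x) x) (hfc : ∀ x, |f x| ≤ 1) (hf1c : ∀ x, |f1 x| ≤ 1)
    {g : Ω → ℝ} (hg : StronglyMeasurable[S.ℱ s] g) {cg : ℝ} (hgc : ∀ ω, |g ω| ≤ cg)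
    (u : EucSp d) :
    |∫ ω, g ω * f ⟪u, S.nmg ξ s t ω⟫ ∂P - Real.exp (-(‖u‖ ^ 2 / 2)) * f 0 * ∫ ω, g ω ∂P|
      ≤ S.bd ^ 3 * S.lipσ * ‖u‖ ^ 2 * ∫ ω, |g ω| * modulus (S.seg ξ) T τ ω ∂P := by
  have := S.hP
  have hb := S.one_le_bd
  have hL := S.lipσ_nonneg
  have hh : 0 < t - s := sub_pos.2 hst
  set v : Ω → EucSp d := fun ω =>
    (√(t - s))⁻¹ • (ContinuousLinearMap.adjoint (S.σinv (S.seg ξ s ω))) u with hv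
  have hsegs : StronglyMeasurable[S.ℱ s] (S.seg ξ s) := by
    have := S.stronglyMeasurable_seg ξ s
    rwa [max_eq_left hs] at this
  have hcinv := S.continuous_σinv
  have hvm : StronglyMeasurable[S.ℱ s] v := by
    have hc : Continuous fun η : Seg d r₀ =>
        (√(t - s))⁻¹ • (ContinuousLinearMap.adjoint (S.σinv η)) u := by
      have h0 : Continuous fun η : Seg d r₀ => ContinuousLinearMap.adjoint (S.σinv η) :=
        (LinearIsometryEquiv.continuous _).comp hcinv
      exact (h0.clm_apply continuous_const).const_smul (√(t - s))⁻¹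
    exact hc.comp_stronglyMeasurable hsegs
  have hvc : ∀ ω, ‖v ω‖ ≤ (√(t - s))⁻¹ * (S.bd * ‖u‖) := fun ω => by
    rw [hv, norm_smul, Real.norm_of_nonneg (by positivity)]
    exact mul_le_mul_of_nonneg_left (S.norm_adjoint_σinv_le _ u) (by positivity)
  have hN : ∀ ω, ⟪v ω, S.mg ξ (max t s) ω - S.mg ξ s ω⟫ = ⟪u, S.nmg ξ s t ω⟫ := fun ω => by
    rw [max_eq_left hst.le, nmg, hv, real_inner_smul_left, real_inner_smul_right,
      ContinuousLinearMap.adjoint_inner_left]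
  have hq0 : ∀ ω, S.diff (S.seg ξ s ω) (v ω) (v ω) = ‖u‖ ^ 2 / (t - s) := fun ω => by
    rw [diff_self, hv, map_smul, adjoint_σ_adjoint_σinv, norm_smul,
      Real.norm_of_nonneg (by positivity), mul_pow, inv_pow, Real.sq_sqrt hh.le]
    ring
  have hmod := integrable_modulus (P := P) (S.continuous_seg ξ) (S.stronglyMeasurable_seg' ξ) T τ
  have key := (S.isBracketMart ξ hs hvm hvc).abs_integral_trig_sub_le hst.le d1 d2 hfc hf1c hg hgc
    (q₀ := ‖u‖ ^ 2 / (t - s)) (by positivity)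
    (w := fun ω => 2 * S.bd ^ 3 * S.lipσ * ‖u‖ ^ 2 / (t - s) * modulus (S.seg ξ) T τ ω)
    (hmod.const_mul _) (fun r hr ω => ?_)
  · have e1 : ‖u‖ ^ 2 / (t - s) * (t - s) / 2 = ‖u‖ ^ 2 / 2 := by
      rw [div_mul_cancel₀ _ hh.ne']
    simp only [hN, max_self, sub_self, inner_zero_right, e1] at key
    rw [integral_mul_const] at key
    have e2 : (fun ω => |g ω| * (2 * S.bd ^ 3 * S.lipσ * ‖u‖ ^ 2 / (t - s) *
        modulus (S.seg ξ) T τ ω)) = fun ω => (2 * S.bd ^ 3 * S.lipσ * ‖u‖ ^ 2 / (t - s)) *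
        (|g ω| * modulus (S.seg ξ) T τ ω) := by
      funext ω; ring
    rw [e2, integral_const_mul] at key
    convert key using 1
    · congr 1; ring
    · field_simp
  · rw [← hq0 ω]
    refine (S.abs_diff_sub_le _ _ _).trans ?_
    have hm : min 1 (dist (S.seg ξ r ω) (S.seg ξ s ω)) ≤ modulus (S.seg ξ) T τ ω :=
      min_dist_le_modulus ⟨hs.trans hr.1, hr.2.trans htT⟩ ⟨hs, hst.le.trans htT⟩
        (by rw [abs_of_nonneg (by linarith [hr.1])]; linarith [hr.2]) ω
    have hv2 : ‖v ω‖ ^ 2 ≤ S.bd ^ 2 * ‖u‖ ^ 2 / (t - s) := by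
      refine (pow_le_pow_left₀ (norm_nonneg _) (hvc ω) 2).trans (le_of_eq ?_)
      rw [mul_pow, inv_pow, Real.sq_sqrt hh.le]; ring
    calc _ ≤ 2 * S.bd * (S.bd ^ 2 * ‖u‖ ^ 2 / (t - s)) * (S.lipσ * modulus (S.seg ξ) T τ ω) := by
          gcongr
      _ = _ := by ring

end PathSDE

lemma exists_add_pow_le (m : ℕ) : ∃ K : ℝ, 0 ≤ K ∧ ∀ a v s : ℝ, 0 ≤ a → 0 ≤ v → 0 ≤ a + s →
    s ^ 2 ≤ 8 * (a * v) + 2 * v ^ 2 → a + s ≤ 2 * a + 2 * v →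
    (a + s) ^ (m + 1) ≤ a ^ (m + 1) + (m + 1) * a ^ m * s + K * (a ^ m * v + v ^ (m + 1)) := by
  induction m with
  | zero => exact ⟨0, le_rfl, fun a v s _ _ _ _ _ => by simp⟩
  | succ m ih =>
    obtain ⟨K, hK, h⟩ := ih
    refine ⟨10 * (m + 1) + 8 * K, by positivity, fun a v s ha hv has hs2 hs => ?_⟩
    have h1 := mul_le_mul_of_nonneg_left (h a v s ha hv has hs2 hs) has
    have y1 : a ^ m * v ^ 2 ≤ a ^ (m + 1) * v + v ^ (m + 2) := by
      rcases le_total a v with hav | hav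
      · have : a ^ m * v ^ 2 ≤ v ^ m * v ^ 2 := by gcongr
        have h2 : 0 ≤ a ^ (m + 1) * v := by positivity
        calc _ ≤ _ := this
          _ = v ^ (m + 2) := by ring
          _ ≤ _ := by linarith
      · have : a ^ m * (v * v) ≤ a ^ m * (a * v) := by gcongr
        have h2 : 0 ≤ v ^ (m + 2) := by positivity
        calc _ = a ^ m * (v * v) := by ring
          _ ≤ _ := this
          _ = a ^ (m + 1) * v := by ring
          _ ≤ _ := by linarith
    have y2 : a * v ^ (m + 1) ≤ a ^ (m + 1) * v + v ^ (m + 2) := by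
      rcases le_total a v with hav | hav
      · have : a * v ^ (m + 1) ≤ v * v ^ (m + 1) := by gcongr
        have h2 : 0 ≤ a ^ (m + 1) * v := by positivity
        calc _ ≤ _ := this
          _ = v ^ (m + 2) := by ring
          _ ≤ _ := by linarith
      · have : a * v * v ^ m ≤ a * v * a ^ m := by gcongr
        have h2 : 0 ≤ v ^ (m + 2) := by positivity
        calc _ = a * v * v ^ m := by ring
          _ ≤ _ := this
          _ = a ^ (m + 1) * v := by ring
          _ ≤ _ := by linarith
    have z1 : (m + 1 : ℝ) * a ^ m * s ^ 2 ≤ (m + 1 : ℝ) * a ^ m * (8 * (a * v) + 2 * v ^ 2) := by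
      gcongr
    have z2 : (a + s) * (K * (a ^ m * v + v ^ (m + 1)))
        ≤ (2 * a + 2 * v) * (K * (a ^ m * v + v ^ (m + 1))) := by gcongr
    have z3 : (m + 1 : ℝ) * (2 * (a ^ m * v ^ 2)) ≤ (m + 1 : ℝ) * (2 * (a ^ (m + 1) * v + v ^ (m + 2))) := by
      gcongr
    have z4 : K * (a ^ m * v ^ 2) ≤ K * (a ^ (m + 1) * v + v ^ (m + 2)) := by gcongr
    have z5 : K * (a * v ^ (m + 1)) ≤ K * (a ^ (m + 1) * v + v ^ (m + 2)) := by gcongr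
    have z6 : 0 ≤ (m + 1 : ℝ) * v ^ (m + 2) := by positivity
    have z7 : 0 ≤ K * v ^ (m + 2) := by positivity
    have z8 : 0 ≤ K * (a ^ (m + 1) * v) := by positivity
    push_cast
    calc (a + s) ^ (m + 1 + 1) = (a + s) * (a + s) ^ (m + 1) := by ring
      _ ≤ _ := h1
      _ = a ^ (m + 1 + 1) + (m + 1 + 1) * a ^ (m + 1) * s + (m + 1) * a ^ m * s ^ 2
          + (a + s) * (K * (a ^ m * v + v ^ (m + 1))) := by ring
      _ ≤ a ^ (m + 1 + 1) + (m + 1 + 1) * a ^ (m + 1) * s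
          + (m + 1 : ℝ) * a ^ m * (8 * (a * v) + 2 * v ^ 2)
          + (2 * a + 2 * v) * (K * (a ^ m * v + v ^ (m + 1))) := by linarith
      _ = a ^ (m + 1 + 1) + (m + 1 + 1) * a ^ (m + 1) * s
          + (8 * ((m + 1) * (a ^ (m + 1) * v)) + (m + 1 : ℝ) * (2 * (a ^ m * v ^ 2))
          + 2 * (K * (a ^ (m + 1) * v)) + 2 * (K * v ^ (m + 2))
          + 2 * (K * (a ^ m * v ^ 2)) + 2 * (K * (a * v ^ (m + 1)))) := by ring
      _ ≤ _ := by
          have : (10 * (m + 1 : ℝ) + 8 * K) * (a ^ (m + 1) * v + v ^ (m + 1 + 1))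
              = 10 * ((m + 1) * (a ^ (m + 1) * v)) + 10 * ((m + 1) * v ^ (m + 2))
                + 8 * (K * (a ^ (m + 1) * v)) + 8 * (K * v ^ (m + 2)) := by ring
          rw [this]
          linarith

/-- Second order expansion of `‖x + w‖ ^ (2 * (m + 1))`. -/
lemma exists_norm_add_pow_le (E : Type*) [NormedAddCommGroup E] [InnerProductSpace ℝ E] (m : ℕ) :
    ∃ K : ℝ, 0 ≤ K ∧ ∀ x w : E, (‖x + w‖ ^ 2) ^ (m + 1) ≤ (‖x‖ ^ 2) ^ (m + 1)
      + (m + 1) * (‖x‖ ^ 2) ^ m * (2 * ⟪x, w⟫)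
      + K * ((‖x‖ ^ 2) ^ m * ‖w‖ ^ 2 + (‖w‖ ^ 2) ^ (m + 1)) := by
  obtain ⟨K, hK, h⟩ := exists_add_pow_le m
  refine ⟨K + (m + 1), by positivity, fun x w => ?_⟩
  have hxw : ‖x + w‖ ^ 2 = ‖x‖ ^ 2 + (2 * ⟪x, w⟫ + ‖w‖ ^ 2) := by
    rw [norm_add_sq_real]; ring
  have hab := abs_le.1 (abs_real_inner_le_norm x w)
  have hi2 : ⟪x, w⟫ ^ 2 ≤ ‖x‖ ^ 2 * ‖w‖ ^ 2 := by
    rw [← mul_pow]; exact sq_le_sq' hab.1 hab.2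
  have := h (‖x‖ ^ 2) (‖w‖ ^ 2) (2 * ⟪x, w⟫ + ‖w‖ ^ 2) (by positivity) (by positivity)
    (by rw [← hxw]; positivity)
    (by nlinarith [sq_nonneg (2 * ⟪x, w⟫ - ‖w‖ ^ 2)])
    (by nlinarith [sq_nonneg (‖x‖ - ‖w‖)])
  rw [hxw]
  refine this.trans ?_
  have h0 : 0 ≤ (m + 1 : ℝ) * (‖w‖ ^ 2) ^ (m + 1) := by positivity
  nlinarith

namespace PathSDE

variable (S : PathSDE d r₀ Ω P) (ξ : Seg d r₀)

/-- The dissipativity condition at the origin, with an exponential margin. -/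
lemma exists_dissipative : ∃ a β c : ℝ, 0 < a ∧ 0 < β ∧ 0 ≤ c ∧ ∀ x : Seg d r₀,
    2 * ⟪ev0 S.hr₀ x, S.b x⟫ ≤ -(a + β) * ‖ev0 S.hr₀ x‖ ^ 2
      + a * Real.exp (-(β * r₀)) * ‖x‖ ^ 2 + c := by
  obtain ⟨l₁, l₂, h1, h2, h12, h⟩ := S.hA2
  have hlt : l₂ < l₁ := by
    have : 1 ≤ Real.exp (l₁ * r₀) := Real.one_le_exp (mul_pos h1 S.hr₀).le
    nlinarith
  set ε := (l₁ - l₂) / 2 with hε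
  have hε0 : 0 < ε := by rw [hε]; linarith
  have hc : Continuous fun β : ℝ => l₂ * Real.exp (β * r₀) + β := by fun_prop
  have hev : ∀ᶠ β in 𝓝[>] (0:ℝ), l₂ * Real.exp (β * r₀) + β < l₁ - ε := by
    have : l₂ * Real.exp (0 * r₀) + 0 < l₁ - ε := by simp [hε]; linarith
    exact nhdsWithin_le_nhds ((hc.tendsto 0).eventually (gt_mem_nhds this))
  obtain ⟨β, hβ, hβ0⟩ := (hev.and self_mem_nhdsWithin).exists
  have hβ0 : 0 < β := hβ0
  refine ⟨l₂ * Real.exp (β * r₀), β, ‖S.b 0‖ ^ 2 / ε, by positivity, hβ0, by positivity,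
    fun x => ?_⟩
  have hx := h x 0
  have e0 : ev0 S.hr₀ (0 : Seg d r₀) = 0 := rfl
  rw [e0, sub_zero, sub_zero, inner_sub_right] at hx
  have hexp : l₂ * Real.exp (β * r₀) * Real.exp (-(β * r₀)) = l₂ := by
    rw [mul_assoc, ← Real.exp_add]; simp
  rw [hexp]
  have h3 : ⟪ev0 S.hr₀ x, S.b 0⟫ ≤ ‖ev0 S.hr₀ x‖ * ‖S.b 0‖ := real_inner_le_norm _ _
  have h4 : 2 * (‖ev0 S.hr₀ x‖ * ‖S.b 0‖) ≤ ε * ‖ev0 S.hr₀ x‖ ^ 2 + ‖S.b 0‖ ^ 2 / ε := by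
    have : 0 ≤ (ε * ‖ev0 S.hr₀ x‖ - ‖S.b 0‖) ^ 2 / ε := by positivity
    have e : (ε * ‖ev0 S.hr₀ x‖ - ‖S.b 0‖) ^ 2 / ε = ε * ‖ev0 S.hr₀ x‖ ^ 2
        - 2 * (‖ev0 S.hr₀ x‖ * ‖S.b 0‖) + ‖S.b 0‖ ^ 2 / ε := by
      field_simp; ring
    linarith
  have h5 : (l₂ * Real.exp (β * r₀) + β) * ‖ev0 S.hr₀ x‖ ^ 2 ≤ (l₁ - ε) * ‖ev0 S.hr₀ x‖ ^ 2 := by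
    gcongr
  linarith

/-- The event that the path stays in the ball of radius `N` up to time `t`. -/
def inBall (S : PathSDE d r₀ Ω P) (ξ : Seg d r₀) (N t : ℝ) : Set Ω :=
  {ω | ∀ s ∈ Icc 0 t, ‖S.seg ξ s ω‖ ≤ N}

lemma inBall_anti {N s t : ℝ} (h : s ≤ t) : S.inBall ξ N t ⊆ S.inBall ξ N s :=
  fun _ hω r hr => hω r ⟨hr.1, hr.2.trans h⟩

lemma measurableSet_inBall (N : ℝ) {t : ℝ} (ht : 0 ≤ t) :
    MeasurableSet[S.ℱ t] (S.inBall ξ N t) := by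
  have : Nonempty (Icc (0:ℝ) t) := ⟨⟨0, le_rfl, ht⟩⟩
  have e : S.inBall ξ N t = ⋂ n : ℕ,
      {ω | ‖S.seg ξ (TopologicalSpace.denseSeq (Icc (0:ℝ) t) n) ω‖ ≤ N} := by
    ext ω
    simp only [inBall, mem_iInter, mem_ofPred_eq]
    refine ⟨fun h n => h _ (TopologicalSpace.denseSeq (Icc (0:ℝ) t) n).2, fun h s hs => ?_⟩
    have hcl : IsClosed {s : Icc (0:ℝ) t | ‖S.seg ξ s ω‖ ≤ N} :=
      isClosed_le (((S.continuous_seg ξ ω).comp continuous_subtype_val).norm) continuous_const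
    exact (TopologicalSpace.denseRange_denseSeq (Icc (0:ℝ) t)).induction_on
      (p := fun s : Icc (0:ℝ) t => ‖S.seg ξ s ω‖ ≤ N) ⟨s, hs⟩ hcl h
  rw [e]
  refine MeasurableSet.iInter fun n => ?_
  have h0 := S.stronglyMeasurable_seg ξ (TopologicalSpace.denseSeq (Icc (0:ℝ) t) n)
  rw [max_eq_left (TopologicalSpace.denseSeq (Icc (0:ℝ) t) n).2.1] at h0
  have h1 := (h0.mono (S.ℱ.mono (TopologicalSpace.denseSeq (Icc (0:ℝ) t) n).2.2)).norm
  exact h1.measurable measurableSet_Iic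

lemma norm_ev0_le (x : Seg d r₀) : ‖ev0 S.hr₀ x‖ ≤ ‖x‖ := x.norm_coe_le_norm _

lemma continuous_ev0 : Continuous (ev0 S.hr₀ : Seg d r₀ → EucSp d) := continuous_eval_const _

end PathSDE

lemma two_mul_add_pow_le (m : ℕ) {a b : ℝ} (ha : 0 ≤ a) (hb : 0 ≤ b) :
    (2 * a + 2 * b) ^ (m + 1) ≤ 4 ^ (m + 1) * (a ^ (m + 1) + b ^ (m + 1)) := by
  have h : ∀ x y : ℝ, 0 ≤ x → 0 ≤ y → x ≤ y →
      (2 * x + 2 * y) ^ (m + 1) ≤ 4 ^ (m + 1) * (x ^ (m + 1) + y ^ (m + 1)) := by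
    intro x y hx hy hxy
    calc (2 * x + 2 * y) ^ (m + 1) ≤ (4 * y) ^ (m + 1) := by gcongr; linarith
      _ = 4 ^ (m + 1) * y ^ (m + 1) := mul_pow _ _ _
      _ ≤ _ := by gcongr; linarith [pow_nonneg hx (m + 1)]
  rcases le_total a b with hab | hab
  · exact h a b ha hb hab
  · have := h b a hb ha hab
    rwa [add_comm (2 * b), add_comm (b ^ _)] at this

namespace PathSDE

variable (S : PathSDE d r₀ Ω P) (ξ : Seg d r₀)

/-- A bound of the drift coefficient on the ball of radius `N`. -/
def bdb (S : PathSDE d r₀ Ω P) (N : ℝ) : ℝ := max 1 (S.hA1bbdd N).choose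

lemma one_le_bdb (N : ℝ) : 1 ≤ S.bdb N := le_max_left _ _

lemma norm_b_le {N : ℝ} {x : Seg d r₀} (hx : ‖x‖ ≤ N) : ‖S.b x‖ ≤ S.bdb N :=
  ((S.hA1bbdd N).choose_spec x hx).trans (le_max_right _ _)

lemma norm_dr_sub_le {N s t : ℝ} (hs : 0 ≤ s) (hst : s ≤ t) {ω : Ω} (hω : ω ∈ S.inBall ξ N t) :
    ‖S.dr ξ t ω - S.dr ξ s ω‖ ≤ (t - s) * S.bdb N := by
  rw [S.dr_sub ξ ω hs (hs.trans hst)]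
  have := intervalIntegral.norm_integral_le_of_norm_le_const (a := s) (b := t)
    (f := fun r => S.b (S.seg ξ r ω)) (C := S.bdb N) (fun r hr => by
      rw [uIoc_of_le hst] at hr
      exact S.norm_b_le (hω r ⟨hs.trans hr.1.le, hr.2⟩))
  rwa [abs_of_nonneg (by linarith), mul_comm] at this

lemma norm_dr_sub_sub_le {N s t T : ℝ} (hs : 0 ≤ s) (hst : s ≤ t) (htT : t ≤ T) {ω : Ω}
    (hω : ω ∈ S.inBall ξ N t) :
    ‖S.dr ξ t ω - S.dr ξ s ω - (t - s) • S.b (S.seg ξ s ω)‖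
      ≤ (t - s) * (2 * S.bdb N * modulus (fun r ω => S.b (S.seg ξ r ω)) T (t - s) ω) := by
  rw [S.dr_sub ξ ω hs (hs.trans hst)]
  have e : (∫ r in s..t, S.b (S.seg ξ r ω)) - (t - s) • S.b (S.seg ξ s ω)
      = ∫ r in s..t, (S.b (S.seg ξ r ω) - S.b (S.seg ξ s ω)) := by
    rw [intervalIntegral.integral_sub ((S.continuous_b_seg ξ ω).intervalIntegrable _ _)
      intervalIntegrable_const, intervalIntegral.integral_const]
  rw [e]
  have hB := S.one_le_bdb N
  have := intervalIntegral.norm_integral_le_of_norm_le_const (a := s) (b := t)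
    (f := fun r => S.b (S.seg ξ r ω) - S.b (S.seg ξ s ω))
    (C := 2 * S.bdb N * modulus (fun r ω => S.b (S.seg ξ r ω)) T (t - s) ω) (fun r hr => by
      rw [uIoc_of_le hst] at hr
      rw [← dist_eq_norm]
      refine dist_le_mul_modulus (Z := fun r ω => S.b (S.seg ξ r ω)) ⟨hs.trans hr.1.le, hr.2.trans htT⟩
        ⟨hs, hst.trans htT⟩ (by rw [abs_of_nonneg (by linarith [hr.1])]; linarith [hr.2]) ω
        (by linarith) ?_
      rw [dist_eq_norm]
      refine (norm_sub_le _ _).trans ?_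
      have h1 := S.norm_b_le (hω r ⟨hs.trans hr.1.le, hr.2⟩)
      have h2 := S.norm_b_le (hω s ⟨hs, hst⟩)
      linarith)
  rwa [abs_of_nonneg (by linarith), mul_comm] at this

set_option maxHeartbeats 1000000 in
/-- One step of the evolution of the moments of the solution, localised to a ball. -/
theorem exists_one_step (m : ℕ) (hm : 1 ≤ m) : ∃ K : ℝ, 0 ≤ K ∧ ∀ ξ : Seg d r₀, ∀ N : ℝ, 0 ≤ N →
    ∃ C : ℝ, 0 ≤ C ∧ ∀ (s t T : ℝ), 0 ≤ s → s ≤ t → t ≤ s + 1 → t ≤ T → ∀ g g' : Ω → ℝ,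
    StronglyMeasurable[S.ℱ s] g → StronglyMeasurable g' → (∀ ω, 0 ≤ g' ω) →
    (∀ ω, g' ω ≤ g ω) → (∀ ω, g ω ≤ 1) → (∀ ω, ω ∉ S.inBall ξ N s → g ω = 0) →
    (∀ ω, ω ∉ S.inBall ξ N t → g' ω = 0) →
    ∫ ω, g' ω * (‖S.Y ξ ω t‖ ^ 2) ^ (m + 1) ∂P ≤
      ∫ ω, g ω * ((‖S.Y ξ ω s‖ ^ 2) ^ (m + 1) + (t - s) * ((m + 1) * (‖S.Y ξ ω s‖ ^ 2) ^ m *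
        (2 * ⟪S.Y ξ ω s, S.b (S.seg ξ s ω)⟫) + K * (‖S.Y ξ ω s‖ ^ 2) ^ m)) ∂P
      + C * ((t - s) ^ 2 + (t - s) * ∫ ω, modulus (fun r ω => S.b (S.seg ξ r ω)) T (t - s) ω ∂P) := by
  have := S.hP
  obtain ⟨K, hK, hT⟩ := exists_norm_add_pow_le (EucSp d) m
  have hc0 := S.momC_nonneg 0
  have hcm := S.momC_nonneg m
  refine ⟨2 * K * S.momC 0, by positivity, fun ξ N hN => ?_⟩
  set B := S.bdb N with hB
  have hB1 : 1 ≤ B := S.one_le_bdb N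
  set C1 := (m + 1 : ℝ) * (N ^ 2) ^ m * (2 * N * (2 * B)) with hC1
  set C2 := K * ((N ^ 2) ^ m * (2 * B ^ 2) + 4 ^ (m + 1) * ((B ^ 2) ^ (m + 1) + S.momC m)) with hC2
  have hC10 : 0 ≤ C1 := by positivity
  have hC20 : 0 ≤ C2 := by positivity
  refine ⟨C1 + C2, by positivity, ?_⟩
  intro s t T hs hst hts htT g g' hg hg' hg'0 hg'g hg1 hgG hg'G
  set τ := t - s with hτ
  have hτ0 : 0 ≤ τ := by rw [hτ]; linarith
  have hτ1 : τ ≤ 1 := by rw [hτ]; linarith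
  set x : Ω → EucSp d := fun ω => S.Y ξ ω s with hx
  set Δ : Ω → EucSp d := fun ω => S.mg ξ t ω - S.mg ξ s ω with hΔ
  set q : Ω → ℝ := fun ω => (‖x ω‖ ^ 2) ^ m with hq
  set w : Ω → ℝ := modulus (fun r ω => S.b (S.seg ξ r ω)) T τ with hw
  have hg0 : ∀ ω, 0 ≤ g ω := fun ω => (hg'0 ω).trans (hg'g ω)
  have hxe : ∀ ω, x ω = ev0 S.hr₀ (S.seg ξ s ω) := fun ω => by
    rw [S.ev0_seg, max_eq_left hs]
  have hxN : ∀ ω, ω ∈ S.inBall ξ N s → ‖x ω‖ ≤ N := fun ω hω => by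
    rw [hxe]; exact (S.norm_ev0_le _).trans (hω s ⟨hs, le_rfl⟩)
  have hseg : StronglyMeasurable[S.ℱ s] (S.seg ξ s) := by
    have := S.stronglyMeasurable_seg ξ s; rwa [max_eq_left hs] at this
  have hxm : StronglyMeasurable[S.ℱ s] x := by
    have : x = fun ω => ev0 S.hr₀ (S.seg ξ s ω) := funext hxe
    rw [this]; exact S.continuous_ev0.comp_stronglyMeasurable hseg
  have hqm : StronglyMeasurable[S.ℱ s] q := (hxm.norm.pow 2).pow m
  have hq0 : ∀ ω, 0 ≤ q ω := fun ω => by positivity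
  have hqN : ∀ ω, ω ∈ S.inBall ξ N s → q ω ≤ (N ^ 2) ^ m := fun ω hω => by
    have := hxN ω hω
    simp only [hq]; gcongr
  have hw0 : ∀ ω, 0 ≤ w ω := modulus_nonneg
  have hw1 : ∀ ω, w ω ≤ 1 := modulus_le_one
  have hwm : StronglyMeasurable w := (measurable_modulus (S.continuous_b_seg ξ)
    (fun t => S.hA1bcont.comp_stronglyMeasurable (S.stronglyMeasurable_seg' ξ t)) T τ).stronglyMeasurable
  -- Taylor expansion with a drift of size `τ B`
  have hTay : ∀ y p D : EucSp d, ‖p‖ ≤ τ * B → (‖y + p + D‖ ^ 2) ^ (m + 1) ≤ (‖y‖ ^ 2) ^ (m + 1)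
      + (m + 1) * (‖y‖ ^ 2) ^ m * (2 * ⟪y, p⟫ + 2 * ⟪y, D⟫)
      + K * ((‖y‖ ^ 2) ^ m * (2 * (τ ^ 2 * B ^ 2) + 2 * ‖D‖ ^ 2)
        + 4 ^ (m + 1) * (τ ^ 2 * (B ^ 2) ^ (m + 1) + (‖D‖ ^ 2) ^ (m + 1))) := by
    intro y p D hp
    have h1 := hT y (p + D)
    rw [← add_assoc] at h1
    refine h1.trans ?_
    have h2 : ‖p + D‖ ^ 2 ≤ 2 * (τ ^ 2 * B ^ 2) + 2 * ‖D‖ ^ 2 := by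
      have h3 := norm_add_le p D
      have h4 : ‖p + D‖ ^ 2 ≤ (τ * B + ‖D‖) ^ 2 := by gcongr; linarith
      nlinarith [sq_nonneg (τ * B - ‖D‖)]
    have h3 : (‖p + D‖ ^ 2) ^ (m + 1)
        ≤ 4 ^ (m + 1) * (τ ^ 2 * (B ^ 2) ^ (m + 1) + (‖D‖ ^ 2) ^ (m + 1)) := by
      calc _ ≤ (2 * (τ ^ 2 * B ^ 2) + 2 * ‖D‖ ^ 2) ^ (m + 1) := by gcongr
        _ ≤ _ := two_mul_add_pow_le m (by positivity) (by positivity)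
        _ ≤ _ := by
          gcongr
          rw [mul_pow]
          gcongr
          exact pow_le_of_le_one (by positivity) (pow_le_one₀ hτ0 hτ1) (by omega)
    rw [inner_add_right]
    have e : (2:ℝ) * (⟪y, p⟫ + ⟪y, D⟫) = 2 * ⟪y, p⟫ + 2 * ⟪y, D⟫ := by ring
    rw [e]
    gcongr
  set R1 : Ω → ℝ := fun ω => (‖x ω‖ ^ 2) ^ (m + 1) + τ * ((m + 1) * q ω *
        (2 * ⟪x ω, S.b (S.seg ξ s ω)⟫)) with hR1
  set R2 : Ω → ℝ := fun ω => ((2 * (m + 1)) * q ω) • ⟪x ω, Δ ω⟫ with hR2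
  set R3 : Ω → ℝ := fun ω => q ω * ‖Δ ω‖ ^ 2 with hR3
  set R4 : Ω → ℝ := fun ω => ‖Δ ω‖ ^ (2 * (m + 1)) with hR4
  have hpt : ∀ ω, g' ω * (‖S.Y ξ ω t‖ ^ 2) ^ (m + 1) ≤ g ω * R1 ω + g ω * R2 ω
      + (2 * K) * (g ω * R3 ω) + (K * 4 ^ (m + 1)) * (g ω * R4 ω)
      + (C1 * (τ * w ω) + K * ((N ^ 2) ^ m * (2 * B ^ 2) + 4 ^ (m + 1) * (B ^ 2) ^ (m + 1)) * τ ^ 2) := by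
    intro ω
    have hR4' : R4 ω = (‖Δ ω‖ ^ 2) ^ (m + 1) := by simp only [hR4]; rw [pow_mul]
    have hq0' := hq0 ω
    have hw0' := hw0 ω
    by_cases hG : ω ∈ S.inBall ξ N s
    · have hqN' := hqN ω hG
      have hxN' := hxN ω hG
      -- upper bound `U` of the expansion
      set U := R1 ω + R2 ω + 2 * K * R3 ω + K * 4 ^ (m + 1) * R4 ω
        + ((m + 1) * q ω * (2 * (N * (τ * (2 * B * w ω))))
          + K * (q ω * (2 * (τ ^ 2 * B ^ 2)) + 4 ^ (m + 1) * (τ ^ 2 * (B ^ 2) ^ (m + 1)))) with hU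
      have hbs : ‖τ • S.b (S.seg ξ s ω)‖ ≤ τ * B := by
        rw [norm_smul, Real.norm_of_nonneg hτ0]
        exact mul_le_mul_of_nonneg_left (S.norm_b_le (hG s ⟨hs, le_rfl⟩)) hτ0
      have hU0 : 0 ≤ U := by
        have h := hTay (x ω) (τ • S.b (S.seg ξ s ω)) (Δ ω) hbs
        rw [inner_smul_right] at h
        have h0 : 0 ≤ (‖x ω + τ • S.b (S.seg ξ s ω) + Δ ω‖ ^ 2) ^ (m + 1) := by positivity
        have h5 : 0 ≤ (m + 1 : ℝ) * q ω * (2 * (N * (τ * (2 * B * w ω)))) := by positivity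
        simp only [hU, hR4', hR1, hR2, hR3, smul_eq_mul]
        refine (h0.trans h).trans ?_
        simp only [hq] at h5 ⊢
        linarith
      have hUC : g' ω * (‖S.Y ξ ω t‖ ^ 2) ^ (m + 1) ≤ g ω * U := by
        by_cases hG' : ω ∈ S.inBall ξ N t
        · have hY : S.Y ξ ω t = x ω + (S.dr ξ t ω - S.dr ξ s ω) + Δ ω :=
            S.Y_eq ξ hs (hs.trans hst) ω
          have h := hTay (x ω) _ (Δ ω) (S.norm_dr_sub_le ξ hs hst hG')
          rw [← hY] at h
          have h6 : ⟪x ω, S.dr ξ t ω - S.dr ξ s ω⟫ ≤ τ * ⟪x ω, S.b (S.seg ξ s ω)⟫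
              + N * (τ * (2 * B * w ω)) := by
            have e : S.dr ξ t ω - S.dr ξ s ω = τ • S.b (S.seg ξ s ω)
              + (S.dr ξ t ω - S.dr ξ s ω - τ • S.b (S.seg ξ s ω)) := by abel
            rw [e, inner_add_right, inner_smul_right]
            gcongr
            refine (real_inner_le_norm _ _).trans ?_
            exact mul_le_mul hxN' (S.norm_dr_sub_sub_le ξ hs hst htT hG') (norm_nonneg _) hN
          have h7 : (‖S.Y ξ ω t‖ ^ 2) ^ (m + 1) ≤ U := by
            refine h.trans ?_
            simp only [hU, hR4', hR1, hR2, hR3, smul_eq_mul]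
            have h8 := mul_le_mul_of_nonneg_left h6 (show 0 ≤ 2 * ((m + 1 : ℝ) * q ω) by positivity)
            simp only [hq] at h8 ⊢
            linarith
          calc _ ≤ g' ω * U := mul_le_mul_of_nonneg_left h7 (hg'0 ω)
            _ ≤ _ := mul_le_mul_of_nonneg_right (hg'g ω) hU0
        · rw [hg'G ω hG', zero_mul]; exact mul_nonneg (hg0 ω) hU0
      refine hUC.trans ?_
      have h9 : g ω * ((m + 1) * q ω * (2 * (N * (τ * (2 * B * w ω))))
          + K * (q ω * (2 * (τ ^ 2 * B ^ 2)) + 4 ^ (m + 1) * (τ ^ 2 * (B ^ 2) ^ (m + 1))))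
          ≤ C1 * (τ * w ω) + K * ((N ^ 2) ^ m * (2 * B ^ 2) + 4 ^ (m + 1) * (B ^ 2) ^ (m + 1)) * τ ^ 2 := by
        calc _ ≤ 1 * ((m + 1) * (N ^ 2) ^ m * (2 * (N * (τ * (2 * B * w ω))))
          + K * ((N ^ 2) ^ m * (2 * (τ ^ 2 * B ^ 2)) + 4 ^ (m + 1) * (τ ^ 2 * (B ^ 2) ^ (m + 1)))) := by
              gcongr; exact hg1 ω
          _ = _ := by rw [hC1]; ring
      simp only [hU]
      linarith
    · rw [hg'G ω (fun h => hG (S.inBall_anti ξ hst h)), hgG ω hG]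
      simp only [zero_mul, mul_zero, add_zero, zero_add]
      positivity
  -- integrability
  have hgB : ∀ f : Ω → ℝ, StronglyMeasurable f → (∃ c, ∀ ω ∈ S.inBall ξ N s, |f ω| ≤ c) →
      Integrable (fun ω => g ω * f ω) P := by
    intro f hf ⟨c, hc⟩
    refine Integrable.of_bound ((hg.mono (S.ℱ.le s)).mul hf).aestronglyMeasurable |c|
      (ae_of_all _ fun ω => ?_)
    rw [Real.norm_eq_abs, abs_mul, abs_of_nonneg (hg0 ω)]
    by_cases hG : ω ∈ S.inBall ξ N s
    · calc _ ≤ 1 * |c| := by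
            refine mul_le_mul (hg1 ω) ((hc ω hG).trans (le_abs_self c)) (abs_nonneg _) (by norm_num)
        _ = _ := one_mul _
    · rw [hgG ω hG, zero_mul]; exact abs_nonneg _
  have hinb : StronglyMeasurable[S.ℱ s] (fun ω => ⟪x ω, S.b (S.seg ξ s ω)⟫) :=
    hxm.inner (S.hA1bcont.comp_stronglyMeasurable hseg)
  have hinbN : ∀ ω ∈ S.inBall ξ N s, |⟪x ω, S.b (S.seg ξ s ω)⟫| ≤ N * B := fun ω hω =>
    (abs_real_inner_le_norm _ _).trans (mul_le_mul (hxN ω hω) (S.norm_b_le (hω s ⟨hs, le_rfl⟩))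
      (norm_nonneg _) hN)
  have hI1 : Integrable (fun ω => g ω * R1 ω) P := by
    refine hgB _ (((hxm.norm.pow 2).pow (m + 1)).add (((hqm.const_mul (m + 1 : ℝ)).mul
      (hinb.const_mul 2)).const_mul τ) |>.mono (S.ℱ.le s)) ⟨(N ^ 2) ^ (m + 1) + τ * ((m + 1) * (N ^ 2) ^ m *
        (2 * (N * B))), fun ω hω => ?_⟩
    have h1 := hxN ω hω
    have h2 := hqN ω hω
    have h3 := hinbN ω hω
    have h4 := hq0 ω
    simp only [hR1]
    refine (abs_add_le _ _).trans ?_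
    rw [abs_of_nonneg (show 0 ≤ (‖x ω‖ ^ 2) ^ (m + 1) by positivity), abs_mul, abs_of_nonneg hτ0,
      abs_mul, abs_of_nonneg (show 0 ≤ (m + 1 : ℝ) * q ω by positivity), abs_mul, abs_two]
    gcongr
  have hIq : Integrable (fun ω => g ω * q ω) P :=
    hgB _ (hqm.mono (S.ℱ.le s)) ⟨(N ^ 2) ^ m, fun ω hω => by
      rw [abs_of_nonneg (hq0 ω)]; exact hqN ω hω⟩
  have hgq0 : ∀ ω, 0 ≤ g ω * q ω := fun ω => mul_nonneg (hg0 ω) (hq0 ω)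
  have hgqN : ∀ ω, |g ω * q ω| ≤ (N ^ 2) ^ m := fun ω => by
    rw [abs_of_nonneg (hgq0 ω)]
    by_cases hG : ω ∈ S.inBall ξ N s
    · calc _ ≤ 1 * (N ^ 2) ^ m := mul_le_mul (hg1 ω) (hqN ω hG) (hq0 ω) (by norm_num)
        _ = _ := one_mul _
    · rw [hgG ω hG, zero_mul]; positivity
  have hM3 := S.integral_mul_norm_pow_le ξ 0 hs hst (hg.mul hqm) hgqN hgq0
  have hM4 := S.integral_mul_norm_pow_le ξ m hs hst hg (cg := 1)
    (fun ω => by rw [abs_of_nonneg (hg0 ω)]; exact hg1 ω) hg0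
  set v : Ω → EucSp d := fun ω => (g ω * ((2 * (m + 1)) * q ω)) • x ω with hv
  have hvm : StronglyMeasurable[S.ℱ s] v := (hg.mul (hqm.const_mul _)).smul hxm
  have hvN : ∀ ω, ‖v ω‖ ≤ (2 * (m + 1)) * (N ^ 2) ^ m * N := fun ω => by
    simp only [hv]
    rw [norm_smul, Real.norm_eq_abs]
    have e : g ω * ((2 * (m + 1)) * q ω) = (2 * (m + 1)) * (g ω * q ω) := by ring
    rw [e, abs_mul, abs_of_nonneg (show (0:ℝ) ≤ 2 * (m + 1) by positivity)]
    by_cases hG : ω ∈ S.inBall ξ N s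
    · have := hxN ω hG
      have h2 := hgqN ω
      gcongr
    · rw [hgG ω hG]; simp; positivity
  have e2 : (fun ω => g ω * R2 ω) = fun ω => ⟪v ω, Δ ω⟫ := by
    funext ω
    simp only [hv, hR2, inner_smul_left, smul_eq_mul]
    simp only [map_mul, conj_trivial]
    ring
  have hΔm : StronglyMeasurable Δ := ((S.stronglyMeasurable_mg ξ t).mono (S.ℱ.le t)).sub
    ((S.stronglyMeasurable_mg ξ s).mono (S.ℱ.le s))
  have hI2 : Integrable (fun ω => g ω * R2 ω) P := by
    rw [e2]
    have hΔ2 := S.integrable_norm_pow ξ 0 hs hst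
    refine Integrable.mono' ((hΔ2.add (integrable_const 1)).const_mul ((2 * (m + 1)) * (N ^ 2) ^ m * N))
      ((hvm.mono (S.ℱ.le s)).inner hΔm).aestronglyMeasurable (ae_of_all _ fun ω => ?_)
    refine (abs_real_inner_le_norm _ _).trans (mul_le_mul (hvN ω) ?_ (norm_nonneg _) (by positivity))
    simp only [Pi.add_apply, zero_add, mul_one]
    nlinarith [sq_nonneg (‖Δ ω‖ - 1)]
  have hZ : ∫ ω, g ω * R2 ω ∂P = 0 := by
    rw [e2]; exact S.integral_inner_sub_eq_zero ξ hs hst hvm hvN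
  have e3 : (fun ω => g ω * R3 ω) = fun ω => g ω * q ω * ‖Δ ω‖ ^ (2 * (0 + 1)) := by
    funext ω; simp only [hR3]; ring
  have hI3 : Integrable (fun ω => g ω * R3 ω) P := by rw [e3]; exact hM3.1
  have hI4 : Integrable (fun ω => g ω * R4 ω) P := hM4.1
  have hB3 : ∫ ω, g ω * R3 ω ∂P ≤ S.momC 0 * τ * ∫ ω, g ω * q ω ∂P := by
    have := hM3.2
    rw [zero_add, pow_one] at this
    rw [e3]; exact this
  have hB4 : ∫ ω, g ω * R4 ω ∂P ≤ S.momC m * τ ^ 2 := by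
    refine hM4.2.trans ?_
    have h1 : ∫ ω, g ω ∂P ≤ 1 := by
      have := integral_mono (μ := P) (f := g) (g := fun _ => 1)
        (Integrable.of_bound (hg.mono (S.ℱ.le s)).aestronglyMeasurable 1 (ae_of_all _ fun ω => by
          rw [Real.norm_eq_abs, abs_of_nonneg (hg0 ω)]; exact hg1 ω)) (integrable_const _) hg1
      simpa using this
    have h2 : (t - s) ^ (m + 1) ≤ τ ^ 2 := pow_le_pow_of_le_one hτ0 hτ1 (by omega)
    calc _ ≤ S.momC m * τ ^ 2 * 1 := by
          refine mul_le_mul (mul_le_mul_of_nonneg_left h2 hcm) h1 (integral_nonneg hg0) (by positivity)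
      _ = _ := mul_one _
  have hIw : Integrable w P := Integrable.of_bound hwm.aestronglyMeasurable 1
    (ae_of_all _ fun ω => by rw [Real.norm_eq_abs, abs_of_nonneg (hw0 ω)]; exact hw1 ω)
  have hfin := integral_mono_of_nonneg (μ := P) (ae_of_all _ fun ω => mul_nonneg (hg'0 ω)
    (by positivity)) ((((hI1.add hI2).add (hI3.const_mul (2 * K))).add
      (hI4.const_mul (K * 4 ^ (m + 1)))).add (((hIw.const_mul τ).const_mul C1).add
      (integrable_const (K * ((N ^ 2) ^ m * (2 * B ^ 2) + 4 ^ (m + 1) * (B ^ 2) ^ (m + 1)) * τ ^ 2))))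
      (ae_of_all _ hpt)
  refine hfin.trans ?_
  simp only [Pi.add_apply]
  have hJ1 := hI1.add hI2
  have hJ2 := hJ1.add (hI3.const_mul (2 * K))
  have hJ3 := hJ2.add (hI4.const_mul (K * 4 ^ (m + 1)))
  have hJ4 := (hIw.const_mul τ).const_mul C1
  have hJ5 := hJ4.add (integrable_const (K * ((N ^ 2) ^ m * (2 * B ^ 2)
    + 4 ^ (m + 1) * (B ^ 2) ^ (m + 1)) * τ ^ 2))
  rw [integral_add (by exact hJ3) (by exact hJ5), integral_add (by exact hJ2)
    (hI4.const_mul (K * 4 ^ (m + 1))), integral_add (by exact hJ1) (hI3.const_mul (2 * K)),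
    integral_add hI1 hI2, hZ, integral_add hJ4 (integrable_const _),
    integral_const_mul, integral_const_mul, integral_const_mul, integral_const_mul]
  have eR : ∫ ω, g ω * ((‖x ω‖ ^ 2) ^ (m + 1) + τ * ((m + 1) * q ω *
        (2 * ⟪x ω, S.b (S.seg ξ s ω)⟫) + 2 * K * S.momC 0 * q ω)) ∂P
      = ∫ ω, g ω * R1 ω ∂P + τ * (2 * K * S.momC 0) * ∫ ω, g ω * q ω ∂P := by
    rw [← integral_const_mul, ← integral_add hI1 (hIq.const_mul _)]
    refine integral_congr_ae (ae_of_all _ fun ω => ?_)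
    simp only [hR1]; ring
  have h1 := mul_le_mul_of_nonneg_left hB3 (show 0 ≤ 2 * K by positivity)
  have h2 := mul_le_mul_of_nonneg_left hB4 (show 0 ≤ K * 4 ^ (m + 1) by positivity)
  have h3 : 0 ≤ C2 * (τ * ∫ ω, w ω ∂P) :=
    mul_nonneg hC20 (mul_nonneg hτ0 (integral_nonneg hw0))
  have h4 : 0 ≤ C1 * τ ^ 2 := by positivity
  simp only [integral_const, probReal_univ, one_smul] 
  rw [eR]
  have e5 : C2 * τ ^ 2 = K * ((N ^ 2) ^ m * (2 * B ^ 2) + 4 ^ (m + 1) * (B ^ 2) ^ (m + 1)) * τ ^ 2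
    + K * 4 ^ (m + 1) * (S.momC m * τ ^ 2) := by rw [hC2]; ring
  linarith

end PathSDE

lemma young_pow (n : ℕ) {x y : ℝ} (hx : 0 ≤ x) (hy : 0 ≤ y) :
    (n + 1) * (x ^ n * y) ≤ n * x ^ (n + 1) + y ^ (n + 1) := by
  induction n with
  | zero => simp
  | succ n ih =>
    have h1 := mul_le_mul_of_nonneg_left ih hx
    have h2 : 0 ≤ (x ^ (n + 1) - y ^ (n + 1)) * (x - y) := by
      rcases le_total x y with h | h
      · exact mul_nonneg_of_nonpos_of_nonpos (sub_nonpos.2 (pow_le_pow_left₀ hx h _))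
          (sub_nonpos.2 h)
      · exact mul_nonneg (sub_nonneg.2 (pow_le_pow_left₀ hy h _)) (sub_nonneg.2 h)
    push_cast
    have e1 : (x ^ (n + 1) - y ^ (n + 1)) * (x - y)
      = x ^ (n + 2) + y ^ (n + 2) - x ^ (n + 1) * y - x * y ^ (n + 1) := by ring
    have e2 : x * ((n + 1) * (x ^ n * y)) = (n + 1) * (x ^ (n + 1) * y) := by ring
    have e3 : x * (n * x ^ (n + 1) + y ^ (n + 1)) = n * x ^ (n + 2) + x * y ^ (n + 1) := by ring
    rw [e2, e3] at h1
    rw [e1] at h2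
    linarith

/-- The function `r ^ p + Q ^ (2 p) / r ^ p` decreases when `r < Q` is raised to `Q`. -/
lemma lyapunov_max_le (p : ℕ) {ρ Q : ℝ} (hρ : 0 < ρ) :
    (max ρ Q) ^ p + Q ^ (2 * p) / (max ρ Q) ^ p ≤ ρ ^ p + Q ^ (2 * p) / ρ ^ p := by
  rcases le_total Q ρ with h | h
  · rw [max_eq_left h]
  · rw [max_eq_right h]
    have hQ : 0 < Q := hρ.trans_le h
    have h1 : Q ^ (2 * p) / Q ^ p = Q ^ p := by
      rw [div_eq_iff (by positivity)]; ring
    have h2 : ρ ^ p + Q ^ (2 * p) / ρ ^ p - 2 * Q ^ p = (ρ ^ p - Q ^ p) ^ 2 / ρ ^ p := by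
      field_simp; ring
    have h3 : 0 ≤ (ρ ^ p - Q ^ p) ^ 2 / ρ ^ p := by positivity
    linarith

set_option maxHeartbeats 600000 in
lemma lyapunov_step {a β c K c0 r Q inn ε R τ : ℝ} {m p : ℕ} (hmp : m + 1 = 2 * p)
    (ha : 0 < a) (hβ : 0 < β) (hK : 0 ≤ K) (hc0 : 1 ≤ c0) (hcc : c + K ≤ β / 4 * c0)
    (hp : a + β / 4 ≤ p * β / 2) (hτ : 0 ≤ τ) (hτp : p * β * τ ≤ 1 / 2)
    (hr : c0 ≤ r) (hrR : r ≤ R) (hQ : 0 ≤ Q) (hQR : Q ≤ R) (hε : 0 ≤ ε)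
    (hinn : inn ≤ -(a + β) * Q + a * (r + ε) + c) :
    (max (Real.exp (-(β * τ)) * r) c0) ^ p
      + (Q ^ (m + 1) + τ * ((m + 1) * Q ^ m * inn + K * Q ^ m)) / (max (Real.exp (-(β * τ)) * r) c0) ^ p
      ≤ (1 - p * β / 2 * τ) * (r ^ p + Q ^ (2 * p) / r ^ p) + p * β * c0 ^ p * τ
        + (2 * (p * β) ^ 2 * R ^ p + a * (m + 1) * R ^ m) * (τ ^ 2 + τ * ε) := by
  set ρ := max (Real.exp (-(β * τ)) * r) c0 with hρ
  have hr0 : 0 < r := by linarith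
  have hR0 : 0 ≤ R := by linarith
  have hρ1 : 1 ≤ ρ := hc0.trans (le_max_right _ _)
  have hρp : 1 ≤ ρ ^ p := one_le_pow₀ hρ1
  have hQm : Q ^ m ≤ R ^ m := by gcongr
  have hQm0 : 0 ≤ Q ^ m := by positivity
  have hrp : 0 < r ^ p := by positivity
  set u := p * β * τ with hu
  have hu0 : 0 ≤ u := by positivity
  have hMp : (m + 1 : ℝ) = 2 * p := by exact_mod_cast hmp
  -- the numerator
  have hnum : Q ^ (m + 1) + τ * ((m + 1) * Q ^ m * inn + K * Q ^ m)
      ≤ (1 - 3 / 2 * u) * Q ^ (m + 1) + τ * (a + β / 4) * r ^ (m + 1) + τ * (a * (m + 1) * R ^ m * ε) := by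
    have hy := young_pow m hQ hr0.le
    have h1 : (m + 1) * Q ^ m * inn ≤ (m + 1) * Q ^ m * (-(a + β) * Q + a * (r + ε) + c) := by gcongr
    have h2 : (m + 1) * Q ^ m * (c + K) ≤ (m + 1) * Q ^ m * (β / 4 * r) := by
      gcongr; refine hcc.trans ?_; gcongr
    have h3 : K * Q ^ m ≤ (m + 1) * Q ^ m * K := by
      have : 0 ≤ (m:ℝ) * (Q ^ m * K) := by positivity
      linarith
    have h4 : a * (m + 1) * Q ^ m * ε ≤ a * (m + 1) * R ^ m * ε := by gcongr
    have h5 := mul_le_mul_of_nonneg_left hy (show 0 ≤ a + β / 4 by positivity)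
    have h6 : 0 ≤ (a + β / 4) * Q ^ (m + 1) := by positivity
    have h7 : (m + 1) * Q ^ m * inn + K * Q ^ m ≤ -(3 / 2 * (p * β)) * Q ^ (m + 1)
        + (a + β / 4) * r ^ (m + 1) + a * (m + 1) * R ^ m * ε := by
      have e : Q ^ (m + 1) = Q ^ m * Q := pow_succ _ _
      have e2 : (m : ℝ) = 2 * p - 1 := by linarith
      have e3 : -(3 / 2 * (p * β)) * Q ^ (m + 1) = -((3 / 4 * β) * (m + 1)) * Q ^ (m + 1) := by
        rw [hMp]; ring
      rw [e3]
      rw [e] at h5 h6 ⊢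
      linarith
    have h8 := mul_le_mul_of_nonneg_left h7 hτ
    rw [hu]
    linarith
  -- estimates of the exponentials
  have hE := Real.abs_exp_sub_one_sub_id_le (x := u) (by rw [abs_of_nonneg hu0]; linarith)
  have hE' := Real.abs_exp_sub_one_sub_id_le (x := -u) (by rw [abs_neg, abs_of_nonneg hu0]; linarith)
  have hE1 : Real.exp u ≤ 1 + u + u ^ 2 := by linarith [(abs_le.1 hE).2]
  have hE2 : Real.exp (-u) ≤ 1 - u + u ^ 2 := by nlinarith [(abs_le.1 hE').2]
  have hE3 : 1 - u ≤ Real.exp (-u) := by linarith [Real.add_one_le_exp (-u)]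
  have hexpp : Real.exp (-(β * τ)) ^ p = Real.exp (-u) := by
    rw [← Real.exp_nat_mul]; congr 1; rw [hu]; ring
  have hρle : ρ ^ p ≤ (1 - u + u ^ 2) * r ^ p + u * c0 ^ p := by
    have hcr : c0 ^ p ≤ r ^ p := by gcongr
    have hcp : 0 < c0 ^ p := by positivity
    have hmax : ρ ^ p ≤ Real.exp (-u) * r ^ p + (1 - Real.exp (-u)) * c0 ^ p := by
      have hle1 : Real.exp (-u) ≤ 1 := Real.exp_le_one_iff.2 (by linarith)
      rcases le_total (Real.exp (-(β * τ)) * r) c0 with h | h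
      · rw [hρ, max_eq_right h]
        linarith [mul_nonneg (Real.exp_pos (-u)).le (sub_nonneg.2 hcr)]
      · rw [hρ, max_eq_left h, mul_pow, hexpp]
        linarith [mul_nonneg (sub_nonneg.2 hle1) hcp.le]
    have h1 := mul_le_mul_of_nonneg_right hE2 hrp.le
    have h2 : (1 - Real.exp (-u)) * c0 ^ p ≤ u * c0 ^ p :=
      mul_le_mul_of_nonneg_right (by linarith) hcp.le
    linarith
  have hinv : 1 / ρ ^ p ≤ Real.exp u / r ^ p := by
    rw [div_le_div_iff₀ (by positivity) hrp, one_mul]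
    have h1 : (Real.exp (-(β * τ)) * r) ^ p ≤ ρ ^ p := by gcongr; exact le_max_left _ _
    rw [mul_pow, hexpp] at h1
    have h2 := mul_le_mul_of_nonneg_left h1 (Real.exp_pos u).le
    rwa [← mul_assoc, ← Real.exp_add, add_neg_cancel, Real.exp_zero, one_mul] at h2
  have hQM : 0 ≤ Q ^ (m + 1) := by positivity
  have hdiv : (Q ^ (m + 1) + τ * ((m + 1) * Q ^ m * inn + K * Q ^ m)) / ρ ^ p
      ≤ (1 - u / 2) * (Q ^ (m + 1) / r ^ p) + (u / 2 + u ^ 2) * r ^ p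
        + τ * (a * (m + 1) * R ^ m * ε) := by
    have h0 : 0 ≤ 1 - 3 / 2 * u := by linarith
    have hA : 0 ≤ (1 - 3 / 2 * u) * Q ^ (m + 1) + τ * (a + β / 4) * r ^ (m + 1) := by positivity
    have hBn : 0 ≤ τ * (a * (m + 1) * R ^ m * ε) := by positivity
    have h1 : ((1 - 3 / 2 * u) * Q ^ (m + 1) + τ * (a + β / 4) * r ^ (m + 1)) * (1 / ρ ^ p)
        ≤ ((1 - 3 / 2 * u) * Q ^ (m + 1) + τ * (a + β / 4) * r ^ (m + 1)) * (Real.exp u / r ^ p) :=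
      mul_le_mul_of_nonneg_left hinv hA
    have h2 : τ * (a * (m + 1) * R ^ m * ε) * (1 / ρ ^ p) ≤ τ * (a * (m + 1) * R ^ m * ε) * 1 := by
      refine mul_le_mul_of_nonneg_left ?_ hBn
      rw [div_le_one (by positivity)]; exact hρp
    have h3 : ((1 - 3 / 2 * u) * Q ^ (m + 1) + τ * (a + β / 4) * r ^ (m + 1)) * (Real.exp u / r ^ p)
        = (Real.exp u * (1 - 3 / 2 * u)) * (Q ^ (m + 1) / r ^ p)
          + (Real.exp u * (τ * (a + β / 4))) * r ^ p := by
      have : r ^ (m + 1) = r ^ p * r ^ p := by rw [hmp]; ring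
      rw [this]; field_simp
    have h4 : Real.exp u * (1 - 3 / 2 * u) ≤ 1 - u / 2 := by
      have h5 := mul_le_mul_of_nonneg_right hE1 h0
      nlinarith [pow_nonneg hu0 3]
    have h6 : Real.exp u * (τ * (a + β / 4)) ≤ u / 2 + u ^ 2 := by
      have h7 : τ * (a + β / 4) ≤ u / 2 := by
        calc _ ≤ τ * (p * β / 2) := by gcongr
          _ = _ := by rw [hu]; ring
      have h8 : Real.exp u ≤ 1 + 2 * u := by nlinarith
      calc _ ≤ (1 + 2 * u) * (u / 2) := by gcongr
        _ = _ := by ring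
    have h9 : (Real.exp u * (1 - 3 / 2 * u)) * (Q ^ (m + 1) / r ^ p)
        ≤ (1 - u / 2) * (Q ^ (m + 1) / r ^ p) := by gcongr
    have h10 : (Real.exp u * (τ * (a + β / 4))) * r ^ p ≤ (u / 2 + u ^ 2) * r ^ p := by gcongr
    calc _ ≤ ((1 - 3 / 2 * u) * Q ^ (m + 1) + τ * (a + β / 4) * r ^ (m + 1)
          + τ * (a * (m + 1) * R ^ m * ε)) / ρ ^ p := by gcongr
      _ = ((1 - 3 / 2 * u) * Q ^ (m + 1) + τ * (a + β / 4) * r ^ (m + 1)) * (1 / ρ ^ p)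
          + τ * (a * (m + 1) * R ^ m * ε) * (1 / ρ ^ p) := by ring
      _ ≤ _ := by linarith
  have hrR' : r ^ p ≤ R ^ p := by gcongr
  have hu2 : 2 * u ^ 2 * r ^ p ≤ 2 * (p * β) ^ 2 * R ^ p * τ ^ 2 := by
    calc _ ≤ 2 * u ^ 2 * R ^ p := by gcongr
      _ = _ := by rw [hu]; ring
  have hx1 : 0 ≤ 2 * (p * β) ^ 2 * R ^ p * (τ * ε) := by positivity
  have hx2 : 0 ≤ a * (m + 1) * R ^ m * τ ^ 2 := by positivity
  rw [← hmp]
  have eu : p * β / 2 * τ = u / 2 := by rw [hu]; ring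
  have eu2 : p * β * c0 ^ p * τ = u * c0 ^ p := by rw [hu]; ring
  rw [eu, eu2]
  linarith

lemma MeasureTheory.integrable_indicator_mul_of_bounded {Ω : Type*} [MeasurableSpace Ω]
    {P : Measure Ω} [IsFiniteMeasure P] {A : Set Ω} (hA : MeasurableSet A) {f : Ω → ℝ}
    (hf : StronglyMeasurable f) {c : ℝ} (hc : ∀ ω ∈ A, |f ω| ≤ c) :
    Integrable (fun ω => A.indicator (fun _ => (1:ℝ)) ω * f ω) P := by
  refine Integrable.of_bound ((stronglyMeasurable_const.indicator hA).mul hf).aestronglyMeasurable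
    |c| (ae_of_all _ fun ω => ?_)
  by_cases h : ω ∈ A
  · simpa [h] using (hc ω h).trans (le_abs_self c)
  · simp [h]

namespace PathSDE

variable (S : PathSDE d r₀ Ω P) (ξ : Seg d r₀)

/-- Exponentially discounted running maximum of `‖Y‖ ^ 2` along a grid. -/
def runMax (S : PathSDE d r₀ Ω P) (ξ : Seg d r₀) (β c0 τ : ℝ) : ℕ → Ω → ℝ
  | 0, _ => max (‖ξ‖ ^ 2) c0
  | j + 1, ω => max (max (Real.exp (-(β * τ)) * runMax S ξ β c0 τ j ω) c0)
      (‖S.Y ξ ω ((j + 1 : ℕ) * τ)‖ ^ 2)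

variable {β c0 τ : ℝ}

lemma le_runMax (j : ℕ) (ω : Ω) : c0 ≤ S.runMax ξ β c0 τ j ω := by
  cases j with
  | zero => exact le_max_right _ _
  | succ j => exact (le_max_right _ _).trans (le_max_left _ _)

lemma stronglyMeasurable_Y {t : ℝ} (ht : 0 ≤ t) : StronglyMeasurable[S.ℱ t] fun ω => S.Y ξ ω t := by
  have h := S.continuous_ev0.comp_stronglyMeasurable (S.stronglyMeasurable_seg ξ t)
  rw [max_eq_left ht] at h
  have e : (fun ω => S.Y ξ ω t) = fun ω => ev0 S.hr₀ (S.seg ξ t ω) := by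
    funext ω; rw [S.ev0_seg, max_eq_left ht]
  rw [e]; exact h

lemma stronglyMeasurable_runMax (hτ : 0 ≤ τ) (j : ℕ) :
    StronglyMeasurable[S.ℱ (j * τ)] (S.runMax ξ β c0 τ j) := by
  induction j with
  | zero => exact stronglyMeasurable_const
  | succ j ih =>
    have h1 := ih.mono (S.ℱ.mono (show (j:ℝ) * τ ≤ (j + 1 : ℕ) * τ by push_cast; nlinarith))
    exact (((h1.measurable.const_mul _).max measurable_const).max
      ((S.stronglyMeasurable_Y ξ (by positivity)).norm.pow 2).measurable).stronglyMeasurable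

lemma norm_Y_le (ω : Ω) {s : ℝ} (hs : s ∈ Icc (-r₀) 0) : ‖S.Y ξ ω s‖ ≤ ‖ξ‖ := by
  have := S.hY0 ξ ω ⟨s, hs⟩
  simp only at this
  rw [this]; exact ξ.norm_coe_le_norm _

lemma sq_norm_Y_le_runMax (j : ℕ) (ω : Ω) :
    ‖S.Y ξ ω (j * τ)‖ ^ 2 ≤ S.runMax ξ β c0 τ j ω := by
  cases j with
  | zero =>
    have := S.norm_Y_le ξ ω (s := 0) ⟨by linarith [S.hr₀], le_rfl⟩
    refine le_trans ?_ (le_max_left _ _)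
    simp only [Nat.cast_zero, zero_mul]
    gcongr
  | succ j => exact le_max_right _ _

lemma runMax_le_exp_mul {k j : ℕ} (hkj : k ≤ j) (ω : Ω) :
    S.runMax ξ β c0 τ k ω ≤ Real.exp (β * (j * τ - k * τ)) * S.runMax ξ β c0 τ j ω := by
  induction j, hkj using Nat.le_induction with
  | base => simp
  | succ j hj ih =>
    have h1 : Real.exp (-(β * τ)) * S.runMax ξ β c0 τ j ω ≤ S.runMax ξ β c0 τ (j + 1) ω :=
      (le_max_left _ _).trans (le_max_left _ _)
    refine ih.trans ?_
    calc _ = Real.exp (β * ((j + 1 : ℕ) * τ - k * τ)) * (Real.exp (-(β * τ)) * S.runMax ξ β c0 τ j ω) := by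
          rw [← mul_assoc, ← Real.exp_add]; congr 2; push_cast; ring
      _ ≤ _ := by gcongr

lemma norm_Y_le_of_inBall {N t : ℝ} (ht : 0 ≤ t) {ω : Ω} (hω : ω ∈ S.inBall ξ N t) :
    ‖S.Y ξ ω t‖ ≤ N := by
  have := (S.norm_ev0_le (S.seg ξ t ω)).trans (hω t ⟨ht, le_rfl⟩)
  rwa [S.ev0_seg, max_eq_left ht] at this

lemma runMax_le_of_inBall (hβ : 0 ≤ β) (hτ : 0 ≤ τ) (hc0 : 0 ≤ c0) {N : ℝ} (j : ℕ) {ω : Ω}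
    (hω : ω ∈ S.inBall ξ N (j * τ)) : S.runMax ξ β c0 τ j ω ≤ ‖ξ‖ ^ 2 + c0 + N ^ 2 := by
  induction j with
  | zero =>
    refine max_le ?_ ?_ <;> nlinarith [sq_nonneg ‖ξ‖, sq_nonneg N]
  | succ j ih =>
    have h1 := ih (S.inBall_anti ξ (by push_cast; nlinarith) hω)
    have h2 := S.norm_Y_le_of_inBall ξ (by positivity) hω
    refine max_le (max_le ?_ ?_) ?_
    · have : Real.exp (-(β * τ)) ≤ 1 := Real.exp_le_one_iff.2 (by nlinarith)
      exact (mul_le_of_le_one_left (hc0.trans (S.le_runMax ξ j ω)) this).trans h1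
    · nlinarith [sq_nonneg ‖ξ‖, sq_nonneg N]
    · have : ‖S.Y ξ ω ((j + 1 : ℕ) * τ)‖ ^ 2 ≤ N ^ 2 := by gcongr
      nlinarith [sq_nonneg ‖ξ‖]

lemma sq_norm_seg_le (hβ : 0 ≤ β) (hτ : 0 < τ) (hc0 : 0 ≤ c0) {N T : ℝ} (hN : 0 ≤ N) (j : ℕ) (hT : j * τ ≤ T)
    {ω : Ω} (hω : ω ∈ S.inBall ξ N (j * τ)) :
    ‖S.seg ξ (j * τ) ω‖ ^ 2 ≤ Real.exp (β * r₀) * S.runMax ξ β c0 τ j ω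
      + 2 * N * (2 * N + 1) * modulus (S.seg ξ) T τ ω := by
  have hm := modulus_nonneg (Z := S.seg ξ) (T := T) (τ := τ) ω
  have hr := hc0.trans (S.le_runMax ξ (β := β) (τ := τ) (c0 := c0) j ω)
  have hA : 0 ≤ Real.exp (β * r₀) * S.runMax ξ β c0 τ j ω
      + 2 * N * (2 * N + 1) * modulus (S.seg ξ) T τ ω := by positivity
  rw [← Real.le_sqrt (norm_nonneg _) hA, ContinuousMap.norm_le _ (Real.sqrt_nonneg _)]
  intro θ
  rw [Real.le_sqrt (norm_nonneg _) hA]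
  have hj0 : 0 ≤ (j : ℝ) * τ := by positivity
  rw [S.seg_apply, max_eq_left hj0]
  have hθ := θ.2
  set s := (j : ℝ) * τ + θ.1 with hs
  have hexp : ∀ k ≤ j, (j : ℝ) * τ - k * τ ≤ r₀ →
      S.runMax ξ β c0 τ k ω ≤ Real.exp (β * r₀) * S.runMax ξ β c0 τ j ω := by
    intro k hk hkr
    refine (S.runMax_le_exp_mul ξ hk ω).trans ?_
    gcongr
  rcases le_or_gt s 0 with h0 | h0
  · have h1 := S.norm_Y_le ξ ω (s := s) ⟨by rw [hs]; linarith [hθ.1], h0⟩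
    have h2 : ‖ξ‖ ^ 2 ≤ S.runMax ξ β c0 τ 0 ω := le_max_left _ _
    have h3 := hexp 0 (Nat.zero_le _) (by simp; linarith [hθ.1])
    have h4 : ‖S.Y ξ ω s‖ ^ 2 ≤ ‖ξ‖ ^ 2 := by gcongr
    have h5 : 0 ≤ 2 * N * (2 * N + 1) * modulus (S.seg ξ) T τ ω := by positivity
    linarith
  · set k := ⌈s / τ⌉₊ with hk
    have hk1 : s ≤ k * τ := by rw [← div_le_iff₀ hτ]; exact Nat.le_ceil _
    have hk2 : (k : ℝ) * τ ≤ s + τ := by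
      have := Nat.ceil_lt_add_one (div_nonneg h0.le hτ.le)
      rw [← hk] at this
      have h := mul_le_mul_of_nonneg_right this.le hτ.le
      rwa [add_mul, div_mul_cancel₀ _ hτ.ne', one_mul] at h
    have hkj : k ≤ j := by
      rw [hk, Nat.ceil_le, div_le_iff₀ hτ, hs]; linarith [hθ.2]
    have hkj' : (k : ℝ) * τ ≤ j * τ := by gcongr
    have hk0 : 0 ≤ (k : ℝ) * τ := by positivity
    have h1 := S.sq_norm_Y_le_runMax ξ (β := β) (c0 := c0) (τ := τ) k ω
    have h2 := hexp k hkj (by linarith [hθ.1])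
    have hsj : s ≤ j * τ := hk1.trans hkj'
    have hYs : ‖S.Y ξ ω s‖ ≤ N := S.norm_Y_le_of_inBall ξ h0.le (S.inBall_anti ξ hsj hω)
    have hYk : ‖S.Y ξ ω (k * τ)‖ ≤ N := S.norm_Y_le_of_inBall ξ hk0 (S.inBall_anti ξ hkj' hω)
    have hd : dist (S.seg ξ s ω) (S.seg ξ (k * τ) ω) ≤ 2 * N + 1 := by
      rw [dist_eq_norm]
      have e1 := hω s ⟨h0.le, hsj⟩
      have e2 := hω (k * τ) ⟨hk0, hkj'⟩
      linarith [norm_sub_le (S.seg ξ s ω) (S.seg ξ (k * τ) ω)]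
    have h3 := dist_le_mul_modulus (Z := S.seg ξ) (T := T) (τ := τ) ⟨h0.le, hsj.trans hT⟩
      ⟨hk0, hkj'.trans hT⟩ (by rw [abs_le]; constructor <;> linarith) ω (by linarith) hd
    have h4 : ‖S.Y ξ ω s - S.Y ξ ω (k * τ)‖ ≤ dist (S.seg ξ s ω) (S.seg ξ (k * τ) ω) := by
      have e1 := S.ev0_seg ξ s ω
      have e2 := S.ev0_seg ξ (k * τ) ω
      rw [max_eq_left h0.le] at e1
      rw [max_eq_left hk0] at e2
      rw [← e1, ← e2, dist_eq_norm]
      exact S.norm_ev0_le (S.seg ξ s ω - S.seg ξ (k * τ) ω)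
    have h5 : ‖S.Y ξ ω s‖ ≤ ‖S.Y ξ ω (k * τ)‖ + ‖S.Y ξ ω s - S.Y ξ ω (k * τ)‖ := by
      have := norm_add_le (S.Y ξ ω (k * τ)) (S.Y ξ ω s - S.Y ξ ω (k * τ))
      rwa [add_sub_cancel] at this
    have h6 : ‖S.Y ξ ω s‖ ^ 2 - ‖S.Y ξ ω (k * τ)‖ ^ 2 ≤ 2 * N * ‖S.Y ξ ω s - S.Y ξ ω (k * τ)‖ := by
      have a1 := norm_nonneg (S.Y ξ ω s)
      have a2 := norm_nonneg (S.Y ξ ω (k * τ))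
      have a3 := norm_nonneg (S.Y ξ ω s - S.Y ξ ω (k * τ))
      calc _ = (‖S.Y ξ ω s‖ - ‖S.Y ξ ω (k * τ)‖) * (‖S.Y ξ ω s‖ + ‖S.Y ξ ω (k * τ)‖) := by ring
        _ ≤ ‖S.Y ξ ω s - S.Y ξ ω (k * τ)‖ * (‖S.Y ξ ω s‖ + ‖S.Y ξ ω (k * τ)‖) := by
            gcongr; linarith
        _ ≤ ‖S.Y ξ ω s - S.Y ξ ω (k * τ)‖ * (N + N) := by gcongr
        _ = _ := by ring
    have h7 := mul_le_mul_of_nonneg_left (h4.trans h3) (show 0 ≤ 2 * N by positivity)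
    linarith

/-- The Lyapunov function along the grid. -/
def lyap (S : PathSDE d r₀ Ω P) (ξ : Seg d r₀) (β c0 τ : ℝ) (p j : ℕ) (ω : Ω) : ℝ :=
  S.runMax ξ β c0 τ j ω ^ p + (‖S.Y ξ ω (j * τ)‖ ^ 2) ^ (2 * p) / S.runMax ξ β c0 τ j ω ^ p

lemma stronglyMeasurable_lyap (hτ : 0 ≤ τ) (p j : ℕ) :
    StronglyMeasurable[S.ℱ (j * τ)] (S.lyap ξ β c0 τ p j) := by
  have h1 := (S.stronglyMeasurable_runMax ξ (β := β) (c0 := c0) hτ j).pow p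
  have h2 := ((S.stronglyMeasurable_Y ξ (t := j * τ) (by positivity)).norm.pow 2).pow (2 * p)
  exact (h1.measurable.add (h2.measurable.div h1.measurable)).stronglyMeasurable

end PathSDE

namespace PathSDE

variable (S : PathSDE d r₀ Ω P) (ξ : Seg d r₀)

lemma measurableSet_inBall' (N : ℝ) {t : ℝ} (ht : 0 ≤ t) : MeasurableSet (S.inBall ξ N t) :=
  S.ℱ.le t _ (S.measurableSet_inBall ξ N ht)

lemma lyap_nonneg {β c0 τ : ℝ} (hc0 : 0 ≤ c0) (p j : ℕ) (ω : Ω) : 0 ≤ S.lyap ξ β c0 τ p j ω := by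
  have := hc0.trans (S.le_runMax ξ (β := β) (c0 := c0) (τ := τ) j ω)
  unfold lyap; positivity

lemma lyap_le_of_inBall {β c0 τ : ℝ} (hβ : 0 ≤ β) (hτ : 0 ≤ τ) (hc0 : 1 ≤ c0) {N : ℝ} (p j : ℕ)
    {ω : Ω} (hω : ω ∈ S.inBall ξ N (j * τ)) :
    S.lyap ξ β c0 τ p j ω ≤ (‖ξ‖ ^ 2 + c0 + N ^ 2) ^ p + (N ^ 2) ^ (2 * p) := by
  have h1 := S.runMax_le_of_inBall ξ hβ hτ (by linarith) j hω
  have h2 := S.le_runMax ξ (β := β) (c0 := c0) (τ := τ) j ω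
  have h3 := S.norm_Y_le_of_inBall ξ (by positivity) hω
  have h4 : 1 ≤ S.runMax ξ β c0 τ j ω ^ p := one_le_pow₀ (hc0.trans h2)
  have h0 : 0 ≤ S.runMax ξ β c0 τ j ω := by linarith
  unfold lyap
  refine add_le_add (by gcongr) ?_
  calc _ ≤ (‖S.Y ξ ω (j * τ)‖ ^ 2) ^ (2 * p) := div_le_self (by positivity) h4
    _ ≤ _ := by gcongr

set_option maxHeartbeats 1000000 in
/-- One step of the recursion for the localised Lyapunov function. -/
theorem exists_lyap_step {a β c : ℝ} (ha : 0 < a) (hβ : 0 < β) (hc : 0 ≤ c)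
    (hdis : ∀ x : Seg d r₀, 2 * ⟪ev0 S.hr₀ x, S.b x⟫ ≤ -(a + β) * ‖ev0 S.hr₀ x‖ ^ 2
      + a * Real.exp (-(β * r₀)) * ‖x‖ ^ 2 + c) (p : ℕ) (hp1 : 1 ≤ p)
    (hp : a + β / 4 ≤ p * β / 2) : ∃ c0 : ℝ, 1 ≤ c0 ∧ ∀ ξ : Seg d r₀, ∀ N : ℝ, 0 ≤ N →
    ∃ C : ℝ, 0 ≤ C ∧ ∀ (τ T : ℝ) (j : ℕ), 0 < τ → τ ≤ 1 → p * β * τ ≤ 1 / 2 → (j + 1 : ℕ) * τ ≤ T →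
    ∫ ω, (S.inBall ξ N ((j + 1 : ℕ) * τ)).indicator (fun _ => 1) ω * S.lyap ξ β c0 τ p (j + 1) ω ∂P
      ≤ (1 - p * β / 2 * τ) *
        ∫ ω, (S.inBall ξ N (j * τ)).indicator (fun _ => 1) ω * S.lyap ξ β c0 τ p j ω ∂P
        + p * β * c0 ^ p * τ + C * (τ * (τ + ∫ ω, modulus (fun r ω => S.b (S.seg ξ r ω)) T τ ω ∂P
          + ∫ ω, modulus (S.seg ξ) T τ ω ∂P)) := by
  have := S.hP
  obtain ⟨m, hmp⟩ : ∃ m, m + 1 = 2 * p := ⟨2 * p - 1, by omega⟩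
  obtain ⟨K, hK0, hK⟩ := S.exists_one_step m (by omega)
  refine ⟨max 1 ((c + K) / (β / 4)), le_max_left _ _, fun ξ N hN => ?_⟩
  set c0 := max 1 ((c + K) / (β / 4)) with hc0
  have hc01 : 1 ≤ c0 := le_max_left _ _
  have hcc : c + K ≤ β / 4 * c0 := by
    rw [mul_comm, ← div_le_iff₀ (by positivity)]; exact le_max_right _ _
  obtain ⟨C1, hC1, hstep⟩ := hK ξ N hN
  set R := ‖ξ‖ ^ 2 + c0 + N ^ 2 with hR
  set C2 := 2 * (p * β) ^ 2 * R ^ p + a * (m + 1) * R ^ m with hC2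
  set L := 2 * N * (2 * N + 1) with hL
  have hR0 : 0 ≤ R := by positivity
  have hL0 : 0 ≤ L := by positivity
  have hC20 : 0 ≤ C2 := by positivity
  refine ⟨C1 + C2 * (1 + L), by positivity, fun τ T j hτ hτ1 hτp hjT => ?_⟩
  set s := (j : ℝ) * τ with hs
  set t := ((j + 1 : ℕ) : ℝ) * τ with ht
  have hs0 : 0 ≤ s := by positivity
  have ht0 : 0 ≤ t := by positivity
  have hts : t - s = τ := by rw [ht, hs]; push_cast; ring
  set G := S.inBall ξ N s with hG
  set G' := S.inBall ξ N t with hG'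
  have hGm : MeasurableSet[S.ℱ s] G := S.measurableSet_inBall ξ N hs0
  have hGm' : MeasurableSet G := S.measurableSet_inBall' ξ N hs0
  have hG'm : MeasurableSet G' := S.measurableSet_inBall' ξ N ht0
  have hG'G : G' ⊆ G := S.inBall_anti ξ (by linarith)
  set r := S.runMax ξ β c0 τ j with hr
  have hrm : StronglyMeasurable[S.ℱ s] r := S.stronglyMeasurable_runMax ξ hτ.le j
  set ρ : Ω → ℝ := fun ω => max (Real.exp (-(β * τ)) * r ω) c0 with hρ
  have hρm : Measurable[S.ℱ s] ρ := (hrm.measurable.const_mul _).max measurable_const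
  have hρ1 : ∀ ω, 1 ≤ ρ ω := fun ω => hc01.trans (le_max_right _ _)
  have hρp1 : ∀ ω, 1 ≤ ρ ω ^ p := fun ω => one_le_pow₀ (hρ1 ω)
  have hρR : ∀ ω ∈ G, ρ ω ≤ R := fun ω hω => by
    refine max_le ?_ (by rw [hR]; nlinarith [sq_nonneg ‖ξ‖, sq_nonneg N])
    have h1 : Real.exp (-(β * τ)) ≤ 1 := Real.exp_le_one_iff.2 (by nlinarith)
    have h2 := S.runMax_le_of_inBall ξ hβ.le hτ.le (c0 := c0) (by linarith) j hω
    have h3 := S.le_runMax ξ (β := β) (c0 := c0) (τ := τ) j ω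
    exact (mul_le_of_le_one_left (by linarith) h1).trans h2
  set Q : Ω → ℝ := fun ω => ‖S.Y ξ ω s‖ ^ 2 with hQ
  set Q' : Ω → ℝ := fun ω => ‖S.Y ξ ω t‖ ^ 2 with hQ'
  have hQm : StronglyMeasurable[S.ℱ s] Q := (S.stronglyMeasurable_Y ξ hs0).norm.pow 2
  have hQ'm : StronglyMeasurable Q' :=
    ((S.stronglyMeasurable_Y ξ ht0).mono (S.ℱ.le t)).norm.pow 2
  have hQN : ∀ ω ∈ G, Q ω ≤ N ^ 2 := fun ω hω => by
    have := S.norm_Y_le_of_inBall ξ hs0 hω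
    simp only [hQ]; gcongr
  have hQ'N : ∀ ω ∈ G', Q' ω ≤ N ^ 2 := fun ω hω => by
    have := S.norm_Y_le_of_inBall ξ ht0 hω
    simp only [hQ']; gcongr
  set I : Set Ω → Ω → ℝ := fun A => A.indicator (fun _ => 1) with hI
  have hI0 : ∀ A ω, 0 ≤ I A ω := fun A ω => indicator_nonneg (by simp) ω
  have hI1 : ∀ A ω, I A ω ≤ 1 := fun A ω => by
    by_cases h : ω ∈ A <;> simp [hI, h]
  -- apply the one-step estimate with weight `ρ ^ (-p)`
  have hg : StronglyMeasurable[S.ℱ s] (fun ω => I G ω / ρ ω ^ p) :=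
    ((measurable_const.indicator hGm).div (hρm.pow_const p)).stronglyMeasurable
  have hg' : StronglyMeasurable (fun ω => I G' ω / ρ ω ^ p) :=
    ((measurable_const.indicator hG'm).div ((hρm.mono (S.ℱ.le s) le_rfl).pow_const p)).stronglyMeasurable
  have h1 := hstep s t T hs0 (by linarith) (by linarith) hjT _ _ hg hg'
    (fun ω => div_nonneg (hI0 _ _) (by linarith [hρp1 ω]))
    (fun ω => by
      refine div_le_div_of_nonneg_right ?_ (by linarith [hρp1 ω])
      exact indicator_le_indicator_of_subset hG'G (fun _ => zero_le_one) ω)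
    (fun ω => (div_le_self (hI0 _ _) (hρp1 ω)).trans (hI1 _ _))
    (fun ω hω => by simp only [hI]; rw [indicator_of_notMem hω, zero_div])
    (fun ω hω => by simp only [hI]; rw [indicator_of_notMem hω, zero_div])
  rw [hts] at h1
  -- integrability
  have hρi : Integrable (fun ω => I G ω * ρ ω ^ p) P :=
    integrable_indicator_mul_of_bounded hGm'
      ((hρm.mono (S.ℱ.le s) le_rfl).pow_const p).stronglyMeasurable (c := R ^ p) (fun ω hω => by
        have h0 := hρ1 ω
        rw [abs_of_nonneg (by positivity)]
        have := hρR ω hω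
        gcongr)
  have hρ'i : Integrable (fun ω => I G' ω * ρ ω ^ p) P :=
    integrable_indicator_mul_of_bounded hG'm
      ((hρm.mono (S.ℱ.le s) le_rfl).pow_const p).stronglyMeasurable (c := R ^ p) (fun ω hω => by
        have h0 := hρ1 ω
        rw [abs_of_nonneg (by positivity)]
        have := hρR ω (hG'G hω)
        gcongr)
  have hQ'i : Integrable (fun ω => I G' ω * (Q' ω ^ (m + 1) / ρ ω ^ p)) P :=
    integrable_indicator_mul_of_bounded hG'm
      ((hQ'm.measurable.pow_const _).div ((hρm.mono (S.ℱ.le s) le_rfl).pow_const p)).stronglyMeasurable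
      (c := (N ^ 2) ^ (m + 1)) (fun ω hω => by
        have h0 := hρ1 ω
        have hq := hQ'N ω hω
        have hq0 : 0 ≤ Q' ω := by positivity
        rw [abs_of_nonneg (by positivity)]
        refine (div_le_self (by positivity) (hρp1 ω)).trans ?_
        gcongr)
  have hinm : StronglyMeasurable (fun ω => 2 * ⟪S.Y ξ ω s, S.b (S.seg ξ s ω)⟫) :=
    (((S.stronglyMeasurable_Y ξ hs0).mono (S.ℱ.le s)).inner
      (S.hA1bcont.comp_stronglyMeasurable (S.stronglyMeasurable_seg' ξ s))).const_mul 2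
  set F : Ω → ℝ := fun ω => Q ω ^ (m + 1) + τ * ((m + 1) * Q ω ^ m *
        (2 * ⟪S.Y ξ ω s, S.b (S.seg ξ s ω)⟫) + K * Q ω ^ m) with hF
  have hFm : StronglyMeasurable F := by
    have hQm' := hQm.mono (S.ℱ.le s)
    exact (hQm'.pow _).add (((((hQm'.pow m).const_mul (m + 1 : ℝ)).mul hinm).add
      ((hQm'.pow m).const_mul K)).const_mul τ)
  have hFi : Integrable (fun ω => I G ω * (F ω / ρ ω ^ p)) P :=
    integrable_indicator_mul_of_bounded hGm'
      (hFm.measurable.div ((hρm.mono (S.ℱ.le s) le_rfl).pow_const p)).stronglyMeasurable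
      (c := (N ^ 2) ^ (m + 1) + τ * ((m + 1) * (N ^ 2) ^ m * (2 * (N * S.bdb N)) + K * (N ^ 2) ^ m))
      (fun ω hω => by
        have h0 := hρp1 ω
        have hq := hQN ω hω
        have hq0 : 0 ≤ Q ω := by positivity
        have hin : |⟪S.Y ξ ω s, S.b (S.seg ξ s ω)⟫| ≤ N * S.bdb N :=
          (abs_real_inner_le_norm _ _).trans (mul_le_mul (S.norm_Y_le_of_inBall ξ hs0 hω)
            (S.norm_b_le (hω s ⟨hs0, le_rfl⟩)) (norm_nonneg _) hN)
        rw [abs_div, abs_of_nonneg (show 0 ≤ ρ ω ^ p by linarith)]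
        refine (div_le_self (abs_nonneg _) h0).trans ?_
        simp only [hF]
        refine (abs_add_le _ _).trans ?_
        rw [abs_of_nonneg (show 0 ≤ Q ω ^ (m + 1) by positivity), abs_mul τ, abs_of_nonneg hτ.le]
        have h3 := abs_add_le ((m + 1) * Q ω ^ m * (2 * ⟪S.Y ξ ω s, S.b (S.seg ξ s ω)⟫)) (K * Q ω ^ m)
        rw [abs_mul ((m + 1) * Q ω ^ m), abs_of_nonneg (show 0 ≤ (m + 1 : ℝ) * Q ω ^ m by positivity),
          abs_mul 2, abs_two, abs_of_nonneg (show 0 ≤ K * Q ω ^ m by positivity)] at h3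
        have h4 : (m + 1) * Q ω ^ m * (2 * |⟪S.Y ξ ω s, S.b (S.seg ξ s ω)⟫|) + K * Q ω ^ m
            ≤ (m + 1) * (N ^ 2) ^ m * (2 * (N * S.bdb N)) + K * (N ^ 2) ^ m := by gcongr
        have h5 : Q ω ^ (m + 1) ≤ (N ^ 2) ^ (m + 1) := by gcongr
        have h6 := mul_le_mul_of_nonneg_left (h3.trans h4) hτ.le
        linarith)
  have hVi : Integrable (fun ω => I G ω * S.lyap ξ β c0 τ p j ω) P :=
    integrable_indicator_mul_of_bounded hGm'
      ((S.stronglyMeasurable_lyap ξ hτ.le p j).mono (S.ℱ.le _)) (fun ω hω => by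
        rw [abs_of_nonneg (S.lyap_nonneg ξ (by linarith) p j ω)]
        exact S.lyap_le_of_inBall ξ hβ.le hτ.le hc01 p j hω)
  set wb := modulus (fun r ω => S.b (S.seg ξ r ω)) T τ with hwb
  set ws := modulus (S.seg ξ) T τ with hws
  have hws0 : ∀ ω, 0 ≤ ws ω := modulus_nonneg
  have hwsi : Integrable ws P := integrable_modulus (S.continuous_seg ξ) (S.stronglyMeasurable_seg' ξ) T τ
  -- first bound
  have hA : ∫ ω, I G' ω * S.lyap ξ β c0 τ p (j + 1) ω ∂P
      ≤ ∫ ω, I G' ω * ρ ω ^ p + I G' ω * (Q' ω ^ (m + 1) / ρ ω ^ p) ∂P := by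
    refine integral_mono_of_nonneg (ae_of_all _ fun ω => mul_nonneg (hI0 _ _)
      (S.lyap_nonneg ξ (by linarith) p _ ω)) (hρ'i.add hQ'i) (ae_of_all _ fun ω => ?_)
    simp only
    rw [← mul_add]
    refine mul_le_mul_of_nonneg_left ?_ (hI0 _ _)
    rw [hmp]
    exact lyapunov_max_le p (by linarith [hρ1 ω])
  have hB : ∫ ω, I G' ω * ρ ω ^ p ∂P ≤ ∫ ω, I G ω * ρ ω ^ p ∂P := by
    refine integral_mono hρ'i hρi fun ω => mul_le_mul_of_nonneg_right ?_ (by linarith [hρp1 ω])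
    exact indicator_le_indicator_of_subset hG'G (fun _ => zero_le_one) ω
  have e1 : ∫ ω, I G' ω / ρ ω ^ p * Q' ω ^ (m + 1) ∂P = ∫ ω, I G' ω * (Q' ω ^ (m + 1) / ρ ω ^ p) ∂P := by
    congr 1; funext ω; ring
  have e2 : ∫ ω, I G ω / ρ ω ^ p * F ω ∂P = ∫ ω, I G ω * (F ω / ρ ω ^ p) ∂P := by
    congr 1; funext ω; ring
  have hD : ∫ ω, I G ω * ρ ω ^ p + I G ω * (F ω / ρ ω ^ p) ∂P
      ≤ ∫ ω, ((1 - p * β / 2 * τ) * (I G ω * S.lyap ξ β c0 τ p j ω)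
          + ((p * β * c0 ^ p * τ + C2 * τ ^ 2) + C2 * L * τ * ws ω)) ∂P := by
    refine integral_mono (hρi.add hFi) ((hVi.const_mul _).add
      ((integrable_const _).add (hwsi.const_mul _))) fun ω => ?_
    simp only
    have hws0' := hws0 ω
    by_cases hω : ω ∈ G
    · have hI : I G ω = 1 := by simp [hI, hω]
      rw [hI, one_mul, one_mul, one_mul]
      have hx := hdis (S.seg ξ s ω)
      rw [S.ev0_seg, max_eq_left hs0] at hx
      have hsn := S.sq_norm_seg_le ξ hβ.le hτ (c0 := c0) (by linarith) hN j
        (show (j:ℝ) * τ ≤ T by linarith) hω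
      have hinn : 2 * ⟪S.Y ξ ω s, S.b (S.seg ξ s ω)⟫
          ≤ -(a + β) * Q ω + a * (r ω + L * ws ω) + c := by
        refine hx.trans ?_
        have hle1 : Real.exp (-(β * r₀)) ≤ 1 :=
          Real.exp_le_one_iff.2 (by have := S.hr₀; nlinarith)
        have h3 := mul_le_mul_of_nonneg_left hsn (Real.exp_pos (-(β * r₀))).le
        have h4 : Real.exp (-(β * r₀)) * (Real.exp (β * r₀) * r ω + L * ws ω) ≤ r ω + L * ws ω := by
          rw [mul_add, ← mul_assoc, ← Real.exp_add, neg_add_cancel, Real.exp_zero, one_mul]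
          have h5 : Real.exp (-(β * r₀)) * (L * ws ω) ≤ L * ws ω :=
            mul_le_of_le_one_left (by positivity) hle1
          linarith
        have h5 := mul_le_mul_of_nonneg_left (h3.trans h4) ha.le
        simp only [hQ]
        linarith
      have := lyapunov_step (ε := L * ws ω) hmp ha hβ hK0 hc01 hcc hp hτ.le hτp (S.le_runMax ξ j ω)
        (S.runMax_le_of_inBall ξ hβ.le hτ.le (c0 := c0) (by linarith) j hω) (by positivity)
        ((hQN ω hω).trans (by nlinarith [sq_nonneg ‖ξ‖])) (by positivity) hinn
      refine this.trans (le_of_eq ?_)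
      unfold lyap
      ring
    · have hI : I G ω = 0 := by simp [hI, hω]
      rw [hI]; simp only [zero_mul, mul_zero, add_zero, zero_add]; positivity
  rw [integral_add hρ'i hQ'i] at hA
  rw [integral_add hρi hFi, integral_add (hVi.const_mul _) (by exact (integrable_const _).add (hwsi.const_mul _)),
    integral_add (integrable_const _) (hwsi.const_mul _), integral_const_mul, integral_const_mul] at hD
  simp only [integral_const, probReal_univ, one_smul] at hD
  have h2 : ∫ ω, I G' ω / ρ ω ^ p * Q' ω ^ (m + 1) ∂P ≤ ∫ ω, I G ω / ρ ω ^ p * F ω ∂P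
    + C1 * (τ ^ 2 + τ * ∫ ω, wb ω ∂P) := h1
  rw [e1, e2] at h2
  have hwb0 : 0 ≤ ∫ ω, wb ω ∂P := integral_nonneg modulus_nonneg
  have hwsI0 : 0 ≤ ∫ ω, ws ω ∂P := integral_nonneg hws0
  have k1 : 0 ≤ C1 * (τ * ∫ ω, ws ω ∂P) := by positivity
  have k2 : 0 ≤ C2 * (1 + L) * (τ * ∫ ω, wb ω ∂P) := by positivity
  have k3 : 0 ≤ C2 * L * τ ^ 2 := by positivity
  have k4 : 0 ≤ C2 * (τ * ∫ ω, ws ω ∂P) := by positivity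
  linarith

end PathSDE

lemma le_of_affine_recursion {E : ℕ → ℝ} {q D : ℝ} (hq : 0 < q) (hq1 : q ≤ 1) (n : ℕ)
    (h : ∀ j < n, E (j + 1) ≤ (1 - q) * E j + D) (hD : 0 ≤ D) :
    E n ≤ (1 - q) ^ n * E 0 + D / q := by
  induction n with
  | zero => simp; positivity
  | succ n ih =>
    have h1 := ih fun j hj => h j (by omega)
    have h2 := mul_le_mul_of_nonneg_left h1 (sub_nonneg.2 hq1)
    have h3 := h n (by omega)
    have h4 : (1 - q) * (D / q) + D = D / q := by field_simp; ring
    calc E (n + 1) ≤ (1 - q) * ((1 - q) ^ n * E 0 + D / q) + D := by linarith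
      _ = (1 - q) ^ (n + 1) * E 0 + ((1 - q) * (D / q) + D) := by ring
      _ = _ := by rw [h4]

namespace PathSDE

variable (S : PathSDE d r₀ Ω P) (ξ : Seg d r₀)

lemma exists_mem_inBall (T : ℝ) (ω : Ω) : ∃ n₀ : ℕ, ∀ n : ℕ, n₀ ≤ n → ω ∈ S.inBall ξ n T := by
  obtain ⟨M, hM⟩ := (isCompact_Icc (a := (0:ℝ)) (b := T)).exists_bound_of_continuousOn
    (S.continuous_seg ξ ω).continuousOn
  obtain ⟨n₀, hn₀⟩ := exists_nat_ge M
  exact ⟨n₀, fun n hn s hs => (hM s hs).trans (hn₀.trans (by exact_mod_cast hn))⟩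

/-- Bound of the moment localised on the paths which stay in a ball. -/
theorem integral_indicator_norm_pow_le {β c0 A T N C : ℝ} (hβ : 0 < β) (hc0 : 1 ≤ c0) {p : ℕ}
    (hp : 1 ≤ p) (hA : 0 ≤ A) (hC : 0 ≤ C) (hT : 0 < T) (hN : 0 ≤ N)
    (hstep : ∀ (τ T : ℝ) (j : ℕ), 0 < τ → τ ≤ 1 → p * β * τ ≤ 1 / 2 → (j + 1 : ℕ) * τ ≤ T →
    ∫ ω, (S.inBall ξ N ((j + 1 : ℕ) * τ)).indicator (fun _ => 1) ω * S.lyap ξ β c0 τ p (j + 1) ω ∂P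
      ≤ (1 - p * β / 2 * τ) *
        ∫ ω, (S.inBall ξ N (j * τ)).indicator (fun _ => 1) ω * S.lyap ξ β c0 τ p j ω ∂P
        + A * τ + C * (τ * (τ + ∫ ω, modulus (fun r ω => S.b (S.seg ξ r ω)) T τ ω ∂P
          + ∫ ω, modulus (S.seg ξ) T τ ω ∂P))) :
    ∫ ω, (S.inBall ξ N T).indicator (fun _ => 1) ω * (‖S.seg ξ T ω‖ ^ 2) ^ p ∂P ≤
      2 ^ p * (Real.exp (β * r₀) ^ p * (Real.exp (-(p * β / 2 * T)) * (2 * (‖ξ‖ ^ 2 + c0) ^ p)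
        + A / (p * β / 2))) := by
  have := S.hP
  set κ := p * β / 2 with hκ
  have hp0 : (0:ℝ) < p := by exact_mod_cast hp
  have hκ0 : 0 < κ := by positivity
  set τ : ℕ → ℝ := fun n => T / (n + 1 : ℕ) with hτ
  have hτ0 : Tendsto τ atTop (𝓝 0) := by
    have := (tendsto_const_div_atTop_nhds_zero_nat T).comp (tendsto_add_atTop_nat 1)
    exact this
  have hτpos : ∀ n, 0 < τ n := fun n => by simp only [hτ]; positivity
  have hτT : ∀ n, ((n + 1 : ℕ) : ℝ) * τ n = T := fun n => by
    simp only [hτ]; field_simp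
  set mb : ℕ → ℝ := fun n => ∫ ω, modulus (fun r ω => S.b (S.seg ξ r ω)) T (τ n) ω ∂P with hmb
  set ms : ℕ → ℝ := fun n => ∫ ω, modulus (S.seg ξ) T (τ n) ω ∂P with hms
  have hmb0 : Tendsto mb atTop (𝓝 0) := tendsto_integral_modulus (S.continuous_b_seg ξ)
    (fun t => S.hA1bcont.comp_stronglyMeasurable (S.stronglyMeasurable_seg' ξ t)) T hτ0
  have hms0 : Tendsto ms atTop (𝓝 0) := tendsto_integral_modulus (S.continuous_seg ξ)
    (S.stronglyMeasurable_seg' ξ) T hτ0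
  set L := 2 * N * (2 * N + 1) with hL
  have hL0 : 0 ≤ L := by positivity
  set V := 2 * (‖ξ‖ ^ 2 + c0) ^ p with hV
  set G := S.inBall ξ N T with hG
  have hGm : MeasurableSet G := S.measurableSet_inBall' ξ N hT.le
  have hbound : ∀ᶠ n in atTop,
      ∫ ω, G.indicator (fun _ => 1) ω * (‖S.seg ξ T ω‖ ^ 2) ^ p ∂P ≤
      2 ^ p * (Real.exp (β * r₀) ^ p * (Real.exp (-(κ * T)) * V
        + (A + C * (τ n + mb n + ms n)) / κ) + L ^ p * ms n) := by
    have hev1 : ∀ᶠ n in atTop, τ n < 1 := hτ0.eventually (gt_mem_nhds one_pos)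
    have hev2 : ∀ᶠ n in atTop, τ n < 1 / 2 / (p * β) :=
      hτ0.eventually (gt_mem_nhds (by positivity))
    filter_upwards [hev1, hev2] with n h1 h2
    have h2' : p * β * τ n ≤ 1 / 2 := by
      have := (lt_div_iff₀ (by positivity)).1 h2
      linarith
    have hmbn : 0 ≤ mb n := integral_nonneg modulus_nonneg
    have hmsn : 0 ≤ ms n := integral_nonneg modulus_nonneg
    have hτn := hτpos n
    set E : ℕ → ℝ := fun j => ∫ ω, (S.inBall ξ N (j * τ n)).indicator (fun _ => 1) ω *
      S.lyap ξ β c0 (τ n) p j ω ∂P with hE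
    have hrec := le_of_affine_recursion (E := E) (q := κ * τ n)
      (D := A * τ n + C * (τ n * (τ n + mb n + ms n))) (by positivity)
      (by rw [hκ]; linarith) (n + 1) (fun j hj => by
        have := hstep (τ n) T j (hτpos n) h1.le h2' (by
          rw [← hτT n]
          have : ((j + 1 : ℕ) : ℝ) ≤ (n + 1 : ℕ) := by exact_mod_cast hj
          exact mul_le_mul_of_nonneg_right this (hτpos n).le)
        simp only [hE, hmb, hms]
        linarith) (by positivity)
    have hD : (A * τ n + C * (τ n * (τ n + mb n + ms n))) / (κ * τ n)
        = (A + C * (τ n + mb n + ms n)) / κ := by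
      field_simp
    have hE0 : E 0 ≤ V := by
      have : ∀ ω, (S.inBall ξ N ((0:ℕ) * τ n)).indicator (fun _ => (1:ℝ)) ω *
          S.lyap ξ β c0 (τ n) p 0 ω ≤ V := fun ω => by
        have hy := S.sq_norm_Y_le_runMax ξ (β := β) (c0 := c0) (τ := τ n) 0 ω
        have hr : S.runMax ξ β c0 (τ n) 0 ω ≤ ‖ξ‖ ^ 2 + c0 :=
          max_le (by linarith) (by linarith [sq_nonneg ‖ξ‖])
        have hc := S.le_runMax ξ (β := β) (c0 := c0) (τ := τ n) 0 ω
        have hr0 : 0 < S.runMax ξ β c0 (τ n) 0 ω := by linarith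
        have hl : S.lyap ξ β c0 (τ n) p 0 ω ≤ V := by
          unfold lyap
          have h3 : (‖S.Y ξ ω ((0:ℕ) * τ n)‖ ^ 2) ^ (2 * p) / S.runMax ξ β c0 (τ n) 0 ω ^ p
              ≤ S.runMax ξ β c0 (τ n) 0 ω ^ p := by
            rw [div_le_iff₀ (by positivity), ← pow_add, ← two_mul]
            gcongr
          have h4 : S.runMax ξ β c0 (τ n) 0 ω ^ p ≤ (‖ξ‖ ^ 2 + c0) ^ p := by gcongr
          rw [hV]; linarith
        have hl0 := S.lyap_nonneg ξ (β := β) (c0 := c0) (τ := τ n) (by linarith) p 0 ω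
        by_cases h : ω ∈ S.inBall ξ N ((0:ℕ) * τ n)
        · rw [indicator_of_mem h, one_mul]; exact hl
        · rw [indicator_of_notMem h, zero_mul]; linarith
      calc E 0 ≤ ∫ _, V ∂P := by
            refine integral_mono_of_nonneg (ae_of_all _ fun ω => mul_nonneg
              (indicator_nonneg (by simp) ω) (S.lyap_nonneg ξ (by linarith) p _ ω))
              (integrable_const _) (ae_of_all _ this)
        _ = V := by simp
    have hV0 : 0 ≤ V := by positivity
    have hexp : (1 - κ * τ n) ^ (n + 1) ≤ Real.exp (-(κ * T)) := by
      have h3 : 1 - κ * τ n ≤ Real.exp (-(κ * τ n)) := by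
        have := Real.add_one_le_exp (-(κ * τ n)); linarith
      have h4 : 0 ≤ 1 - κ * τ n := by rw [hκ]; linarith
      calc _ ≤ Real.exp (-(κ * τ n)) ^ (n + 1) := by gcongr
        _ = _ := by rw [← Real.exp_nat_mul]; congr 1; rw [← hτT n]; ring
    have hEn : E (n + 1) ≤ Real.exp (-(κ * T)) * V + (A + C * (τ n + mb n + ms n)) / κ := by
      rw [hD] at hrec
      have h4 : 0 ≤ 1 - κ * τ n := by rw [hκ]; linarith
      have h5 : (1 - κ * τ n) ^ (n + 1) * E 0 ≤ Real.exp (-(κ * T)) * V :=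
        (mul_le_mul_of_nonneg_left hE0 (by positivity)).trans (mul_le_mul_of_nonneg_right hexp hV0)
      linarith
    have hVi : Integrable (fun ω => G.indicator (fun _ => 1) ω *
        S.lyap ξ β c0 (τ n) p (n + 1) ω) P :=
      integrable_indicator_mul_of_bounded hGm
        ((S.stronglyMeasurable_lyap ξ hτn.le p (n + 1)).mono (S.ℱ.le _)) (fun ω hω => by
          rw [abs_of_nonneg (S.lyap_nonneg ξ (by linarith) p _ ω)]
          exact S.lyap_le_of_inBall ξ (N := N) hβ.le hτn.le hc0 p _ (by rw [hτT]; exact hω))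
    have hmi : Integrable (modulus (S.seg ξ) T (τ n)) P :=
      integrable_modulus (S.continuous_seg ξ) (S.stronglyMeasurable_seg' ξ) T _
    have hEG : E (n + 1) = ∫ ω, G.indicator (fun _ => 1) ω *
        S.lyap ξ β c0 (τ n) p (n + 1) ω ∂P := by
      simp only [hE]; rw [hτT]
    calc ∫ ω, G.indicator (fun _ => 1) ω * (‖S.seg ξ T ω‖ ^ 2) ^ p ∂P
        ≤ ∫ ω, (2 ^ p * (Real.exp (β * r₀) ^ p) * (G.indicator (fun _ => 1) ω *
        S.lyap ξ β c0 (τ n) p (n + 1) ω) + 2 ^ p * L ^ p * modulus (S.seg ξ) T (τ n) ω) ∂P := by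
          refine integral_mono_of_nonneg (ae_of_all _ fun ω => mul_nonneg
            (indicator_nonneg (by simp) ω) (by positivity))
            ((hVi.const_mul _).add (hmi.const_mul _)) (ae_of_all _ fun ω => ?_)
          simp only
          have hm0 := modulus_nonneg (Z := S.seg ξ) (T := T) (τ := τ n) ω
          have hm1 := modulus_le_one (Z := S.seg ξ) (T := T) (τ := τ n) ω
          by_cases h : ω ∈ G
          · rw [indicator_of_mem h, one_mul, one_mul]
            have hs := S.sq_norm_seg_le ξ hβ.le hτn (c0 := c0) (by linarith) hN (n + 1)
              (hτT n).le (by rw [hτT]; exact h)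
            rw [hτT] at hs
            have hr := S.le_runMax ξ (β := β) (c0 := c0) (τ := τ n) (n + 1) ω
            have hr0 : 0 ≤ S.runMax ξ β c0 (τ n) (n + 1) ω := by linarith
            have hly : S.runMax ξ β c0 (τ n) (n + 1) ω ^ p ≤ S.lyap ξ β c0 (τ n) p (n + 1) ω := by
              unfold lyap
              exact le_add_of_nonneg_right (by positivity)
            have hmp : modulus (S.seg ξ) T (τ n) ω ^ p ≤ modulus (S.seg ξ) T (τ n) ω :=
              pow_le_of_le_one hm0 hm1 (by omega)
            calc (‖S.seg ξ T ω‖ ^ 2) ^ p ≤ (Real.exp (β * r₀) * S.runMax ξ β c0 (τ n) (n + 1) ω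
                  + L * modulus (S.seg ξ) T (τ n) ω) ^ p := by gcongr
              _ ≤ 2 ^ p * ((Real.exp (β * r₀) * S.runMax ξ β c0 (τ n) (n + 1) ω) ^ p
                  + (L * modulus (S.seg ξ) T (τ n) ω) ^ p) := by
                have h5 := add_pow_le (show 0 ≤ Real.exp (β * r₀) * S.runMax ξ β c0 (τ n) (n + 1) ω
                  by positivity) (show 0 ≤ L * modulus (S.seg ξ) T (τ n) ω by positivity) p
                refine h5.trans (mul_le_mul_of_nonneg_right ?_ (by positivity))
                exact pow_le_pow_right₀ one_le_two (by omega)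
              _ ≤ _ := by
                rw [mul_pow, mul_pow, mul_add, ← mul_assoc, ← mul_assoc]
                gcongr
          · rw [indicator_of_notMem h, zero_mul, zero_mul, mul_zero, zero_add]
            positivity
      _ = 2 ^ p * (Real.exp (β * r₀) ^ p) * E (n + 1) + 2 ^ p * L ^ p * ms n := by
          have i1 := hVi.const_mul (2 ^ p * (Real.exp (β * r₀) ^ p))
          have i2 := hmi.const_mul (2 ^ p * L ^ p)
          rw [integral_add (by exact i1) (by exact i2), integral_const_mul, integral_const_mul, hEG]
      _ ≤ _ := by
          have h6 := mul_le_mul_of_nonneg_left hEn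
            (show 0 ≤ (2:ℝ) ^ p * (Real.exp (β * r₀) ^ p) by positivity)
          linarith
  have hlim : Tendsto (fun n => 2 ^ p * (Real.exp (β * r₀) ^ p * (Real.exp (-(κ * T)) * V
        + (A + C * (τ n + mb n + ms n)) / κ) + L ^ p * ms n)) atTop
      (𝓝 (2 ^ p * (Real.exp (β * r₀) ^ p * (Real.exp (-(κ * T)) * V
        + (A + C * (0 + 0 + 0)) / κ) + L ^ p * 0))) :=
    (((((((hτ0.add hmb0).add hms0).const_mul C).const_add A).div_const κ).const_add _
      |>.const_mul _).add (hms0.const_mul _)).const_mul _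
  have := ge_of_tendsto hlim hbound
  simpa using this

/-- Uniform polynomial moment bounds of the segment process. -/
theorem exists_moment_bound (q : ℕ) : ∃ p : ℕ, q ≤ p ∧ 1 ≤ p ∧ ∃ C κ : ℝ, 0 < κ ∧ 0 ≤ C ∧
    ∀ (ξ : Seg d r₀) (T : ℝ), 0 ≤ T → Integrable (fun ω => ‖S.X ξ T ω‖ ^ (2 * p)) P ∧
      ∫ ω, ‖S.X ξ T ω‖ ^ (2 * p) ∂P ≤ C * (1 + Real.exp (-(κ * T)) * ‖ξ‖ ^ (2 * p)) := by
  have := S.hP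
  obtain ⟨a, β, c, ha, hβ, hc, hdis⟩ := S.exists_dissipative
  obtain ⟨p0, hp0⟩ := exists_nat_ge ((a + β / 4) / (β / 2))
  set p := max (max p0 1) q with hpdef
  have hp1 : 1 ≤ p := (le_max_right _ _).trans (le_max_left _ _)
  have hp : a + β / 4 ≤ p * β / 2 := by
    have h1 : ((a + β / 4) / (β / 2)) ≤ p :=
      hp0.trans (by exact_mod_cast (le_max_left _ _).trans (le_max_left _ _))
    have := (div_le_iff₀ (by positivity)).1 h1
    linarith
  obtain ⟨c0, hc0, hstep⟩ := S.exists_lyap_step ha hβ hc hdis p hp1 hp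
  have hp0' : (0:ℝ) < p := by exact_mod_cast hp1
  set κ := p * β / 2 with hκ
  have hκ0 : 0 < κ := by positivity
  set A := p * β * c0 ^ p with hA
  have hA0 : 0 ≤ A := by positivity
  set D := (2:ℝ) ^ p * Real.exp (β * r₀) ^ p with hD
  have hD1 : 1 ≤ D := by
    have h1 : (1:ℝ) ≤ 2 ^ p := one_le_pow₀ one_le_two
    have h2 : 1 ≤ Real.exp (β * r₀) ^ p :=
      one_le_pow₀ (Real.one_le_exp (by have := S.hr₀; positivity))
    nlinarith
  set V := 2 * 2 ^ p * c0 ^ p with hV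
  have hc0p : 1 ≤ c0 ^ p := one_le_pow₀ hc0
  have h2p : (1:ℝ) ≤ 2 ^ p := one_le_pow₀ one_le_two
  have hV1 : 1 ≤ V := by rw [hV]; nlinarith
  refine ⟨p, le_max_right _ _, hp1, D * (V + A / κ), κ, hκ0, by positivity, fun ξ T hT => ?_⟩
  have hAκ : 0 ≤ A / κ := by positivity
  have hC1 : 1 ≤ D * (V + A / κ) := by nlinarith
  rcases hT.eq_or_lt with rfl | hT
  · have e : ∀ ω, S.X ξ 0 ω = ξ := fun ω => by
      rw [← S.seg_of_nonneg ξ le_rfl, S.seg_zero]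
    simp only [e, integral_const, probReal_univ, one_smul, mul_zero, neg_zero, Real.exp_zero, one_mul]
    refine ⟨integrable_const _, ?_⟩
    have : 0 ≤ ‖ξ‖ ^ (2 * p) := by positivity
    nlinarith
  have hpow : ∀ x : Seg d r₀, ‖x‖ ^ (2 * p) = (‖x‖ ^ 2) ^ p := fun x => pow_mul _ _ _
  simp only [hpow]
  refine integrable_and_integral_le_of_tendsto
    (F := fun n ω => (S.inBall ξ n T).indicator (fun _ => 1) ω * (‖S.X ξ T ω‖ ^ 2) ^ p)
    (fun n => ?_) (fun n ω => mul_nonneg (indicator_nonneg (by simp) ω) (by positivity))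
    (fun ω => ?_) (Eventually.of_forall fun n => ?_)
  · refine integrable_indicator_mul_of_bounded (S.measurableSet_inBall' ξ n hT.le)
      (((((S.hXadapted ξ T hT.le).mono (S.ℱ.le T)).norm.pow 2).pow p)) (c := ((n:ℝ) ^ 2) ^ p)
      (fun ω hω => ?_)
    have := hω T ⟨hT.le, le_rfl⟩
    rw [S.seg_of_nonneg ξ hT.le] at this
    rw [abs_of_nonneg (by positivity)]
    gcongr
  · obtain ⟨n₀, h⟩ := S.exists_mem_inBall ξ T ω
    refine tendsto_const_nhds.congr' ?_
    filter_upwards [eventually_ge_atTop n₀] with n hn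
    rw [indicator_of_mem (h n hn), one_mul]
  · obtain ⟨C, hC, hst⟩ := hstep ξ n (by positivity)
    have := S.integral_indicator_norm_pow_le ξ hβ hc0 hp1 hA0 hC hT (by positivity) hst
    simp only [S.seg_of_nonneg ξ hT.le] at this
    refine this.trans ?_
    have h3 : 2 * (‖ξ‖ ^ 2 + c0) ^ p ≤ V * (1 + (‖ξ‖ ^ 2) ^ p) := by
      have h4 := add_pow_le (show 0 ≤ ‖ξ‖ ^ 2 by positivity) (show 0 ≤ c0 by linarith) p
      have h5 : (2:ℝ) ^ (p - 1) ≤ 2 ^ p := pow_le_pow_right₀ one_le_two (by omega)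
      have h6 : 0 ≤ (‖ξ‖ ^ 2) ^ p := by positivity
      calc 2 * (‖ξ‖ ^ 2 + c0) ^ p ≤ 2 * (2 ^ p * ((‖ξ‖ ^ 2) ^ p + c0 ^ p)) := by
            refine mul_le_mul_of_nonneg_left (h4.trans ?_) two_pos.le
            exact mul_le_mul_of_nonneg_right h5 (by positivity)
        _ ≤ 2 * (2 ^ p * (c0 ^ p * (‖ξ‖ ^ 2) ^ p + c0 ^ p)) := by
            gcongr; exact le_mul_of_one_le_left h6 hc0p
        _ = _ := by rw [hV]; ring
    have hexp1 : Real.exp (-(κ * T)) ≤ 1 := Real.exp_le_one_iff.2 (by nlinarith)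
    have h7 := mul_le_mul_of_nonneg_left h3 (Real.exp_pos (-(κ * T))).le
    have h8 : Real.exp (-(κ * T)) * (V * (1 + (‖ξ‖ ^ 2) ^ p)) + A / κ
        ≤ (V + A / κ) * (1 + Real.exp (-(κ * T)) * (‖ξ‖ ^ 2) ^ p) := by
      have h9 : Real.exp (-(κ * T)) * V ≤ V := mul_le_of_le_one_left (by linarith) hexp1
      have h10 : 0 ≤ A / κ * (Real.exp (-(κ * T)) * (‖ξ‖ ^ 2) ^ p) := by positivity
      linarith
    have h11 := mul_le_mul_of_nonneg_left ((add_le_add_left h7 (A / κ)).trans h8) (show 0 ≤ D by linarith)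
    rw [mul_assoc D]
    refine le_trans (le_of_eq ?_) h11
    rw [hD]
    ring

end PathSDE

lemma MeasureTheory.StronglyMeasurable.clm_apply' {Ω E F : Type*} {m : MeasurableSpace Ω}
    [NormedAddCommGroup E] [NormedSpace ℝ E] [NormedAddCommGroup F] [NormedSpace ℝ F]
    {B : Ω → E →L[ℝ] F} {v : Ω → E} (hB : StronglyMeasurable[m] B)
    (hv : StronglyMeasurable[m] v) : StronglyMeasurable[m] fun ω => B ω (v ω) :=
  isBoundedBilinearMap_apply.continuous.comp_stronglyMeasurable (hB.prodMk hv)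

lemma MeasureTheory.MemLp.integrable_inner' {Ω E : Type*} [MeasurableSpace Ω] {P : Measure Ω}
    [NormedAddCommGroup E] [InnerProductSpace ℝ E] {v w : Ω → E} (hv : MemLp v 2 P)
    (hw : MemLp w 2 P) : Integrable (fun ω => ⟪v ω, w ω⟫) P :=
  (hv.norm.integrable_mul hw.norm).mono' (hv.1.inner hw.1)
    (ae_of_all _ fun ω => by simpa using norm_inner_le_norm (𝕜 := ℝ) (v ω) (w ω))

namespace PathSDE

variable (S : PathSDE d r₀ Ω P) (ξ : Seg d r₀)

lemma stronglyMeasurable_mg_sub {s t : ℝ} (hst : s ≤ t) :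
    StronglyMeasurable[S.ℱ t] fun ω => S.mg ξ t ω - S.mg ξ s ω :=
  (S.stronglyMeasurable_mg ξ t).sub ((S.stronglyMeasurable_mg ξ s).mono (S.ℱ.mono hst))

lemma memLp_mg_sub {s t : ℝ} (hs : 0 ≤ s) (hst : s ≤ t) :
    MemLp (fun ω => S.mg ξ t ω - S.mg ξ s ω) 2 P := by
  rw [memLp_two_iff_integrable_sq_norm
    ((S.stronglyMeasurable_mg_sub ξ hst).mono (S.ℱ.le _)).aestronglyMeasurable]
  exact S.integrable_norm_pow ξ 0 hs hst

/-- Increments of the martingale part are orthogonal to square integrable past variables. -/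
lemma integral_inner_sub_eq_zero_of_memLp {s t : ℝ} (hst : s ≤ t) {v : Ω → EucSp d}
    (hv : StronglyMeasurable[S.ℱ s] v) (hv2 : MemLp v 2 P) :
    ∫ ω, ⟪v ω, S.mg ξ t ω - S.mg ξ s ω⟫ ∂P = 0 := by
  have := S.hP
  let e : Fin d → EucSp d := fun i => EuclideanSpace.single i 1
  have hc : ∀ i, MemLp (fun ω => v ω i) 2 P := fun i => hv2.eval_piLp i
  have hm : ∀ i r, MemLp (fun ω => S.mg ξ r ω i) 2 P := fun i r => by
    simpa [e, EuclideanSpace.inner_single_left] using S.memLp_inner_mg ξ (e i) r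
  have hM : ∀ i, Martingale (fun r ω => S.mg ξ r ω i) S.ℱ P := fun i => by
    simpa [e, EuclideanSpace.inner_single_left] using S.martingale_inner_mg ξ (e i)
  have hvi : ∀ i, StronglyMeasurable[S.ℱ s] fun ω => v ω i := fun i =>
    (EuclideanSpace.proj i : EucSp d →L[ℝ] ℝ).continuous.comp_stronglyMeasurable hv
  have hz : ∀ i, ∫ ω, v ω i * (S.mg ξ t ω i - S.mg ξ s ω i) ∂P = 0 := fun i =>
    (hM i).integral_mul_sub_eq_zero hst (hvi i) ((hc i).integrable_mul (hm i s))
      ((hc i).integrable_mul (hm i t))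
  have hI : ∀ i, Integrable (fun ω => v ω i * (S.mg ξ t ω i - S.mg ξ s ω i)) P := fun i =>
    (hc i).integrable_mul ((hm i t).sub (hm i s))
  have : ∀ ω, ⟪v ω, S.mg ξ t ω - S.mg ξ s ω⟫
      = ∑ i, v ω i * (S.mg ξ t ω i - S.mg ξ s ω i) := fun ω => by
    rw [PiLp.inner_apply]
    exact Finset.sum_congr rfl fun i _ => by simp [mul_comm]
  simp only [this]
  rw [integral_finsetSum _ fun i _ => hI i]
  exact Finset.sum_eq_zero fun i _ => hz i

/-- The discrete stochastic integral `∑ i < j, Aᵢ (M(τᵢ₊₁) - M(τᵢ))`. -/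
def isum (S : PathSDE d r₀ Ω P) (ξ : Seg d r₀) (τ : ℕ → ℝ) (A : ℕ → Ω → EucSp d →L[ℝ] EucSp d)
    (j : ℕ) (ω : Ω) : EucSp d :=
  ∑ i ∈ Finset.range j, A i ω (S.mg ξ (τ (i + 1)) ω - S.mg ξ (τ i) ω)

variable {τ : ℕ → ℝ} {A : ℕ → Ω → EucSp d →L[ℝ] EucSp d} {c : ℝ}

lemma isum_succ (j : ℕ) (ω : Ω) : S.isum ξ τ A (j + 1) ω
    = S.isum ξ τ A j ω + A j ω (S.mg ξ (τ (j + 1)) ω - S.mg ξ (τ j) ω) :=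
  Finset.sum_range_succ _ _

lemma stronglyMeasurable_isum (hτ : Monotone τ) (hA : ∀ i, StronglyMeasurable[S.ℱ (τ i)] (A i))
    (j : ℕ) : StronglyMeasurable[S.ℱ (τ j)] (S.isum ξ τ A j) := by
  unfold isum
  refine Finset.stronglyMeasurable_fun_sum _ fun i hi => ?_
  have hij : i + 1 ≤ j := Finset.mem_range.1 hi
  exact ((hA i).mono (S.ℱ.mono (hτ (Nat.le_of_succ_le hij)))).clm_apply'
    ((S.stronglyMeasurable_mg_sub ξ (hτ (Nat.le_succ i))).mono (S.ℱ.mono (hτ hij)))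

lemma memLp_clm_apply {B : Ω → EucSp d →L[ℝ] EucSp d} (hB : StronglyMeasurable B)
    (hBc : ∀ ω, ‖B ω‖ ≤ c) {v : Ω → EucSp d} (hvm : StronglyMeasurable v) (hv : MemLp v 2 P) :
    MemLp (fun ω => B ω (v ω)) 2 P := by
  refine hv.of_le_mul (c := c) ?_ (ae_of_all _ fun ω => ?_)
  · exact (hB.clm_apply' hvm).aestronglyMeasurable
  · exact ((B ω).le_opNorm _).trans (mul_le_mul_of_nonneg_right (hBc ω) (norm_nonneg _))

lemma memLp_isum (hτ : Monotone τ) (h0 : 0 ≤ τ 0)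
    (hA : ∀ i, StronglyMeasurable[S.ℱ (τ i)] (A i)) (hAc : ∀ i ω, ‖A i ω‖ ≤ c) (j : ℕ) :
    MemLp (S.isum ξ τ A j) 2 P := by
  unfold isum
  exact memLp_finsetSum _ fun i _ => memLp_clm_apply ((hA i).mono (S.ℱ.le _)) (hAc i)
    ((S.stronglyMeasurable_mg_sub ξ (hτ (Nat.le_succ i))).mono (S.ℱ.le _))
    (S.memLp_mg_sub ξ (h0.trans (hτ (Nat.zero_le i))) (hτ (Nat.le_succ i)))

lemma integral_inner_isum (hτ : Monotone τ) (h0 : 0 ≤ τ 0)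
    (hA : ∀ i, StronglyMeasurable[S.ℱ (τ i)] (A i)) (hAc : ∀ i ω, ‖A i ω‖ ≤ c) (j : ℕ)
    {v : Ω → EucSp d} (hv : StronglyMeasurable[S.ℱ (τ 0)] v) {cv : ℝ} (hvc : ∀ ω, ‖v ω‖ ≤ cv) :
    ∫ ω, ⟪v ω, S.isum ξ τ A j ω⟫ ∂P = 0 := by
  have := S.hP
  have hv2 : MemLp v 2 P :=
    MemLp.of_bound (hv.mono (S.ℱ.le _)).aestronglyMeasurable cv (ae_of_all _ hvc)
  have hadj : ∀ i, StronglyMeasurable[S.ℱ (τ i)]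
      fun ω => ContinuousLinearMap.adjoint (A i ω) := fun i =>
    (LinearIsometryEquiv.continuous _).comp_stronglyMeasurable (hA i)
  simp only [isum, inner_sum]
  rw [integral_finsetSum]
  · refine Finset.sum_eq_zero fun i _ => ?_
    simp only [← ContinuousLinearMap.adjoint_inner_left]
    refine S.integral_inner_sub_eq_zero_of_memLp ξ (hτ (Nat.le_succ i))
      ((hadj i).clm_apply' (hv.mono (S.ℱ.mono (hτ (Nat.zero_le i))))) ?_
    exact memLp_clm_apply ((hadj i).mono (S.ℱ.le _)) (c := c)
      (fun ω => by rw [LinearIsometryEquiv.norm_map]; exact hAc i ω) (hv.mono (S.ℱ.le _)) hv2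
  · intro i _
    exact hv2.integrable_inner' (memLp_clm_apply ((hA i).mono (S.ℱ.le _)) (hAc i)
      ((S.stronglyMeasurable_mg_sub ξ (hτ (Nat.le_succ i))).mono (S.ℱ.le _))
      (S.memLp_mg_sub ξ (h0.trans (hτ (Nat.zero_le i))) (hτ (Nat.le_succ i))))

lemma integrable_mul_norm_sq {g : Ω → ℝ} (hg : StronglyMeasurable g) {cg : ℝ}
    (hgc : ∀ ω, |g ω| ≤ cg) {v : Ω → EucSp d} (hv : MemLp v 2 P) :
    Integrable (fun ω => g ω * ‖v ω‖ ^ 2) P :=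
  integrable_bdd_mul' hg hgc ((memLp_two_iff_integrable_sq_norm hv.1).1 hv)

/-- The Itô inequality for discrete stochastic integrals. -/
theorem integral_mul_norm_isum_sq_le (hτ : Monotone τ) (h0 : 0 ≤ τ 0)
    (hA : ∀ i, StronglyMeasurable[S.ℱ (τ i)] (A i)) (hAc : ∀ i ω, ‖A i ω‖ ≤ c)
    {g : Ω → ℝ} (hg : StronglyMeasurable[S.ℱ (τ 0)] g) {cg : ℝ} (hgc : ∀ ω, |g ω| ≤ cg)
    (hg0 : ∀ ω, 0 ≤ g ω) (j : ℕ) :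
    ∫ ω, g ω * ‖S.isum ξ τ A j ω‖ ^ 2 ∂P ≤
      ∑ i ∈ Finset.range j, S.momC 0 * (τ (i + 1) - τ i) * ∫ ω, g ω * ‖A i ω‖ ^ 2 ∂P := by
  have := S.hP
  have hgm := hg.mono (S.ℱ.le _)
  induction j with
  | zero => simp [isum]
  | succ j ih =>
    rw [Finset.sum_range_succ]
    have hgj : StronglyMeasurable[S.ℱ (τ j)] g := hg.mono (S.ℱ.mono (hτ (Nat.zero_le j)))
    have hj0 : 0 ≤ τ j := h0.trans (hτ (Nat.zero_le j))
    have hjj : τ j ≤ τ (j + 1) := hτ (Nat.le_succ j)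
    have hS := S.memLp_isum ξ hτ h0 hA hAc j
    have hΔ := S.memLp_mg_sub ξ hj0 hjj
    have hW := memLp_clm_apply ((hA j).mono (S.ℱ.le _)) (hAc j)
      ((S.stronglyMeasurable_mg_sub ξ hjj).mono (S.ℱ.le _)) hΔ
    have hadj : StronglyMeasurable[S.ℱ (τ j)] fun ω => ContinuousLinearMap.adjoint (A j ω) :=
      (LinearIsometryEquiv.continuous _).comp_stronglyMeasurable (hA j)
    have hvm : StronglyMeasurable[S.ℱ (τ j)] fun ω =>
        g ω • (ContinuousLinearMap.adjoint (A j ω)) (S.isum ξ τ A j ω) :=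
      hgj.smul (hadj.clm_apply' (S.stronglyMeasurable_isum ξ hτ hA j))
    have hv2 : MemLp (fun ω => g ω • (ContinuousLinearMap.adjoint (A j ω)) (S.isum ξ τ A j ω)) 2 P := by
      refine (memLp_clm_apply (hadj.mono (S.ℱ.le _)) (c := c)
        (fun ω => by rw [LinearIsometryEquiv.norm_map]; exact hAc j ω)
        ((S.stronglyMeasurable_isum ξ hτ hA j).mono (S.ℱ.le _)) hS).of_le_mul (c := cg)
        (hvm.mono (S.ℱ.le _)).aestronglyMeasurable (ae_of_all _ fun ω => ?_)
      rw [norm_smul]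
      exact mul_le_mul_of_nonneg_right (hgc ω) (norm_nonneg _)
    have hcross := S.integral_inner_sub_eq_zero_of_memLp ξ hjj hvm hv2
    have i1 := integrable_mul_norm_sq hgm hgc hS
    have i2 := hv2.integrable_inner' hΔ
    have i3 := integrable_mul_norm_sq hgm hgc hW
    have e : ∀ ω, g ω * ‖S.isum ξ τ A (j + 1) ω‖ ^ 2 = g ω * ‖S.isum ξ τ A j ω‖ ^ 2
        + 2 * ⟪g ω • (ContinuousLinearMap.adjoint (A j ω)) (S.isum ξ τ A j ω),
            S.mg ξ (τ (j + 1)) ω - S.mg ξ (τ j) ω⟫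
        + g ω * ‖A j ω (S.mg ξ (τ (j + 1)) ω - S.mg ξ (τ j) ω)‖ ^ 2 := fun ω => by
      rw [isum_succ, norm_add_sq_real, real_inner_smul_left,
        ContinuousLinearMap.adjoint_inner_left]
      ring
    have i2' := i2.const_mul 2
    have i12 := i1.add i2'
    have hb : ∫ ω, g ω * ‖A j ω (S.mg ξ (τ (j + 1)) ω - S.mg ξ (τ j) ω)‖ ^ 2 ∂P
        ≤ S.momC 0 * (τ (j + 1) - τ j) * ∫ ω, g ω * ‖A j ω‖ ^ 2 ∂P := by
      have hc0 : 0 ≤ c := (norm_nonneg _).trans (hAc 0 (P.nonempty_of_neZero).some)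
      have h := S.integral_mul_norm_pow_le ξ 0 hj0 hjj (g := fun ω => g ω * ‖A j ω‖ ^ 2)
        (hgj.mul ((hA j).norm.pow 2)) (cg := cg * c ^ 2)
        (fun ω => by
          rw [abs_mul, abs_of_nonneg (sq_nonneg ‖A j ω‖)]
          exact mul_le_mul (hgc ω) (pow_le_pow_left₀ (norm_nonneg _) (hAc j ω) 2) (sq_nonneg _)
            ((abs_nonneg _).trans (hgc ω)))
        (fun ω => mul_nonneg (hg0 ω) (sq_nonneg _))
      simp only [zero_add, mul_one, pow_one] at h
      refine le_trans (integral_mono i3 h.1 fun ω => ?_) h.2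
      have : ‖A j ω (S.mg ξ (τ (j + 1)) ω - S.mg ξ (τ j) ω)‖ ^ 2
          ≤ ‖A j ω‖ ^ 2 * ‖S.mg ξ (τ (j + 1)) ω - S.mg ξ (τ j) ω‖ ^ 2 := by
        rw [← mul_pow]
        exact pow_le_pow_left₀ (norm_nonneg _) ((A j ω).le_opNorm _) 2
      simp only [mul_assoc]
      exact mul_le_mul_of_nonneg_left this (hg0 ω)
    have e2 : ∫ ω, g ω * ‖S.isum ξ τ A (j + 1) ω‖ ^ 2 ∂P
        = ∫ ω, g ω * ‖S.isum ξ τ A j ω‖ ^ 2 ∂P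
          + ∫ ω, g ω * ‖A j ω (S.mg ξ (τ (j + 1)) ω - S.mg ξ (τ j) ω)‖ ^ 2 ∂P := by
      simp only [e]
      rw [integral_add (by exact i12) i3, integral_add i1 i2', integral_const_mul, hcross]
      ring
    rw [e2]
    exact add_le_add ih hb

end PathSDE

lemma sum_range_mul_refine {E F : Type*} [AddCommGroup E] [AddCommGroup F] (G : ℕ → E)
    (f : ℕ → E →+ F) (m : ℕ) {l : ℕ} (hl : 0 < l) :
    ∑ i ∈ Finset.range m, f i (G ((i + 1) * l) - G (i * l))
      = ∑ k ∈ Finset.range (m * l), f (k / l) (G (k + 1) - G k) := by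
  induction m with
  | zero => simp
  | succ m ih =>
    rw [Finset.sum_range_succ, ih, Nat.succ_mul, Finset.sum_range_add]
    congr 1
    have : ∀ k ∈ Finset.range l, f ((m * l + k) / l) (G (m * l + k + 1) - G (m * l + k))
        = f m (G (m * l + (k + 1)) - G (m * l + k)) := fun k hk => by
      rw [mul_comm m l, Nat.mul_add_div hl, Nat.div_eq_of_lt (Finset.mem_range.1 hk), add_zero]
      rfl
    rw [Finset.sum_congr rfl this, ← map_sum, Finset.sum_range_sub fun k => G (m * l + k)]
    simp

lemma unifPt_mul (s t : ℝ) (m : ℕ) {l : ℕ} (hl : 0 < l) (i : ℕ) :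
    unifPt s t (m * l) (i * l) = unifPt s t m i := by
  have : (l : ℝ) ≠ 0 := by positivity
  simp only [unifPt, Nat.cast_mul]
  rw [mul_div_mul_right _ _ this]

namespace PathSDE

variable (S : PathSDE d r₀ Ω P) (ξ : Seg d r₀)

lemma norm_σinv_sub_le (η ζ : Seg d r₀) :
    ‖S.σinv η - S.σinv ζ‖ ≤ S.bd ^ 2 * S.lipσ * min 1 (dist η ζ) := by
  have e : S.σinv η - S.σinv ζ = (S.σinv η).comp ((S.σ ζ - S.σ η).comp (S.σinv ζ)) := by
    rw [ContinuousLinearMap.sub_comp, ContinuousLinearMap.comp_sub, (S.hσinv ζ).1,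
      ← ContinuousLinearMap.comp_assoc, (S.hσinv η).2]
    rfl
  rw [e]
  have hb := S.one_le_bd
  calc _ ≤ ‖S.σinv η‖ * (‖S.σ ζ - S.σ η‖ * ‖S.σinv ζ‖) :=
        (ContinuousLinearMap.opNorm_comp_le _ _).trans (mul_le_mul_of_nonneg_left
          (ContinuousLinearMap.opNorm_comp_le _ _) (norm_nonneg _))
    _ ≤ S.bd * ((S.lipσ * min 1 (dist ζ η)) * S.bd) := by
        have h1 := S.norm_σinv_le η
        have h2 := S.norm_σinv_le ζ
        have h3 := S.norm_σ_sub_le_lipσ ζ η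
        have h4 : 0 ≤ S.lipσ * min 1 (dist ζ η) := (norm_nonneg _).trans h3
        gcongr
    _ = _ := by rw [dist_comm]; ring

/-- Coefficients of the Riemann sum approximating `∫ σ⁻¹(X) dM`. -/
def σinvAt (S : PathSDE d r₀ Ω P) (ξ : Seg d r₀) (τ : ℕ → ℝ) (i : ℕ) (ω : Ω) :
    EucSp d →L[ℝ] EucSp d := S.σinv (S.seg ξ (τ i) ω)

lemma stronglyMeasurable_seg_of_nonneg {t : ℝ} (ht : 0 ≤ t) :
    StronglyMeasurable[S.ℱ t] (S.seg ξ t) := by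
  have := S.stronglyMeasurable_seg ξ t
  rwa [max_eq_left ht] at this

/-- Riemann sum for the driving noise on `[s, t]` (not normalised). -/
def noiseSum (S : PathSDE d r₀ Ω P) (ξ : Seg d r₀) (s t : ℝ) (m : ℕ) : Ω → EucSp d :=
  S.isum ξ (unifPt s t m) (S.σinvAt ξ (unifPt s t m)) m

variable {s t T : ℝ}

lemma stronglyMeasurable_σinvAt (hs : 0 ≤ s) (hst : s ≤ t) (m i : ℕ) :
    StronglyMeasurable[S.ℱ (unifPt s t m i)] (S.σinvAt ξ (unifPt s t m) i) :=
  S.continuous_σinv.comp_stronglyMeasurable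
    (S.stronglyMeasurable_seg_of_nonneg ξ (hs.trans (le_unifPt hst m i)))

lemma stronglyMeasurable_noiseSum (hs : 0 ≤ s) (hst : s ≤ t) {m : ℕ} (hm : m ≠ 0) :
    StronglyMeasurable[S.ℱ t] (S.noiseSum ξ s t m) := by
  have := S.stronglyMeasurable_isum ξ (unifPt_mono hst m) (S.stronglyMeasurable_σinvAt ξ hs hst m) m
  rwa [unifPt_self s t hm] at this

lemma memLp_noiseSum (hs : 0 ≤ s) (hst : s ≤ t) (m : ℕ) : MemLp (S.noiseSum ξ s t m) 2 P :=
  S.memLp_isum ξ (unifPt_mono hst m) (by rwa [unifPt_zero])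
    (S.stronglyMeasurable_σinvAt ξ hs hst m) (fun _ _ => S.norm_σinv_le _) m

lemma noiseSum_sub_eq (m : ℕ) {l : ℕ} (hl : 0 < l) (ω : Ω) :
    S.noiseSum ξ s t m ω - S.noiseSum ξ s t (m * l) ω
      = S.isum ξ (unifPt s t (m * l)) (fun k ω => S.σinvAt ξ (unifPt s t m) (k / l) ω
          - S.σinvAt ξ (unifPt s t (m * l)) k ω) (m * l) ω := by
  have := sum_range_mul_refine (fun k => S.mg ξ (unifPt s t (m * l) k) ω)
    (fun i => (S.σinvAt ξ (unifPt s t m) i ω).toLinearMap.toAddMonoidHom) m hl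
  simp only [unifPt_mul s t m hl] at this
  simp only [noiseSum, isum, _root_.sub_apply, Finset.sum_sub_distrib]
  rw [sub_left_inj]
  exact this

/-- Refining the partition changes the Riemann sums by the modulus of continuity. -/
lemma integral_norm_noiseSum_sub_sq_le (hs : 0 ≤ s) (hst : s ≤ t) (htT : t ≤ T) {m l : ℕ}
    (hm : 0 < m) (hl : 0 < l) :
    ∫ ω, ‖S.noiseSum ξ s t m ω - S.noiseSum ξ s t (m * l) ω‖ ^ 2 ∂P
      ≤ S.momC 0 * (t - s) * ((S.bd ^ 2 * S.lipσ) ^ 2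
        * ∫ ω, modulus (S.seg ξ) T ((t - s) / m) ω ∂P) := by
  have := S.hP
  have hml : 0 < m * l := Nat.mul_pos hm hl
  have hdiv : ∀ k, unifPt s t m (k / l) ≤ unifPt s t (m * l) k := fun k => by
    rw [← unifPt_mul s t m hl]
    exact unifPt_mono hst _ (Nat.div_mul_le_self k l)
  have hdiff : ∀ k, unifPt s t (m * l) k - unifPt s t m (k / l) ≤ (t - s) / m := fun k => by
    rw [← unifPt_succ_sub s t m (k / l)]
    refine sub_le_sub_right ?_ _
    rw [← unifPt_mul s t m hl (k / l + 1)]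
    exact unifPt_mono hst _ (Nat.lt_div_mul_add hl |>.le.trans (by rw [Nat.succ_mul]))
  have hA : ∀ k, StronglyMeasurable[S.ℱ (unifPt s t (m * l) k)] fun ω =>
      S.σinvAt ξ (unifPt s t m) (k / l) ω - S.σinvAt ξ (unifPt s t (m * l)) k ω := fun k =>
    ((S.stronglyMeasurable_σinvAt ξ hs hst m (k / l)).mono (S.ℱ.mono (hdiv k))).sub
      (S.stronglyMeasurable_σinvAt ξ hs hst (m * l) k)
  have hAc : ∀ k ω, ‖S.σinvAt ξ (unifPt s t m) (k / l) ω - S.σinvAt ξ (unifPt s t (m * l)) k ω‖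
      ≤ 2 * S.bd := fun k ω => by
    refine (norm_sub_le _ _).trans ?_
    have h1 := S.norm_σinv_le (S.seg ξ (unifPt s t m (k / l)) ω)
    have h2 := S.norm_σinv_le (S.seg ξ (unifPt s t (m * l) k) ω)
    simp only [σinvAt]
    linarith
  have h := S.integral_mul_norm_isum_sq_le ξ (unifPt_mono hst (m * l)) (by rwa [unifPt_zero]) hA hAc
    (g := fun _ => 1) stronglyMeasurable_const (cg := 1) (fun _ => by simp) (fun _ => zero_le_one)
    (m * l)
  simp only [one_mul] at h
  simp only [S.noiseSum_sub_eq ξ m hl]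
  refine h.trans ?_
  have hmod := integrable_modulus (P := P) (S.continuous_seg ξ) (S.stronglyMeasurable_seg' ξ) T
    ((t - s) / m)
  calc _ ≤ ∑ k ∈ Finset.range (m * l), S.momC 0 * ((t - s) / (m * l : ℕ)) *
        ((S.bd ^ 2 * S.lipσ) ^ 2 * ∫ ω, modulus (S.seg ξ) T ((t - s) / m) ω ∂P) := by
        refine Finset.sum_le_sum fun k hk => ?_
        rw [unifPt_succ_sub]
        refine mul_le_mul_of_nonneg_left ?_
          (mul_nonneg (S.momC_nonneg 0) (div_nonneg (sub_nonneg.2 hst) (Nat.cast_nonneg _)))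
        rw [← integral_const_mul]
        have hkml := (Finset.mem_range.1 hk).le
        refine integral_mono ?_ (hmod.const_mul _) fun ω => ?_
        · exact Integrable.of_bound (((hA k).mono (S.ℱ.le _)).norm.pow 2).aestronglyMeasurable
            ((2 * S.bd) ^ 2) (ae_of_all _ fun ω => by
              rw [Real.norm_of_nonneg (sq_nonneg _)]
              exact pow_le_pow_left₀ (norm_nonneg _) (hAc k ω) 2)
        · have hb := S.norm_σinv_sub_le (S.seg ξ (unifPt s t m (k / l)) ω)
            (S.seg ξ (unifPt s t (m * l) k) ω)
          have h2 := min_dist_le_modulus (Z := S.seg ξ) (T := T) (τ := (t - s) / m)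
            (s := unifPt s t m (k / l)) (t := unifPt s t (m * l) k)
            ⟨hs.trans (le_unifPt hst _ _), (hdiv k).trans ((unifPt_le hst hkml hml.ne').trans htT)⟩
            ⟨hs.trans (le_unifPt hst _ _), (unifPt_le hst hkml hml.ne').trans htT⟩
            (by rw [abs_sub_comm, abs_of_nonneg (sub_nonneg.2 (hdiv k))]; exact hdiff k) ω
          set q := min 1 (dist (S.seg ξ (unifPt s t m (k / l)) ω) (S.seg ξ (unifPt s t (m * l) k) ω))
          have hq0 : 0 ≤ q := le_min zero_le_one dist_nonneg
          have hq1 : q ≤ 1 := min_le_left _ _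
          calc _ ≤ (S.bd ^ 2 * S.lipσ * q) ^ 2 := pow_le_pow_left₀ (norm_nonneg _) hb 2
            _ = (S.bd ^ 2 * S.lipσ) ^ 2 * (q * q) := by ring
            _ ≤ _ := mul_le_mul_of_nonneg_left ((mul_le_of_le_one_left hq0 hq1).trans h2)
              (sq_nonneg _)
    _ = _ := by
        rw [Finset.sum_const, Finset.card_range, nsmul_eq_mul]
        have : ((m * l : ℕ) : ℝ) ≠ 0 := by positivity
        field_simp

end PathSDE

/-- Completeness of `L²`, in terms of integrals. -/
lemma MeasureTheory.exists_tendsto_integral_norm_sub_sq {Ω E : Type*} {mΩ : MeasurableSpace Ω}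
    {P : Measure Ω} [NormedAddCommGroup E] [InnerProductSpace ℝ E] [CompleteSpace E]
    {f : ℕ → Ω → E} (hf2 : ∀ n, MemLp (f n) 2 P) {b : ℕ → ℝ} (hb : Tendsto b atTop (𝓝 0))
    (h : ∀ n k, n ≤ k → ∫ ω, ‖f n ω - f k ω‖ ^ 2 ∂P ≤ b n) :
    ∃ z : Ω → E, StronglyMeasurable z ∧ MemLp z 2 P ∧
      Tendsto (fun n => ∫ ω, ‖f n ω - z ω‖ ^ 2 ∂P) atTop (𝓝 0) := by
  have key : ∀ u : Lp E 2 P, ‖u‖ ^ 2 = ∫ ω, ‖u ω‖ ^ 2 ∂P := fun u => by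
    rw [← real_inner_self_eq_norm_sq, L2.inner_def]
    simp
  have hd : ∀ n k, n ≤ k → dist ((hf2 n).toLp (f n)) ((hf2 k).toLp (f k)) ≤ √(b n) :=
    fun n k hnk => by
    rw [dist_eq_norm]
    refine Real.le_sqrt_of_sq_le (le_trans (le_of_eq ?_) (h n k hnk))
    rw [key]
    refine integral_congr_ae ?_
    filter_upwards [Lp.coeFn_sub ((hf2 n).toLp (f n)) ((hf2 k).toLp (f k)), (hf2 n).coeFn_toLp,
      (hf2 k).coeFn_toLp] with ω h1 h2 h3
    rw [h1, Pi.sub_apply, h2, h3]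
  have hs : Tendsto (fun n => √(b n)) atTop (𝓝 0) := by
    simpa using hb.sqrt
  have hC := cauchySeq_of_le_tendsto_0' _ hd hs
  obtain ⟨L, hL⟩ := cauchySeq_tendsto_of_complete hC
  refine ⟨L, Lp.stronglyMeasurable L, Lp.memLp L, ?_⟩
  have h0 := (tendsto_iff_norm_sub_tendsto_zero.1 hL).pow 2
  rw [zero_pow two_ne_zero] at h0
  refine h0.congr fun n => ?_
  rw [key]
  refine integral_congr_ae ?_
  filter_upwards [Lp.coeFn_sub ((hf2 n).toLp (f n)) L, (hf2 n).coeFn_toLp] with ω h1 h2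
  rw [h1, Pi.sub_apply, h2]

namespace PathSDE

variable (S : PathSDE d r₀ Ω P) (ξ : Seg d r₀) {s t : ℝ}

lemma tendsto_mesh_two_pow (s t : ℝ) : Tendsto (fun n : ℕ => (t - s) / (2 ^ n : ℕ)) atTop (𝓝 0) :=
  (tendsto_mesh s t).comp (tendsto_pow_atTop_atTop_of_one_lt one_lt_two)

/-- The stochastic integral `∫ σ⁻¹(X) dM` over `[s, t]` as limit of Riemann sums. -/
theorem exists_noise_limit (hs : 0 ≤ s) (hst : s ≤ t) : ∃ I : Ω → EucSp d,
    StronglyMeasurable[S.ℱ t] I ∧ MemLp I 2 P ∧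
    Tendsto (fun n : ℕ => ∫ ω, ‖S.noiseSum ξ s t (2 ^ n) ω - I ω‖ ^ 2 ∂P) atTop (𝓝 0) := by
  have := S.hP
  have hm := S.ℱ.le t
  have hf : ∀ n : ℕ, StronglyMeasurable[S.ℱ t] (S.noiseSum ξ s t (2 ^ n)) := fun n =>
    S.stronglyMeasurable_noiseSum ξ hs hst (by positivity)
  have hlim : Tendsto (fun n : ℕ => S.momC 0 * (t - s) * ((S.bd ^ 2 * S.lipσ) ^ 2
        * ∫ ω, modulus (S.seg ξ) t ((t - s) / (2 ^ n : ℕ)) ω ∂P)) atTop (𝓝 0) := by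
    simpa using ((tendsto_integral_modulus (P := P) (S.continuous_seg ξ)
      (S.stronglyMeasurable_seg' ξ) t (tendsto_mesh_two_pow s t)).const_mul
        ((S.bd ^ 2 * S.lipσ) ^ 2)).const_mul (S.momC 0 * (t - s))
  obtain ⟨I, h1, h2, h3⟩ := @exists_tendsto_integral_norm_sub_sq Ω (EucSp d) (S.ℱ t) (P.trim hm)
    _ _ _ (fun n => S.noiseSum ξ s t (2 ^ n))
    (fun n => by
      refine ⟨(hf n).aestronglyMeasurable, ?_⟩
      rw [eLpNorm_trim hm (hf n)]
      exact (S.memLp_noiseSum ξ hs hst _).2) _ hlim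
    (fun n k hnk => by
      refine le_trans (le_of_eq (integral_trim hm (((hf n).sub (hf k)).norm.pow 2)).symm) ?_
      obtain ⟨j, rfl⟩ := Nat.exists_eq_add_of_le hnk
      rw [pow_add]
      exact S.integral_norm_noiseSum_sub_sq_le ξ hs hst le_rfl (by positivity) (by positivity))
  refine ⟨I, h1, memLp_of_memLp_trim hm h2, h3.congr fun n => ?_⟩
  exact (integral_trim hm (((hf n).sub h1).norm.pow 2)).symm

end PathSDE

namespace PathSDE

variable (S : PathSDE d r₀ Ω P) (ξ : Seg d r₀) {s t T : ℝ}

lemma inner_σinvAt_eq (hst : s < t) {m : ℕ} (hm : m ≠ 0) (i : ℕ) (u : EucSp d) (ω : Ω) :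
    ⟪u, (√(t - s))⁻¹ • S.σinvAt ξ (unifPt s t m) i ω
      (S.mg ξ (unifPt s t m (i + 1)) ω - S.mg ξ (unifPt s t m i) ω)⟫
      = ⟪(√(m : ℝ))⁻¹ • u, S.nmg ξ (unifPt s t m i) (unifPt s t m (i + 1)) ω⟫ := by
  have h1 : √(t - s) ≠ 0 := (Real.sqrt_pos.2 (sub_pos.2 hst)).ne'
  have h2 : √(m : ℝ) ≠ 0 := (Real.sqrt_pos.2 (by positivity)).ne'
  rw [nmg, unifPt_succ_sub, real_inner_smul_left, real_inner_smul_right, real_inner_smul_right,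
    Real.sqrt_div (sub_pos.2 hst).le, σinvAt]
  field_simp

/-- Characteristic functions of the Riemann sums. -/
lemma abs_integral_cos_isum_le (hs : 0 ≤ s) (hst : s < t) {m : ℕ} (hm : m ≠ 0)
    {g : Ω → ℝ} (hg : StronglyMeasurable[S.ℱ s] g) {cg : ℝ} (hgc : ∀ ω, |g ω| ≤ cg)
    (u : EucSp d) (φ : ℝ) {j : ℕ} (hj : j ≤ m) :
    |∫ ω, g ω * Real.cos (φ + ⟪u, (√(t - s))⁻¹ •
        S.isum ξ (unifPt s t m) (S.σinvAt ξ (unifPt s t m)) j ω⟫) ∂P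
      - Real.exp (-(‖u‖ ^ 2 / m / 2)) ^ j * (Real.cos φ * ∫ ω, g ω ∂P)|
      ≤ j * (2 * (S.bd ^ 3 * S.lipσ * (‖u‖ ^ 2 / m) *
          (cg * ∫ ω, modulus (S.seg ξ) t ((t - s) / m) ω ∂P))) := by
  have := S.hP
  have hm0 : (0:ℝ) < m := by positivity
  have hmod := integrable_modulus (P := P) (S.continuous_seg ξ) (S.stronglyMeasurable_seg' ξ) t
    ((t - s) / m)
  induction j with
  | zero =>
    simp only [isum, Finset.range_zero, Finset.sum_empty, smul_zero, inner_zero_right, add_zero,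
      pow_zero, one_mul, Nat.cast_zero, zero_mul]
    rw [integral_mul_const, mul_comm, sub_self, abs_zero]
  | succ j ih =>
    have ih := ih (Nat.le_of_succ_le hj)
    set r : ℝ := Real.exp (-(‖u‖ ^ 2 / m / 2)) with hr
    have hr0 : 0 ≤ r := (Real.exp_pos _).le
    have hr1 : r ≤ 1 := Real.exp_le_one_iff.2 (by rw [neg_nonpos]; positivity)
    set τ := unifPt s t m with hτ
    have hτj : 0 ≤ τ j := hs.trans (le_unifPt hst.le m j)
    have hτs : s ≤ τ j := le_unifPt hst.le m j
    have hlt : τ j < τ (j + 1) := by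
      have := unifPt_succ_sub s t m j
      have h2 : 0 < (t - s) / m := div_pos (sub_pos.2 hst) hm0
      simp only [hτ]; linarith
    have hle : τ (j + 1) ≤ t := unifPt_le hst.le hj hm
    set a : Ω → ℝ := fun ω => φ + ⟪u, (√(t - s))⁻¹ • S.isum ξ τ (S.σinvAt ξ τ) j ω⟫ with ha
    set v : EucSp d := (√(m : ℝ))⁻¹ • u with hv
    have hvn : ‖v‖ ^ 2 = ‖u‖ ^ 2 / m := by
      rw [hv, norm_smul, mul_pow, norm_inv, inv_pow, Real.norm_of_nonneg (Real.sqrt_nonneg _),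
        Real.sq_sqrt hm0.le]
      field_simp
    have ham : StronglyMeasurable[S.ℱ (τ j)] a := by
      have h1 := (S.stronglyMeasurable_isum ξ (unifPt_mono hst.le m)
        (S.stronglyMeasurable_σinvAt ξ hs hst.le m) j).const_smul (√(t - s))⁻¹
      exact stronglyMeasurable_const.add ((innerSL ℝ u).continuous.comp_stronglyMeasurable h1)
    have hgj := hg.mono (S.ℱ.mono hτs)
    have hg1 : StronglyMeasurable[S.ℱ (τ j)] fun ω => g ω * Real.cos (a ω) :=
      hgj.mul (Real.continuous_cos.comp_stronglyMeasurable ham)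
    have hg2 : StronglyMeasurable[S.ℱ (τ j)] fun ω => g ω * Real.sin (a ω) :=
      hgj.mul (Real.continuous_sin.comp_stronglyMeasurable ham)
    have hg1c : ∀ ω, |g ω * Real.cos (a ω)| ≤ cg := fun ω => by
      rw [abs_mul]
      exact (mul_le_of_le_one_right (abs_nonneg _) (Real.abs_cos_le_one _)).trans (hgc ω)
    have hg2c : ∀ ω, |g ω * Real.sin (a ω)| ≤ cg := fun ω => by
      rw [abs_mul]
      exact (mul_le_of_le_one_right (abs_nonneg _) (Real.abs_sin_le_one _)).trans (hgc ω)
    have hcos := S.abs_integral_trig_nmg_le ξ hτj hlt hle (unifPt_succ_sub s t m j).le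
      (f := Real.cos) (f1 := fun x => -Real.sin x) (fun x => Real.hasDerivAt_cos x)
      (fun x => (Real.hasDerivAt_sin x).neg) Real.abs_cos_le_one
      (fun x => by rw [abs_neg]; exact Real.abs_sin_le_one x) hg1 hg1c v
    have hsin := S.abs_integral_trig_nmg_le ξ hτj hlt hle (unifPt_succ_sub s t m j).le
      (f := Real.sin) (f1 := Real.cos) (fun x => Real.hasDerivAt_sin x)
      (fun x => Real.hasDerivAt_cos x) Real.abs_sin_le_one Real.abs_cos_le_one hg2 hg2c v
    rw [Real.cos_zero, mul_one, hvn] at hcos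
    rw [Real.sin_zero, mul_zero, zero_mul, sub_zero, hvn] at hsin
    rw [← hr] at hcos
    set D : ℝ := S.bd ^ 3 * S.lipσ * (‖u‖ ^ 2 / m) *
      (cg * ∫ ω, modulus (S.seg ξ) t ((t - s) / m) ω ∂P) with hD
    have hK : 0 ≤ S.bd ^ 3 * S.lipσ * (‖u‖ ^ 2 / m) := by
      have := S.one_le_bd
      have := S.lipσ_nonneg
      positivity
    have hbound : ∀ g' : Ω → ℝ, (∀ ω, |g' ω| ≤ cg) → StronglyMeasurable[S.ℱ (τ j)] g' →
        S.bd ^ 3 * S.lipσ * (‖u‖ ^ 2 / m) * ∫ ω, |g' ω| * modulus (S.seg ξ) t ((t - s) / m) ω ∂P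
          ≤ D := fun g' hg' hgm' => by
      refine mul_le_mul_of_nonneg_left ?_ hK
      rw [← integral_const_mul]
      refine integral_mono ?_ (hmod.const_mul _) fun ω =>
        mul_le_mul_of_nonneg_right (hg' ω) (modulus_nonneg ω)
      exact integrable_bdd_mul' (by simpa using (hgm'.mono (S.ℱ.le _)).norm) (c := cg)
        (fun ω => by rw [abs_abs]; exact hg' ω) hmod
    have hcos' := hcos.trans (hbound _ hg1c hg1)
    have hsin' := hsin.trans (hbound _ hg2c hg2)
    have nm : StronglyMeasurable fun ω => ⟪v, S.nmg ξ (τ j) (τ (j + 1)) ω⟫ := by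
      have h1 := ((S.stronglyMeasurable_σinvAt ξ hs hst.le m j).mono (S.ℱ.le _)).clm_apply'
        ((S.stronglyMeasurable_mg_sub ξ hlt.le).mono (S.ℱ.le _))
      exact (innerSL ℝ v).continuous.comp_stronglyMeasurable
        (h1.const_smul (√(τ (j + 1) - τ j))⁻¹)
    have hone : ∀ (f : ℝ → ℝ), Continuous f → (∀ x, |f x| ≤ 1) →
        ∀ g' : Ω → ℝ, (∀ ω, |g' ω| ≤ cg) → StronglyMeasurable[S.ℱ (τ j)] g' →
        Integrable (fun ω => g' ω * f ⟪v, S.nmg ξ (τ j) (τ (j + 1)) ω⟫) P :=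
      fun f hf hf1 g' hg' hgm' => by
      refine integrable_bdd_mul' (hgm'.mono (S.ℱ.le _)) hg' ?_
      exact Integrable.of_bound (hf.comp_stronglyMeasurable nm).aestronglyMeasurable 1
        (ae_of_all _ fun ω => hf1 _)
    have i1 := hone _ Real.continuous_cos Real.abs_cos_le_one _ hg1c hg1
    have i2 := hone _ Real.continuous_sin Real.abs_sin_le_one _ hg2c hg2
    have e : ∀ ω, g ω * Real.cos (φ + ⟪u, (√(t - s))⁻¹ • S.isum ξ τ (S.σinvAt ξ τ) (j + 1) ω⟫)
        = g ω * Real.cos (a ω) * Real.cos ⟪v, S.nmg ξ (τ j) (τ (j + 1)) ω⟫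
          - g ω * Real.sin (a ω) * Real.sin ⟪v, S.nmg ξ (τ j) (τ (j + 1)) ω⟫ := fun ω => by
      rw [isum_succ, smul_add, inner_add_right, ← add_assoc, S.inner_σinvAt_eq ξ hst hm,
        Real.cos_add]
      ring
    simp only [e]
    rw [integral_sub i1 i2]
    push_cast
    rw [abs_le] at hcos' hsin' ih ⊢
    have ih1 := mul_le_mul_of_nonneg_left ih.1 hr0
    have ih2 := mul_le_mul_of_nonneg_left ih.2 hr0
    have hD0 : 0 ≤ D := by linarith [hsin'.1, hsin'.2]
    have hjD : r * (j * (2 * D)) ≤ j * (2 * D) := mul_le_of_le_one_left (by positivity) hr1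
    rw [pow_succ']
    constructor <;> linarith [hcos'.1, hcos'.2, hsin'.1, hsin'.2]

end PathSDE

section L2

variable {Ω E : Type*} {mΩ : MeasurableSpace Ω} {P : Measure Ω} [IsProbabilityMeasure P]
  [NormedAddCommGroup E]

lemma MeasureTheory.MemLp.integral_norm_le_sqrt {f : Ω → E} (hf : MemLp f 2 P) :
    ∫ ω, ‖f ω‖ ∂P ≤ √(∫ ω, ‖f ω‖ ^ 2 ∂P) := by
  refine Real.le_sqrt_of_sq_le ?_
  have h := variance_nonneg (fun ω => ‖f ω‖) P
  rw [variance_eq_sub hf.norm] at h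
  simpa using h

lemma MeasureTheory.tendsto_integral_norm_of_sq {f : ℕ → Ω → E} (hf : ∀ n, MemLp (f n) 2 P)
    (h : Tendsto (fun n => ∫ ω, ‖f n ω‖ ^ 2 ∂P) atTop (𝓝 0)) :
    Tendsto (fun n => ∫ ω, ‖f n ω‖ ∂P) atTop (𝓝 0) := by
  refine squeeze_zero (fun n => integral_nonneg fun ω => norm_nonneg _)
    (fun n => (hf n).integral_norm_le_sqrt) ?_
  simpa using h.sqrt

/-- Weighted second moments pass to the limit under `L²` convergence. -/
lemma MeasureTheory.integral_mul_norm_sq_le_of_tendsto {f : ℕ → Ω → E} {F : Ω → E}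
    (hf : ∀ n, MemLp (f n) 2 P) (hF : MemLp F 2 P)
    (h : Tendsto (fun n => ∫ ω, ‖f n ω - F ω‖ ^ 2 ∂P) atTop (𝓝 0)) {g : Ω → ℝ}
    (hg : StronglyMeasurable g) {cg : ℝ} (hgc : ∀ ω, |g ω| ≤ cg) (hg0 : ∀ ω, 0 ≤ g ω) {B : ℝ}
    (hB : ∀ n, ∫ ω, g ω * ‖f n ω‖ ^ 2 ∂P ≤ B) : ∫ ω, g ω * ‖F ω‖ ^ 2 ∂P ≤ B := by
  have i1 : ∀ n, Integrable (fun ω => g ω * ‖f n ω‖ ^ 2) P := fun n =>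
    integrable_bdd_mul' hg hgc ((hf n).integrable_norm_pow (by norm_num))
  have i2 : ∀ n, Integrable (fun ω => ‖f n ω - F ω‖ ^ 2) P := fun n =>
    ((hf n).sub hF).integrable_norm_pow (by norm_num)
  have iF : Integrable (fun ω => g ω * ‖F ω‖ ^ 2) P :=
    integrable_bdd_mul' hg hgc (hF.integrable_norm_pow (by norm_num))
  have step : ∀ ε : ℝ, 0 < ε → ∫ ω, g ω * ‖F ω‖ ^ 2 ∂P ≤ (1 + ε) * B := fun ε hε => by
    have hl : Tendsto (fun n => (1 + ε) * B + (1 + 1 / ε) * cg * ∫ ω, ‖f n ω - F ω‖ ^ 2 ∂P) atTop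
        (𝓝 ((1 + ε) * B + (1 + 1 / ε) * cg * 0)) := (h.const_mul _).const_add _
    rw [mul_zero, add_zero] at hl
    refine ge_of_tendsto' hl fun n => ?_
    have hle : ∫ ω, g ω * ‖F ω‖ ^ 2 ∂P ≤ ∫ ω, ((1 + ε) * (g ω * ‖f n ω‖ ^ 2)
        + (1 + 1 / ε) * cg * ‖f n ω - F ω‖ ^ 2) ∂P := by
      refine integral_mono iF (((i1 n).const_mul _).add ((i2 n).const_mul _)) fun ω => ?_
      have h1 : ‖F ω‖ ≤ ‖f n ω‖ + ‖f n ω - F ω‖ := by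
        have := norm_sub_le (f n ω) (f n ω - F ω)
        rwa [sub_sub_cancel] at this
      set x := ‖f n ω‖
      set y := ‖f n ω - F ω‖
      have h2 : ‖F ω‖ ^ 2 ≤ (1 + ε) * x ^ 2 + (1 + 1 / ε) * y ^ 2 := by
        have h3 : ‖F ω‖ ^ 2 ≤ (x + y) ^ 2 := pow_le_pow_left₀ (norm_nonneg _) h1 2
        have h4 : 0 ≤ (ε * x - y) ^ 2 / ε := div_nonneg (sq_nonneg _) hε.le
        have h5 : (ε * x - y) ^ 2 / ε = ε * x ^ 2 - 2 * x * y + 1 / ε * y ^ 2 := by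
          field_simp
          ring
        linarith
      have h6 := mul_le_mul_of_nonneg_left h2 (hg0 ω)
      have h7 : g ω * ((1 + 1 / ε) * y ^ 2) ≤ cg * ((1 + 1 / ε) * y ^ 2) :=
        mul_le_mul_of_nonneg_right ((le_abs_self _).trans (hgc ω)) (by positivity)
      show g ω * ‖F ω‖ ^ 2 ≤ (1 + ε) * (g ω * x ^ 2) + (1 + 1 / ε) * cg * y ^ 2
      linarith
    rw [integral_add ((i1 n).const_mul _) ((i2 n).const_mul _), integral_const_mul,
      integral_const_mul] at hle
    have := mul_le_mul_of_nonneg_left (hB n) (by positivity : 0 ≤ 1 + ε)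
    linarith
  have hl : Tendsto (fun ε : ℝ => (1 + ε) * B) (𝓝[>] 0) (𝓝 ((1 + 0) * B)) :=
    ((tendsto_id.const_add 1).mul_const B).mono_left nhdsWithin_le_nhds
  rw [add_zero, one_mul] at hl
  exact ge_of_tendsto hl (by filter_upwards [self_mem_nhdsWithin] with ε hε using step ε hε)

end L2

namespace PathSDE

variable (S : PathSDE d r₀ Ω P) (ξ : Seg d r₀) {s t : ℝ}

lemma σ_noiseSum_sub_eq (x : Ω → Seg d r₀) {m : ℕ} (hm : m ≠ 0) (ω : Ω) :
    S.σ (x ω) (S.noiseSum ξ s t m ω) - (S.mg ξ t ω - S.mg ξ s ω)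
      = S.isum ξ (unifPt s t m) (fun i ω => (S.σ (x ω) - S.σ (S.seg ξ (unifPt s t m i) ω)).comp
          (S.σinvAt ξ (unifPt s t m) i ω)) m ω := by
  have h : S.mg ξ t ω - S.mg ξ s ω = ∑ i ∈ Finset.range m,
      (S.mg ξ (unifPt s t m (i + 1)) ω - S.mg ξ (unifPt s t m i) ω) := by
    rw [Finset.sum_range_sub fun i => S.mg ξ (unifPt s t m i) ω, unifPt_self s t hm, unifPt_zero]
  rw [h]
  simp only [noiseSum, isum, map_sum, ← Finset.sum_sub_distrib]
  refine Finset.sum_congr rfl fun i _ => ?_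
  rw [ContinuousLinearMap.comp_apply, _root_.sub_apply]
  congr 1
  exact (congrArg (fun L => L (S.mg ξ (unifPt s t m (i + 1)) ω - S.mg ξ (unifPt s t m i) ω))
    (S.hσinv (S.seg ξ (unifPt s t m i) ω)).1).symm

variable {x : Ω → Seg d r₀}

lemma stronglyMeasurable_σ_defect (hx : StronglyMeasurable[S.ℱ s] x) (hs : 0 ≤ s) (hst : s ≤ t)
    (m i : ℕ) : StronglyMeasurable[S.ℱ (unifPt s t m i)]
    fun ω => (S.σ (x ω) - S.σ (S.seg ξ (unifPt s t m i) ω)).comp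
          (S.σinvAt ξ (unifPt s t m) i ω) := by
  have h1 : StronglyMeasurable[S.ℱ (unifPt s t m i)] fun ω =>
      S.σ (x ω) - S.σ (S.seg ξ (unifPt s t m i) ω) :=
    (S.continuous_σ.comp_stronglyMeasurable (hx.mono (S.ℱ.mono (le_unifPt hst m i)))).sub
      (S.continuous_σ.comp_stronglyMeasurable
        (S.stronglyMeasurable_seg_of_nonneg ξ (hs.trans (le_unifPt hst m i))))
  exact (isBoundedBilinearMap_comp.continuous).comp_stronglyMeasurable
    (h1.prodMk (S.stronglyMeasurable_σinvAt ξ hs hst m i))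

lemma norm_σ_defect_le (τ : ℕ → ℝ) (i : ℕ) (ω : Ω) :
    ‖(S.σ (x ω) - S.σ (S.seg ξ (τ i) ω)).comp (S.σinvAt ξ τ i ω)‖
      ≤ S.lipσ * S.bd * min 1 (dist (x ω) (S.seg ξ (τ i) ω)) := by
  refine (ContinuousLinearMap.opNorm_comp_le _ _).trans ?_
  refine (mul_le_mul (S.norm_σ_sub_le_lipσ _ _) (S.norm_σinv_le _) (norm_nonneg _)
    (mul_nonneg S.lipσ_nonneg (le_min zero_le_one dist_nonneg))).trans_eq ?_
  ring

lemma norm_σ_defect_le_const (m i : ℕ) (ω : Ω) :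
    ‖(S.σ (x ω) - S.σ (S.seg ξ (unifPt s t m i) ω)).comp (S.σinvAt ξ (unifPt s t m) i ω)‖
      ≤ S.lipσ * S.bd :=
  (S.norm_σ_defect_le ξ _ i ω).trans (mul_le_of_le_one_right
    (mul_nonneg S.lipσ_nonneg (zero_le_one.trans S.one_le_bd)) (min_le_left _ _))

lemma integral_mul_norm_σ_noiseSum_sub_sq_le (hx : StronglyMeasurable[S.ℱ s] x) (hs : 0 ≤ s)
    (hst : s ≤ t) {T : ℝ} (htT : t ≤ T) {g : Ω → ℝ}
    (hg : StronglyMeasurable[S.ℱ s] g) {cg : ℝ} (hgc : ∀ ω, |g ω| ≤ cg) (hg0 : ∀ ω, 0 ≤ g ω)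
    {m : ℕ} (hm : m ≠ 0) :
    ∫ ω, g ω * ‖S.σ (x ω) (S.noiseSum ξ s t m ω) - (S.mg ξ t ω - S.mg ξ s ω)‖ ^ 2 ∂P
      ≤ S.momC 0 * (t - s) * (2 * (S.lipσ * S.bd) ^ 2
        * ∫ ω, g ω * (min 1 (dist (x ω) (S.seg ξ s ω)) ^ 2
          + modulus (S.seg ξ) T (t - s) ω) ∂P) := by
  have := S.hP
  have hA := S.stronglyMeasurable_σ_defect ξ hx hs hst m
  have hAc := S.norm_σ_defect_le_const ξ (x := x) (s := s) (t := t) m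
  have h := S.integral_mul_norm_isum_sq_le ξ (unifPt_mono hst m) (by rwa [unifPt_zero]) hA hAc
    (g := g) (by rwa [unifPt_zero]) hgc hg0 m
  simp only [S.σ_noiseSum_sub_eq ξ x hm]
  refine h.trans ?_
  have hmod := integrable_modulus (P := P) (S.continuous_seg ξ) (S.stronglyMeasurable_seg' ξ) T
    (t - s)
  have hg' := hg.mono (S.ℱ.le s)
  have hmin : Integrable (fun ω => min 1 (dist (x ω) (S.seg ξ s ω)) ^ 2) P := by
    refine Integrable.of_bound ?_ 1 (ae_of_all _ fun ω => ?_)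
    · exact ((stronglyMeasurable_const.inf ((hx.mono (S.ℱ.le s)).dist
        (S.stronglyMeasurable_seg' ξ s))).pow 2).aestronglyMeasurable
    · have h0 : 0 ≤ min 1 (dist (x ω) (S.seg ξ s ω)) := le_min zero_le_one dist_nonneg
      rw [Real.norm_of_nonneg (sq_nonneg _)]
      exact pow_le_one₀ h0 (min_le_left _ _)
  have hint := integrable_bdd_mul' hg' hgc (hmin.add hmod)
  calc _ ≤ ∑ i ∈ Finset.range m, S.momC 0 * ((t - s) / m) * (2 * (S.lipσ * S.bd) ^ 2
        * ∫ ω, g ω * (min 1 (dist (x ω) (S.seg ξ s ω)) ^ 2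
          + modulus (S.seg ξ) T (t - s) ω) ∂P) := by
        refine Finset.sum_le_sum fun i hi => ?_
        rw [unifPt_succ_sub]
        refine mul_le_mul_of_nonneg_left ?_
          (mul_nonneg (S.momC_nonneg 0) (div_nonneg (sub_nonneg.2 hst) (Nat.cast_nonneg _)))
        rw [← integral_const_mul]
        have him := (Finset.mem_range.1 hi).le
        refine integral_mono ?_ (hint.const_mul _) fun ω => ?_
        · refine integrable_bdd_mul' hg' hgc ?_
          exact Integrable.of_bound (((hA i).mono (S.ℱ.le _)).norm.pow 2).aestronglyMeasurable
            ((S.lipσ * S.bd) ^ 2) (ae_of_all _ fun ω => by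
              rw [Real.norm_of_nonneg (sq_nonneg _)]
              exact pow_le_pow_left₀ (norm_nonneg _) (hAc i ω) 2)
        · have hb := S.norm_σ_defect_le ξ (x := x) (unifPt s t m) i ω
          have h1 := le_unifPt hst m i
          have h3 := unifPt_le hst him hm
          have h2 := min_dist_le_modulus (Z := S.seg ξ) (T := T) (τ := t - s)
            (s := s) (t := unifPt s t m i) ⟨hs, hst.trans htT⟩ ⟨hs.trans h1, h3.trans htT⟩
            (by rw [abs_sub_comm, abs_of_nonneg (sub_nonneg.2 h1)]; linarith) ω
          have htri : min 1 (dist (x ω) (S.seg ξ (unifPt s t m i) ω))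
              ≤ min 1 (dist (x ω) (S.seg ξ s ω)) + modulus (S.seg ξ) T (t - s) ω := by
            have h4 := dist_triangle (x ω) (S.seg ξ s ω) (S.seg ξ (unifPt s t m i) ω)
            have h5 : (0:ℝ) ≤ dist (x ω) (S.seg ξ s ω) := dist_nonneg
            have h6 : (0:ℝ) ≤ dist (S.seg ξ s ω) (S.seg ξ (unifPt s t m i) ω) := dist_nonneg
            refine le_trans ?_ (add_le_add_right h2 _)
            rcases min_cases 1 (dist (x ω) (S.seg ξ s ω)) with h | h <;>
            rcases min_cases 1 (dist (S.seg ξ s ω) (S.seg ξ (unifPt s t m i) ω)) with h' | h' <;>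
            rcases min_cases 1 (dist (x ω) (S.seg ξ (unifPt s t m i) ω)) with h'' | h'' <;>
            linarith
          have hm0 := modulus_nonneg (Z := S.seg ξ) (T := T) (τ := t - s) ω
          have hm1 := modulus_le_one (Z := S.seg ξ) (T := T) (τ := t - s) ω
          set q := min 1 (dist (x ω) (S.seg ξ s ω))
          set μ := modulus (S.seg ξ) T (t - s) ω
          set K := S.lipσ * S.bd with hK
          have hK0 : 0 ≤ K := mul_nonneg S.lipσ_nonneg (zero_le_one.trans S.one_le_bd)
          have h7 : ‖(S.σ (x ω) - S.σ (S.seg ξ (unifPt s t m i) ω)).comp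
              (S.σinvAt ξ (unifPt s t m) i ω)‖ ^ 2 ≤ (K * (q + μ)) ^ 2 :=
            pow_le_pow_left₀ (norm_nonneg _) (hb.trans (mul_le_mul_of_nonneg_left htri hK0)) 2
          have h8 : (q + μ) ^ 2 ≤ 2 * (q ^ 2 + μ) := by nlinarith [sq_nonneg (q - μ)]
          have h9 := mul_le_mul_of_nonneg_left h8 (sq_nonneg K)
          have h10 : ‖(S.σ (x ω) - S.σ (S.seg ξ (unifPt s t m i) ω)).comp
              (S.σinvAt ξ (unifPt s t m) i ω)‖ ^ 2 ≤ 2 * K ^ 2 * (q ^ 2 + μ) := by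
            rw [mul_pow] at h7; linarith
          have := mul_le_mul_of_nonneg_left h10 (hg0 ω)
          show g ω * _ ≤ 2 * K ^ 2 * (g ω * (q ^ 2 + μ))
          linarith
    _ = _ := by
        rw [Finset.sum_const, Finset.card_range, nsmul_eq_mul]
        have : (m : ℝ) ≠ 0 := Nat.cast_ne_zero.2 hm
        field_simp

end PathSDE

namespace PathSDE

variable (S : PathSDE d r₀ Ω P) (ξ : Seg d r₀) {s t : ℝ}

lemma memLp_σ_apply {x : Ω → Seg d r₀} (hx : StronglyMeasurable x) {v : Ω → EucSp d}
    (hv : StronglyMeasurable v) (hv2 : MemLp v 2 P) : MemLp (fun ω => S.σ (x ω) (v ω)) 2 P :=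
  memLp_clm_apply (S.continuous_σ.comp_stronglyMeasurable hx) (fun _ => S.norm_σ_le _) hv hv2

/-- The Riemann sums, transported by a bounded coefficient, converge in `L²`. -/
lemma tendsto_integral_σ_noiseSum (x : Ω → Seg d r₀)
    (hs : 0 ≤ s) (hst : s ≤ t) {I : Ω → EucSp d} (hI2 : MemLp I 2 P)
    (h : Tendsto (fun n : ℕ => ∫ ω, ‖S.noiseSum ξ s t (2 ^ n) ω - I ω‖ ^ 2 ∂P) atTop (𝓝 0)) :
    Tendsto (fun n : ℕ => ∫ ω, ‖(S.σ (x ω) (S.noiseSum ξ s t (2 ^ n) ω)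
        - (S.mg ξ t ω - S.mg ξ s ω)) - (S.σ (x ω) (I ω) - (S.mg ξ t ω - S.mg ξ s ω))‖ ^ 2 ∂P)
      atTop (𝓝 0) := by
  have := S.hP
  have h' := h.const_mul (S.bd ^ 2)
  rw [mul_zero] at h'
  refine squeeze_zero (fun n => integral_nonneg fun ω => sq_nonneg _) (fun n => ?_) h'
  have hn := S.memLp_noiseSum (P := P) ξ hs hst (2 ^ n)
  have hnm := (S.stronglyMeasurable_noiseSum (P := P) ξ hs hst (m := 2 ^ n)
    (by positivity)).mono (S.ℱ.le t)
  rw [← integral_const_mul]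
  have i2 := ((hn.sub hI2).integrable_norm_pow (p := 2) (by norm_num)).const_mul (S.bd ^ 2)
  refine integral_mono_of_nonneg (ae_of_all _ fun ω => sq_nonneg _) i2 (ae_of_all _ fun ω => ?_)
  have e : (S.σ (x ω) (S.noiseSum ξ s t (2 ^ n) ω) - (S.mg ξ t ω - S.mg ξ s ω))
      - (S.σ (x ω) (I ω) - (S.mg ξ t ω - S.mg ξ s ω))
      = S.σ (x ω) (S.noiseSum ξ s t (2 ^ n) ω - I ω) := by rw [map_sub]; abel
  show ‖(S.σ (x ω) (S.noiseSum ξ s t (2 ^ n) ω) - (S.mg ξ t ω - S.mg ξ s ω))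
      - (S.σ (x ω) (I ω) - (S.mg ξ t ω - S.mg ξ s ω))‖ ^ 2
      ≤ S.bd ^ 2 * ‖S.noiseSum ξ s t (2 ^ n) ω - I ω‖ ^ 2
  rw [e, ← mul_pow]
  exact pow_le_pow_left₀ (norm_nonneg _) ((ContinuousLinearMap.le_opNorm _ _).trans
    (mul_le_mul_of_nonneg_right (S.norm_σ_le _) (norm_nonneg _))) 2

/-- Conditional characteristic function of the limiting noise. -/
lemma integral_mul_cos_noise (hs : 0 ≤ s) (hst : s < t) {I : Ω → EucSp d}
    (hI : StronglyMeasurable I) (hI2 : MemLp I 2 P)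
    (h : Tendsto (fun n : ℕ => ∫ ω, ‖S.noiseSum ξ s t (2 ^ n) ω - I ω‖ ^ 2 ∂P) atTop (𝓝 0))
    {g : Ω → ℝ} (hg : StronglyMeasurable[S.ℱ s] g) {cg : ℝ} (hgc : ∀ ω, |g ω| ≤ cg)
    (u : EucSp d) (φ : ℝ) :
    ∫ ω, g ω * Real.cos (φ + ⟪u, (√(t - s))⁻¹ • I ω⟫) ∂P
      = Real.exp (-(‖u‖ ^ 2 / 2)) * (Real.cos φ * ∫ ω, g ω ∂P) := by
  have := S.hP
  have hn := fun n : ℕ => S.memLp_noiseSum (P := P) ξ hs hst.le (2 ^ n)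
  have hnm := fun n : ℕ => (S.stronglyMeasurable_noiseSum (P := P) ξ hs hst.le (m := 2 ^ n)
    (by positivity)).mono (S.ℱ.le t)
  have h1 := tendsto_integral_norm_of_sq (fun n => (hn n).sub hI2) h
  set c := (√(t - s))⁻¹ with hc
  have hc0 : 0 ≤ c := by positivity
  have hg' := hg.mono (S.ℱ.le s)
  have hone : ∀ J : Ω → EucSp d, StronglyMeasurable J →
      Integrable (fun ω => g ω * Real.cos (φ + ⟪u, c • J ω⟫)) P := fun J hJ => by
    refine integrable_bdd_mul' hg' hgc ?_
    have : StronglyMeasurable fun ω => Real.cos (φ + ⟪u, c • J ω⟫) :=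
      (by fun_prop : Continuous fun y : EucSp d => Real.cos (φ + ⟪u, c • y⟫)).comp_stronglyMeasurable
        hJ
    exact Integrable.of_bound this.aestronglyMeasurable 1 (ae_of_all _ fun ω =>
      Real.abs_cos_le_one _)
  have hA : Tendsto (fun n : ℕ => ∫ ω, g ω * Real.cos (φ + ⟪u, c • S.noiseSum ξ s t (2 ^ n) ω⟫) ∂P)
      atTop (𝓝 (∫ ω, g ω * Real.cos (φ + ⟪u, c • I ω⟫) ∂P)) := by
    rw [tendsto_iff_norm_sub_tendsto_zero]
    have h2 := h1.const_mul (cg * (‖u‖ * c))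
    rw [mul_zero] at h2
    refine squeeze_zero (fun n => norm_nonneg _) (fun n => ?_) h2
    rw [← integral_sub (hone _ (hnm n)) (hone _ hI), ← integral_const_mul]
    refine norm_integral_le_of_norm_le ((((hn n).sub hI2).integrable one_le_two).norm.const_mul _)
      (ae_of_all _ fun ω => ?_)
    rw [← mul_sub, Real.norm_eq_abs, abs_mul]
    have h3 := Real.abs_cos_sub_cos_le (φ + ⟪u, c • S.noiseSum ξ s t (2 ^ n) ω⟫)
      (φ + ⟪u, c • I ω⟫)
    have h4 : |φ + ⟪u, c • S.noiseSum ξ s t (2 ^ n) ω⟫ - (φ + ⟪u, c • I ω⟫)|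
        ≤ ‖u‖ * c * ‖S.noiseSum ξ s t (2 ^ n) ω - I ω‖ := by
      rw [add_sub_add_left_eq_sub, ← inner_sub_right, ← smul_sub]
      refine (abs_real_inner_le_norm _ _).trans ?_
      rw [norm_smul, Real.norm_of_nonneg hc0, mul_assoc]
    calc _ ≤ cg * (‖u‖ * c * ‖S.noiseSum ξ s t (2 ^ n) ω - I ω‖) :=
          mul_le_mul (hgc ω) (h3.trans h4) (abs_nonneg _) ((abs_nonneg _).trans (hgc ω))
      _ = _ := by rw [Pi.sub_apply]; ring
  refine tendsto_nhds_unique hA ?_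
  rw [tendsto_iff_norm_sub_tendsto_zero]
  have h2 : Tendsto (fun n : ℕ => 2 * (S.bd ^ 3 * S.lipσ * ‖u‖ ^ 2 *
      (cg * ∫ ω, modulus (S.seg ξ) t ((t - s) / (2 ^ n : ℕ)) ω ∂P))) atTop (𝓝 0) := by
    simpa using (((tendsto_integral_modulus (P := P) (S.continuous_seg ξ)
      (S.stronglyMeasurable_seg' ξ) t (tendsto_mesh_two_pow s t)).const_mul cg).const_mul
        (S.bd ^ 3 * S.lipσ * ‖u‖ ^ 2)).const_mul 2
  refine squeeze_zero (fun n => norm_nonneg _) (fun n => ?_) h2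
  have h3 := S.abs_integral_cos_isum_le ξ hs hst (m := 2 ^ n) (by positivity) hg hgc u φ le_rfl
  have hm : ((2 ^ n : ℕ) : ℝ) ≠ 0 := by positivity
  rw [← Real.exp_nat_mul] at h3
  have e : ((2 ^ n : ℕ) : ℝ) * -(‖u‖ ^ 2 / ((2 ^ n : ℕ) : ℝ) / 2) = -(‖u‖ ^ 2 / 2) := by
    field_simp
  rw [e] at h3
  refine h3.trans_eq ?_
  field_simp

lemma map_restrict_eq_of_cos (s : ℝ) {z : Ω → EucSp d} (hz : StronglyMeasurable z)
    (h : ∀ g : Ω → ℝ, StronglyMeasurable[S.ℱ s] g → (∀ ω, |g ω| ≤ 1) → ∀ (u : EucSp d) (φ : ℝ),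
      ∫ ω, g ω * Real.cos (φ + ⟪u, z ω⟫) ∂P
        = Real.exp (-(‖u‖ ^ 2 / 2)) * (Real.cos φ * ∫ ω, g ω ∂P)) {A : Set Ω}
    (hA : MeasurableSet[S.ℱ s] A) : (P.restrict A).map z = P A • stdGaussian (EucSp d) := by
  have := S.hP
  have hA' := S.ℱ.le s A hA
  have hfin : IsFiniteMeasure (P A • stdGaussian (EucSp d)) :=
    ⟨by simp⟩
  refine Measure.ext_of_charFun (funext fun u => ?_)
  have key : ∀ φ, ∫ ω in A, Real.cos (φ + ⟪u, z ω⟫) ∂P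
      = Real.exp (-(‖u‖ ^ 2 / 2)) * (Real.cos φ * P.real A) := fun φ => by
    have := h (A.indicator fun _ => 1) ((stronglyMeasurable_const).indicator hA) (fun ω => by
      by_cases hω : ω ∈ A <;> simp [hω]) u φ
    rw [integral_indicator_const _ hA', smul_eq_mul, mul_one] at this
    rw [← this, ← integral_indicator hA']
    refine integral_congr_ae (ae_of_all _ fun ω => ?_)
    by_cases hω : ω ∈ A <;> simp [hω]
  have hr := key 0
  have hi := key (-(Real.pi / 2))
  simp only [zero_add, Real.cos_zero, one_mul] at hr
  have e : ∀ x : ℝ, Real.cos (-(Real.pi / 2) + x) = Real.sin x := fun x => by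
    rw [add_comm, ← sub_eq_add_neg, Real.cos_sub_pi_div_two]
  simp only [e, Real.cos_neg, Real.cos_pi_div_two, zero_mul, mul_zero] at hi
  rw [charFun_apply, charFun_apply, integral_map hz.measurable.aemeasurable (by fun_prop),
    integral_smul_measure, ← charFun_apply, charFun_stdGaussian]
  have hm' : StronglyMeasurable fun ω => ⟪u, z ω⟫ :=
    (innerSL ℝ u).continuous.comp_stronglyMeasurable hz
  have i1 : Integrable (fun ω => Real.cos ⟪u, z ω⟫) (P.restrict A) :=
    Integrable.of_bound (Real.continuous_cos.comp_stronglyMeasurable hm').aestronglyMeasurable 1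
      (ae_of_all _ fun ω => Real.abs_cos_le_one _)
  have i2 : Integrable (fun ω => Real.sin ⟪u, z ω⟫) (P.restrict A) :=
    Integrable.of_bound (Real.continuous_sin.comp_stronglyMeasurable hm').aestronglyMeasurable 1
      (ae_of_all _ fun ω => Real.abs_sin_le_one _)
  have e2 : ∀ ω, Complex.exp (⟪z ω, u⟫ * Complex.I)
      = (Real.cos ⟪u, z ω⟫ : ℂ) + (Real.sin ⟪u, z ω⟫ : ℂ) * Complex.I := fun ω => by
    rw [real_inner_comm, Complex.exp_mul_I, Complex.ofReal_cos, Complex.ofReal_sin]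
  simp only [e2]
  rw [integral_add i1.ofReal (i2.ofReal.mul_const _), integral_mul_const, integral_complex_ofReal,
    integral_complex_ofReal, hr, hi, Complex.ofReal_zero, zero_mul, add_zero, Complex.real_smul]
  push_cast
  rw [mul_comm]
  congr 1
  congr 1
  ring

/-- The normalised driving noise on `[s, t]`: a standard Gaussian vector independent of the past,
which reproduces the martingale part up to the variation of the diffusion coefficient. -/
theorem exists_noise (hs : 0 ≤ s) (hst : s < t) : ∃ z : Ω → EucSp d,
    StronglyMeasurable[S.ℱ t] z ∧
    (∀ A, MeasurableSet[S.ℱ s] A → (P.restrict A).map z = P A • stdGaussian (EucSp d)) ∧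
    (∀ (x : Ω → Seg d r₀) (_ : StronglyMeasurable[S.ℱ s] x) (T : ℝ) (_ : t ≤ T) (g : Ω → ℝ)
      (_ : StronglyMeasurable[S.ℱ s] g) (cg : ℝ) (_ : ∀ ω, |g ω| ≤ cg) (_ : ∀ ω, 0 ≤ g ω),
      ∫ ω, g ω * ‖√(t - s) • S.σ (x ω) (z ω) - (S.mg ξ t ω - S.mg ξ s ω)‖ ^ 2 ∂P
        ≤ S.momC 0 * (t - s) * (2 * (S.lipσ * S.bd) ^ 2
          * ∫ ω, g ω * (min 1 (dist (x ω) (S.seg ξ s ω)) ^ 2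
            + modulus (S.seg ξ) T (t - s) ω) ∂P)) ∧
    (∀ (x : Ω → Seg d r₀) (_ : StronglyMeasurable[S.ℱ s] x) (v : Ω → EucSp d)
      (_ : StronglyMeasurable[S.ℱ s] v) (cv : ℝ) (_ : ∀ ω, ‖v ω‖ ≤ cv),
      ∫ ω, ⟪v ω, √(t - s) • S.σ (x ω) (z ω) - (S.mg ξ t ω - S.mg ξ s ω)⟫ ∂P = 0) := by
  have := S.hP
  obtain ⟨I, hI, hI2, hlim⟩ := S.exists_noise_limit ξ hs hst.le
  have hI' := hI.mono (S.ℱ.le t)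
  have hc0 : √(t - s) ≠ 0 := (Real.sqrt_pos.2 (sub_pos.2 hst)).ne'
  have hsc : ∀ (x : Ω → Seg d r₀) ω, √(t - s) • S.σ (x ω) ((√(t - s))⁻¹ • I ω) = S.σ (x ω) (I ω) :=
    fun x ω => by rw [← map_smul, smul_smul, mul_inv_cancel₀ hc0, one_smul]
  have hn := fun n : ℕ => S.memLp_noiseSum (P := P) ξ hs hst.le (2 ^ n)
  have hnm := fun n : ℕ => (S.stronglyMeasurable_noiseSum (P := P) ξ hs hst.le (m := 2 ^ n)
    (by positivity)).mono (S.ℱ.le t)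
  have hM := S.memLp_mg_sub (P := P) ξ hs hst.le
  refine ⟨fun ω => (√(t - s))⁻¹ • I ω,
    (continuous_const_smul _).comp_stronglyMeasurable hI, fun A hA => ?_, ?_, ?_⟩
  · exact S.map_restrict_eq_of_cos s ((continuous_const_smul _).comp_stronglyMeasurable hI')
      (fun g hg hgc u φ => S.integral_mul_cos_noise ξ hs hst hI' hI2 hlim hg hgc u φ) hA
  · intro x hx T htT g hg cg hgc hg0
    simp only [hsc]
    have hx' := hx.mono (S.ℱ.le s)
    exact integral_mul_norm_sq_le_of_tendsto
      (fun n => (S.memLp_σ_apply hx' (hnm n) (hn n)).sub hM) ((S.memLp_σ_apply hx' hI' hI2).sub hM)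
      (S.tendsto_integral_σ_noiseSum ξ x hs hst.le hI2 hlim) (hg.mono (S.ℱ.le s)) hgc hg0
      (fun n => S.integral_mul_norm_σ_noiseSum_sub_sq_le ξ hx hs hst.le htT hg hgc hg0
        (by positivity))
  · intro x hx v hv cv hvc
    simp only [hsc]
    have hx' := hx.mono (S.ℱ.le s)
    have hv' := hv.mono (S.ℱ.le s)
    have hL := fun n => (S.memLp_σ_apply hx' (hnm n) (hn n)).sub hM
    have hLI := (S.memLp_σ_apply hx' hI' hI2).sub hM
    have hz : ∀ n : ℕ, ∫ ω, ⟪v ω, S.σ (x ω) (S.noiseSum ξ s t (2 ^ n) ω)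
        - (S.mg ξ t ω - S.mg ξ s ω)⟫ ∂P = 0 := fun n => by
      simp only [S.σ_noiseSum_sub_eq ξ x (m := 2 ^ n) (by positivity)]
      exact S.integral_inner_isum ξ (unifPt_mono hst.le _) (by rwa [unifPt_zero])
        (S.stronglyMeasurable_σ_defect ξ hx hs hst.le _) (S.norm_σ_defect_le_const ξ _) _
        (by rwa [unifPt_zero]) hvc
    have hvL : MemLp v 2 P := MemLp.of_bound hv'.aestronglyMeasurable cv (ae_of_all _ hvc)
    have h1 := (tendsto_integral_norm_of_sq (fun n => (hL n).sub hLI)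
      (S.tendsto_integral_σ_noiseSum ξ x hs hst.le hI2 hlim)).const_mul cv
    rw [mul_zero] at h1
    have h2 : ∀ n : ℕ, |∫ ω, ⟪v ω, S.σ (x ω) (I ω) - (S.mg ξ t ω - S.mg ξ s ω)⟫ ∂P|
        ≤ cv * ∫ ω, ‖(S.σ (x ω) (S.noiseSum ξ s t (2 ^ n) ω) - (S.mg ξ t ω - S.mg ξ s ω))
          - (S.σ (x ω) (I ω) - (S.mg ξ t ω - S.mg ξ s ω))‖ ∂P := fun n => by
      have i1 := MemLp.integrable_inner' hvL (hL n)
      have i2 := MemLp.integrable_inner' hvL hLI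
      rw [← abs_neg, ← zero_sub, ← hz n]
      rw [← integral_const_mul]
      refine le_trans (le_of_eq (congrArg _ (integral_sub i1 i2).symm)) ?_
      rw [← Real.norm_eq_abs]
      refine norm_integral_le_of_norm_le
        ((((hL n).sub hLI).integrable one_le_two).norm.const_mul _) (ae_of_all _ fun ω => ?_)
      refine le_trans (le_of_eq (congrArg _ (inner_sub_right _ _ _).symm)) ?_
      exact (norm_inner_le_norm _ _).trans (mul_le_mul_of_nonneg_right (hvc ω) (norm_nonneg _))
    have := ge_of_tendsto' h1 h2
    exact abs_eq_zero.1 (le_antisymm this (abs_nonneg _))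

end PathSDE

section Gaussian

variable {d : ℕ}

lemma integral_cexp_stdGaussian (c : Fin d → ℂ) :
    ∫ y, Complex.exp (∑ j, c j * (y j : ℝ)) ∂(stdGaussian (EucSp d))
      = Complex.exp (∑ j, c j ^ 2 / 2) := by
  rw [← map_pi_eq_stdGaussian, integral_map (by fun_prop)
    (Measurable.aestronglyMeasurable (by fun_prop))]
  simp only [Complex.exp_sum]
  rw [integral_fintype_prod_eq_prod (f := fun j (x : ℝ) => Complex.exp (c j * x))]
  refine Finset.prod_congr rfl fun j _ => ?_
  have := complexMGF_id_gaussianReal (μ := 0) (v := 1) (c j)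
  simpa [complexMGF] using this

lemma integrable_exp_inner_stdGaussian (w : EucSp d) :
    Integrable (fun y => Real.exp ⟪w, y⟫) (stdGaussian (EucSp d)) := by
  have h := IsGaussian.map_eq_gaussianReal (μ := stdGaussian (EucSp d)) (innerSL ℝ w)
  have h2 : Integrable Real.exp ((stdGaussian (EucSp d)).map (innerSL ℝ w)) := by
    rw [h]
    simpa using integrable_exp_mul_gaussianReal (μ := (stdGaussian (EucSp d))[innerSL ℝ w])
      (v := (Var[innerSL ℝ w; stdGaussian (EucSp d)]).toNNReal) 1
  exact h2.comp_aemeasurable (innerSL ℝ w).continuous.measurable.aemeasurable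

/-- The Cameron–Martin formula for the standard Gaussian measure. -/
lemma map_add_withDensity_stdGaussian (w : EucSp d) :
    ((stdGaussian (EucSp d)).withDensity fun y =>
      ENNReal.ofReal (Real.exp (-⟪w, y⟫ - ‖w‖ ^ 2 / 2))).map (· + w) = stdGaussian (EucSp d) := by
  have hint : Integrable (fun y => Real.exp (-⟪w, y⟫ - ‖w‖ ^ 2 / 2)) (stdGaussian (EucSp d)) := by
    have := (integrable_exp_inner_stdGaussian (-w)).mul_const (Real.exp (-(‖w‖ ^ 2 / 2)))
    refine this.congr (ae_of_all _ fun y => ?_)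
    simp only [← Real.exp_add, inner_neg_left, sub_eq_add_neg]
  have hfin := isFiniteMeasure_withDensity_ofReal hint.2
  refine Measure.ext_of_charFun (funext fun u => ?_)
  rw [charFun_apply, integral_map (by fun_prop) (Measurable.aestronglyMeasurable (by fun_prop)),
    integral_withDensity_eq_integral_toReal_smul (by fun_prop) (by simp), charFun_stdGaussian]
  have e : ∀ y : EucSp d, (ENNReal.ofReal (Real.exp (-⟪w, y⟫ - ‖w‖ ^ 2 / 2))).toReal •
      Complex.exp (⟪y + w, u⟫ * Complex.I)
      = Complex.exp (∑ j, (u j * Complex.I - w j) * (y j : ℝ))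
        * Complex.exp (⟪w, u⟫ * Complex.I - ‖w‖ ^ 2 / 2) := fun y => by
    rw [ENNReal.toReal_ofReal (Real.exp_pos _).le, Complex.real_smul, Complex.ofReal_exp,
      ← Complex.exp_add, ← Complex.exp_add]
    congr 1
    have h : ∑ j, (u j * Complex.I - w j) * (y j : ℝ)
        = ((⟪y, u⟫ : ℝ) : ℂ) * Complex.I - (⟪w, y⟫ : ℝ) := by
      simp only [PiLp.inner_apply, RCLike.inner_apply, conj_trivial]
      push_cast
      rw [Finset.sum_mul, ← Finset.sum_sub_distrib]
      exact Finset.sum_congr rfl fun j _ => by ring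
    rw [h, inner_add_left]
    push_cast
    ring
  simp only [e]
  rw [integral_mul_const, integral_cexp_stdGaussian, ← Complex.exp_add]
  congr 1
  simp only [sub_sq, mul_pow, Complex.I_sq, ← Complex.ofReal_pow, EuclideanSpace.real_norm_sq_eq,
    PiLp.inner_apply, RCLike.inner_apply, conj_trivial]
  push_cast
  simp only [Finset.sum_mul, Finset.sum_div, ← Finset.sum_sub_distrib, ← Finset.sum_add_distrib,
    ← Finset.sum_neg_distrib]
  refine Finset.sum_congr rfl fun j _ => ?_
  ring

/-- Entropy cost of a Gaussian shift. -/
theorem integral_log_add_le_stdGaussian {f : EucSp d → ℝ} (hf : Measurable f) (h1 : ∀ y, 1 ≤ f y)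
    {B : ℝ} (hB : ∀ y, f y ≤ B) (w : EucSp d) :
    ∫ y, Real.log (f (y + w)) ∂(stdGaussian (EucSp d))
      ≤ Real.log (∫ y, f y ∂(stdGaussian (EucSp d))) + ‖w‖ ^ 2 / 2 := by
  set γ := stdGaussian (EucSp d) with hγ
  have hfi : Integrable f γ := Integrable.of_bound hf.aestronglyMeasurable B
    (ae_of_all _ fun y => by rw [Real.norm_of_nonneg (zero_le_one.trans (h1 y))]; exact hB y)
  set c := ∫ y, f y ∂γ with hc
  have hc1 : 1 ≤ c := by
    have := integral_mono (μ := γ) (integrable_const (1:ℝ)) hfi h1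
    simpa using this
  have hc0 : 0 < c := zero_lt_one.trans_le hc1
  set ρ : EucSp d → ℝ := fun y => Real.exp (-⟪w, y⟫ - ‖w‖ ^ 2 / 2) with hρ
  have hCM : ∫ y, ρ y * f (y + w) ∂γ = c := by
    have h := map_add_withDensity_stdGaussian w
    rw [hc, hγ]
    conv_rhs => rw [← h]
    rw [integral_map (by fun_prop) hf.aestronglyMeasurable,
      integral_withDensity_eq_integral_toReal_smul (by fun_prop) (by simp)]
    refine integral_congr_ae (ae_of_all _ fun y => ?_)
    simp only [ENNReal.toReal_ofReal (Real.exp_pos _).le, smul_eq_mul, hρ]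
  have hρi : Integrable ρ γ := by
    have := (integrable_exp_inner_stdGaussian (-w)).mul_const (Real.exp (-(‖w‖ ^ 2 / 2)))
    refine this.congr (ae_of_all _ fun y => ?_)
    simp only [hρ, ← Real.exp_add, inner_neg_left, sub_eq_add_neg]
  have hfw : Measurable fun y => f (y + w) := hf.comp (measurable_add_const w)
  have i1 : Integrable (fun y => ρ y * f (y + w)) γ := by
    refine (hρi.mul_const B).mono' (by fun_prop) (ae_of_all _ fun y => ?_)
    rw [Real.norm_of_nonneg (mul_nonneg (Real.exp_pos _).le (zero_le_one.trans (h1 _)))]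
    exact mul_le_mul_of_nonneg_left (hB _) (Real.exp_pos _).le
  have i2 : Integrable (fun y : EucSp d => ⟪w, y⟫) γ :=
    (innerSL ℝ w).integrable_comp (IsGaussian.integrable_id (μ := γ))
  have i3 : Integrable (fun y => Real.log (f (y + w))) γ :=
    Integrable.of_bound (Real.measurable_log.comp hfw).aestronglyMeasurable (Real.log B)
      (ae_of_all _ fun y => by
        rw [Real.norm_of_nonneg (Real.log_nonneg (h1 _))]
        exact Real.log_le_log (zero_lt_one.trans_le (h1 _)) (hB _))
  have hz : ∫ y, ⟪w, y⟫ ∂γ = 0 := by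
    have := integral_strongDual_stdGaussian (E := EucSp d) (innerSL ℝ w)
    simpa using this
  have hle : ∫ y, Real.log (f (y + w)) ∂γ ≤ ∫ y, (((Real.log c - 1 + ‖w‖ ^ 2 / 2) + ⟪w, y⟫)
      + 1 / c * (ρ y * f (y + w))) ∂γ := by
    refine integral_mono i3 (((integrable_const _).add i2).add (i1.const_mul _)) fun y => ?_
    have hf0 : 0 < f (y + w) := zero_lt_one.trans_le (h1 _)
    have hρ0 : 0 < ρ y := Real.exp_pos _
    have h2 := Real.log_le_sub_one_of_pos (x := ρ y * f (y + w) / c) (by positivity)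
    rw [Real.log_div (by positivity) hc0.ne', Real.log_mul hρ0.ne' hf0.ne'] at h2
    have h3 : Real.log (ρ y) = -⟪w, y⟫ - ‖w‖ ^ 2 / 2 := Real.log_exp _
    rw [h3] at h2
    show Real.log (f (y + w)) ≤ _
    have h4 : ρ y * f (y + w) / c = 1 / c * (ρ y * f (y + w)) := by ring
    linarith
  rw [integral_add (by exact (integrable_const _).add i2) (by exact i1.const_mul _),
    integral_add (by exact integrable_const _) (by exact i2), integral_const_mul, hCM, hz,
    integral_const] at hle
  have h5 : 1 / c * c = 1 := by field_simp
  simp only [probReal_univ, smul_eq_mul, one_mul] at hle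
  linarith

end Gaussian

namespace PathSDE

variable (S : PathSDE d r₀ Ω P) {s : ℝ}

lemma map_prodMk_noise {z : Ω → EucSp d} (hz : Measurable z)
    (h : ∀ A, MeasurableSet[S.ℱ s] A → (P.restrict A).map z = P A • stdGaussian (EucSp d))
    {α : Type*} [MeasurableSpace α] {a : Ω → α} (ha : Measurable[S.ℱ s] a) :
    P.map (fun ω => (a ω, z ω)) = (P.map a).prod (stdGaussian (EucSp d)) := by
  have := S.hP
  have ha' : Measurable a := ha.mono (S.ℱ.le s) le_rfl
  have := Measure.isProbabilityMeasure_map (μ := P) ha'.aemeasurable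
  refine (Measure.prod_eq fun B C hB hC => ?_).symm
  rw [Measure.map_apply (ha'.prodMk hz) (hB.prod hC), Measure.map_apply ha' hB]
  have h1 := congrArg (fun μ => μ C) (h (a ⁻¹' B) (ha hB))
  simp only [Measure.map_apply hz hC, Measure.restrict_apply (hz hC), Measure.smul_apply,
    smul_eq_mul] at h1
  rw [← h1]
  congr 1
  ext ω
  simp [and_comm]

/-- Freezing lemma: the noise is integrated out against the Gaussian law. -/
lemma integral_comp_noise {z : Ω → EucSp d} (hz : Measurable z)
    (h : ∀ A, MeasurableSet[S.ℱ s] A → (P.restrict A).map z = P A • stdGaussian (EucSp d))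
    {α : Type*} [MeasurableSpace α] {a : Ω → α} (ha : Measurable[S.ℱ s] a)
    {Φ : α → EucSp d → ℝ} (hΦ : Measurable (Function.uncurry Φ))
    (hi : Integrable (fun ω => Φ (a ω) (z ω)) P) :
    Integrable (fun ω => ∫ y, Φ (a ω) y ∂(stdGaussian (EucSp d))) P ∧
    ∫ ω, Φ (a ω) (z ω) ∂P = ∫ ω, ∫ y, Φ (a ω) y ∂(stdGaussian (EucSp d)) ∂P := by
  have := S.hP
  have ha' : Measurable a := ha.mono (S.ℱ.le s) le_rfl
  have hm := S.map_prodMk_noise hz h ha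
  have := Measure.isProbabilityMeasure_map (μ := P) ha'.aemeasurable
  have hΦm := hΦ.aestronglyMeasurable (μ := P.map (fun ω => (a ω, z ω)))
  have hi' : Integrable (Function.uncurry Φ) ((P.map a).prod (stdGaussian (EucSp d))) := by
    rw [← hm]
    exact (integrable_map_measure hΦm (ha'.prodMk hz).aemeasurable).2 hi
  have hi2 := hi'.integral_prod_left
  refine ⟨(integrable_map_measure hi2.1 ha'.aemeasurable).1 hi2, ?_⟩
  have e : ∫ ω, Φ (a ω) (z ω) ∂P = ∫ q, Function.uncurry Φ q ∂(P.map fun ω => (a ω, z ω)) :=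
    (integral_map (ha'.prodMk hz).aemeasurable hΦm).symm
  rw [e, hm, integral_prod _ hi', integral_map ha'.aemeasurable hi2.1]
  rfl

/-- Moments of the noise, weighted by the past. -/
lemma integral_mul_norm_pow_noise {z : Ω → EucSp d} (hz : Measurable z)
    (h : ∀ A, MeasurableSet[S.ℱ s] A → (P.restrict A).map z = P A • stdGaussian (EucSp d))
    (k : ℕ) {g : Ω → ℝ} (hg : StronglyMeasurable[S.ℱ s] g) {cg : ℝ} (hgc : ∀ ω, |g ω| ≤ cg) :
    Integrable (fun ω => ‖z ω‖ ^ k) P ∧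
    ∫ ω, g ω * ‖z ω‖ ^ k ∂P = (∫ y, ‖y‖ ^ k ∂(stdGaussian (EucSp d))) * ∫ ω, g ω ∂P := by
  have := S.hP
  have hmap : P.map z = stdGaussian (EucSp d) := by
    simpa using h univ MeasurableSet.univ
  have h1 : Integrable (fun y : EucSp d => ‖y‖ ^ k) (stdGaussian (EucSp d)) :=
    (IsGaussian.memLp_id (stdGaussian (EucSp d)) k (by simp)).integrable_norm_pow'
  have h2 : Integrable (fun ω => ‖z ω‖ ^ k) P := by
    rw [← hmap] at h1
    exact h1.comp_measurable hz
  refine ⟨h2, ?_⟩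
  have h3 := (S.integral_comp_noise hz h hg.measurable (Φ := fun (r : ℝ) y => r * ‖y‖ ^ k)
    (by fun_prop) (integrable_bdd_mul' (hg.mono (S.ℱ.le s)) hgc h2)).2
  rw [h3]
  simp only [integral_const_mul, integral_mul_const]
  rw [mul_comm]

end PathSDE

namespace PathSDE

variable (S : PathSDE d r₀ Ω P)

/-- Increment of the Euler scheme with step `h`. -/
def eulerInc (S : PathSDE d r₀ Ω P) (h : ℝ) (x : Seg d r₀) (y : EucSp d) : EucSp d :=
  h • S.b x + √h • S.σ x y

/-- One step of the Euler scheme on segments, with linear interpolation. -/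
def euler (S : PathSDE d r₀ Ω P) (h : ℝ) (x : Seg d r₀) (y : EucSp d) : Seg d r₀ :=
  ⟨fun θ => x (projIcc (-r₀) 0 (neg_nonpos.2 S.hr₀.le) (θ.1 + h))
      + (max (θ.1 + h) 0 / h) • S.eulerInc h x y, by
    refine (x.continuous.comp (continuous_projIcc.comp (by fun_prop))).add ?_
    have h1 : Continuous fun θ : Icc (-r₀) (0:ℝ) => max (θ.1 + h) 0 / h := by fun_prop
    exact h1.smul continuous_const⟩

lemma euler_apply (h : ℝ) (x : Seg d r₀) (y : EucSp d) (θ : Icc (-r₀) (0:ℝ)) :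
    S.euler h x y θ = x (projIcc (-r₀) 0 (neg_nonpos.2 S.hr₀.le) (θ.1 + h))
      + (max (θ.1 + h) 0 / h) • S.eulerInc h x y := rfl

lemma euler_apply_of_nonpos {h : ℝ} (hh : 0 ≤ h) (x : Seg d r₀) (y : EucSp d)
    (θ : Icc (-r₀) (0:ℝ)) (hθ : θ.1 + h ≤ 0) :
    S.euler h x y θ = x ⟨θ.1 + h, by linarith [θ.2.1], hθ⟩ := by
  rw [euler_apply, projIcc_of_mem _ ⟨by linarith [θ.2.1], hθ⟩, max_eq_right hθ, zero_div, zero_smul,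
    add_zero]

lemma euler_apply_of_nonneg {h : ℝ} (x : Seg d r₀) (y : EucSp d)
    (θ : Icc (-r₀) (0:ℝ)) (hθ : 0 ≤ θ.1 + h) :
    S.euler h x y θ = ev0 S.hr₀ x + ((θ.1 + h) / h) • S.eulerInc h x y := by
  rw [euler_apply, projIcc_of_right_le _ hθ, max_eq_left hθ]
  rfl

lemma ev0_euler {h : ℝ} (hh : 0 < h) (x : Seg d r₀) (y : EucSp d) :
    ev0 S.hr₀ (S.euler h x y) = ev0 S.hr₀ x + S.eulerInc h x y := by
  have := S.euler_apply_of_nonneg (h := h) x y ⟨0, neg_nonpos.2 S.hr₀.le, le_rfl⟩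
    (by simpa using hh.le)
  rw [zero_add, div_self hh.ne', one_smul] at this
  exact this

lemma continuous_eulerInc (h : ℝ) :
    Continuous fun p : Seg d r₀ × EucSp d => S.eulerInc h p.1 p.2 := by
  have h1 := S.hA1bcont
  have h2 := S.continuous_σ
  unfold eulerInc
  fun_prop

lemma continuous_euler (h : ℝ) :
    Continuous fun p : Seg d r₀ × EucSp d => S.euler h p.1 p.2 := by
  refine ContinuousMap.continuous_of_continuous_uncurry _ ?_
  have h1 := S.continuous_eulerInc h
  have h2 : Continuous fun q : (Seg d r₀ × EucSp d) × Icc (-r₀) (0:ℝ) =>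
      q.1.1 (projIcc (-r₀) 0 (neg_nonpos.2 S.hr₀.le) (q.2.1 + h)) := by
    refine Continuous.eval (by fun_prop) ?_
    exact continuous_projIcc.comp (by fun_prop)
  have h3 : Continuous fun q : (Seg d r₀ × EucSp d) × Icc (-r₀) (0:ℝ) =>
      max (q.2.1 + h) 0 / h := by fun_prop
  exact h2.add (h3.smul (h1.comp continuous_fst))

/-- Iterated transition operator of the Euler scheme. -/
def eulerOp (S : PathSDE d r₀ Ω P) (h : ℝ) : ℕ → (Seg d r₀ → ℝ) → Seg d r₀ → ℝ
  | 0, ψ => ψ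
  | n + 1, ψ => fun x => ∫ y, eulerOp S h n ψ (S.euler h x y) ∂(stdGaussian (EucSp d))

variable {h : ℝ}

lemma eulerOp_succ (n : ℕ) (ψ : Seg d r₀ → ℝ) (x : Seg d r₀) : S.eulerOp h (n + 1) ψ x
    = ∫ y, S.eulerOp h n ψ (S.euler h x y) ∂(stdGaussian (EucSp d)) := rfl

lemma measurable_eulerOp {ψ : Seg d r₀ → ℝ} (hψ : Measurable ψ) (n : ℕ) :
    Measurable (S.eulerOp h n ψ) := by
  induction n with
  | zero => exact hψ
  | succ n ih =>
    exact ((ih.comp (S.continuous_euler h).measurable).stronglyMeasurable.integral_prod_right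
      (f := fun x y => S.eulerOp h n ψ (S.euler h x y))).measurable

lemma eulerOp_mem {ψ : Seg d r₀ → ℝ} (hψ : Measurable ψ) {a c : ℝ} (h1 : ∀ x, ψ x ∈ Icc a c)
    (n : ℕ) (x : Seg d r₀) : S.eulerOp h n ψ x ∈ Icc a c := by
  induction n generalizing x with
  | zero => exact h1 x
  | succ n ih =>
    rw [eulerOp_succ]
    have hm : Measurable fun y => S.eulerOp h n ψ (S.euler h x y) :=
      (S.measurable_eulerOp hψ n).comp ((S.continuous_euler h).measurable.comp
        measurable_prodMk_left)
    have hi : Integrable (fun y => S.eulerOp h n ψ (S.euler h x y)) (stdGaussian (EucSp d)) :=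
      Integrable.of_bound hm.aestronglyMeasurable (max |a| |c|) (ae_of_all _ fun y =>
        abs_le_max_abs_abs (ih _).1 (ih _).2)
    constructor
    · simpa using integral_mono (integrable_const a) hi fun y => (ih _).1
    · simpa using integral_mono hi (integrable_const c) fun y => (ih _).2

lemma integrable_eulerOp {ψ : Seg d r₀ → ℝ} (hψ : Measurable ψ) {a c : ℝ}
    (h1 : ∀ x, ψ x ∈ Icc a c) (n : ℕ) (x : Seg d r₀) :
    Integrable (fun y => S.eulerOp h n ψ (S.euler h x y)) (stdGaussian (EucSp d)) := by
  have hm : Measurable fun y => S.eulerOp h n ψ (S.euler h x y) :=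
    (S.measurable_eulerOp hψ n).comp ((S.continuous_euler h).measurable.comp
      measurable_prodMk_left)
  exact Integrable.of_bound hm.aestronglyMeasurable (max |a| |c|) (ae_of_all _ fun y =>
    abs_le_max_abs_abs (S.eulerOp_mem hψ h1 n _).1 (S.eulerOp_mem hψ h1 n _).2)

lemma eulerOp_mono {ψ ψ' : Seg d r₀ → ℝ} (hψ : Measurable ψ) (hψ' : Measurable ψ') {a c a' c' : ℝ}
    (h1 : ∀ x, ψ x ∈ Icc a c) (h1' : ∀ x, ψ' x ∈ Icc a' c') (hle : ∀ x, ψ x ≤ ψ' x)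
    (n : ℕ) (x : Seg d r₀) : S.eulerOp h n ψ x ≤ S.eulerOp h n ψ' x := by
  induction n generalizing x with
  | zero => exact hle x
  | succ n ih =>
    exact integral_mono (S.integrable_eulerOp hψ h1 n x) (S.integrable_eulerOp hψ' h1' n x)
      fun y => ih _

lemma eulerOp_affine {ψ : Seg d r₀ → ℝ} (hψ : Measurable ψ) {a c : ℝ}
    (h1 : ∀ x, ψ x ∈ Icc a c) (α β : ℝ) (n : ℕ) (x : Seg d r₀) :
    S.eulerOp h n (fun x => α + β * ψ x) x = α + β * S.eulerOp h n ψ x := by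
  induction n generalizing x with
  | zero => rfl
  | succ n ih =>
    simp only [eulerOp_succ, ih]
    have hi := (S.integrable_eulerOp (h := h) hψ h1 n x).const_mul β
    rw [integral_add (integrable_const _) hi, integral_const_mul]
    simp

/-- Entropy cost of shifting the noise in one step of the Euler scheme. -/
lemma integral_log_eulerOp_le {ψ : Seg d r₀ → ℝ} (hψ : Measurable ψ) {B : ℝ}
    (h1 : ∀ x, ψ x ∈ Icc 1 B) (n : ℕ) (x : Seg d r₀) (w : EucSp d) :
    ∫ y, Real.log (S.eulerOp h n ψ (S.euler h x (y + w))) ∂(stdGaussian (EucSp d))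
      ≤ Real.log (S.eulerOp h (n + 1) ψ x) + ‖w‖ ^ 2 / 2 :=
  integral_log_add_le_stdGaussian (f := fun y => S.eulerOp h n ψ (S.euler h x y))
    ((S.measurable_eulerOp hψ n).comp ((S.continuous_euler h).measurable.comp
      measurable_prodMk_left)) (fun _ => (S.eulerOp_mem hψ h1 n _).1)
    (fun _ => (S.eulerOp_mem hψ h1 n _).2) w

end PathSDE

namespace PathSDE

variable (S : PathSDE d r₀ Ω P)

/-- Bound for the oscillation of the solution inside the ball of radius `N`. -/
def osc (S : PathSDE d r₀ Ω P) (η : Seg d r₀) (N T h : ℝ) (ω : Ω) : ℝ :=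
  (2 * N + 1) * modulus (S.seg η) T h ω

/-- The state at time `s` of the Euler scheme steered towards the solution started from `η`:
the segment `x`, a bound `R` for the distance and the set `G` on which nothing has exited. -/
structure Coupled (S : PathSDE d r₀ Ω P) (η : Seg d r₀) (N ε T h s : ℝ) where
  x : Ω → Seg d r₀
  R : Ω → ℝ
  G : Set Ω
  hx : StronglyMeasurable[S.ℱ s] x
  hR : StronglyMeasurable[S.ℱ s] R
  hG : MeasurableSet[S.ℱ s] G
  ball : G ⊆ S.inBall η N s
  le_R : ∀ ω ∈ G, ε * Real.exp (-s) ≤ R ω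
  R_le : ∀ ω ∈ G, R ω ≤ N
  ev_le : ∀ ω ∈ G, ‖ev0 S.hr₀ (x ω) - S.Y η ω s‖ ≤ R ω
  seg_le : ∀ ω ∈ G, ∀ θ, ‖x ω θ - S.seg η s ω θ‖ ≤ Real.exp (h - θ.1) * R ω + S.osc η N T h ω

variable {S} {η : Seg d r₀} {N ε T h s : ℝ}

/-- Difference of the current values. -/
def Coupled.D (c : Coupled S η N ε T h s) (ω : Ω) : EucSp d :=
  ev0 S.hr₀ (c.x ω) - S.Y η ω s

/-- Drift steering the Euler scheme. -/
def Coupled.w (c : Coupled S η N ε T h s) (K : ℝ) (ω : Ω) : EucSp d :=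
  -((√h * K) • S.σinv (c.x ω) (c.D ω))

/-- The Lyapunov function. -/
def Coupled.V (c : Coupled S η N ε T h s) (ω : Ω) : ℝ :=
  c.R ω ^ 2 + ‖c.D ω‖ ^ 4 / c.R ω ^ 2

/-- The Euler step with the steered noise. -/
def Coupled.nextx (c : Coupled S η N ε T h s) (K : ℝ) (z : Ω → EucSp d) (ω : Ω) : Seg d r₀ :=
  S.euler h (c.x ω) (z ω + c.w K ω)

/-- The next distance bound. -/
def Coupled.nextR (c : Coupled S η N ε T h s) (K : ℝ) (z : Ω → EucSp d) (ω : Ω) : ℝ :=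
  max (Real.exp (-h) * c.R ω) ‖ev0 S.hr₀ (c.nextx K z ω) - S.Y η ω (s + h)‖

lemma Coupled.stronglyMeasurable_D (c : Coupled S η N ε T h s) (hs : 0 ≤ s) :
    StronglyMeasurable[S.ℱ s] c.D :=
  (S.continuous_ev0.comp_stronglyMeasurable c.hx).sub (S.stronglyMeasurable_Y η hs)

lemma Coupled.stronglyMeasurable_w (c : Coupled S η N ε T h s) (hs : 0 ≤ s) (K : ℝ) :
    StronglyMeasurable[S.ℱ s] (c.w K) := by
  have h1 : Continuous fun p : (EucSp d →L[ℝ] EucSp d) × EucSp d => -((√h * K) • p.1 p.2) := by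
    fun_prop
  exact h1.comp_stronglyMeasurable
    ((S.continuous_σinv.comp_stronglyMeasurable c.hx).prodMk (c.stronglyMeasurable_D hs))

lemma Coupled.stronglyMeasurable_nextx (c : Coupled S η N ε T h s) (hs : 0 ≤ s) (hh : 0 ≤ h)
    (K : ℝ) {z : Ω → EucSp d} (hz : StronglyMeasurable[S.ℱ (s + h)] z) :
    StronglyMeasurable[S.ℱ (s + h)] (c.nextx K z) := by
  have hle := S.ℱ.mono (le_add_of_nonneg_right hh : s ≤ s + h)
  exact (S.continuous_euler h).comp_stronglyMeasurable
    ((c.hx.mono hle).prodMk (hz.add ((c.stronglyMeasurable_w hs K).mono hle)))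

lemma Coupled.stronglyMeasurable_nextR (c : Coupled S η N ε T h s) (hs : 0 ≤ s) (hh : 0 ≤ h)
    (K : ℝ) {z : Ω → EucSp d} (hz : StronglyMeasurable[S.ℱ (s + h)] z) :
    StronglyMeasurable[S.ℱ (s + h)] (c.nextR K z) := by
  have hle := S.ℱ.mono (le_add_of_nonneg_right hh : s ≤ s + h)
  have h1 : Continuous fun p : ℝ × EucSp d => max (Real.exp (-h) * p.1) ‖p.2‖ := by fun_prop
  exact h1.comp_stronglyMeasurable ((c.hR.mono hle).prodMk
    ((S.continuous_ev0.comp_stronglyMeasurable (c.stronglyMeasurable_nextx hs hh K hz)).sub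
      (S.stronglyMeasurable_Y η (add_nonneg hs hh))))

lemma norm_interp_sub_le (hs : 0 ≤ s) (hh : 0 < h) (hT : s + h ≤ T) (hN : 0 ≤ N) {ω : Ω}
    (hω : ω ∈ S.inBall η N (s + h)) {l : ℝ} (hl : l ∈ Icc (0:ℝ) 1) :
    ‖(1 - l) • S.Y η ω s + l • S.Y η ω (s + h) - S.Y η ω (s + l * h)‖ ≤ S.osc η N T h ω := by
  have hlh : 0 ≤ l * h := mul_nonneg hl.1 hh.le
  have hlh' : l * h ≤ h := mul_le_of_le_one_left hh.le hl.2
  have key : ∀ u ∈ Icc s (s + h), ‖S.Y η ω u - S.Y η ω (s + l * h)‖ ≤ S.osc η N T h ω := by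
    intro u hu
    have h0u : 0 ≤ u := hs.trans hu.1
    have hd : ‖S.Y η ω u - S.Y η ω (s + l * h)‖
        ≤ dist (S.seg η u ω) (S.seg η (s + l * h) ω) := by
      have := S.norm_ev0_le (S.seg η u ω - S.seg η (s + l * h) ω)
      rw [dist_eq_norm]
      refine le_trans (le_of_eq ?_) this
      have e : ev0 S.hr₀ (S.seg η u ω - S.seg η (s + l * h) ω)
        = ev0 S.hr₀ (S.seg η u ω) - ev0 S.hr₀ (S.seg η (s + l * h) ω) := rfl
      rw [e, S.ev0_seg, S.ev0_seg, max_eq_left h0u, max_eq_left (by positivity)]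
    refine hd.trans (dist_le_mul_modulus ⟨h0u, hu.2.trans hT⟩ ⟨by positivity, by linarith⟩
      ?_ ω (by linarith) ?_)
    · rw [abs_le]; constructor <;> linarith [hu.1, hu.2]
    · have h1 := hω u ⟨h0u, hu.2⟩
      have h2 := hω (s + l * h) ⟨by positivity, by linarith⟩
      have := dist_le_norm_add_norm (S.seg η u ω) (S.seg η (s + l * h) ω)
      linarith
  have e : (1 - l) • S.Y η ω s + l • S.Y η ω (s + h) - S.Y η ω (s + l * h)
      = (1 - l) • (S.Y η ω s - S.Y η ω (s + l * h))
        + l • (S.Y η ω (s + h) - S.Y η ω (s + l * h)) := by module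
  rw [e]
  have k1 := key s ⟨le_rfl, by linarith⟩
  have k2 := key (s + h) ⟨by linarith, le_rfl⟩
  refine (norm_add_le _ _).trans ?_
  rw [norm_smul, norm_smul, Real.norm_of_nonneg hl.1, Real.norm_of_nonneg (by linarith [hl.2])]
  nlinarith [mul_le_mul_of_nonneg_left k1 (by linarith [hl.2] : 0 ≤ 1 - l),
    mul_le_mul_of_nonneg_left k2 hl.1]

lemma osc_nonneg (hN : 0 ≤ N) (ω : Ω) : 0 ≤ S.osc η N T h ω :=
  mul_nonneg (by linarith) (modulus_nonneg ω)

/-- The next state. -/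
def Coupled.next (c : Coupled S η N ε T h s) (hs : 0 ≤ s) (hh : 0 < h) (hT : s + h ≤ T)
    (hN : 0 ≤ N) (K : ℝ) {z : Ω → EucSp d} (hz : StronglyMeasurable[S.ℱ (s + h)] z) :
    Coupled S η N ε T h (s + h) where
  x := c.nextx K z
  R := c.nextR K z
  G := c.G ∩ S.inBall η N (s + h) ∩ {ω | c.nextR K z ω ≤ N}
  hx := c.stronglyMeasurable_nextx hs hh.le K hz
  hR := c.stronglyMeasurable_nextR hs hh.le K hz
  hG := by
    have hle := S.ℱ.mono (le_add_of_nonneg_right hh.le : s ≤ s + h)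
    refine ((hle _ c.hG).inter (S.measurableSet_inBall η N (add_nonneg hs hh.le))).inter ?_
    exact measurableSet_le (c.stronglyMeasurable_nextR hs hh.le K hz).measurable measurable_const
  ball := fun ω hω => hω.1.2
  le_R := fun ω hω => by
    refine le_trans ?_ (le_max_left _ _)
    have := mul_le_mul_of_nonneg_left (c.le_R ω hω.1.1) (Real.exp_pos (-h)).le
    rw [neg_add, Real.exp_add]
    linarith
  R_le := fun ω hω => hω.2
  ev_le := fun ω hω => le_max_right _ _
  seg_le := fun ω hω θ => by
    have hR1 : Real.exp (-h) * c.R ω ≤ c.nextR K z ω := le_max_left _ _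
    have hR2 : ‖ev0 S.hr₀ (c.nextx K z ω) - S.Y η ω (s + h)‖ ≤ c.nextR K z ω := le_max_right _ _
    have hR0 : 0 ≤ c.nextR K z ω := (norm_nonneg _).trans hR2
    have hRh : c.R ω ≤ Real.exp h * c.nextR K z ω := by
      have := mul_le_mul_of_nonneg_left hR1 (Real.exp_pos h).le
      rwa [← mul_assoc, ← Real.exp_add, add_neg_cancel, Real.exp_zero, one_mul] at this
    have hsh : 0 ≤ s + h := add_nonneg hs hh.le
    rw [S.seg_apply, max_eq_left hsh]
    rcases le_total (θ.1 + h) 0 with h0 | h0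
    · have := c.seg_le ω hω.1.1 ⟨θ.1 + h, by linarith [θ.2.1], h0⟩
      rw [S.seg_apply, max_eq_left hs] at this
      rw [nextx, S.euler_apply_of_nonpos hh.le _ _ θ h0]
      have e : s + h + θ.1 = s + (θ.1 + h) := by ring
      rw [e]
      refine this.trans (add_le_add_left ?_ _)
      have e2 : Real.exp (h - (θ.1 + h)) * c.R ω
          = Real.exp (h - θ.1) * (Real.exp (-h) * c.R ω) := by
        rw [← mul_assoc, ← Real.exp_add]; ring_nf
      rw [e2]
      exact mul_le_mul_of_nonneg_left hR1 (Real.exp_pos _).le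
    · have hl : (θ.1 + h) / h ∈ Icc (0:ℝ) 1 :=
        ⟨div_nonneg h0 hh.le, (div_le_one hh).2 (by linarith [θ.2.2])⟩
      have hi := norm_interp_sub_le hs hh hT hN hω.1.2 hl
      set l := (θ.1 + h) / h with hldef
      have hlh : l * h = θ.1 + h := div_mul_cancel₀ _ hh.ne'
      have e1 : S.euler h (c.x ω) (z ω + c.w K ω) θ
          = ev0 S.hr₀ (c.x ω) + l • S.eulerInc h (c.x ω) (z ω + c.w K ω) :=
        S.euler_apply_of_nonneg _ _ θ h0
      have e2 : S.eulerInc h (c.x ω) (z ω + c.w K ω)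
          = ev0 S.hr₀ (c.nextx K z ω) - ev0 S.hr₀ (c.x ω) := by
        rw [nextx, S.ev0_euler hh]; abel
      have e3 : s + h + θ.1 = s + l * h := by rw [hlh]; ring
      rw [nextx, e1, e2, e3]
      have e4 : ev0 S.hr₀ (c.x ω) + l • (ev0 S.hr₀ (c.nextx K z ω) - ev0 S.hr₀ (c.x ω))
          - S.Y η ω (s + l * h)
          = ((1 - l) • (ev0 S.hr₀ (c.x ω) - S.Y η ω s)
            + l • (ev0 S.hr₀ (c.nextx K z ω) - S.Y η ω (s + h)))
            + ((1 - l) • S.Y η ω s + l • S.Y η ω (s + h) - S.Y η ω (s + l * h)) := by module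
      rw [e4]
      refine (norm_add_le _ _).trans (add_le_add ?_ hi)
      refine (norm_add_le _ _).trans ?_
      rw [norm_smul, norm_smul, Real.norm_of_nonneg hl.1, Real.norm_of_nonneg (by linarith [hl.2])]
      have hb1 : ‖ev0 S.hr₀ (c.x ω) - S.Y η ω s‖ ≤ Real.exp h * c.nextR K z ω :=
        (c.ev_le ω hω.1.1).trans hRh
      have hb2 : ‖ev0 S.hr₀ (c.nextx K z ω) - S.Y η ω (s + h)‖ ≤ Real.exp h * c.nextR K z ω :=
        hR2.trans (le_mul_of_one_le_left hR0 (Real.one_le_exp hh.le))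
      have hb3 : Real.exp h * c.nextR K z ω ≤ Real.exp (h - θ.1) * c.nextR K z ω :=
        mul_le_mul_of_nonneg_right (Real.exp_le_exp.2 (by linarith [θ.2.2])) hR0
      nlinarith [mul_le_mul_of_nonneg_left hb1 (by linarith [hl.2] : 0 ≤ 1 - l),
        mul_le_mul_of_nonneg_left hb2 hl.1]

/-- The initial state. -/
def Coupled.init (ξ : Seg d r₀) (hη : ‖η‖ ≤ N) (hh : 0 ≤ h) (hε : 0 ≤ ε) (hR : ‖ξ - η‖ + ε ≤ N) :
    Coupled S η N ε T h 0 where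
  x := fun _ => ξ
  R := fun _ => ‖ξ - η‖ + ε
  G := univ
  hx := stronglyMeasurable_const
  hR := stronglyMeasurable_const
  hG := MeasurableSet.univ
  ball := fun ω _ r hr => by
    rw [le_antisymm hr.2 hr.1, S.seg_zero]
    exact hη
  le_R := fun _ _ => by simp
  R_le := fun _ _ => hR
  ev_le := fun ω _ => by
    have := S.norm_ev0_le (ξ - η)
    have e := S.ev0_seg η 0 ω
    rw [S.seg_zero, max_self] at e
    rw [← e]
    have e' : ev0 S.hr₀ (ξ - η) = ev0 S.hr₀ ξ - ev0 S.hr₀ η := rfl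
    rw [← e']
    linarith
  seg_le := fun ω _ θ => by
    rw [S.seg_zero]
    have h1 : ‖ξ θ - η θ‖ ≤ ‖ξ - η‖ := (ξ - η).norm_coe_le_norm θ
    have h2 : 1 ≤ Real.exp (h - θ.1) := Real.one_le_exp (by linarith [θ.2.2])
    have h3 : 0 ≤ ‖ξ - η‖ + ε := add_nonneg (norm_nonneg _) hε
    have h4 := osc_nonneg (S := S) (η := η) (T := T) (h := h) ((norm_nonneg _).trans hη) ω
    nlinarith

end PathSDE

/-- `f` is integrable with integral at most `r`. -/
def IntLE {Ω : Type*} [MeasurableSpace Ω] (P : Measure Ω) (f : Ω → ℝ) (r : ℝ) : Prop :=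
  Integrable f P ∧ ∫ ω, f ω ∂P ≤ r

namespace IntLE

variable {Ω : Type*} [MeasurableSpace Ω] {P : Measure Ω} {f g : Ω → ℝ} {r q : ℝ}

lemma add (hf : IntLE P f r) (hg : IntLE P g q) : IntLE P (fun ω => f ω + g ω) (r + q) :=
  ⟨hf.1.add hg.1, by rw [integral_add hf.1 hg.1]; exact add_le_add hf.2 hg.2⟩

lemma const_mul (hf : IntLE P f r) {c : ℝ} (hc : 0 ≤ c) : IntLE P (fun ω => c * f ω) (c * r) :=
  ⟨hf.1.const_mul c, by rw [integral_const_mul]; exact mul_le_mul_of_nonneg_left hf.2 hc⟩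

lemma mono (hg : IntLE P g r) (hf : AEStronglyMeasurable f P) (h0 : ∀ ω, 0 ≤ f ω)
    (h : ∀ ω, f ω ≤ g ω) : IntLE P f r :=
  ⟨hg.1.mono' hf (ae_of_all _ fun ω => by rw [Real.norm_of_nonneg (h0 ω)]; exact h ω),
    (integral_mono_of_nonneg (ae_of_all _ h0) hg.1 (ae_of_all _ h)).trans hg.2⟩

lemma const [IsProbabilityMeasure P] (c : ℝ) : IntLE P (fun _ => c) c :=
  ⟨integrable_const c, by simp⟩

lemma of_integrable (hf : Integrable f P) : IntLE P f (∫ ω, f ω ∂P) := ⟨hf, le_rfl⟩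

lemma le_right (hf : IntLE P f r) (h : r ≤ q) : IntLE P f q := ⟨hf.1, hf.2.trans h⟩

end IntLE

/-- The fourth power of the norm after one steered Euler step. -/
lemma norm_pow_four_step_le {E : Type*} [NormedAddCommGroup E] [InnerProductSpace ℝ E] {C₁ : ℝ}
    (hC₁ : 0 ≤ C₁) (hC : ∀ x w : E, (‖x + w‖ ^ 2) ^ 2 ≤ (‖x‖ ^ 2) ^ 2
      + 2 * ‖x‖ ^ 2 * (2 * ⟪x, w⟫) + C₁ * (‖x‖ ^ 2 * ‖w‖ ^ 2 + (‖w‖ ^ 2) ^ 2))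
    {D B e n : E} {R ρ N h K l c δ β m M : ℝ} (hρ : 0 < ρ) (hρR : ρ ≤ R) (hRN : R ≤ N)
    (hD : ‖D‖ ≤ R) (hDB : ⟪D, B⟫ ≤ l * (c ^ 2 * R ^ 2 + δ ^ 2)) (hB : ‖B‖ ≤ β)
    (he : ‖e‖ ≤ h * m) (hmM : m ≤ M) (hh : 0 ≤ h) (hh1 : h ≤ 1) (hK : 0 ≤ K) (hl : 0 ≤ l) :
    ‖D + (h • B - (h * K) • D - e + n)‖ ^ 4 / R ^ 2
      ≤ (1 - 4 * h * K) * (‖D‖ ^ 4 / R ^ 2) + 4 * h * l * c ^ 2 * ‖D‖ ^ 2 + 4 * h * l * δ ^ 2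
        + 4 * h * N * m + 4 * ⟪(‖D‖ ^ 2 / R ^ 2) • D, n⟫
        + C₁ * 2 * ((‖D‖ ^ 2 / R ^ 2) * ‖n‖ ^ 2)
        + C₁ * (2 * (β + K * N + M) ^ 2 + 8 * (β + K * N + M) ^ 4 / ρ ^ 2) * h ^ 2
        + C₁ * 8 / ρ ^ 2 * ‖n‖ ^ 4 := by
  have hR : 0 < R := hρ.trans_le hρR
  have hN : 0 ≤ N := hR.le.trans hRN
  set A := β + K * N + M with hA
  set W := h • B - (h * K) • D - e + n with hW
  have hm0 : 0 ≤ h * m := (norm_nonneg _).trans he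
  have hβ : 0 ≤ β := (norm_nonneg _).trans hB
  set g := ‖D‖ ^ 2 / R ^ 2 with hg
  have hg0 : 0 ≤ g := by positivity
  have hg1 : g ≤ 1 := by
    rw [hg, div_le_one (by positivity)]; exact pow_le_pow_left₀ (norm_nonneg _) hD 2
  have hgR : g * R ^ 2 = ‖D‖ ^ 2 := div_mul_cancel₀ _ (by positivity)
  have hgD : g * ‖D‖ ^ 2 = ‖D‖ ^ 4 / R ^ 2 := by rw [hg]; ring
  have hWn : ‖W‖ ≤ h * A + ‖n‖ := by
    have h1 : ‖h • B‖ ≤ h * β := by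
      rw [norm_smul, Real.norm_of_nonneg hh]; exact mul_le_mul_of_nonneg_left hB hh
    have h2 : ‖(h * K) • D‖ ≤ h * K * N := by
      rw [norm_smul, Real.norm_of_nonneg (by positivity)]
      exact mul_le_mul_of_nonneg_left (hD.trans hRN) (by positivity)
    have h3 := norm_add_le (h • B - (h * K) • D - e) n
    have h4 := norm_sub_le (h • B - (h * K) • D) e
    have h5 := norm_sub_le (h • B) ((h * K) • D)
    have h6 := mul_le_mul_of_nonneg_left hmM hh
    rw [hA]; linarith
  have hW2 : ‖W‖ ^ 2 ≤ 2 * (h ^ 2 * A ^ 2) + 2 * ‖n‖ ^ 2 := by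
    have := pow_le_pow_left₀ (norm_nonneg _) hWn 2
    nlinarith [sq_nonneg (h * A - ‖n‖)]
  have hW4 : (‖W‖ ^ 2) ^ 2 ≤ 8 * (h ^ 2 * A ^ 4) + 8 * ‖n‖ ^ 4 := by
    have h1 := pow_le_pow_left₀ (sq_nonneg _) hW2 2
    have h2 : h ^ 4 * A ^ 4 ≤ h ^ 2 * A ^ 4 :=
      mul_le_mul_of_nonneg_right (pow_le_pow_of_le_one hh hh1 (by norm_num)) (by positivity)
    nlinarith [sq_nonneg (h ^ 2 * A ^ 2 - ‖n‖ ^ 2)]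
  have hinner : ⟪D, W⟫ = h * ⟪D, B⟫ - h * K * ‖D‖ ^ 2 - ⟪D, e⟫ + ⟪D, n⟫ := by
    rw [hW, inner_add_right, inner_sub_right, inner_sub_right, real_inner_smul_right,
      real_inner_smul_right, real_inner_self_eq_norm_sq]
  have hDe : -⟪D, e⟫ ≤ N * (h * m) := by
    have h1 := neg_le_of_abs_le (abs_real_inner_le_norm D e)
    have h2 := mul_le_mul (hD.trans hRN) he (norm_nonneg _) hN
    linarith
  have hin : g * ⟪D, W⟫ ≤ h * l * c ^ 2 * ‖D‖ ^ 2 + h * l * δ ^ 2 - h * K * (‖D‖ ^ 4 / R ^ 2)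
      + h * N * m + g * ⟪D, n⟫ := by
    have h1 : g * (h * ⟪D, B⟫) ≤ h * l * c ^ 2 * ‖D‖ ^ 2 + h * l * δ ^ 2 := by
      have a1 := mul_le_mul_of_nonneg_left hDB (mul_nonneg hg0 hh)
      have a2 : g * (h * l * δ ^ 2) ≤ h * l * δ ^ 2 :=
        mul_le_of_le_one_left (by positivity) hg1
      have a3 : g * h * (l * (c ^ 2 * R ^ 2 + δ ^ 2))
        = h * l * c ^ 2 * (g * R ^ 2) + g * (h * l * δ ^ 2) := by ring
      rw [a3, hgR] at a1
      linarith
    have h2 : g * (-⟪D, e⟫) ≤ h * N * m := by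
      have a1 := mul_le_mul_of_nonneg_left hDe hg0
      have a2 : g * (N * (h * m)) ≤ N * (h * m) := mul_le_of_le_one_left (by positivity) hg1
      linarith
    rw [hinner, ← hgD]
    linarith
  have hq : 0 ≤ 1 / R ^ 2 := by positivity
  have hqρ : 1 / R ^ 2 ≤ 1 / ρ ^ 2 :=
    one_div_le_one_div_of_le (by positivity) (pow_le_pow_left₀ hρ.le hρR 2)
  have hmain := mul_le_mul_of_nonneg_left (hC D W) hq
  have e1 : 1 / R ^ 2 * (‖D + W‖ ^ 2) ^ 2 = ‖D + W‖ ^ 4 / R ^ 2 := by ring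
  have e2 : 1 / R ^ 2 * ((‖D‖ ^ 2) ^ 2 + 2 * ‖D‖ ^ 2 * (2 * ⟪D, W⟫)
      + C₁ * (‖D‖ ^ 2 * ‖W‖ ^ 2 + (‖W‖ ^ 2) ^ 2))
      = ‖D‖ ^ 4 / R ^ 2 + 4 * (g * ⟪D, W⟫) + C₁ * (g * ‖W‖ ^ 2 + 1 / R ^ 2 * (‖W‖ ^ 2) ^ 2) := by
    rw [hg]; ring
  rw [e1, e2] at hmain
  have b1 : g * ‖W‖ ^ 2 ≤ 2 * (h ^ 2 * A ^ 2) + 2 * (g * ‖n‖ ^ 2) := by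
    have a1 := mul_le_mul_of_nonneg_left hW2 hg0
    have a2 : g * (2 * (h ^ 2 * A ^ 2)) ≤ 2 * (h ^ 2 * A ^ 2) :=
      mul_le_of_le_one_left (by positivity) hg1
    linarith
  have b2 : 1 / R ^ 2 * (‖W‖ ^ 2) ^ 2 ≤ 1 / ρ ^ 2 * (8 * (h ^ 2 * A ^ 4) + 8 * ‖n‖ ^ 4) :=
    mul_le_mul hqρ hW4 (by positivity) (by positivity)
  have b3 := mul_le_mul_of_nonneg_left (add_le_add b1 b2) hC₁
  have e3 : C₁ * (2 * (h ^ 2 * A ^ 2) + 2 * (g * ‖n‖ ^ 2)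
      + 1 / ρ ^ 2 * (8 * (h ^ 2 * A ^ 4) + 8 * ‖n‖ ^ 4))
      = C₁ * 2 * (g * ‖n‖ ^ 2) + C₁ * (2 * A ^ 2 + 8 * A ^ 4 / ρ ^ 2) * h ^ 2
        + C₁ * 8 / ρ ^ 2 * ‖n‖ ^ 4 := by ring
  rw [e3] at b3
  rw [real_inner_smul_left]
  linarith

namespace PathSDE

variable {S : PathSDE d r₀ Ω P}
variable {η : Seg d r₀} {N ε T h s : ℝ}

/-- Error of the noise approximation over one step. -/
def Coupled.err (c : Coupled S η N ε T h s) (z : Ω → EucSp d) (ω : Ω) : EucSp d :=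
  √h • S.σ (c.x ω) (z ω) - (S.mg η (s + h) ω - S.mg η s ω)

/-- Error of the drift approximation over one step. -/
def Coupled.drErr (_c : Coupled S η N ε T h s) (ω : Ω) : EucSp d :=
  S.dr η (s + h) ω - S.dr η s ω - h • S.b (S.seg η s ω)

lemma Coupled.next_ev_eq (c : Coupled S η N ε T h s) (hs : 0 ≤ s) (hh : 0 < h) (K : ℝ)
    (z : Ω → EucSp d) (ω : Ω) :
    ev0 S.hr₀ (c.nextx K z ω) - S.Y η ω (s + h)
      = c.D ω + (h • (S.b (c.x ω) - S.b (S.seg η s ω)) - (h * K) • c.D ω - c.drErr ω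
        + c.err z ω) := by
  have h1 : S.σ (c.x ω) (c.w K ω) = -((√h * K) • c.D ω) := by
    rw [Coupled.w, map_neg, map_smul]
    have := congrArg (fun L => L (c.D ω)) (S.hσinv (c.x ω)).1
    simp only [ContinuousLinearMap.comp_apply, ContinuousLinearMap.id_apply] at this
    rw [this]
  rw [Coupled.nextx, S.ev0_euler hh, eulerInc, map_add, h1, S.Y_eq η hs (add_nonneg hs hh.le) ω]
  have h2 : √h • -((√h * K) • c.D ω) = -((h * K) • c.D ω) := by
    rw [smul_neg, smul_smul, ← mul_assoc, Real.mul_self_sqrt hh.le]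
  rw [smul_add, h2]
  simp only [Coupled.D, Coupled.drErr, Coupled.err, smul_sub]
  abel

lemma Coupled.norm_seg_sub_le (c : Coupled S η N ε T h s) (hε : 0 ≤ ε) (hN : 0 ≤ N) (hh1 : h ≤ 1)
    {ω : Ω} (hω : ω ∈ c.G) :
    ‖c.x ω - S.seg η s ω‖ ≤ Real.exp (1 + r₀) * c.R ω + S.osc η N T h ω := by
  have hR : 0 ≤ c.R ω := le_trans (by positivity) (c.le_R ω hω)
  have ho := osc_nonneg (S := S) (η := η) (T := T) (h := h) hN ω
  refine (ContinuousMap.norm_le _ (by positivity)).2 fun θ => ?_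
  refine (c.seg_le ω hω θ).trans (add_le_add_left ?_ _)
  exact mul_le_mul_of_nonneg_right (Real.exp_le_exp.2 (by linarith [θ.2.1])) hR

lemma Coupled.norm_x_le (c : Coupled S η N ε T h s) (hs : 0 ≤ s) (hε : 0 ≤ ε) (hN : 0 ≤ N)
    (hh1 : h ≤ 1) {ω : Ω} (hω : ω ∈ c.G) :
    ‖c.x ω‖ ≤ N + (Real.exp (1 + r₀) * N + (2 * N + 1)) := by
  have h1 := c.norm_seg_sub_le hε hN hh1 hω
  have h2 := c.ball hω s ⟨hs, le_rfl⟩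
  have h3 := mul_le_mul_of_nonneg_left (c.R_le ω hω) (Real.exp_pos (1 + r₀)).le
  have h4 : S.osc η N T h ω ≤ 2 * N + 1 :=
    mul_le_of_le_one_right (by linarith) (modulus_le_one ω)
  have h5 := norm_sub_norm_le (c.x ω) (S.seg η s ω)
  linarith

lemma Coupled.measurable_err (c : Coupled S η N ε T h s) (hh : 0 ≤ h) {z : Ω → EucSp d}
    (hz : StronglyMeasurable[S.ℱ (s + h)] z) : StronglyMeasurable (c.err z) := by
  have h1 : Continuous fun p : (EucSp d →L[ℝ] EucSp d) × EucSp d => √h • p.1 p.2 := by fun_prop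
  have h2 := h1.comp_stronglyMeasurable
    ((S.continuous_σ.comp_stronglyMeasurable (c.hx.mono (S.ℱ.le s))).prodMk
      (hz.mono (S.ℱ.le (s + h))))
  exact h2.sub ((S.stronglyMeasurable_mg_sub η (le_add_of_nonneg_right hh)).mono (S.ℱ.le _))

lemma Coupled.intLE_err (c : Coupled S η N ε T h s) (hs : 0 ≤ s) (hh : 0 ≤ h) {z : Ω → EucSp d}
    (hz : StronglyMeasurable[S.ℱ (s + h)] z)
    (hind : ∀ A, MeasurableSet[S.ℱ s] A → (P.restrict A).map z = P A • stdGaussian (EucSp d)) :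
    IntLE P (fun ω => ‖c.err z ω‖ ^ 4)
      (8 * (S.bd ^ 4 * (∫ y, ‖y‖ ^ 4 ∂(stdGaussian (EucSp d))) + S.momC 1) * h ^ 2) := by
  have := S.hP
  have hone : StronglyMeasurable[S.ℱ s] fun _ : Ω => (1:ℝ) := stronglyMeasurable_const
  have hz4 := S.integral_mul_norm_pow_noise (hz.measurable.mono (S.ℱ.le _) le_rfl) hind 4 hone
    (cg := 1) (by simp)
  have hm4 := S.integral_mul_norm_pow_le η 1 hs (le_add_of_nonneg_right hh : s ≤ s + h) hone
    (cg := 1) (by simp) (by simp)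
  simp only [one_mul, integral_const, probReal_univ, smul_eq_mul, mul_one, add_sub_cancel_left]
    at hz4 hm4
  have hz4' : IntLE P (fun ω => ‖z ω‖ ^ 4) (∫ y, ‖y‖ ^ 4 ∂(stdGaussian (EucSp d))) :=
    ⟨hz4.1, hz4.2.le⟩
  have hb : 0 ≤ S.bd := zero_le_one.trans S.one_le_bd
  have hm4' : IntLE P (fun ω => ‖S.mg η (s + h) ω - S.mg η s ω‖ ^ 4) (S.momC 1 * h ^ 2) := hm4
  refine ((((hz4'.const_mul (by positivity : 0 ≤ h ^ 2 * S.bd ^ 4)).add hm4').const_mul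
    (by norm_num : (0:ℝ) ≤ 8)).mono (f := fun ω => ‖c.err z ω‖ ^ 4) ((c.measurable_err hh hz).norm.pow 4).aestronglyMeasurable
    (fun ω => by positivity) fun ω => ?_).le_right (le_of_eq (by ring))
  have h1 : ‖√h • S.σ (c.x ω) (z ω)‖ ≤ √h * (S.bd * ‖z ω‖) := by
    rw [norm_smul, Real.norm_of_nonneg (Real.sqrt_nonneg h)]
    exact mul_le_mul_of_nonneg_left (((S.σ (c.x ω)).le_opNorm _).trans
      (mul_le_mul_of_nonneg_right (S.norm_σ_le _) (norm_nonneg _))) (Real.sqrt_nonneg _)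
  have h2 := norm_sub_le (√h • S.σ (c.x ω) (z ω)) (S.mg η (s + h) ω - S.mg η s ω)
  have h3 : ‖c.err z ω‖ ≤ √h * (S.bd * ‖z ω‖) + ‖S.mg η (s + h) ω - S.mg η s ω‖ :=
    h2.trans (add_le_add_left h1 _)
  have h4 := pow_le_pow_left₀ (norm_nonneg _) h3 4
  have h5 : (√h * (S.bd * ‖z ω‖)) ^ 4 = h ^ 2 * S.bd ^ 4 * ‖z ω‖ ^ 4 := by
    rw [mul_pow, mul_pow, (by norm_num : (4:ℕ) = 2 * 2), pow_mul √h, Real.sq_sqrt hh]; ring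
  have h6 : (√h * (S.bd * ‖z ω‖) + ‖S.mg η (s + h) ω - S.mg η s ω‖) ^ 4
      ≤ 2 ^ 3 * ((√h * (S.bd * ‖z ω‖)) ^ 4 + ‖S.mg η (s + h) ω - S.mg η s ω‖ ^ 4) :=
    add_pow_le (by positivity) (norm_nonneg _) 4
  rw [h5] at h6
  linarith

lemma Coupled.V_next_le (c : Coupled S η N ε T h s) (hε : 0 < ε) (hs : 0 ≤ s)
    (hh : 0 < h) (hT : s + h ≤ T) (hN : 0 ≤ N) (K : ℝ) {z : Ω → EucSp d}
    (hz : StronglyMeasurable[S.ℱ (s + h)] z) {ω : Ω} (hω : ω ∈ c.G) :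
    (c.next hs hh hT hN K hz).V ω ≤ Real.exp (-(2 * h)) * c.R ω ^ 2
      + Real.exp (2 * h) * (‖ev0 S.hr₀ (c.nextx K z ω) - S.Y η ω (s + h)‖ ^ 4 / c.R ω ^ 2) := by
  have hR : 0 < c.R ω := lt_of_lt_of_le (by positivity) (c.le_R ω hω)
  have h1 := lyapunov_max_le 2 (ρ := Real.exp (-h) * c.R ω)
    (Q := ‖ev0 S.hr₀ (c.nextx K z ω) - S.Y η ω (s + h)‖) (by positivity)
  refine h1.trans (le_of_eq ?_)
  have e1 : (Real.exp (-h) * c.R ω) ^ 2 = Real.exp (-(2 * h)) * c.R ω ^ 2 := by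
    rw [mul_pow, ← Real.exp_nat_mul]; norm_num
  have e2 : Real.exp (2 * h) = (Real.exp (-(2 * h)))⁻¹ := by rw [Real.exp_neg, inv_inv]
  rw [e1, e2]
  have : 0 < Real.exp (-(2 * h)) := Real.exp_pos _
  norm_num
  field_simp

lemma Coupled.R_sq_le_V (c : Coupled S η N ε T h s) (ω : Ω) : c.R ω ^ 2 ≤ c.V ω :=
  le_add_of_nonneg_right (by positivity)

lemma Coupled.V_nonneg (c : Coupled S η N ε T h s) (ω : Ω) : 0 ≤ c.V ω :=
  (sq_nonneg _).trans (c.R_sq_le_V ω)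

lemma Coupled.V_le (c : Coupled S η N ε T h s) (hε : 0 < ε) {ω : Ω} (hω : ω ∈ c.G) :
    c.V ω ≤ 2 * c.R ω ^ 2 := by
  have hR : 0 < c.R ω := lt_of_lt_of_le (by positivity) (c.le_R ω hω)
  have h1 : ‖c.D ω‖ ^ 4 ≤ c.R ω ^ 4 := pow_le_pow_left₀ (norm_nonneg _) (c.ev_le ω hω) 4
  have h2 : ‖c.D ω‖ ^ 4 / c.R ω ^ 2 ≤ c.R ω ^ 2 := by
    rw [div_le_iff₀ (by positivity)]; linarith
  unfold Coupled.V
  linarith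

lemma Coupled.stronglyMeasurable_V (c : Coupled S η N ε T h s) (hs : 0 ≤ s) :
    StronglyMeasurable[S.ℱ s] c.V := by
  have h1 : Measurable fun p : ℝ × EucSp d => p.1 ^ 2 + ‖p.2‖ ^ 4 / p.1 ^ 2 := by fun_prop
  exact (h1.comp (c.hR.measurable.prodMk
    (c.stronglyMeasurable_D hs).measurable)).stronglyMeasurable

lemma Coupled.integrable_V (c : Coupled S η N ε T h s) (hε : 0 < ε) (hs : 0 ≤ s) :
    Integrable (c.G.indicator c.V) P := by
  have := S.hP
  refine Integrable.of_bound (((c.stronglyMeasurable_V hs).mono (S.ℱ.le s)).indicator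
    (S.ℱ.le s _ c.hG)).aestronglyMeasurable (2 * N ^ 2) (ae_of_all _ fun ω => ?_)
  by_cases hω : ω ∈ c.G
  · rw [indicator_of_mem hω, Real.norm_of_nonneg (c.V_nonneg ω)]
    have hR : 0 ≤ c.R ω := le_trans (by positivity) (c.le_R ω hω)
    have := pow_le_pow_left₀ hR (c.R_le ω hω) 2
    linarith [c.V_le hε hω]
  · rw [indicator_of_notMem hω, norm_zero]; positivity

end PathSDE

namespace PathSDE

variable {S : PathSDE d r₀ Ω P}
variable {η : Seg d r₀} {N ε T h s : ℝ}

/-- The weight `‖D‖² / R²` on the good set. -/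
def Coupled.g (c : Coupled S η N ε T h s) : Ω → ℝ :=
  c.G.indicator fun ω => ‖c.D ω‖ ^ 2 / c.R ω ^ 2

/-- `‖D‖²` on the good set. -/
def Coupled.D2 (c : Coupled S η N ε T h s) : Ω → ℝ := c.G.indicator fun ω => ‖c.D ω‖ ^ 2

/-- `‖D‖⁴ / R²` on the good set. -/
def Coupled.D4 (c : Coupled S η N ε T h s) : Ω → ℝ :=
  c.G.indicator fun ω => ‖c.D ω‖ ^ 4 / c.R ω ^ 2

/-- `R²` on the good set. -/
def Coupled.R2 (c : Coupled S η N ε T h s) : Ω → ℝ := c.G.indicator fun ω => c.R ω ^ 2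

/-- The direction tested against the noise error. -/
def Coupled.v (c : Coupled S η N ε T h s) : Ω → EucSp d :=
  c.G.indicator fun ω => (‖c.D ω‖ ^ 2 / c.R ω ^ 2) • c.D ω

/-- Upper bound for `‖D'‖⁴ / R²` after one step. -/
def Coupled.phi (c : Coupled S η N ε T h s) (K l C₁ a₁ a₂ a₃ a₄ : ℝ) (z : Ω → EucSp d) (ω : Ω) :
    ℝ :=
  (1 - 4 * h * K) * c.D4 ω + 4 * h * l * Real.exp (1 + r₀) ^ 2 * c.D2 ω
    + h * a₁ * modulus (S.seg η) T h ω
    + h * a₂ * modulus (fun r ω => S.b (S.seg η r ω)) T h ω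
    + 4 * ⟪c.v ω, c.err z ω⟫ + C₁ * 2 * (c.g ω * ‖c.err z ω‖ ^ 2) + a₃ * h ^ 2
    + a₄ * ‖c.err z ω‖ ^ 4

lemma Coupled.pow_four_le_phi (c : Coupled S η N ε T h s) {K l C₁ : ℝ} (hK : 0 ≤ K) (hl : 0 ≤ l)
    (hA2 : ∀ x y : Seg d r₀, 2 * ⟪ev0 S.hr₀ x - ev0 S.hr₀ y, S.b x - S.b y⟫ ≤ l * ‖x - y‖ ^ 2)
    (hC₁ : 0 ≤ C₁) (hC : ∀ x w : EucSp d, (‖x + w‖ ^ 2) ^ 2 ≤ (‖x‖ ^ 2) ^ 2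
      + 2 * ‖x‖ ^ 2 * (2 * ⟪x, w⟫) + C₁ * (‖x‖ ^ 2 * ‖w‖ ^ 2 + (‖w‖ ^ 2) ^ 2))
    (hs : 0 ≤ s) (hh : 0 < h) (hh1 : h ≤ 1) (hT : s + h ≤ T) (hN : 0 ≤ N) (hε : 0 < ε)
    {β A : ℝ} (hβ : β = 2 * S.bdb (N + (Real.exp (1 + r₀) * N + (2 * N + 1))))
    (hA : A = β + K * N + 2 * S.bdb N) (z : Ω → EucSp d) (ω : Ω) :
    (c.G ∩ S.inBall η N (s + h)).indicator
      (fun ω => ‖ev0 S.hr₀ (c.nextx K z ω) - S.Y η ω (s + h)‖ ^ 4 / c.R ω ^ 2) ω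
      ≤ c.phi K l C₁ (4 * l * (2 * N + 1) ^ 2) (8 * N * S.bdb N)
        (C₁ * (2 * A ^ 2 + 8 * A ^ 4 / (ε * Real.exp (-T)) ^ 2))
        (C₁ * 8 / (ε * Real.exp (-T)) ^ 2) z ω := by
  have hm1 := modulus_nonneg (Z := S.seg η) (T := T) (τ := h) ω
  have hm1' := modulus_le_one (Z := S.seg η) (T := T) (τ := h) ω
  have hm2 := modulus_nonneg (Z := fun r ω => S.b (S.seg η r ω)) (T := T) (τ := h) ω
  have hm2' := modulus_le_one (Z := fun r ω => S.b (S.seg η r ω)) (T := T) (τ := h) ω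
  have hb1 := S.one_le_bdb N
  by_cases hG : ω ∈ c.G
  swap
  · rw [indicator_of_notMem fun h' => hG h'.1]
    simp only [Coupled.phi, Coupled.D4, Coupled.D2, Coupled.v, Coupled.g, indicator_of_notMem hG,
      inner_zero_left, mul_zero, zero_mul, add_zero, zero_add]
    have : 0 ≤ S.bdb N := by linarith
    positivity
  have hR : ε * Real.exp (-T) ≤ c.R ω := le_trans (mul_le_mul_of_nonneg_left
    (Real.exp_le_exp.2 (by linarith)) hε.le) (c.le_R ω hG)
  have hR0 : 0 < c.R ω := lt_of_lt_of_le (by positivity) hR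
  have hseg := c.norm_seg_sub_le hε.le hN hh1 hG
  have hx := c.norm_x_le hs hε.le hN hh1 hG
  have ho := osc_nonneg (S := S) (η := η) (T := T) (h := h) hN ω
  have hDR : ‖c.D ω‖ ≤ c.R ω := c.ev_le ω hG
  have hDB : ⟪c.D ω, S.b (c.x ω) - S.b (S.seg η s ω)⟫
      ≤ l * (Real.exp (1 + r₀) ^ 2 * c.R ω ^ 2 + S.osc η N T h ω ^ 2) := by
    have h1 := hA2 (c.x ω) (S.seg η s ω)
    rw [S.ev0_seg, max_eq_left hs] at h1
    have h2 := pow_le_pow_left₀ (norm_nonneg _) hseg 2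
    have h3 : (Real.exp (1 + r₀) * c.R ω + S.osc η N T h ω) ^ 2
        ≤ 2 * (Real.exp (1 + r₀) ^ 2 * c.R ω ^ 2 + S.osc η N T h ω ^ 2) := by
      nlinarith [sq_nonneg (Real.exp (1 + r₀) * c.R ω - S.osc η N T h ω)]
    have h4 := mul_le_mul_of_nonneg_left (h2.trans h3) hl
    change 2 * ⟪c.D ω, _⟫ ≤ _ at h1
    linarith
  have hB : ‖S.b (c.x ω) - S.b (S.seg η s ω)‖ ≤ β := by
    have h1 := S.norm_b_le hx
    have h2 : ‖S.seg η s ω‖ ≤ N + (Real.exp (1 + r₀) * N + (2 * N + 1)) := by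
      have := c.ball hG s ⟨hs, le_rfl⟩
      have : 0 ≤ Real.exp (1 + r₀) * N := by positivity
      linarith
    have h3 := S.norm_b_le h2
    have := norm_sub_le (S.b (c.x ω)) (S.b (S.seg η s ω))
    rw [hβ]; linarith
  have key : ∀ e : EucSp d,
      ‖e‖ ≤ h * (2 * S.bdb N * modulus (fun r ω => S.b (S.seg η r ω)) T h ω) →
      ‖c.D ω + (h • (S.b (c.x ω) - S.b (S.seg η s ω)) - (h * K) • c.D ω - e + c.err z ω)‖ ^ 4
        / c.R ω ^ 2 ≤ c.phi K l C₁ (4 * l * (2 * N + 1) ^ 2) (8 * N * S.bdb N)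
        (C₁ * (2 * A ^ 2 + 8 * A ^ 4 / (ε * Real.exp (-T)) ^ 2))
        (C₁ * 8 / (ε * Real.exp (-T)) ^ 2) z ω := by
    intro e he
    have hmM : 2 * S.bdb N * modulus (fun r ω => S.b (S.seg η r ω)) T h ω ≤ 2 * S.bdb N :=
      mul_le_of_le_one_right (by linarith) hm2'
    refine (norm_pow_four_step_le hC₁ hC (by positivity : 0 < ε * Real.exp (-T)) hR (c.R_le ω hG)
      hDR hDB hB he hmM hh.le hh1 hK hl).trans ?_
    have hosc : S.osc η N T h ω ^ 2 ≤ (2 * N + 1) ^ 2 * modulus (S.seg η) T h ω := by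
      rw [osc, mul_pow]
      exact mul_le_mul_of_nonneg_left (pow_le_of_le_one hm1 hm1' (by norm_num)) (by positivity)
    have hosc' := mul_le_mul_of_nonneg_left hosc (by positivity : 0 ≤ 4 * h * l)
    simp only [Coupled.phi, Coupled.D4, Coupled.D2, Coupled.v, Coupled.g, indicator_of_mem hG, hA]
    linarith
  by_cases hb : ω ∈ S.inBall η N (s + h)
  · have hGb : ω ∈ c.G ∩ S.inBall η N (s + h) := ⟨hG, hb⟩
    rw [indicator_of_mem hGb, c.next_ev_eq hs hh K z ω]
    refine key _ ?_
    have := S.norm_dr_sub_sub_le η hs (le_add_of_nonneg_right hh.le) hT hb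
    rwa [add_sub_cancel_left] at this
  · rw [indicator_of_notMem fun h' => hb h'.2]
    refine le_trans ?_ (key 0 ?_)
    · positivity
    · rw [norm_zero]
      have : 0 ≤ S.bdb N := by linarith
      positivity

lemma Coupled.step_le (c : Coupled S η N ε T h s) (hε : 0 < ε) (hs : 0 ≤ s)
    (hh : 0 < h) (hT : s + h ≤ T) (hN : 0 ≤ N) (K : ℝ) {z : Ω → EucSp d}
    (hz : StronglyMeasurable[S.ℱ (s + h)] z) {Φ : Ω → ℝ}
    (hΦ : ∀ ω, (c.G ∩ S.inBall η N (s + h)).indicator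
      (fun ω => ‖ev0 S.hr₀ (c.nextx K z ω) - S.Y η ω (s + h)‖ ^ 4 / c.R ω ^ 2) ω ≤ Φ ω) (ω : Ω) :
    (c.G ∩ S.inBall η N (s + h) ∩ {ω | N < c.nextR K z ω}).indicator (fun _ => N ^ 2) ω
      + (c.next hs hh hT hN K hz).G.indicator (c.next hs hh hT hN K hz).V ω
      ≤ Real.exp (-(2 * h)) * c.R2 ω + Real.exp (2 * h) * Φ ω := by
  have hΦω := hΦ ω
  have he : 0 < Real.exp (2 * h) := Real.exp_pos _
  by_cases hω : ω ∈ c.G ∩ S.inBall η N (s + h)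
  · rw [indicator_of_mem hω] at hΦω
    have h1 := c.V_next_le hε hs hh hT hN K hz hω.1
    have h2 := mul_le_mul_of_nonneg_left hΦω he.le
    rw [Coupled.R2, indicator_of_mem hω.1]
    by_cases hN' : c.nextR K z ω ≤ N
    · have hm : ω ∈ (c.next hs hh hT hN K hz).G := ⟨hω, hN'⟩
      rw [indicator_of_notMem fun h' => absurd hN' (not_le.2 h'.2), indicator_of_mem hm]
      linarith
    · have hm : ω ∈ c.G ∩ S.inBall η N (s + h) ∩ {ω | N < c.nextR K z ω} :=
        ⟨hω, not_le.1 hN'⟩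
      rw [indicator_of_mem hm, indicator_of_notMem fun h' => hN' h'.2]
      have h3 := (c.next hs hh hT hN K hz).R_sq_le_V ω
      have h4 : N ^ 2 ≤ (c.nextR K z ω) ^ 2 := pow_le_pow_left₀ hN (not_le.1 hN').le 2
      change (c.nextR K z ω) ^ 2 ≤ _ at h3
      linarith
  · rw [indicator_of_notMem hω] at hΦω
    rw [indicator_of_notMem fun h' => hω h'.1, indicator_of_notMem fun h' => hω h'.1, Coupled.R2]
    have h1 : 0 ≤ c.G.indicator (fun ω => c.R ω ^ 2) ω :=
      indicator_nonneg (fun _ _ => sq_nonneg _) ω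
    have h2 := mul_nonneg he.le hΦω
    have h3 := mul_nonneg (Real.exp_pos (-(2 * h))).le h1
    linarith

end PathSDE

namespace PathSDE

variable {S : PathSDE d r₀ Ω P}
variable {η : Seg d r₀} {N ε T h s : ℝ}

lemma Coupled.stronglyMeasurable_indicator (c : Coupled S η N ε T h s) (hs : 0 ≤ s)
    {F : ℝ × EucSp d → ℝ} (hF : Measurable F) :
    StronglyMeasurable[S.ℱ s] (c.G.indicator fun ω => F (c.R ω, c.D ω)) :=
  ((hF.comp (c.hR.measurable.prodMk
    (c.stronglyMeasurable_D hs).measurable)).stronglyMeasurable).indicator c.hG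

lemma Coupled.pos_R (c : Coupled S η N ε T h s) (hε : 0 < ε) {ω : Ω} (hω : ω ∈ c.G) : 0 < c.R ω :=
  lt_of_lt_of_le (by positivity) (c.le_R ω hω)

lemma Coupled.g_mem (c : Coupled S η N ε T h s) (hε : 0 < ε) (ω : Ω) : c.g ω ∈ Icc (0:ℝ) 1 := by
  by_cases hω : ω ∈ c.G
  · have hR := c.pos_R hε hω
    have hD : ‖c.D ω‖ ≤ c.R ω := c.ev_le ω hω
    rw [Coupled.g, indicator_of_mem hω]
    exact ⟨by positivity, (div_le_one (by positivity)).2 (pow_le_pow_left₀ (norm_nonneg _) hD 2)⟩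
  · rw [Coupled.g, indicator_of_notMem hω]; simp

lemma Coupled.D2_mem (c : Coupled S η N ε T h s) (ω : Ω) : c.D2 ω ∈ Icc (0:ℝ) (N ^ 2) := by
  by_cases hω : ω ∈ c.G
  · have hD : ‖c.D ω‖ ≤ c.R ω := c.ev_le ω hω
    rw [Coupled.D2, indicator_of_mem hω]
    exact ⟨by positivity, pow_le_pow_left₀ (norm_nonneg _) (hD.trans (c.R_le ω hω)) 2⟩
  · rw [Coupled.D2, indicator_of_notMem hω]; exact ⟨le_rfl, by positivity⟩

lemma Coupled.R2_mem (c : Coupled S η N ε T h s) (hε : 0 < ε) (ω : Ω) :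
    c.R2 ω ∈ Icc (0:ℝ) (N ^ 2) := by
  by_cases hω : ω ∈ c.G
  · rw [Coupled.R2, indicator_of_mem hω]
    exact ⟨by positivity, pow_le_pow_left₀ (c.pos_R hε hω).le (c.R_le ω hω) 2⟩
  · rw [Coupled.R2, indicator_of_notMem hω]; exact ⟨le_rfl, by positivity⟩

lemma Coupled.D4_eq (c : Coupled S η N ε T h s) (ω : Ω) : c.D4 ω = c.g ω * c.D2 ω := by
  by_cases hω : ω ∈ c.G
  · simp only [Coupled.D4, Coupled.g, Coupled.D2, indicator_of_mem hω]; ring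
  · simp [Coupled.D4, Coupled.g, Coupled.D2, indicator_of_notMem hω]

lemma Coupled.D4_mem (c : Coupled S η N ε T h s) (hε : 0 < ε) (ω : Ω) :
    c.D4 ω ∈ Icc (0:ℝ) (N ^ 2) := by
  rw [c.D4_eq]
  have h1 := c.g_mem hε ω
  have h2 := c.D2_mem ω
  exact ⟨mul_nonneg h1.1 h2.1, (mul_le_of_le_one_left h2.1 h1.2).trans h2.2⟩

lemma Coupled.V_eq (c : Coupled S η N ε T h s) (ω : Ω) :
    c.G.indicator c.V ω = c.R2 ω + c.D4 ω := by
  by_cases hω : ω ∈ c.G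
  · simp only [Coupled.D4, Coupled.R2, Coupled.V, indicator_of_mem hω]
  · simp [Coupled.D4, Coupled.R2, indicator_of_notMem hω]

lemma Coupled.D2_le (c : Coupled S η N ε T h s) (hε : 0 < ε) {A : ℝ} (ω : Ω) :
    2 * A * c.D2 ω ≤ c.R2 ω / 2 + 2 * A ^ 2 * c.D4 ω := by
  by_cases hω : ω ∈ c.G
  · have hR := c.pos_R hε hω
    simp only [Coupled.D4, Coupled.R2, Coupled.D2, indicator_of_mem hω]
    have h1 := sq_nonneg (c.R ω - 2 * A * (‖c.D ω‖ ^ 2 / c.R ω))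
    have h2 : (c.R ω - 2 * A * (‖c.D ω‖ ^ 2 / c.R ω)) ^ 2
        = c.R ω ^ 2 - 4 * A * ‖c.D ω‖ ^ 2 + 4 * A ^ 2 * (‖c.D ω‖ ^ 4 / c.R ω ^ 2) := by
      field_simp; ring
    rw [h2] at h1
    linarith
  · simp [Coupled.D4, Coupled.R2, Coupled.D2, indicator_of_notMem hω]

lemma Coupled.norm_v_le (c : Coupled S η N ε T h s) (hε : 0 < ε) (hN : 0 ≤ N) (ω : Ω) :
    ‖c.v ω‖ ≤ N := by
  by_cases hω : ω ∈ c.G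
  · have h1 := c.g_mem hε ω
    have hD : ‖c.D ω‖ ≤ c.R ω := c.ev_le ω hω
    rw [Coupled.g, indicator_of_mem hω] at h1
    rw [Coupled.v, indicator_of_mem hω, norm_smul, Real.norm_of_nonneg h1.1]
    exact (mul_le_of_le_one_left (norm_nonneg _) h1.2).trans (hD.trans (c.R_le ω hω))
  · rw [Coupled.v, indicator_of_notMem hω, norm_zero]; exact hN

lemma Coupled.stronglyMeasurable_v (c : Coupled S η N ε T h s) (hs : 0 ≤ s) :
    StronglyMeasurable[S.ℱ s] c.v := by
  have h1 : Measurable fun p : ℝ × EucSp d => (‖p.2‖ ^ 2 / p.1 ^ 2) • p.2 := by fun_prop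
  exact ((h1.comp (c.hR.measurable.prodMk
    (c.stronglyMeasurable_D hs).measurable)).stronglyMeasurable).indicator c.hG

lemma integrable_of_mem_Icc {f : Ω → ℝ} (hP : IsProbabilityMeasure P) (hf : StronglyMeasurable f)
    {a : ℝ} (h : ∀ ω, f ω ∈ Icc 0 a) : Integrable f P :=
  Integrable.of_bound hf.aestronglyMeasurable a (ae_of_all _ fun ω => by
    rw [Real.norm_of_nonneg (h ω).1]; exact (h ω).2)

lemma Coupled.g_mul_le (c : Coupled S η N ε T h s) (hε : 0 < ε) (hN : 0 ≤ N) (hh1 : h ≤ 1)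
    (ω : Ω) :
    c.g ω * (min 1 (dist (c.x ω) (S.seg η s ω)) ^ 2 + modulus (S.seg η) T h ω)
      ≤ 2 * Real.exp (1 + r₀) ^ 2 * c.D2 ω
        + (2 * (2 * N + 1) ^ 2 + 1) * modulus (S.seg η) T h ω := by
  have hm1 := modulus_nonneg (Z := S.seg η) (T := T) (τ := h) ω
  have hm1' := modulus_le_one (Z := S.seg η) (T := T) (τ := h) ω
  by_cases hω : ω ∈ c.G
  · have hR := c.pos_R hε hω
    have hg := c.g_mem hε ω
    have h1 := c.norm_seg_sub_le hε.le hN hh1 hω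
    have ho := osc_nonneg (S := S) (η := η) (T := T) (h := h) hN ω
    rw [← dist_eq_norm] at h1
    have h2 : min 1 (dist (c.x ω) (S.seg η s ω)) ^ 2
        ≤ 2 * (Real.exp (1 + r₀) ^ 2 * c.R ω ^ 2) + 2 * S.osc η N T h ω ^ 2 := by
      have := pow_le_pow_left₀ (le_min zero_le_one dist_nonneg) ((min_le_right _ _).trans h1) 2
      nlinarith [sq_nonneg (Real.exp (1 + r₀) * c.R ω - S.osc η N T h ω)]
    have h3 := mul_le_mul_of_nonneg_left h2 hg.1
    have h4 : c.g ω * c.R ω ^ 2 = c.D2 ω := by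
      rw [Coupled.g, Coupled.D2, indicator_of_mem hω, indicator_of_mem hω]
      exact div_mul_cancel₀ _ (by positivity)
    have h5 : S.osc η N T h ω ^ 2 ≤ (2 * N + 1) ^ 2 * modulus (S.seg η) T h ω := by
      rw [osc, mul_pow]
      exact mul_le_mul_of_nonneg_left (pow_le_of_le_one hm1 hm1' (by norm_num)) (by positivity)
    have h6 : c.g ω * (2 * S.osc η N T h ω ^ 2) ≤ 2 * S.osc η N T h ω ^ 2 :=
      mul_le_of_le_one_left (by positivity) hg.2
    have h7 : c.g ω * modulus (S.seg η) T h ω ≤ modulus (S.seg η) T h ω :=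
      mul_le_of_le_one_left hm1 hg.2
    have h8 : c.g ω * (2 * (Real.exp (1 + r₀) ^ 2 * c.R ω ^ 2) + 2 * S.osc η N T h ω ^ 2)
      = 2 * Real.exp (1 + r₀) ^ 2 * (c.g ω * c.R ω ^ 2) + c.g ω * (2 * S.osc η N T h ω ^ 2) := by
      ring
    rw [h8, h4] at h3
    rw [mul_add]
    linarith
  · have := c.D2_mem ω
    simp only [Coupled.g, indicator_of_notMem hω, zero_mul]
    exact add_nonneg (mul_nonneg (by positivity) this.1) (mul_nonneg (by positivity) hm1)

end PathSDE

namespace PathSDE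

lemma integrable_modulus_seg (S : PathSDE d r₀ Ω P) (η : Seg d r₀) (T h : ℝ) :
    Integrable (modulus (S.seg η) T h) P := by
  have := S.hP
  exact integrable_modulus (fun ω => S.continuous_seg η ω) (fun t => S.stronglyMeasurable_seg' η t)
    T h

lemma integrable_modulus_b (S : PathSDE d r₀ Ω P) (η : Seg d r₀) (T h : ℝ) :
    Integrable (modulus (fun r ω => S.b (S.seg η r ω)) T h) P := by
  have := S.hP
  exact integrable_modulus (fun ω => S.continuous_b_seg η ω)
    (fun t => S.hA1bcont.comp_stronglyMeasurable (S.stronglyMeasurable_seg' η t)) T h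

variable {S : PathSDE d r₀ Ω P} {η : Seg d r₀} {N ε T h s : ℝ}

/-- Average size of the increments of the solution over times at most `h`. -/
def modErr (S : PathSDE d r₀ Ω P) (η : Seg d r₀) (T h : ℝ) : ℝ :=
  (∫ ω, modulus (S.seg η) T h ω ∂P) + ∫ ω, modulus (fun r ω => S.b (S.seg η r ω)) T h ω ∂P

lemma Coupled.intLE_phi (c : Coupled S η N ε T h s) (hε : 0 < ε) (hN : 0 ≤ N) (hs : 0 ≤ s)
    (hh : 0 < h) (hh1 : h ≤ 1) (hT : s + h ≤ T)
    {z : Ω → EucSp d} (hz : StronglyMeasurable[S.ℱ (s + h)] z)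
    (hind : ∀ A, MeasurableSet[S.ℱ s] A → (P.restrict A).map z = P A • stdGaussian (EucSp d))
    (hB : ∀ x : Ω → Seg d r₀, StronglyMeasurable[S.ℱ s] x → ∀ T, s + h ≤ T →
      ∀ g : Ω → ℝ, StronglyMeasurable[S.ℱ s] g → ∀ cg : ℝ, (∀ ω, |g ω| ≤ cg) → (∀ ω, 0 ≤ g ω) →
      ∫ ω, g ω * ‖√(s + h - s) • S.σ (x ω) (z ω) - (S.mg η (s + h) ω - S.mg η s ω)‖ ^ 2 ∂P
        ≤ S.momC 0 * (s + h - s) * (2 * (S.lipσ * S.bd) ^ 2 * ∫ ω, g ω *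
          (min 1 (dist (x ω) (S.seg η s ω)) ^ 2 + modulus (S.seg η) T (s + h - s) ω) ∂P))
    (hCc : ∀ x : Ω → Seg d r₀, StronglyMeasurable[S.ℱ s] x → ∀ v : Ω → EucSp d,
      StronglyMeasurable[S.ℱ s] v → ∀ cv : ℝ, (∀ ω, ‖v ω‖ ≤ cv) →
      ∫ ω, ⟪v ω, √(s + h - s) • S.σ (x ω) (z ω) - (S.mg η (s + h) ω - S.mg η s ω)⟫ ∂P = 0)
    {K l C₁ a₁ a₂ a₃ a₄ : ℝ} (hK : 4 * h * K ≤ 1) (hl : 0 ≤ l) (hC₁ : 0 ≤ C₁) (ha₁ : 0 ≤ a₁)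
    (ha₂ : 0 ≤ a₂) (ha₄ : 0 ≤ a₄) :
    IntLE P (c.phi K l C₁ a₁ a₂ a₃ a₄ z)
      ((1 - 4 * h * K) * (∫ ω, c.D4 ω ∂P) + h * (4 * l * Real.exp (1 + r₀) ^ 2
          + C₁ * 2 * (S.momC 0 * (2 * (S.lipσ * S.bd) ^ 2) * (2 * Real.exp (1 + r₀) ^ 2)))
            * (∫ ω, c.D2 ω ∂P)
        + (a₁ + a₂ + C₁ * 2 * (S.momC 0 * (2 * (S.lipσ * S.bd) ^ 2) * (2 * (2 * N + 1) ^ 2 + 1)))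
          * (h * S.modErr η T h)
        + (a₃ + a₄ * (8 * (S.bd ^ 4 * (∫ y, ‖y‖ ^ 4 ∂(stdGaussian (EucSp d))) + S.momC 1)))
          * h ^ 2) := by
  have hP := S.hP
  simp only [add_sub_cancel_left] at hB hCc
  have sg : StronglyMeasurable[S.ℱ s] c.g := c.stronglyMeasurable_indicator hs
    (F := fun p => ‖p.2‖ ^ 2 / p.1 ^ 2) (by fun_prop)
  have s2 : StronglyMeasurable[S.ℱ s] c.D2 := c.stronglyMeasurable_indicator hs
    (F := fun p => ‖p.2‖ ^ 2) (by fun_prop)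
  have s4 : StronglyMeasurable[S.ℱ s] c.D4 := c.stronglyMeasurable_indicator hs
    (F := fun p => ‖p.2‖ ^ 4 / p.1 ^ 2) (by fun_prop)
  have i2 : Integrable c.D2 P := integrable_of_mem_Icc hP (s2.mono (S.ℱ.le s)) c.D2_mem
  have i4 : Integrable c.D4 P := integrable_of_mem_Icc hP (s4.mono (S.ℱ.le s)) (c.D4_mem hε)
  have im := S.integrable_modulus_seg η T h
  have imb := S.integrable_modulus_b η T h
  have im0 : 0 ≤ ∫ ω, modulus (S.seg η) T h ω ∂P := integral_nonneg fun ω => modulus_nonneg ω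
  have imb0 : 0 ≤ ∫ ω, modulus (fun r ω => S.b (S.seg η r ω)) T h ω ∂P :=
    integral_nonneg fun ω => modulus_nonneg ω
  have ie := c.intLE_err hs hh.le hz hind
  have se := c.measurable_err hh.le hz
  have iv : IntLE P (fun ω => ⟪c.v ω, c.err z ω⟫) 0 := by
    refine ⟨?_, (hCc c.x c.hx c.v (c.stronglyMeasurable_v hs) N (c.norm_v_le hε hN)).le⟩
    refine (((integrable_const (1:ℝ)).add ie.1).const_mul N).mono'
      (((c.stronglyMeasurable_v hs).mono (S.ℱ.le s)).inner se).aestronglyMeasurable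
      (ae_of_all _ fun ω => ?_)
    refine (norm_inner_le_norm _ _).trans
      (mul_le_mul (c.norm_v_le hε hN ω) ?_ (norm_nonneg _) hN)
    change ‖c.err z ω‖ ≤ 1 + ‖c.err z ω‖ ^ 4
    nlinarith [sq_nonneg (‖c.err z ω‖ ^ 2 - 1), sq_nonneg (‖c.err z ω‖ - 1), sq_nonneg ‖c.err z ω‖]
  have ig : IntLE P (fun ω => c.g ω * ‖c.err z ω‖ ^ 2)
      (S.momC 0 * h * (2 * (S.lipσ * S.bd) ^ 2 * (2 * Real.exp (1 + r₀) ^ 2 * (∫ ω, c.D2 ω ∂P)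
        + (2 * (2 * N + 1) ^ 2 + 1) * ∫ ω, modulus (S.seg η) T h ω ∂P))) := by
    refine ⟨?_, (hB c.x c.hx T hT c.g sg 1 (fun ω => ?_) (fun ω => (c.g_mem hε ω).1)).trans ?_⟩
    · refine ((integrable_const (1:ℝ)).add ie.1).mono'
        ((sg.mono (S.ℱ.le s)).mul (se.norm.pow 2)).aestronglyMeasurable (ae_of_all _ fun ω => ?_)
      have h1 := c.g_mem hε ω
      rw [Real.norm_of_nonneg (mul_nonneg h1.1 (sq_nonneg _))]
      refine (mul_le_of_le_one_left (sq_nonneg _) h1.2).trans ?_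
      change ‖c.err z ω‖ ^ 2 ≤ 1 + ‖c.err z ω‖ ^ 4
      nlinarith [sq_nonneg (‖c.err z ω‖ ^ 2 - 1)]
    · rw [abs_of_nonneg (c.g_mem hε ω).1]; exact (c.g_mem hε ω).2
    · refine mul_le_mul_of_nonneg_left (mul_le_mul_of_nonneg_left ?_ (by positivity))
        (mul_nonneg (S.momC_nonneg 0) hh.le)
      have hi := ((i2.const_mul (2 * Real.exp (1 + r₀) ^ 2)).add
        (im.const_mul (2 * (2 * N + 1) ^ 2 + 1)))
      have h1 : ∫ ω, c.g ω * (min 1 (dist (c.x ω) (S.seg η s ω)) ^ 2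
          + modulus (S.seg η) T h ω) ∂P ≤ ∫ ω, (2 * Real.exp (1 + r₀) ^ 2 * c.D2 ω
          + (2 * (2 * N + 1) ^ 2 + 1) * modulus (S.seg η) T h ω) ∂P := by
        refine integral_mono_of_nonneg (ae_of_all _ fun ω => ?_) hi
          (ae_of_all _ fun ω => c.g_mul_le hε hN hh1 ω)
        exact mul_nonneg (c.g_mem hε ω).1 (add_nonneg (sq_nonneg _) (modulus_nonneg ω))
      rw [integral_add (by exact i2.const_mul _) (by exact im.const_mul _), integral_const_mul,
        integral_const_mul] at h1
      exact h1
  have hsum := (((((((IntLE.of_integrable i4).const_mul (by linarith : 0 ≤ 1 - 4 * h * K)).add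
    ((IntLE.of_integrable i2).const_mul
      (by positivity : 0 ≤ 4 * h * l * Real.exp (1 + r₀) ^ 2))).add
    ((IntLE.of_integrable im).const_mul (by positivity : 0 ≤ h * a₁))).add
    ((IntLE.of_integrable imb).const_mul (by positivity : 0 ≤ h * a₂))).add
    (iv.const_mul (by norm_num : (0:ℝ) ≤ 4))).add
    (ig.const_mul (by positivity : 0 ≤ C₁ * 2))).add (IntLE.const (P := P) (a₃ * h ^ 2))
  refine (hsum.add (ie.const_mul ha₄)).le_right ?_
  have hm := S.momC_nonneg 0
  have k1 : 0 ≤ (a₁ + C₁ * 2 * (S.momC 0 * (2 * (S.lipσ * S.bd) ^ 2) * (2 * (2 * N + 1) ^ 2 + 1)))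
      * h * ∫ ω, modulus (fun r ω => S.b (S.seg η r ω)) T h ω ∂P := by positivity
  have k2 : 0 ≤ a₂ * h * ∫ ω, modulus (S.seg η) T h ω ∂P := by positivity
  rw [modErr]
  linarith

end PathSDE

namespace PathSDE

lemma modErr_nonneg (S : PathSDE d r₀ Ω P) (η : Seg d r₀) (T h : ℝ) : 0 ≤ S.modErr η T h :=
  add_nonneg (integral_nonneg fun ω => modulus_nonneg ω) (integral_nonneg fun ω => modulus_nonneg ω)

/-- Real arithmetic behind `exists_step`. -/
lemma step_arith {h K A₀ B₁ B₂ x4 x2 xR m : ℝ} (hh : 0 < h) (hA₀0 : 0 ≤ A₀)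
    (hKdef : K = 2 + A₀ ^ 2 / 2) (hK : 0 < K) (hB₁0 : 0 ≤ B₁) (hB₂0 : 0 ≤ B₂)
    (hhK : 4 * h * K ≤ 1) (hh4 : h ≤ 1 / 8)
    (h2 : 2 * A₀ * x2 ≤ xR / 2 + 2 * A₀ ^ 2 * x4) (n4 : 0 ≤ x4) (n2 : 0 ≤ x2) (nR : 0 ≤ xR)
    (nm : 0 ≤ m) :
    Real.exp (-(2 * h)) * xR + Real.exp (2 * h) *
      ((1 - 4 * h * K) * x4 + h * A₀ * x2 + B₁ * (h * m) + B₂ * h ^ 2)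
      ≤ (1 - h / 2) * (xR + x4) + 2 * (B₁ + B₂) * (h * m + h ^ 2) := by
  have hexp1 : Real.exp (-(2 * h)) ≤ 1 - h := by
    have h1 := Real.abs_exp_sub_one_sub_id_le (x := -(2 * h)) (by rw [abs_le]; constructor <;> linarith)
    have h3 := (abs_le.1 h1).2
    nlinarith
  have hexp2 : Real.exp (2 * h) ≤ 1 + 4 * h := by
    have h1 := Real.abs_exp_sub_one_sub_id_le (x := 2 * h) (by rw [abs_le]; constructor <;> linarith)
    have h3 := (abs_le.1 h1).2
    nlinarith
  have hexp3 : Real.exp (2 * h) ≤ 2 := by linarith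
  have hexp0 : 0 ≤ Real.exp (2 * h) := (Real.exp_pos _).le
  have t1 : Real.exp (-(2 * h)) * xR ≤ (1 - h) * xR := mul_le_mul_of_nonneg_right hexp1 nR
  have t2 : Real.exp (2 * h) * ((1 - 4 * h * K) * x4) ≤ (1 + 4 * h - 4 * h * K) * x4 := by
    have k1 := mul_le_mul_of_nonneg_right hexp2 (mul_nonneg (by linarith : 0 ≤ 1 - 4 * h * K) n4)
    have k2 : 0 ≤ 16 * h ^ 2 * K * x4 := by positivity
    nlinarith
  have t3 : Real.exp (2 * h) * (h * A₀ * x2) ≤ h * (xR / 2 + 2 * A₀ ^ 2 * x4) := by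
    have k1 := mul_le_mul_of_nonneg_right hexp3 (by positivity : 0 ≤ h * A₀ * x2)
    have k2 := mul_le_mul_of_nonneg_left h2 hh.le
    linarith
  have t4 : Real.exp (2 * h) * (B₁ * (h * m)) ≤ 2 * (B₁ + B₂) * (h * m) := by
    have k1 := mul_le_mul_of_nonneg_right hexp3 (by positivity : 0 ≤ B₁ * (h * m))
    have k2 : 0 ≤ B₂ * (h * m) := by positivity
    linarith
  have t5 : Real.exp (2 * h) * (B₂ * h ^ 2) ≤ 2 * (B₁ + B₂) * h ^ 2 := by
    have k1 := mul_le_mul_of_nonneg_right hexp3 (by positivity : 0 ≤ B₂ * h ^ 2)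
    have k2 : 0 ≤ B₁ * h ^ 2 := by positivity
    linarith
  have t6 : (1 + 4 * h - 4 * h * K) * x4 + h * (2 * A₀ ^ 2 * x4) ≤ (1 - h / 2) * x4 := by
    rw [hKdef]
    have : 0 ≤ h * x4 := by positivity
    linarith
  rw [mul_add (Real.exp (2 * h)), mul_add (Real.exp (2 * h)), mul_add (Real.exp (2 * h))]
  linarith

set_option maxHeartbeats 1000000 in
/-- The Lyapunov function decreases on average along the steered Euler scheme. -/
lemma exists_step (S : PathSDE d r₀ Ω P) : ∃ K : ℝ, 0 < K ∧ ∃ h₀ : ℝ, 0 < h₀ ∧ h₀ ≤ 1 ∧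
    ∀ N ε T : ℝ, ∀ hN : 0 ≤ N, 0 < ε → ∃ C : ℝ, 0 ≤ C ∧ ∀ (η : Seg d r₀) (h s : ℝ)
      (c : Coupled S η N ε T h s) (hs : 0 ≤ s) (hh : 0 < h) (hT : s + h ≤ T), h ≤ h₀ →
      ∃ (z : Ω → EucSp d) (hz : StronglyMeasurable[S.ℱ (s + h)] z),
        (∀ A, MeasurableSet[S.ℱ s] A → (P.restrict A).map z = P A • stdGaussian (EucSp d)) ∧
        N ^ 2 * P.real (c.G ∩ S.inBall η N (s + h) ∩ {ω | N < c.nextR K z ω})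
          + ∫ ω, (c.next hs hh hT hN K hz).G.indicator (c.next hs hh hT hN K hz).V ω ∂P
        ≤ (1 - h / 2) * (∫ ω, c.G.indicator c.V ω ∂P) + C * (h * S.modErr η T h + h ^ 2) := by
  have hP := S.hP
  obtain ⟨l₁, l, hl₁, hl, -, hA2'⟩ := S.hA2
  obtain ⟨C₁, hC₁, hC'⟩ := exists_norm_add_pow_le (EucSp d) 1
  have hA2 : ∀ x y : Seg d r₀,
      2 * ⟪ev0 S.hr₀ x - ev0 S.hr₀ y, S.b x - S.b y⟫ ≤ l * ‖x - y‖ ^ 2 := fun x y => by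
    have h1 := hA2' x y
    have h2 : 0 ≤ l₁ * ‖ev0 S.hr₀ x - ev0 S.hr₀ y‖ ^ 2 := by positivity
    linarith
  have hC : ∀ x w : EucSp d, (‖x + w‖ ^ 2) ^ 2 ≤ (‖x‖ ^ 2) ^ 2
      + 2 * ‖x‖ ^ 2 * (2 * ⟪x, w⟫) + C₁ * (‖x‖ ^ 2 * ‖w‖ ^ 2 + (‖w‖ ^ 2) ^ 2) := fun x w => by
    have := hC' x w
    norm_num at this
    linarith
  have hm0 := S.momC_nonneg 0
  have hm1 := S.momC_nonneg 1
  have hbd : 0 ≤ S.bd := zero_le_one.trans S.one_le_bd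
  set A₀ : ℝ := 4 * l * Real.exp (1 + r₀) ^ 2
    + C₁ * 2 * (S.momC 0 * (2 * (S.lipσ * S.bd) ^ 2) * (2 * Real.exp (1 + r₀) ^ 2)) with hA₀
  have hA₀0 : 0 ≤ A₀ := by positivity
  set K : ℝ := 2 + A₀ ^ 2 / 2 with hKdef
  have hK : 0 < K := by positivity
  refine ⟨K, hK, 1 / (4 * K), by positivity, ?_, fun N ε T hN hε => ?_⟩
  · rw [div_le_one (by positivity)]; nlinarith [sq_nonneg A₀]
  set β : ℝ := 2 * S.bdb (N + (Real.exp (1 + r₀) * N + (2 * N + 1))) with hβ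
  set A : ℝ := β + K * N + 2 * S.bdb N with hA
  set a₁ : ℝ := 4 * l * (2 * N + 1) ^ 2 with ha₁
  set a₂ : ℝ := 8 * N * S.bdb N with ha₂
  set a₃ : ℝ := C₁ * (2 * A ^ 2 + 8 * A ^ 4 / (ε * Real.exp (-T)) ^ 2) with ha₃
  set a₄ : ℝ := C₁ * 8 / (ε * Real.exp (-T)) ^ 2 with ha₄
  have ha₁0 : 0 ≤ a₁ := by positivity
  have ha₂0 : 0 ≤ a₂ := by
    have := S.one_le_bdb N
    have : 0 ≤ S.bdb N := by linarith
    positivity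
  have ha₃0 : 0 ≤ a₃ := by positivity
  have ha₄0 : 0 ≤ a₄ := by positivity
  have hE4 : 0 ≤ ∫ y, ‖y‖ ^ 4 ∂(stdGaussian (EucSp d)) := integral_nonneg fun y => by positivity
  set B₁ : ℝ := a₁ + a₂
    + C₁ * 2 * (S.momC 0 * (2 * (S.lipσ * S.bd) ^ 2) * (2 * (2 * N + 1) ^ 2 + 1)) with hB₁
  set B₂ : ℝ := a₃ + a₄ * (8 * (S.bd ^ 4 * (∫ y, ‖y‖ ^ 4 ∂(stdGaussian (EucSp d))) + S.momC 1))
    with hB₂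
  have hB₁0 : 0 ≤ B₁ := by positivity
  have hB₂0 : 0 ≤ B₂ := by positivity
  refine ⟨2 * (B₁ + B₂), by positivity, fun η h s c hs hh hT hh₀ => ?_⟩
  have hhK : 4 * h * K ≤ 1 := by
    rw [le_div_iff₀ (by positivity)] at hh₀; linarith
  have hh4 : h ≤ 1 / 8 := by nlinarith [sq_nonneg A₀]
  have hh1 : h ≤ 1 := by linarith
  obtain ⟨z, hz, hind, hzB, hzC⟩ := S.exists_noise η hs (by linarith : s < s + h)
  refine ⟨z, hz, hind, ?_⟩
  have hphi := c.intLE_phi hε hN hs hh hh1 hT hz hind hzB hzC (K := K) (a₃ := a₃) hhK hl.le hC₁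
    ha₁0 ha₂0 ha₄0
  have hpt := c.step_le hε hs hh hT hN K hz
    (c.pow_four_le_phi hK.le hl.le hA2 hC₁ hC hs hh hh1 hT hN hε hβ hA z)
  have i2 : Integrable c.D2 P := integrable_of_mem_Icc hP ((c.stronglyMeasurable_indicator hs
    (F := fun p => ‖p.2‖ ^ 2) (by fun_prop)).mono (S.ℱ.le s)) c.D2_mem
  have i4 : Integrable c.D4 P := integrable_of_mem_Icc hP ((c.stronglyMeasurable_indicator hs
    (F := fun p => ‖p.2‖ ^ 4 / p.1 ^ 2) (by fun_prop)).mono (S.ℱ.le s)) (c.D4_mem hε)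
  have iR : Integrable c.R2 P := integrable_of_mem_Icc hP ((c.stronglyMeasurable_indicator hs
    (F := fun p => p.1 ^ 2) (by fun_prop)).mono (S.ℱ.le s)) (c.R2_mem hε)
  have hsum := ((IntLE.of_integrable iR).const_mul (Real.exp_pos (-(2 * h))).le).add
    (hphi.const_mul (Real.exp_pos (2 * h)).le)
  have hmeas : MeasurableSet (c.G ∩ S.inBall η N (s + h) ∩ {ω | N < c.nextR K z ω}) :=
    ((S.ℱ.le s _ c.hG).inter (S.measurableSet_inBall' η N (add_nonneg hs hh.le))).inter
      (measurableSet_lt measurable_const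
        ((c.stronglyMeasurable_nextR hs hh.le K hz).mono (S.ℱ.le _)).measurable)
  have iV := (c.next hs hh hT hN K hz).integrable_V hε (add_nonneg hs hh.le)
  have iE : Integrable ((c.G ∩ S.inBall η N (s + h) ∩ {ω | N < c.nextR K z ω}).indicator
      (fun _ => N ^ 2)) P := (integrable_const _).indicator hmeas
  have hle := (integral_mono (iE.add iV) hsum.1 hpt).trans hsum.2
  have e1 : ∫ ω, ((c.G ∩ S.inBall η N (s + h) ∩ {ω | N < c.nextR K z ω}).indicator
      (fun _ => N ^ 2) + (c.next hs hh hT hN K hz).G.indicator (c.next hs hh hT hN K hz).V) ω ∂P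
      = N ^ 2 * P.real (c.G ∩ S.inBall η N (s + h) ∩ {ω | N < c.nextR K z ω})
        + ∫ ω, (c.next hs hh hT hN K hz).G.indicator (c.next hs hh hT hN K hz).V ω ∂P := by
    rw [integral_add' iE iV, integral_indicator_const _ hmeas, smul_eq_mul, mul_comm]
  rw [e1] at hle
  have e2 : ∫ ω, c.G.indicator c.V ω ∂P = (∫ ω, c.R2 ω ∂P) + ∫ ω, c.D4 ω ∂P := by
    rw [← integral_add iR i4]; exact integral_congr_ae (ae_of_all _ c.V_eq)
  rw [e2]
  have h2 : 2 * A₀ * (∫ ω, c.D2 ω ∂P) ≤ (∫ ω, c.R2 ω ∂P) / 2 + 2 * A₀ ^ 2 * ∫ ω, c.D4 ω ∂P := by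
    have := integral_mono (i2.const_mul (2 * A₀))
      ((iR.div_const 2).add (i4.const_mul (2 * A₀ ^ 2))) (c.D2_le hε)
    rwa [integral_const_mul, integral_add' (iR.div_const 2) (i4.const_mul _), integral_div,
      integral_const_mul] at this
  have n4 : 0 ≤ ∫ ω, c.D4 ω ∂P := integral_nonneg fun ω => (c.D4_mem hε ω).1
  have n2 : 0 ≤ ∫ ω, c.D2 ω ∂P := integral_nonneg fun ω => (c.D2_mem ω).1
  have nR : 0 ≤ ∫ ω, c.R2 ω ∂P := integral_nonneg fun ω => (c.R2_mem hε ω).1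
  have nm := S.modErr_nonneg η T h
  exact hle.trans (step_arith hh hA₀0 hKdef hK hB₁0 hB₂0 hhK hh4 h2 n4 n2 nR nm)

end PathSDE

namespace PathSDE

variable {S : PathSDE d r₀ Ω P}
variable {η : Seg d r₀} {N ε T h s : ℝ}

lemma Coupled.norm_w_sq_le (c : Coupled S η N ε T h s) (hε : 0 < ε) (hh : 0 ≤ h) (K : ℝ) {ω : Ω}
    (hω : ω ∈ c.G) : ‖c.w K ω‖ ^ 2 / 2 ≤ h * (K ^ 2 * S.bd ^ 2 / 4) * c.V ω := by
  have hR := c.pos_R hε hω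
  have h1 : ‖c.w K ω‖ ^ 2 = h * K ^ 2 * ‖S.σinv (c.x ω) (c.D ω)‖ ^ 2 := by
    rw [Coupled.w, norm_neg, norm_smul, mul_pow, Real.norm_eq_abs, sq_abs, mul_pow, Real.sq_sqrt hh]
  have h2 : ‖S.σinv (c.x ω) (c.D ω)‖ ^ 2 ≤ S.bd ^ 2 * ‖c.D ω‖ ^ 2 := by
    rw [← mul_pow]
    refine pow_le_pow_left₀ (norm_nonneg _) ?_ 2
    exact (ContinuousLinearMap.le_opNorm _ _).trans
      (mul_le_mul_of_nonneg_right (S.norm_σinv_le _) (norm_nonneg _))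
  have h3 : 2 * ‖c.D ω‖ ^ 2 ≤ c.V ω := by
    have e : c.V ω - 2 * ‖c.D ω‖ ^ 2 = (c.R ω - ‖c.D ω‖ ^ 2 / c.R ω) ^ 2 := by
      rw [Coupled.V]; field_simp; ring
    linarith [sq_nonneg (c.R ω - ‖c.D ω‖ ^ 2 / c.R ω)]
  have h4 := mul_le_mul_of_nonneg_left h2 (by positivity : 0 ≤ h * K ^ 2)
  have h5 := mul_le_mul_of_nonneg_left h3 (by positivity : 0 ≤ h * K ^ 2 * S.bd ^ 2)
  rw [h1]
  linarith

/-- Entropy inequality along one step of the steered Euler scheme. -/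
lemma Coupled.entropy_step (c : Coupled S η N ε T h s) (hε : 0 < ε) (hs : 0 ≤ s) (hh : 0 < h)
    (hT : s + h ≤ T) (hN : 0 ≤ N) (K : ℝ) {z : Ω → EucSp d}
    (hz : StronglyMeasurable[S.ℱ (s + h)] z)
    (hind : ∀ A, MeasurableSet[S.ℱ s] A → (P.restrict A).map z = P A • stdGaussian (EucSp d))
    {ψ : Seg d r₀ → ℝ} (hψ : Measurable ψ) {B : ℝ} (h1 : ∀ x, ψ x ∈ Icc 1 B) (n : ℕ) :
    ∫ ω, (c.next hs hh hT hN K hz).G.indicator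
        (fun ω => Real.log (S.eulerOp h n ψ ((c.next hs hh hT hN K hz).x ω))) ω ∂P
      ≤ (∫ ω, c.G.indicator (fun ω => Real.log (S.eulerOp h (n + 1) ψ (c.x ω))) ω ∂P)
        + K ^ 2 * S.bd ^ 2 / 4 * (h * ∫ ω, c.G.indicator c.V ω ∂P) := by
  have hP := S.hP
  have hmem := fun n x => S.eulerOp_mem (h := h) hψ h1 n x
  have hlog0 : ∀ n x, 0 ≤ Real.log (S.eulerOp h n ψ x) := fun n x => Real.log_nonneg (hmem n x).1
  have hlogB : ∀ n x, Real.log (S.eulerOp h n ψ x) ≤ Real.log B := fun n x =>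
    Real.log_le_log (by linarith [(hmem n x).1]) (hmem n x).2
  have hlogm : ∀ n, Measurable fun x => Real.log (S.eulerOp h n ψ x) := fun n =>
    Real.measurable_log.comp (S.measurable_eulerOp hψ n)
  have hz' : Measurable z := (hz.mono (S.ℱ.le _)).measurable
  set a : Ω → Seg d r₀ × EucSp d × ℝ := fun ω => (c.x ω, c.w K ω, c.G.indicator (fun _ => 1) ω)
  have ha : Measurable[S.ℱ s] a := c.hx.measurable.prodMk
    ((c.stronglyMeasurable_w hs K).measurable.prodMk (measurable_const.indicator c.hG))
  set Φ : Seg d r₀ × EucSp d × ℝ → EucSp d → ℝ := fun p y =>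
    p.2.2 * Real.log (S.eulerOp h n ψ (S.euler h p.1 (y + p.2.1))) with hΦdef
  have hΦ : Measurable (Function.uncurry Φ) := by
    have e : Measurable fun p : (Seg d r₀ × EucSp d × ℝ) × EucSp d =>
        S.euler h p.1.1 (p.2 + p.1.2.1) :=
      (S.continuous_euler h).measurable.comp
        (measurable_fst.fst.prodMk (measurable_snd.add measurable_fst.snd.fst))
    exact measurable_fst.snd.snd.mul ((hlogm n).comp e)
  have hval : ∀ ω y, Φ (a ω) y = c.G.indicator
      (fun ω => Real.log (S.eulerOp h n ψ (S.euler h (c.x ω) (y + c.w K ω)))) ω := fun ω y => by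
    by_cases hω : ω ∈ c.G
    · simp [Φ, a, indicator_of_mem hω]
    · simp [Φ, a, indicator_of_notMem hω]
  have hmemΦ : ∀ ω y, Φ (a ω) y ∈ Icc 0 (Real.log B) := fun ω y => by
    rw [hval]
    by_cases hω : ω ∈ c.G
    · rw [indicator_of_mem hω]; exact ⟨hlog0 _ _, hlogB _ _⟩
    · rw [indicator_of_notMem hω]; exact ⟨le_rfl, (hlog0 0 0).trans (hlogB 0 0)⟩
  have hi : Integrable (fun ω => Φ (a ω) (z ω)) P :=
    integrable_of_mem_Icc hP
      (hΦ.comp ((ha.mono (S.ℱ.le s) le_rfl).prodMk hz')).stronglyMeasurable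
      (fun ω => hmemΦ ω (z ω))
  obtain ⟨hi2, he⟩ := S.integral_comp_noise hz' hind ha hΦ hi
  have hGm : MeasurableSet c.G := S.ℱ.le s _ c.hG
  have iU : Integrable (c.G.indicator (fun ω => Real.log (S.eulerOp h (n + 1) ψ (c.x ω)))) P :=
    integrable_of_mem_Icc hP (((hlogm (n + 1)).comp
      (c.hx.mono (S.ℱ.le s)).measurable).indicator hGm).stronglyMeasurable (a := Real.log B)
      (fun ω => by
        by_cases hω : ω ∈ c.G
        · rw [indicator_of_mem hω]; exact ⟨hlog0 _ _, hlogB _ _⟩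
        · rw [indicator_of_notMem hω]; exact ⟨le_rfl, (hlog0 0 0).trans (hlogB 0 0)⟩)
  have iV := (c.integrable_V hε hs).const_mul (h * (K ^ 2 * S.bd ^ 2 / 4))
  have hle1 : ∫ ω, (c.next hs hh hT hN K hz).G.indicator
        (fun ω => Real.log (S.eulerOp h n ψ ((c.next hs hh hT hN K hz).x ω))) ω ∂P
        ≤ ∫ ω, Φ (a ω) (z ω) ∂P := by
    refine integral_mono_of_nonneg (ae_of_all _ fun ω => indicator_nonneg (fun _ _ => hlog0 _ _) ω)
      hi (ae_of_all _ fun ω => ?_)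
    simp only [hval]
    by_cases hω : ω ∈ (c.next hs hh hT hN K hz).G
    · rw [indicator_of_mem hω, indicator_of_mem (show ω ∈ c.G from hω.1.1)]; exact le_rfl
    · rw [indicator_of_notMem hω]; exact indicator_nonneg (fun _ _ => hlog0 _ _) ω
  have hle2 : ∫ ω, ∫ y, Φ (a ω) y ∂(stdGaussian (EucSp d)) ∂P
      ≤ ∫ ω, (c.G.indicator (fun ω => Real.log (S.eulerOp h (n + 1) ψ (c.x ω))) ω
        + h * (K ^ 2 * S.bd ^ 2 / 4) * c.G.indicator c.V ω) ∂P := by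
    refine integral_mono hi2 (iU.add iV) fun ω => ?_
    simp only [hval]
    by_cases hω : ω ∈ c.G
    · simp only [indicator_of_mem hω]
      exact (S.integral_log_eulerOp_le hψ h1 n (c.x ω) (c.w K ω)).trans
        (add_le_add le_rfl (c.norm_w_sq_le hε hh.le K hω))
    · simp [indicator_of_notMem hω]
  rw [integral_add iU iV, integral_const_mul] at hle2
  linarith

/-- The steered Euler scheme started from `ξ` at the end of `k` steps. -/
lemma exists_chain (S : PathSDE d r₀ Ω P) : ∃ κ : ℝ, 0 ≤ κ ∧ ∃ h₀ : ℝ, 0 < h₀ ∧ h₀ ≤ 1 ∧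
    ∀ N ε T : ℝ, 0 ≤ N → 0 < ε → ∃ C : ℝ, 0 ≤ C ∧ ∀ (ξ η : Seg d r₀) (h : ℝ) (n : ℕ),
      0 < h → h ≤ h₀ → n * h = T → ‖η‖ ≤ N → ‖ξ - η‖ + ε ≤ N →
      ∀ (ψ : Seg d r₀ → ℝ) (B : ℝ), Measurable ψ → (∀ x, ψ x ∈ Icc 1 B) → ∀ k : ℕ, k ≤ n →
      ∃ (s : ℝ) (c : Coupled S η N ε T h s) (q a : ℝ), s = k * h ∧ 0 ≤ a ∧
        P.real (S.inBall η N s \ c.G) ≤ q ∧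
        N ^ 2 * q + (∫ ω, c.G.indicator c.V ω ∂P) + a / 2
          ≤ 2 * (‖ξ - η‖ + ε) ^ 2 + k * (C * (h * S.modErr η T h + h ^ 2)) ∧
        (∫ ω, c.G.indicator (fun ω => Real.log (S.eulerOp h (n - k) ψ (c.x ω))) ω ∂P)
          ≤ Real.log (S.eulerOp h n ψ ξ) + κ * a ∧
        (∫ ω, c.G.indicator c.V ω ∂P) ≤ (1 - h / 2) ^ k * (2 * (‖ξ - η‖ + ε) ^ 2)
          + k * (C * (h * S.modErr η T h + h ^ 2)) := by
  have hP := S.hP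
  obtain ⟨K, hK, h₀, hh₀, hh₀1, hst⟩ := S.exists_step
  refine ⟨K ^ 2 * S.bd ^ 2 / 4, by positivity, h₀, hh₀, hh₀1, fun N ε T hN hε => ?_⟩
  obtain ⟨C, hC, hstep⟩ := hst N ε T hN hε
  refine ⟨C, hC, fun ξ η h n hh hhh₀ hnT hη hR ψ B hψ hψB k => ?_⟩
  set err := C * (h * S.modErr η T h + h ^ 2) with herr
  have herr0 : 0 ≤ err := by
    have := S.modErr_nonneg η T h
    positivity
  set V0 := 2 * (‖ξ - η‖ + ε) ^ 2 with hV0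
  induction k with
  | zero =>
    intro _
    set c : Coupled S η N ε T h 0 := Coupled.init ξ hη hh.le hε.le hR with hc
    have hG : c.G = univ := rfl
    have hE : ∫ ω, c.G.indicator c.V ω ∂P ≤ V0 := by
      have := integral_mono (c.integrable_V hε le_rfl) (integrable_const V0) fun ω => by
        have := c.V_le hε (show ω ∈ c.G from mem_univ ω)
        rw [indicator_of_mem (show ω ∈ c.G from mem_univ ω)]
        exact this
      simpa using this
    refine ⟨0, c, 0, 0, by simp, le_rfl, ?_, ?_, ?_, ?_⟩
    · simp [hG]
    · simpa using hE
    · have hx : ∀ ω, c.x ω = ξ := fun ω => rfl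
      simp [hG, hx]
    · simpa using hE
  | succ k ih =>
    intro hk
    obtain ⟨s, c, q, a, hs, ha, hq, i1, i2, i3⟩ := ih (by omega)
    have hs0 : 0 ≤ s := by rw [hs]; positivity
    have hsT : s + h ≤ T := by
      have : ((k + 1 : ℕ) : ℝ) * h ≤ n * h := by gcongr
      push_cast at this
      linarith
    obtain ⟨z, hz, hind, hle⟩ := hstep η h s c hs0 hh hsT hhh₀
    have hent := c.entropy_step hε hs0 hh hsT hN K hz hind hψ hψB (n - (k + 1))
    rw [show n - (k + 1) + 1 = n - k by omega] at hent
    set E := ∫ ω, c.G.indicator c.V ω ∂P with hEdef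
    have hE0 : 0 ≤ E := integral_nonneg fun ω => indicator_nonneg (fun ω _ => c.V_nonneg ω) ω
    set p := P.real (c.G ∩ S.inBall η N (s + h) ∩ {ω | N < c.nextR K z ω}) with hp
    have hp0 : 0 ≤ N ^ 2 * p := by positivity
    have hhE : 0 ≤ h * E := by positivity
    refine ⟨s + h, c.next hs0 hh hsT hN K hz, q + p, a + h * E, by push_cast; linarith,
      by positivity, ?_, ?_, ?_, ?_⟩
    · have hsub : S.inBall η N (s + h) \ (c.next hs0 hh hsT hN K hz).G
          ⊆ (S.inBall η N s \ c.G) ∪ (c.G ∩ S.inBall η N (s + h) ∩ {ω | N < c.nextR K z ω}) := by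
        rintro ω ⟨h1, h2⟩
        by_cases hω : ω ∈ c.G
        · right
          refine ⟨⟨hω, h1⟩, ?_⟩
          by_contra h3
          have h4 : c.nextR K z ω ≤ N := le_of_not_gt h3
          exact h2 ⟨⟨hω, h1⟩, h4⟩
        · left
          exact ⟨fun r hr => h1 r ⟨hr.1, by linarith [hr.2]⟩, hω⟩
      exact (measureReal_mono hsub).trans ((measureReal_union_le _ _).trans
        (add_le_add hq le_rfl))
    · push_cast; linarith
    · linarith
    · have h2 : 0 ≤ 1 - h / 2 := by linarith
      have h3 := mul_le_mul_of_nonneg_left i3 h2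
      have h4 : 0 ≤ h * (k * err) := by positivity
      rw [pow_succ]
      push_cast
      linarith

end PathSDE

namespace PathSDE

variable {S : PathSDE d r₀ Ω P}

lemma Coupled.integral_le {η : Seg d r₀} {N ε T h s : ℝ} (c : Coupled S η N ε T h s) (hε : 0 < ε)
    (hN : 0 ≤ N) (hs : 0 ≤ s) (hh1 : h ≤ 1) {g : Seg d r₀ → ℝ} {B : ℝ} {Λ : ℝ≥0}
    (hg : ∀ x, g x ∈ Icc 0 B) (hgL : LipschitzWith Λ g) {δ : ℝ} (hδ : 0 < δ) :
    ∫ ω, g (S.seg η s ω) ∂P ≤ (∫ ω, c.G.indicator (fun ω => g (c.x ω)) ω ∂P)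
      + Λ * (Real.exp (1 + r₀) * (δ + (∫ ω, c.G.indicator c.V ω ∂P) / δ)
        + (2 * N + 1) * S.modErr η T h) + B * P.real c.Gᶜ := by
  have hP := S.hP
  have hGm : MeasurableSet c.G := S.ℱ.le s _ c.hG
  have hB : 0 ≤ B := (hg 0).1.trans (hg 0).2
  have iS : Integrable (fun ω => g (S.seg η s ω)) P := integrable_of_mem_Icc hP
    (hgL.continuous.comp_stronglyMeasurable (S.stronglyMeasurable_seg' η s)) fun ω => hg _
  have ix : Integrable (c.G.indicator (fun ω => g (c.x ω))) P := by
    refine integrable_of_mem_Icc hP ((hgL.continuous.comp_stronglyMeasurable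
      (c.hx.mono (S.ℱ.le s))).indicator hGm) (a := B) fun ω => ?_
    by_cases hω : ω ∈ c.G
    · rw [indicator_of_mem hω]; exact hg _
    · rw [indicator_of_notMem hω]; exact ⟨le_rfl, hB⟩
  have iV := c.integrable_V hε hs
  have im := S.integrable_modulus_seg η T h
  have i1 : IntLE P (fun ω => Real.exp (1 + r₀) * (δ + δ⁻¹ * c.G.indicator c.V ω)
      + (2 * N + 1) * modulus (S.seg η) T h ω) (Real.exp (1 + r₀) * (δ + δ⁻¹ *
        (∫ ω, c.G.indicator c.V ω ∂P)) + (2 * N + 1) * ∫ ω, modulus (S.seg η) T h ω ∂P) :=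
    (((IntLE.const δ).add ((IntLE.of_integrable iV).const_mul (by positivity))).const_mul
      (Real.exp_pos _).le).add ((IntLE.of_integrable im).const_mul (by positivity))
  have i2 : IntLE P (fun ω => B * c.Gᶜ.indicator (fun _ => (1:ℝ)) ω) (B * P.real c.Gᶜ) := by
    refine IntLE.const_mul ⟨(integrable_const _).indicator hGm.compl, ?_⟩ hB
    rw [integral_indicator_const _ hGm.compl]; simp
  have i3 := ((IntLE.of_integrable ix).add (i1.const_mul Λ.2)).add i2
  have hpt : ∀ ω, g (S.seg η s ω) ≤ c.G.indicator (fun ω => g (c.x ω)) ω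
      + Λ * (Real.exp (1 + r₀) * (δ + δ⁻¹ * c.G.indicator c.V ω)
      + (2 * N + 1) * modulus (S.seg η) T h ω) + B * c.Gᶜ.indicator (fun _ => (1:ℝ)) ω := by
    intro ω
    have hm := modulus_nonneg (Z := S.seg η) (T := T) (τ := h) ω
    by_cases hω : ω ∈ c.G
    · rw [indicator_of_mem hω, indicator_of_mem hω, indicator_of_notMem (notMem_compl_iff.2 hω)]
      have h1 := c.norm_seg_sub_le hε.le hN hh1 hω
      have h2 : g (S.seg η s ω) - g (c.x ω) ≤ Λ * ‖c.x ω - S.seg η s ω‖ := by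
        have := hgL.dist_le_mul (S.seg η s ω) (c.x ω)
        rw [dist_comm (S.seg η s ω), dist_eq_norm (c.x ω), Real.dist_eq] at this
        exact (le_abs_self _).trans this
      have h3 : c.R ω ≤ δ + δ⁻¹ * c.V ω := by
        have h4 := c.R_sq_le_V ω
        have h5 : c.R ω ≤ δ + δ⁻¹ * c.R ω ^ 2 := by
          have e : δ + δ⁻¹ * c.R ω ^ 2 - c.R ω = δ⁻¹ * ((c.R ω - δ / 2) ^ 2 + 3 / 4 * δ ^ 2) := by
            field_simp; ring
          have : 0 ≤ δ⁻¹ * ((c.R ω - δ / 2) ^ 2 + 3 / 4 * δ ^ 2) := by positivity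
          linarith
        have h6 := mul_le_mul_of_nonneg_left h4 (inv_pos.2 hδ).le
        linarith
      have h7 : ‖c.x ω - S.seg η s ω‖ ≤ Real.exp (1 + r₀) * (δ + δ⁻¹ * c.V ω)
          + (2 * N + 1) * modulus (S.seg η) T h ω := by
        refine h1.trans (add_le_add (mul_le_mul_of_nonneg_left h3 (Real.exp_pos _).le) le_rfl)
      have h8 := mul_le_mul_of_nonneg_left h7 Λ.2
      simp only [NNReal.val_eq_coe] at h8
      linarith
    · rw [indicator_of_notMem hω, indicator_of_notMem hω, indicator_of_mem (by exact hω)]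
      have h1 := (hg (S.seg η s ω)).2
      have h2 : 0 ≤ (Λ:ℝ) * (Real.exp (1 + r₀) * (δ + δ⁻¹ * 0)
          + (2 * N + 1) * modulus (S.seg η) T h ω) :=
        mul_nonneg Λ.2 (add_nonneg (mul_nonneg (Real.exp_pos _).le (by simp [hδ.le]))
          (mul_nonneg (by linarith) hm))
      linarith
  refine ((integral_mono iS i3.1 hpt).trans i3.2).trans ?_
  have hme : ∫ ω, modulus (S.seg η) T h ω ∂P ≤ S.modErr η T h :=
    le_add_of_nonneg_right (integral_nonneg fun ω => modulus_nonneg ω)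
  have h1 := mul_le_mul_of_nonneg_left (mul_le_mul_of_nonneg_left hme
    (by linarith : 0 ≤ 2 * N + 1)) Λ.2
  simp only [NNReal.val_eq_coe] at h1 ⊢
  rw [div_eq_inv_mul]
  linarith

lemma tendsto_modErr (S : PathSDE d r₀ Ω P) (η : Seg d r₀) (T : ℝ) {τ : ℕ → ℝ}
    (hτ : Tendsto τ atTop (𝓝 0)) : Tendsto (fun n => S.modErr η T (τ n)) atTop (𝓝 0) := by
  have := S.hP
  have h1 := tendsto_integral_modulus (P := P) (fun ω => S.continuous_seg η ω)
    (fun t => S.stronglyMeasurable_seg' η t) T hτ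
  have h2 := tendsto_integral_modulus (P := P) (fun ω => S.continuous_b_seg η ω)
    (fun t => S.hA1bcont.comp_stronglyMeasurable (S.stronglyMeasurable_seg' η t)) T hτ
  simpa [modErr] using h1.add h2

/-- Comparison of the solution with the Euler scheme at a fixed localisation level. -/
lemma exists_eventually_le (S : PathSDE d r₀ Ω P) : ∃ κ : ℝ, 0 ≤ κ ∧ ∀ (N ε T : ℝ), 0 < N → 0 < ε →
    0 < T → ∀ (ξ η : Seg d r₀), ‖η‖ ≤ N → ‖ξ - η‖ + ε ≤ N →
    ∀ (g : Seg d r₀ → ℝ) (B : ℝ) (Λ : ℝ≥0), (∀ x, g x ∈ Icc 0 B) → LipschitzWith Λ g →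
    ∀ δ, 0 < δ → ∀ ρ, 0 < ρ → ∀ᶠ n : ℕ in atTop,
      ∫ ω, g (S.seg η T ω) ∂P
        ≤ Real.log (S.eulerOp (T / n) n (fun x => Real.exp (g x)) ξ)
          + κ * (2 * (2 * (‖ξ - η‖ + ε) ^ 2))
          + Λ * (Real.exp (1 + r₀)
            * (δ + (Real.exp (-(T / 2)) * (2 * (‖ξ - η‖ + ε) ^ 2)) / δ))
          + B * (P.real (S.inBall η N T)ᶜ + (2 * (‖ξ - η‖ + ε) ^ 2) / N ^ 2) + ρ := by
  have hP := S.hP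
  obtain ⟨κ, hκ, h₀, hh₀, hh₀1, hch⟩ := S.exists_chain
  refine ⟨κ, hκ, fun N ε T hN hε hT ξ η hη hR g B Λ hg hgL δ hδ ρ hρ => ?_⟩
  obtain ⟨C, hC, hchain⟩ := hch N ε T hN.le hε
  have hB : 0 ≤ B := (hg 0).1.trans (hg 0).2
  set V0 := 2 * (‖ξ - η‖ + ε) ^ 2 with hV0
  have hτ : Tendsto (fun n : ℕ => T / (n:ℝ)) atTop (𝓝 0) := tendsto_const_div_atTop_nhds_zero_nat T
  have hm := S.tendsto_modErr η T hτ
  have herr : Tendsto (fun n : ℕ => C * (T * S.modErr η T (T / n) + T * (T / n))) atTop (𝓝 0) := by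
    simpa using ((hm.const_mul T).add (hτ.const_mul T)).const_mul C
  have hlim : Tendsto (fun n : ℕ => κ * (2 * (C * (T * S.modErr η T (T / n) + T * (T / n))))
      + Λ * (Real.exp (1 + r₀) * (C * (T * S.modErr η T (T / n) + T * (T / n)) / δ)
        + (2 * N + 1) * S.modErr η T (T / n))
      + B * (C * (T * S.modErr η T (T / n) + T * (T / n)) / N ^ 2)) atTop (𝓝 0) := by
    simpa using (((herr.const_mul 2).const_mul κ).add ((((herr.div_const δ).const_mul
      (Real.exp (1 + r₀))).add (hm.const_mul (2 * N + 1))).const_mul (Λ:ℝ))).add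
      ((herr.div_const (N ^ 2)).const_mul B)
  filter_upwards [hlim.eventually_lt_const hρ, hτ.eventually_lt_const hh₀, eventually_gt_atTop 0]
    with n hn1 hn2 hn3
  have hn : (0:ℝ) < n := by exact_mod_cast hn3
  have hh : 0 < T / n := div_pos hT hn
  have hnT : n * (T / n) = T := mul_div_cancel₀ T hn.ne'
  set h := T / n with hhdef
  obtain ⟨s, c, q, a, hs, ha, hq, i1, i2, i3⟩ := hchain ξ η h n hh hn2.le hnT hη hR
    (fun x => Real.exp (g x)) (Real.exp B) (Real.measurable_exp.comp hgL.continuous.measurable)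
    (fun x => ⟨Real.one_le_exp (hg x).1, Real.exp_le_exp.2 (hg x).2⟩) n le_rfl
  rw [hnT] at hs
  subst hs
  have hs0 : 0 ≤ s := hT.le
  have hne : (n:ℝ) * (C * (h * S.modErr η s h + h ^ 2)) = C * (s * S.modErr η s h + s * h) := by
    rw [← hnT]; ring
  rw [hne] at i1 i3
  set err := C * (s * S.modErr η s h + s * h) with herrdef
  set E := ∫ ω, c.G.indicator c.V ω ∂P with hEdef
  have hE0 : 0 ≤ E := integral_nonneg fun ω => indicator_nonneg (fun ω _ => c.V_nonneg ω) ω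
  have hfin := c.integral_le hε hN.le hs0 (by linarith) hg hgL hδ
  rw [← hEdef] at hfin
  have e1 : ∀ x, Real.log (S.eulerOp h (n - n) (fun x => Real.exp (g x)) x) = g x := fun x => by
    rw [Nat.sub_self]; exact Real.log_exp _
  simp only [e1] at i2
  have hq0 : 0 ≤ q := measureReal_nonneg.trans hq
  have hNq : 0 ≤ N ^ 2 * q := by positivity
  have ha' : a ≤ 2 * V0 + 2 * err := by linarith
  have hka := mul_le_mul_of_nonneg_left ha' hκ
  have hpow : (1 - h / 2) ^ n ≤ Real.exp (-(s / 2)) := by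
    have h1 : 1 - h / 2 ≤ Real.exp (-(h / 2)) := Real.one_sub_le_exp_neg _
    have h2 := pow_le_pow_left₀ (by linarith : 0 ≤ 1 - h / 2) h1 n
    rwa [← Real.exp_nat_mul, show (n:ℝ) * -(h / 2) = -(s / 2) by rw [← hnT]; ring] at h2
  have hE : E ≤ Real.exp (-(s / 2)) * V0 + err :=
    i3.trans (add_le_add (mul_le_mul_of_nonneg_right hpow (by positivity)) le_rfl)
  have hEδ : E / δ ≤ (Real.exp (-(s / 2)) * V0) / δ + err / δ := by
    rw [← add_div]; exact div_le_div_of_nonneg_right hE hδ.le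
  have hΛ := mul_le_mul_of_nonneg_left (mul_le_mul_of_nonneg_left hEδ (Real.exp_pos (1 + r₀)).le)
    Λ.2
  have hqV : q ≤ V0 / N ^ 2 + err / N ^ 2 := by
    rw [← add_div, le_div_iff₀ (by positivity)]; linarith
  have hPG : P.real c.Gᶜ ≤ P.real (S.inBall η N s)ᶜ + q := by
    have hsub : c.Gᶜ ⊆ (S.inBall η N s)ᶜ ∪ (S.inBall η N s \ c.G) := fun ω hω => by
      by_cases h1 : ω ∈ S.inBall η N s
      · exact Or.inr ⟨h1, hω⟩
      · exact Or.inl h1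
    exact (measureReal_mono hsub).trans ((measureReal_union_le _ _).trans (add_le_add le_rfl hq))
  have hBG := mul_le_mul_of_nonneg_left (hPG.trans (add_le_add le_rfl hqV)) hB
  simp only [NNReal.val_eq_coe] at hΛ
  linarith

end PathSDE

namespace PathSDE

lemma tendsto_measureReal_inBall_compl (S : PathSDE d r₀ Ω P) (η : Seg d r₀) {T : ℝ} (hT : 0 ≤ T) :
    Tendsto (fun n : ℕ => P.real (S.inBall η n T)ᶜ) atTop (𝓝 0) := by
  have hP := S.hP
  have hm : ∀ n : ℕ, MeasurableSet (S.inBall η n T)ᶜ := fun n =>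
    (S.measurableSet_inBall' η n hT).compl
  have h1 := tendsto_integral_of_dominated_convergence (μ := P)
    (F := fun n : ℕ => (S.inBall η n T)ᶜ.indicator fun _ => (1:ℝ)) (f := fun _ => 0)
    (fun _ => (1:ℝ)) (fun n => (stronglyMeasurable_const.indicator (hm n)).aestronglyMeasurable)
    (integrable_const _) (fun n => ae_of_all _ fun ω => by
      refine (norm_indicator_le_norm_self _ _).trans (by simp)) (ae_of_all _ fun ω => by
      obtain ⟨n₀, h⟩ := S.exists_mem_inBall η T ω
      refine tendsto_const_nhds.congr' ?_
      filter_upwards [eventually_ge_atTop n₀] with n hn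
      rw [indicator_of_notMem (notMem_compl_iff.2 (h n hn))])
  simpa [integral_indicator_const, hm] using h1

/-- Comparison of the solution from `η` with the Euler scheme from `ξ`. -/
lemma exists_eventually_le_eulerOp (S : PathSDE d r₀ Ω P) : ∃ κ : ℝ, 0 ≤ κ ∧ ∀ T : ℝ,
    0 < T → ∀ (ξ η : Seg d r₀) (g : Seg d r₀ → ℝ) (B : ℝ) (Λ : ℝ≥0), (∀ x, g x ∈ Icc 0 B) →
    LipschitzWith Λ g → ∀ δ, 0 < δ → ∀ ρ, 0 < ρ → ∀ᶠ n : ℕ in atTop,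
      ∫ ω, g (S.seg η T ω) ∂P
        ≤ Real.log (S.eulerOp (T / n) n (fun x => Real.exp (g x)) ξ)
          + κ * (2 * (2 * ‖ξ - η‖ ^ 2))
          + Λ * (Real.exp (1 + r₀) * (δ + (Real.exp (-(T / 2)) * (2 * ‖ξ - η‖ ^ 2)) / δ)) + ρ := by
  obtain ⟨κ, hκ, H⟩ := S.exists_eventually_le
  refine ⟨κ, hκ, fun T hT ξ η g B Λ hg hgL δ hδ ρ hρ => ?_⟩
  have hB : 0 ≤ B := (hg 0).1.trans (hg 0).2
  set F : ℝ → ℝ := fun ε => κ * (2 * (2 * (‖ξ - η‖ + ε) ^ 2))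
    + Λ * (Real.exp (1 + r₀) * (δ + (Real.exp (-(T / 2)) * (2 * (‖ξ - η‖ + ε) ^ 2)) / δ)) with hF
  have hFc : Tendsto F (𝓝[>] 0) (𝓝 (F 0)) :=
    (by fun_prop : Continuous F).continuousAt.mono_left nhdsWithin_le_nhds
  obtain ⟨ε, hε1, hε⟩ := ((hFc.eventually_lt_const (by linarith : F 0 < F 0 + ρ / 3)).and
    self_mem_nhdsWithin).exists
  have hε0 : 0 < ε := hε
  have hN : Tendsto (fun n : ℕ => B * (P.real (S.inBall η n T)ᶜ
      + (2 * (‖ξ - η‖ + ε) ^ 2) / (n:ℝ) ^ 2)) atTop (𝓝 0) := by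
    have h2 : Tendsto (fun n : ℕ => (2 * (‖ξ - η‖ + ε) ^ 2) / (n:ℝ) ^ 2) atTop (𝓝 0) :=
      Tendsto.div_atTop tendsto_const_nhds
        ((tendsto_pow_atTop two_ne_zero).comp tendsto_natCast_atTop_atTop)
    simpa using ((S.tendsto_measureReal_inBall_compl η hT.le).add h2).const_mul B
  obtain ⟨N, hN1, hN2, hN3, hN4⟩ := ((hN.eventually_lt_const (by linarith : 0 < ρ / 3)).and
    ((eventually_gt_atTop 0).and ((tendsto_natCast_atTop_atTop.eventually_ge_atTop ‖η‖).and
      (tendsto_natCast_atTop_atTop.eventually_ge_atTop (‖ξ - η‖ + ε))))).exists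
  filter_upwards [H N ε T (by exact_mod_cast hN2) hε0 hT ξ η hN3 hN4 g B Λ hg hgL δ hδ (ρ / 3)
    (by linarith)] with n hn
  have e0 : F 0 = κ * (2 * (2 * ‖ξ - η‖ ^ 2))
    + Λ * (Real.exp (1 + r₀) * (δ + (Real.exp (-(T / 2)) * (2 * ‖ξ - η‖ ^ 2)) / δ)) := by
    simp [hF]
  simp only [hF] at hε1
  simp only [hF] at e0
  linarith

/-- The Euler scheme is asymptotically bounded above by the solution. -/
lemma eventually_eulerOp_le (S : PathSDE d r₀ Ω P) {T : ℝ} (hT : 0 < T) (ξ : Seg d r₀)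
    {ψ : Seg d r₀ → ℝ} {B : ℝ} {Λ : ℝ≥0} (hψ : ∀ x, ψ x ∈ Icc 0 B) (hψL : LipschitzWith Λ ψ)
    {ρ : ℝ} (hρ : 0 < ρ) :
    ∀ᶠ n : ℕ in atTop, S.eulerOp (T / n) n ψ ξ ≤ (∫ ω, ψ (S.seg ξ T ω) ∂P) + ρ := by
  have hP := S.hP
  obtain ⟨κ, hκ, H⟩ := S.exists_eventually_le_eulerOp
  have hB : 0 ≤ B := (hψ 0).1.trans (hψ 0).2
  set c := Real.exp (1 + r₀) with hc
  have hc0 : 0 < c := Real.exp_pos _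
  obtain ⟨u, hu0, hu1, hu2⟩ : ∃ u : ℝ, 0 < u ∧ u * B ≤ 1 ∧ u * (B ^ 2 + 1 + Λ * c) ≤ ρ := by
    have hΛ : (0:ℝ) ≤ Λ := Λ.2
    refine ⟨min (1 / (B + 1)) (ρ / (B ^ 2 + 1 + Λ * c)), by positivity, ?_, ?_⟩
    · calc _ ≤ 1 / (B + 1) * B := mul_le_mul_of_nonneg_right (min_le_left _ _) hB
        _ ≤ 1 := by rw [div_mul_eq_mul_div, div_le_one (by positivity)]; linarith
    · calc _ ≤ ρ / (B ^ 2 + 1 + Λ * c) * (B ^ 2 + 1 + Λ * c) :=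
            mul_le_mul_of_nonneg_right (min_le_right _ _) (by positivity)
        _ = ρ := div_mul_cancel₀ _ (by positivity)
  set g : Seg d r₀ → ℝ := fun x => u * (B - ψ x) with hgdef
  have hg : ∀ x, g x ∈ Icc 0 1 := fun x =>
    ⟨mul_nonneg hu0.le (by linarith [(hψ x).2]),
      (mul_le_mul_of_nonneg_left (by linarith [(hψ x).1]) hu0.le).trans hu1⟩
  have hgL : LipschitzWith (Real.toNNReal u * Λ) g := by
    refine LipschitzWith.of_dist_le_mul fun x y => ?_
    have h1 := hψL.dist_le_mul x y
    have e : g x - g y = -(u * (ψ x - ψ y)) := by simp only [hgdef]; ring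
    rw [Real.dist_eq, e, abs_neg, abs_mul, abs_of_pos hu0, NNReal.coe_mul,
      Real.coe_toNNReal _ hu0.le, mul_assoc]
    exact mul_le_mul_of_nonneg_left h1 hu0.le
  filter_upwards [H T hT ξ ξ g 1 _ hg hgL u hu0 (u ^ 2) (by positivity)] with n hn
  have hψm : Measurable ψ := hψL.continuous.measurable
  have hgm : Measurable g := hgL.continuous.measurable
  have hpt : ∀ x, Real.exp (g x) ≤ (1 + u * B + u ^ 2 * B ^ 2) + (-u) * ψ x := fun x => by
    have h1 := Real.abs_exp_sub_one_sub_id_le (x := g x)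
      (by rw [abs_of_nonneg (hg x).1]; exact (hg x).2)
    have h2 := (abs_le.1 h1).2
    have h3 : g x ≤ u * B := mul_le_mul_of_nonneg_left (by linarith [(hψ x).1]) hu0.le
    have h4 := pow_le_pow_left₀ (hg x).1 h3 2
    have e : g x = u * B - u * ψ x := by simp only [hgdef]; ring
    rw [mul_pow] at h4
    linarith
  have hQ : S.eulerOp (T / n) n (fun x => Real.exp (g x)) ξ
      ≤ (1 + u * B + u ^ 2 * B ^ 2) + (-u) * S.eulerOp (T / n) n ψ ξ := by
    rw [← S.eulerOp_affine hψm hψ]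
    refine S.eulerOp_mono (a := 0) (c := Real.exp 1) (a' := -(u * B))
      (c' := 1 + u * B + u ^ 2 * B ^ 2) (Real.measurable_exp.comp hgm)
      ((hψm.const_mul (-u)).const_add _)
      (fun x => ⟨(Real.exp_pos _).le, Real.exp_le_exp.2 (hg x).2⟩) (fun x => ?_) hpt n ξ
    have h1 := mul_le_mul_of_nonneg_left (hψ x).2 hu0.le
    have h2 := mul_nonneg hu0.le (hψ x).1
    have h3 : 0 ≤ u ^ 2 * B ^ 2 := by positivity
    have h4 : 0 ≤ u * B := by positivity
    constructor <;> linarith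
  have hQ1 : 1 ≤ S.eulerOp (T / n) n (fun x => Real.exp (g x)) ξ :=
    (S.eulerOp_mem (c := Real.exp 1) (Real.measurable_exp.comp hgm)
      (fun x => ⟨Real.one_le_exp (hg x).1, Real.exp_le_exp.2 (hg x).2⟩) n ξ).1
  have hlog := Real.log_le_sub_one_of_pos (zero_lt_one.trans_le hQ1)
  have hint : ∫ ω, g (S.seg ξ T ω) ∂P = u * (B - ∫ ω, ψ (S.seg ξ T ω) ∂P) := by
    have i : Integrable (fun ω => ψ (S.seg ξ T ω)) P := integrable_of_mem_Icc hP
      (hψL.continuous.comp_stronglyMeasurable (S.stronglyMeasurable_seg' ξ T)) fun ω => hψ _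
    simp only [hgdef]
    rw [integral_const_mul, integral_sub (integrable_const _) i]
    simp
  rw [hint] at hn
  simp only [sub_self, norm_zero, NNReal.coe_mul, Real.coe_toNNReal _ hu0.le] at hn
  norm_num at hn
  have key : u * S.eulerOp (T / n) n ψ ξ ≤ u * ((∫ ω, ψ (S.seg ξ T ω) ∂P) + ρ) := by
    have h5 := mul_le_mul_of_nonneg_left hu2 hu0.le
    nlinarith
  exact le_of_mul_le_mul_left key hu0

/-- Asymptotic log-Harnack inequality. -/
theorem exists_harnack (S : PathSDE d r₀ Ω P) : ∃ κ c : ℝ, 0 ≤ κ ∧ 0 ≤ c ∧ ∀ T : ℝ, 0 < T →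
    ∀ (ξ η : Seg d r₀) (g : Seg d r₀ → ℝ) (B : ℝ) (Λ : ℝ≥0), (∀ x, g x ∈ Icc 0 B) →
    LipschitzWith Λ g → ∀ δ, 0 < δ →
      ∫ ω, g (S.seg η T ω) ∂P ≤ Real.log (∫ ω, Real.exp (g (S.seg ξ T ω)) ∂P)
        + κ * ‖ξ - η‖ ^ 2 + Λ * (c * (δ + Real.exp (-(T / 2)) * ‖ξ - η‖ ^ 2 / δ)) := by
  have hP := S.hP
  obtain ⟨κ, hκ, H⟩ := S.exists_eventually_le_eulerOp
  refine ⟨κ * 4, Real.exp (1 + r₀) * 2, by positivity, by positivity,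
    fun T hT ξ η g B Λ hg hgL δ hδ => le_of_forall_pos_le_add fun ρ hρ => ?_⟩
  have hB : 0 ≤ B := (hg 0).1.trans (hg 0).2
  have hψ : ∀ x, Real.exp (g x) ∈ Icc 0 (Real.exp B) := fun x =>
    ⟨(Real.exp_pos _).le, Real.exp_le_exp.2 (hg x).2⟩
  have hψL : LipschitzWith (Real.toNNReal (Real.exp B) * Λ) fun x => Real.exp (g x) := by
    refine LipschitzWith.of_dist_le_mul fun x y => ?_
    have key : ∀ a b : ℝ, a ≤ B → Real.exp a - Real.exp b ≤ Real.exp B * |a - b| := fun a b ha => by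
      have h1 : 1 - (a - b) ≤ Real.exp (-(a - b)) := Real.one_sub_le_exp_neg _
      have e : Real.exp b = Real.exp a * Real.exp (-(a - b)) := by
        rw [← Real.exp_add]; ring_nf
      have h2 := mul_le_mul_of_nonneg_left h1 (Real.exp_pos a).le
      have h3 := mul_le_mul_of_nonneg_left (le_abs_self (a - b)) (Real.exp_pos a).le
      have h4 := mul_le_mul_of_nonneg_right (Real.exp_le_exp.2 ha) (abs_nonneg (a - b))
      linarith
    have h1 := hgL.dist_le_mul x y
    rw [Real.dist_eq] at h1 ⊢
    rw [NNReal.coe_mul, Real.coe_toNNReal _ (Real.exp_pos _).le, mul_assoc]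
    refine le_trans ?_ (mul_le_mul_of_nonneg_left h1 (Real.exp_pos B).le)
    rw [abs_le]
    have k1 := key (g x) (g y) (hg x).2
    have k2 := key (g y) (g x) (hg y).2
    rw [abs_sub_comm] at k2
    constructor <;> linarith
  obtain ⟨n, hn1, hn2⟩ := ((H T hT ξ η g B Λ hg hgL δ hδ (ρ / 2) (by positivity)).and
    (S.eventually_eulerOp_le hT ξ hψ hψL (ρ := ρ / 2) (by positivity))).exists
  have iI : Integrable (fun ω => Real.exp (g (S.seg ξ T ω))) P := integrable_of_mem_Icc hP
    (hψL.continuous.comp_stronglyMeasurable (S.stronglyMeasurable_seg' ξ T)) fun ω => hψ _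
  set I := ∫ ω, Real.exp (g (S.seg ξ T ω)) ∂P with hI
  have hI1 : 1 ≤ I := by
    simpa using integral_mono (integrable_const (1:ℝ)) iI fun ω => Real.one_le_exp (hg _).1
  have hQ1 : 1 ≤ S.eulerOp (T / n) n (fun x => Real.exp (g x)) ξ :=
    (S.eulerOp_mem (c := Real.exp B) (Real.measurable_exp.comp hgL.continuous.measurable)
      (fun x => ⟨Real.one_le_exp (hg x).1, Real.exp_le_exp.2 (hg x).2⟩) n ξ).1
  have hlog : Real.log (S.eulerOp (T / n) n (fun x => Real.exp (g x)) ξ) ≤ Real.log I + ρ / 2 := by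
    have h1 := Real.log_le_log (zero_lt_one.trans_le hQ1) hn2
    have h2 : I + ρ / 2 ≤ I * (1 + ρ / 2) := by
      have := mul_le_mul_of_nonneg_right hI1 (by positivity : 0 ≤ ρ / 2)
      linarith
    have h3 := Real.log_le_log (by positivity) h2
    rw [Real.log_mul (by positivity) (by positivity)] at h3
    have h4 := Real.log_le_sub_one_of_pos (by positivity : 0 < 1 + ρ / 2)
    linarith
  have e : (Λ:ℝ) * (Real.exp (1 + r₀) * (δ + Real.exp (-(T / 2)) * (2 * ‖ξ - η‖ ^ 2) / δ))
      ≤ Λ * (Real.exp (1 + r₀) * 2 * (δ + Real.exp (-(T / 2)) * ‖ξ - η‖ ^ 2 / δ)) := by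
    refine mul_le_mul_of_nonneg_left ?_ Λ.2
    have : 0 ≤ Real.exp (1 + r₀) * δ := by positivity
    have e1 : Real.exp (1 + r₀) * 2 * (δ + Real.exp (-(T / 2)) * ‖ξ - η‖ ^ 2 / δ)
      = Real.exp (1 + r₀) * (δ + Real.exp (-(T / 2)) * (2 * ‖ξ - η‖ ^ 2) / δ)
        + Real.exp (1 + r₀) * δ := by ring
    linarith
  linarith

end PathSDE

/-- For `f ∈ [0, a]` with `a ≤ 1`, `log ∫ exp f ≤ ∫ f + a ^ 2`. -/
lemma log_integral_exp_le {α : Type*} [MeasurableSpace α] {m : Measure α} [IsProbabilityMeasure m]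
    {f : α → ℝ} (hf : AEStronglyMeasurable f m) {a : ℝ} (ha : a ≤ 1) (h : ∀ x, f x ∈ Icc 0 a) :
    Real.log (∫ x, Real.exp (f x) ∂m) ≤ ∫ x, f x ∂m + a ^ 2 := by
  have hi : Integrable f m := .of_bound hf a (.of_forall fun x => by
    rw [Real.norm_of_nonneg (h x).1]; exact (h x).2)
  have he : Integrable (fun x => Real.exp (f x)) m :=
    .of_bound (Real.continuous_exp.comp_aestronglyMeasurable hf) (Real.exp a)
      (.of_forall fun x => by
        rw [Real.norm_of_nonneg (Real.exp_pos _).le]; exact Real.exp_le_exp.2 (h x).2)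
  have h1 : ∫ x, Real.exp (f x) ∂m ≤ ∫ x, (f x + (1 + a ^ 2)) ∂m := by
    refine integral_mono he (hi.add (integrable_const _)) fun x => ?_
    have h0 := (h x).1
    have hx := (h x).2
    have := Real.abs_exp_sub_one_sub_id_le (x := f x) (by rw [abs_of_nonneg h0]; linarith)
    have := (abs_le.1 this).2
    simp only
    nlinarith [pow_le_pow_left₀ h0 hx 2]
  rw [integral_add hi (integrable_const _)] at h1
  have hpos : 0 < ∫ x, Real.exp (f x) ∂m := integral_exp_pos he
  have := Real.log_le_sub_one_of_pos hpos
  simp at h1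
  linarith

lemma LipschitzWith.real_const_mul {α : Type*} [PseudoMetricSpace α] {f : α → ℝ} {Λ : ℝ≥0}
    (hf : LipschitzWith Λ f) {r : ℝ} (hr : 0 ≤ r) :
    LipschitzWith (r.toNNReal * Λ) fun x => r * f x :=
  .of_dist_le_mul fun x y => by
    rw [Real.dist_eq, ← mul_sub, abs_mul, abs_of_nonneg hr, NNReal.coe_mul,
      Real.coe_toNNReal _ hr, mul_assoc]
    exact mul_le_mul_of_nonneg_left (hf.dist_le_mul x y) hr

/-- An asymptotic log-Harnack inequality for a family of measures on a normed space. -/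
def LogHarnack {E : Type*} [NormedAddCommGroup E] [MeasurableSpace E] (m : E → Measure E)
    (κ c e : ℝ) : Prop :=
  ∀ (ξ η : E) (g : E → ℝ) (B : ℝ) (Λ : ℝ≥0), (∀ x, g x ∈ Icc 0 B) → LipschitzWith Λ g →
    ∀ δ, 0 < δ → ∫ x, g x ∂(m η) ≤ Real.log (∫ x, Real.exp (g x) ∂(m ξ))
      + κ * ‖ξ - η‖ ^ 2 + Λ * (c * (δ + e * ‖ξ - η‖ ^ 2 / δ))

namespace LogHarnack

variable {E : Type*} [NormedAddCommGroup E] [MeasurableSpace E] [BorelSpace E]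
  {m : E → Measure E} {κ c e : ℝ}

lemma continuous_integral [SecondCountableTopology E] (H : LogHarnack m κ c e)
    (hm : ∀ x, IsProbabilityMeasure (m x))
    {f : E → ℝ} {B : ℝ} {Λ : ℝ≥0} (hf : ∀ x, f x ∈ Icc 0 B) (hL : LipschitzWith Λ f) :
    Continuous fun x => ∫ y, f y ∂(m x) := by
  have hB : 0 ≤ B := (hf 0).1.trans (hf 0).2
  have key : ∀ ξ η : E, 0 < ‖ξ - η‖ → ‖ξ - η‖ * B ≤ 1 →
      ∫ y, f y ∂(m η) - ∫ y, f y ∂(m ξ) ≤ (B ^ 2 + κ + Λ * (c * (1 + e))) * ‖ξ - η‖ := by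
    intro ξ η hr hrB
    set r := ‖ξ - η‖
    have hg : ∀ x, r * f x ∈ Icc 0 (r * B) := fun x =>
      ⟨mul_nonneg hr.le (hf x).1, mul_le_mul_of_nonneg_left (hf x).2 hr.le⟩
    have hgL := hL.real_const_mul hr.le
    have h1 := H ξ η _ _ _ hg hgL r hr
    have h2 := log_integral_exp_le (m := m ξ)
      (hL.continuous.const_mul r).aestronglyMeasurable hrB hg
    rw [integral_const_mul] at h1 h2
    rw [NNReal.coe_mul, Real.coe_toNNReal _ hr.le] at h1
    have h3 : e * r ^ 2 / r = e * r := by field_simp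
    change r * _ ≤ _ + κ * r ^ 2 + r * Λ * (c * (r + e * r ^ 2 / r)) at h1
    rw [h3] at h1
    have h4 : r * (∫ y, f y ∂(m η) - ∫ y, f y ∂(m ξ)) ≤
        r * ((B ^ 2 + κ + Λ * (c * (1 + e))) * r) := by nlinarith
    exact le_of_mul_le_mul_left h4 hr
  refine continuous_iff_continuousAt.2 fun ξ => ?_
  rw [ContinuousAt, tendsto_iff_dist_tendsto_zero]
  refine squeeze_zero' (g := fun η => |B ^ 2 + κ + Λ * (c * (1 + e))| * ‖ξ - η‖)
    (.of_forall fun _ => dist_nonneg) ?_ ?_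
  · have : ∀ᶠ η in 𝓝 ξ, ‖ξ - η‖ * B < 1 := by
      have hc : Continuous fun η : E => ‖ξ - η‖ * B := by fun_prop
      exact hc.continuousAt.eventually_lt continuousAt_const (by simp)
    filter_upwards [this] with η hη
    rcases (norm_nonneg (ξ - η)).eq_or_lt with h0 | h0
    · have : ξ = η := sub_eq_zero.1 (norm_eq_zero.1 h0.symm)
      simp [this]
    · have hle := mul_le_mul_of_nonneg_right (le_abs_self (B ^ 2 + κ + Λ * (c * (1 + e)))) h0.le
      rw [Real.dist_eq, abs_sub_le_iff]
      refine ⟨(key ξ η h0 hη.le).trans hle, ?_⟩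
      have h0' := h0
      rw [norm_sub_rev] at h0' hη
      have := key η ξ h0' hη.le
      rw [norm_sub_rev η ξ] at this
      exact this.trans hle
  · have : Tendsto (fun η : E => |B ^ 2 + κ + Λ * (c * (1 + e))| * ‖ξ - η‖) (𝓝 ξ)
        (𝓝 (|B ^ 2 + κ + Λ * (c * (1 + e))| * ‖ξ - ξ‖)) :=
      Continuous.tendsto (by fun_prop) ξ
    simpa using this

lemma measurable [SecondCountableTopology E] (H : LogHarnack m κ c e)
    (hm : ∀ x, IsProbabilityMeasure (m x)) : Measurable m := by
  refine .measure_of_isPiSystem_of_isProbabilityMeasure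
    (BorelSpace.measurable_eq.trans borel_eq_generateFrom_isClosed) isPiSystem_isClosed
    fun F hF => ?_
  have hlim := fun x => tendsto_integral_thickenedIndicator_of_isClosed (m x) hF
    (δs := fun n : ℕ => (1 : ℝ) / (n + 1)) (fun n => by positivity)
    tendsto_one_div_add_atTop_nhds_zero_nat
  have : Measurable fun x => (m x).real F :=
    measurable_of_tendsto_metrizable (fun n => (H.continuous_integral hm (B := 1)
      (fun x => ⟨NNReal.coe_nonneg _, by exact_mod_cast thickenedIndicator_le_one _ F x⟩)
      (lipschitzWith_thickenedIndicator (by positivity) F)).measurable) (tendsto_pi_nhds.2 hlim)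
  simpa [Measure.real] using this.ennreal_ofReal

end LogHarnack

lemma ProbabilityTheory.Kernel.integral_bind {α β : Type*} [MeasurableSpace α] [MeasurableSpace β]
    (κ : Kernel α β) {μ : Measure α} {f : β → ℝ} (hf : Integrable f (μ.bind κ)) :
    Integrable (fun x => ∫ y, f y ∂(κ x)) μ ∧ ∫ y, f y ∂(μ.bind κ) = ∫ x, ∫ y, f y ∂(κ x) ∂μ := by
  rw [Measure.comp_eq_comp_const_apply] at hf ⊢
  exact ⟨by simpa using hf.integral_comp, by simpa using Kernel.integral_comp hf⟩

lemma integral_le_add_mul_integral {α : Type*} [MeasurableSpace α] {μ : Measure α}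
    [IsProbabilityMeasure μ] {f φ : α → ℝ} (hf : Integrable f μ) (hφ : Integrable φ μ) {A D : ℝ}
    (h : ∀ x, f x ≤ A + D * φ x) : ∫ x, f x ∂μ ≤ A + D * ∫ x, φ x ∂μ := by
  refine (integral_mono hf ((integrable_const A).add (hφ.const_mul D)) h).trans_eq ?_
  rw [integral_add' (integrable_const A) (hφ.const_mul D), integral_const_mul]
  simp

/-- Invariant measures inherit the moment bounds of a contracting family of kernels. -/
lemma integrable_of_forall_invariant {E : Type*} [MeasurableSpace E] {K : ℕ → Kernel E E}
    [∀ n, IsMarkovKernel (K n)] {φ : E → ℝ≥0∞} (hφ : Measurable φ) (hφt : ∀ x, φ x ≠ ∞) {C : ℝ≥0∞}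
    (hC : C ≠ ∞) {a : ℕ → ℝ≥0∞} (ha : Tendsto a atTop (𝓝 0))
    (hK : ∀ n x, ∫⁻ y, φ y ∂(K n x) ≤ C * (1 + a n * φ x)) {μ : Measure E} [IsProbabilityMeasure μ]
    (hμ : ∀ n, (K n).Invariant μ) : ∫⁻ x, φ x ∂μ ≤ C := by
  have hM : ∀ M : ℕ, ∫⁻ x, min (φ x) M ∂μ ≤ C := by
    intro M
    have hle : ∀ n, ∫⁻ x, min (φ x) M ∂μ ≤ ∫⁻ x, min (C * (1 + a n * φ x)) M ∂μ := fun n => by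
      conv_lhs => rw [← (hμ n).def]
      rw [Measure.lintegral_bind (K n).aemeasurable (by fun_prop)]
      refine lintegral_mono fun x => le_min ((lintegral_mono fun y => min_le_left _ _).trans
        (hK n x)) ((lintegral_mono fun y => min_le_right _ _).trans (by simp))
    have hlim : Tendsto (fun n => ∫⁻ x, min (C * (1 + a n * φ x)) M ∂μ) atTop
        (𝓝 (∫⁻ _, min (C * (1 + 0)) M ∂μ)) := by
      refine tendsto_lintegral_of_dominated_convergence (fun _ => (M : ℝ≥0∞)) (fun n => by fun_prop)
        (fun n => .of_forall fun x => min_le_right _ _) (by simp) (.of_forall fun x => ?_)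
      refine Tendsto.min (ENNReal.Tendsto.const_mul (tendsto_const_nhds.add ?_) (.inr hC))
        tendsto_const_nhds
      simpa using ENNReal.Tendsto.mul_const ha (.inr (hφt x))
    exact (ge_of_tendsto' hlim hle).trans (by simp)
  have hmon : Tendsto (fun M : ℕ => ∫⁻ x, min (φ x) M ∂μ) atTop (𝓝 (∫⁻ x, φ x ∂μ)) := by
    refine lintegral_tendsto_of_tendsto_of_monotone (fun n => by fun_prop)
      (.of_forall fun x m n h => min_le_min le_rfl (by exact_mod_cast h)) (.of_forall fun x => ?_)
    have := Tendsto.min (tendsto_const_nhds (x := φ x)) ENNReal.tendsto_nat_nhds_top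
    simpa using this
  exact le_of_tendsto' hmon hM

lemma log_integral_exp_mul_le {α : Type*} [MeasurableSpace α] {m : Measure α}
    [IsProbabilityMeasure m] {f : α → ℝ} (hf : AEStronglyMeasurable f m) {N : ℝ} (hN : 0 ≤ N)
    (h : ∀ x, f x ∈ Icc (0:ℝ) 1) :
    Real.log (∫ x, Real.exp (N * f x) ∂m) ≤ (∫ x, f x ∂m) * Real.exp N := by
  have hi : Integrable f m := .of_bound hf 1 (.of_forall fun x => by
    rw [Real.norm_of_nonneg (h x).1]; exact (h x).2)
  have he : Integrable (fun x => Real.exp (N * f x)) m :=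
    .of_bound (Real.continuous_exp.comp_aestronglyMeasurable (hf.const_mul N)) (Real.exp N)
      (.of_forall fun x => by
        rw [Real.norm_of_nonneg (Real.exp_pos _).le]
        exact Real.exp_le_exp.2 (mul_le_of_le_one_right hN (h x).2))
  have h1 := integral_le_add_mul_integral he hi (A := 1) (D := Real.exp N) fun x => by
    have := convexOn_exp.2 (mem_univ (0:ℝ)) (mem_univ N) (sub_nonneg.2 (h x).2) (h x).1 (by ring)
    simp only [smul_eq_mul, mul_zero, zero_add, Real.exp_zero, mul_one] at this
    rw [mul_comm N, mul_comm _ (f x)]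
    linarith [(h x).1]
  linarith [Real.log_le_sub_one_of_pos (integral_exp_pos he)]

namespace LogHarnack

variable {E : Type*} [NormedAddCommGroup E] [SecondCountableTopology E] [MeasurableSpace E]
  [BorelSpace E] {K : ℕ → Kernel E E} [∀ n, IsMarkovKernel (K n)] {κ c : ℝ} {e : ℕ → ℝ}

lemma integral_le_of_invariant (hκ : 0 ≤ κ) (hc : 0 ≤ c) (he : ∀ n, 0 ≤ e n)
    (he0 : Tendsto e atTop (𝓝 0)) (H : ∀ n, LogHarnack (K n) κ c (e n)) {μ ν : Measure E}
    [IsProbabilityMeasure μ] [IsProbabilityMeasure ν] (hμ : ∀ n, (K n).Invariant μ)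
    (hν : ∀ n, (K n).Invariant ν) (hμi : Integrable (fun x => ‖x‖ ^ 2) μ)
    (hνi : Integrable (fun x => ‖x‖ ^ 2) ν) {g : E → ℝ} {B : ℝ} {Λ : ℝ≥0}
    (hg : ∀ x, g x ∈ Icc 0 B) (hL : LipschitzWith Λ g) :
    ∫ x, g x ∂ν ≤ Real.log (∫ x, Real.exp (g x) ∂μ)
      + κ * (2 * (∫ x, ‖x‖ ^ 2 ∂μ + ∫ x, ‖x‖ ^ 2 ∂ν)) := by
  set V := 2 * (∫ x, ‖x‖ ^ 2 ∂μ + ∫ x, ‖x‖ ^ 2 ∂ν) with hV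
  have hgi : ∀ m : Measure E, IsProbabilityMeasure m → Integrable g m := fun m _ =>
    .of_bound hL.continuous.aestronglyMeasurable B (.of_forall fun x => by
      rw [Real.norm_of_nonneg (hg x).1]; exact (hg x).2)
  have hei : ∀ m : Measure E, IsProbabilityMeasure m → Integrable (fun x => Real.exp (g x)) m :=
    fun m _ => .of_bound (Real.continuous_exp.comp hL.continuous).aestronglyMeasurable (Real.exp B)
      (.of_forall fun x => by
        rw [Real.norm_of_nonneg (Real.exp_pos _).le]; exact Real.exp_le_exp.2 (hg x).2)
  set a := ∫ x, Real.exp (g x) ∂μ with ha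
  have ha0 : 0 < a := integral_exp_pos (hei μ inferInstance)
  have key : ∀ n δ, 0 < δ → ∫ x, g x ∂ν ≤ Real.log a + (κ + Λ * (c * (e n / δ))) * V
      + Λ * (c * δ) := by
    intro n δ hδ
    have hD : 0 ≤ κ + Λ * (c * (e n / δ)) := by have := he n; positivity
    set D := κ + Λ * (c * (e n / δ))
    have hpt : ∀ ξ η : E, ∫ x, g x ∂(K n η) ≤ Real.log a + (∫ x, Real.exp (g x) ∂(K n ξ)) / a - 1
        + D * (2 * ‖ξ‖ ^ 2 + 2 * ‖η‖ ^ 2) + Λ * (c * δ) := by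
      intro ξ η
      have h1 := H n ξ η g B Λ hg hL δ hδ
      have hb0 : 0 < ∫ x, Real.exp (g x) ∂(K n ξ) := integral_exp_pos (hei _ inferInstance)
      have h2 := Real.log_le_sub_one_of_pos (div_pos hb0 ha0)
      rw [Real.log_div hb0.ne' ha0.ne'] at h2
      have h3 : ‖ξ - η‖ ^ 2 ≤ 2 * ‖ξ‖ ^ 2 + 2 * ‖η‖ ^ 2 := by
        nlinarith [norm_sub_le ξ η, norm_nonneg (ξ - η), norm_nonneg ξ, norm_nonneg η,
          sq_nonneg (‖ξ‖ - ‖η‖)]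
      have h4 := mul_le_mul_of_nonneg_left h3 hD
      have h5 : κ * ‖ξ - η‖ ^ 2 + Λ * (c * (δ + e n * ‖ξ - η‖ ^ 2 / δ))
          = D * ‖ξ - η‖ ^ 2 + Λ * (c * δ) := by simp only [D]; ring
      linarith
    have hν' : ∀ ξ : E, ∫ x, g x ∂ν ≤ Real.log a + (∫ x, Real.exp (g x) ∂(K n ξ)) / a - 1
        + D * (2 * ‖ξ‖ ^ 2 + 2 * ∫ x, ‖x‖ ^ 2 ∂ν) + Λ * (c * δ) := by
      intro ξ
      obtain ⟨h1, h2⟩ := (K n).integral_bind (μ := ν) (f := g) (by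
        rw [(hν n).def]; exact hgi ν inferInstance)
      rw [(hν n).def] at h2
      rw [h2]
      have := integral_le_add_mul_integral h1 hνi fun η => (hpt ξ η).trans_eq
        (show _ = Real.log a + (∫ x, Real.exp (g x) ∂(K n ξ)) / a - 1 + D * (2 * ‖ξ‖ ^ 2)
          + Λ * (c * δ) + D * 2 * ‖η‖ ^ 2 by ring)
      linarith
    obtain ⟨h1, h2⟩ := (K n).integral_bind (μ := μ) (f := fun x => Real.exp (g x)) (by
      rw [(hμ n).def]; exact hei μ inferInstance)
    rw [(hμ n).def] at h2
    have h3 := integral_le_add_mul_integral ((integrable_const (∫ x, g x ∂ν)).sub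
      (h1.div_const a)) hμi (A := Real.log a - 1 + D * (2 * ∫ x, ‖x‖ ^ 2 ∂ν) + Λ * (c * δ))
      (D := D * 2) fun ξ => by simp only [Pi.sub_apply]; linarith [hν' ξ]
    rw [integral_sub' (integrable_const _) (h1.div_const a), integral_div, ← h2, ← ha,
      div_self ha0.ne'] at h3
    simp only [integral_const, probReal_univ, smul_eq_mul, one_mul] at h3
    rw [hV]
    linarith
  have key2 : ∀ δ, 0 < δ → ∫ x, g x ∂ν ≤ Real.log a + κ * V + Λ * (c * δ) := by
    intro δ hδ
    have hlim : Tendsto (fun n => Real.log a + (κ + Λ * (c * (e n / δ))) * V + Λ * (c * δ)) atTop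
        (𝓝 (Real.log a + (κ + Λ * (c * (0 / δ))) * V + Λ * (c * δ))) :=
      (((((he0.div_const δ).const_mul c).const_mul _).const_add κ).mul_const V
        |>.const_add _).add_const _
    have := ge_of_tendsto' hlim fun n => key n δ hδ
    simpa using this
  have hlim : Tendsto (fun δ : ℝ => Real.log a + κ * V + Λ * (c * δ)) (𝓝[>] 0)
      (𝓝 (Real.log a + κ * V + Λ * (c * 0))) :=
    (Continuous.tendsto (by fun_prop) 0).mono_left nhdsWithin_le_nhds
  have := ge_of_tendsto hlim (eventually_mem_nhdsWithin.mono fun δ hδ => key2 δ hδ)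
  simpa using this

lemma absolutelyContinuous_of_invariant (hκ : 0 ≤ κ) (hc : 0 ≤ c) (he : ∀ n, 0 ≤ e n)
    (he0 : Tendsto e atTop (𝓝 0)) (H : ∀ n, LogHarnack (K n) κ c (e n)) {μ ν : Measure E}
    [IsProbabilityMeasure μ] [IsProbabilityMeasure ν] (hμ : ∀ n, (K n).Invariant μ)
    (hν : ∀ n, (K n).Invariant ν) (hμi : Integrable (fun x => ‖x‖ ^ 2) μ)
    (hνi : Integrable (fun x => ‖x‖ ^ 2) ν) : ν ≪ μ := by
  set V := κ * (2 * (∫ x, ‖x‖ ^ 2 ∂μ + ∫ x, ‖x‖ ^ 2 ∂ν)) with hV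
  have hF : ∀ F : Set E, IsClosed F → μ F = 0 → ν F = 0 := by
    intro F hF hμF
    have hN : ∀ N : ℕ, N * ν.real F ≤ V := by
      intro N
      have hδ : ∀ n : ℕ, (0:ℝ) < 1 / (n + 1) := fun n => by positivity
      have hm := fun (m : Measure E) (_ : IsProbabilityMeasure m) =>
        tendsto_integral_thickenedIndicator_of_isClosed m hF hδ
          tendsto_one_div_add_atTop_nhds_zero_nat
      have hlim := ((hm μ inferInstance).mul_const (Real.exp N)).add_const V
      have hlim' := (hm ν inferInstance).const_mul (N : ℝ)
      rw [Measure.real, hμF] at hlim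
      refine (le_of_tendsto_of_tendsto' hlim' hlim fun n => ?_).trans_eq (by simp)
      have ht : ∀ x, ((thickenedIndicator (hδ n) F x : ℝ≥0) : ℝ) ∈ Icc (0:ℝ) 1 := fun x =>
        ⟨NNReal.coe_nonneg _, by exact_mod_cast thickenedIndicator_le_one _ F x⟩
      have hti := integrable_thickenedIndicator (μ := μ) F (hδ n)
      have hL := (LipschitzWith.of_dist_le_mul (f := fun x => (thickenedIndicator (hδ n) F x : ℝ))
        (lipschitzWith_thickenedIndicator (hδ n) F).dist_le_mul).real_const_mul
          (Nat.cast_nonneg (α := ℝ) N)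
      have h1 := integral_le_of_invariant hκ hc he he0 H hμ hν hμi hνi (B := N)
        (fun x => ⟨mul_nonneg (Nat.cast_nonneg _) (ht x).1,
          mul_le_of_le_one_right (Nat.cast_nonneg _) (ht x).2⟩) hL
      rw [integral_const_mul] at h1
      have h2 := log_integral_exp_mul_le hti.1 (Nat.cast_nonneg (α := ℝ) N) ht
      linarith
    by_contra h
    have h0 : 0 < ν.real F := ENNReal.toReal_pos h (measure_ne_top _ _)
    obtain ⟨N, hN'⟩ := exists_nat_gt (V / ν.real F)
    exact absurd (hN N) (not_le.2 ((div_lt_iff₀ h0).1 hN'))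
  refine Measure.AbsolutelyContinuous.mk fun s hs hμs => ?_
  by_contra h
  obtain ⟨F, hFs, hFc, hF0⟩ := hs.exists_lt_isClosed_of_ne_top (measure_ne_top ν s)
    (pos_iff_ne_zero.2 h)
  exact hF0.ne' (hF F hFc (measure_mono_null hFs hμs))

end LogHarnack

/-- Two distinct invariant probability measures give two mutually singular ones. -/
lemma ProbabilityTheory.Kernel.Invariant.eq_of_forall_absolutelyContinuous {E : Type*}
    [MeasurableSpace E] {Q : Kernel E E} [IsMarkovKernel Q]
    (hQ : ∀ μ ν : Measure E, IsProbabilityMeasure μ → IsProbabilityMeasure ν → Q.Invariant μ →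
      Q.Invariant ν → ν ≪ μ) {μ ν : Measure E} [IsProbabilityMeasure μ] [IsProbabilityMeasure ν]
    (hμ : Q.Invariant μ) (hν : Q.Invariant ν) : μ = ν := by
  have hle : ∀ μ ν : Measure E, IsProbabilityMeasure μ → IsProbabilityMeasure ν →
      μ ≤ μ - ν + ν := by
    intro μ ν _ _
    obtain ⟨s, hs⟩ := exists_isHahnDecomposition μ ν
    have h1 : (μ - ν).restrict sᶜ + ν.restrict sᶜ = μ.restrict sᶜ := by
      rw [Measure.restrict_sub_eq_restrict_sub_restrict hs.measurableSet.compl,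
        Measure.sub_add_cancel_of_le hs.ge_on_compl]
    calc μ = μ.restrict s + μ.restrict sᶜ := (Measure.restrict_add_restrict_compl hs.1).symm
      _ ≤ ν.restrict s + ((μ - ν).restrict sᶜ + ν.restrict sᶜ) := by
          rw [h1]; exact add_le_add hs.le_on le_rfl
      _ = (μ - ν).restrict sᶜ + (ν.restrict s + ν.restrict sᶜ) := by abel
      _ ≤ _ := by
          rw [Measure.restrict_add_restrict_compl hs.1]
          exact add_le_add Measure.restrict_le_self le_rfl
  have hsub : ∀ μ ν : Measure E, IsProbabilityMeasure μ → IsProbabilityMeasure ν → Q.Invariant μ →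
      Q.Invariant ν → Q.Invariant (μ - ν) := by
    intro μ ν hμp hνp hμ hν
    have : IsFiniteMeasure (μ - ν) := isFiniteMeasure_of_le μ Measure.sub_le
    have h1 : μ - ν ≤ (μ - ν).bind Q := by
      refine Measure.sub_le_of_le_add ?_
      calc μ = μ.bind Q := hμ.def.symm
        _ ≤ (μ - ν + ν).bind Q := Measure.le_iff.2 fun s hs => by
            rw [Measure.bind_apply hs Q.aemeasurable, Measure.bind_apply hs Q.aemeasurable]
            exact lintegral_mono' (hle μ ν hμp hνp) le_rfl
        _ = _ := by rw [Measure.comp_add, hν.def]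
    exact (Measure.eq_of_le_of_measure_univ_eq h1 (by
      rw [Measure.bind_apply .univ Q.aemeasurable]; simp)).symm
  have hnorm : ∀ α : Measure E, IsFiniteMeasure α → α ≠ 0 → Q.Invariant α →
      IsProbabilityMeasure ((α univ)⁻¹ • α) ∧ Q.Invariant ((α univ)⁻¹ • α) := by
    intro α _ h0 h
    have : NeZero α := ⟨h0⟩
    exact ⟨inferInstance, by rw [Kernel.Invariant, Measure.comp_smul, h.def]⟩
  have hz : ∀ μ ν : Measure E, IsProbabilityMeasure μ → IsProbabilityMeasure ν → μ - ν = 0 →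
      μ = ν := by
    intro μ ν hμp hνp h
    have := hle μ ν hμp hνp
    rw [h, zero_add] at this
    exact Measure.eq_of_le_of_isProbabilityMeasure this
  by_contra hne
  have ha : μ - ν ≠ 0 := fun h => hne (hz μ ν inferInstance inferInstance h)
  have hb : ν - μ ≠ 0 := fun h => hne (hz ν μ inferInstance inferInstance h).symm
  have : IsFiniteMeasure (μ - ν) := isFiniteMeasure_of_le μ Measure.sub_le
  have : IsFiniteMeasure (ν - μ) := isFiniteMeasure_of_le ν Measure.sub_le
  obtain ⟨ha1, ha2⟩ := hnorm _ inferInstance ha (hsub μ ν inferInstance inferInstance hμ hν)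
  obtain ⟨hb1, hb2⟩ := hnorm _ inferInstance hb (hsub ν μ inferInstance inferInstance hν hμ)
  have hac := hQ _ _ hb1 ha1 hb2 ha2
  have hms := ((Measure.mutually_singular_measure_sub (μ := μ) (ν := ν)).smul
    (((μ - ν) univ)⁻¹)).symm.smul (((ν - μ) univ)⁻¹)
  have h0 := Measure.eq_zero_of_absolutelyContinuous_of_mutuallySingular hac hms.symm
  exact IsProbabilityMeasure.ne_zero _ h0

namespace LogHarnack

variable {E : Type*} [NormedAddCommGroup E] [CompleteSpace E] [SecondCountableTopology E]
  [MeasurableSpace E] [BorelSpace E] {K : ℕ → Kernel E E} [∀ n, IsMarkovKernel (K n)] {κ c : ℝ}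
  {e : ℕ → ℝ}

lemma exists_compact_forall_measure_thickening_le (hκ : 0 ≤ κ) (hc : 0 ≤ c)
    (he0 : Tendsto e atTop (𝓝 0)) (he : ∀ n, 0 ≤ e n) (H : ∀ n, LogHarnack (K n) κ c (e n))
    (x₀ : E) {r : ℝ} {ε δ : ℝ} (hε : 0 < ε) (hδ : 0 < δ) :
    ∃ n, ∃ C : Set E, IsCompact C ∧ ∀ y, ‖x₀ - y‖ ≤ r →
      K n y (Metric.thickening δ C)ᶜ ≤ ENNReal.ofReal ε := by
  obtain ⟨N, hN⟩ := exists_nat_gt ((κ * r ^ 2 + 3) / ε)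
  have hN0 : (0:ℝ) < N := lt_of_le_of_lt (by positivity) hN
  rw [div_lt_iff₀ hε] at hN
  set Λ : ℝ≥0 := (N : ℝ).toNNReal * δ.toNNReal⁻¹
  set δ' : ℝ := 1 / (Λ * c + 1)
  have hδ' : 0 < δ' := by positivity
  have hlim : Tendsto (fun n => Λ * (c * (e n * r ^ 2 / δ'))) atTop
      (𝓝 (Λ * (c * (0 * r ^ 2 / δ')))) :=
    (((he0.mul_const _).div_const _).const_mul c).const_mul _
  obtain ⟨n, hn⟩ := (hlim.eventually_lt_const (u := 1) (by simp)).exists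
  obtain ⟨C, hC, hCm⟩ := isTightMeasureSet_iff_exists_isCompact_measure_compl_le.1
    (isTightMeasureSet_singleton (μ := K n x₀)) (ENNReal.ofReal (Real.exp (-N)))
    (ENNReal.ofReal_pos.2 (Real.exp_pos _))
  refine ⟨n, C, hC, fun y hy => ?_⟩
  set t : E → ℝ := fun x => 1 - (thickenedIndicator hδ C x : ℝ)
  have ht : ∀ x, t x ∈ Icc (0:ℝ) 1 := fun x =>
    ⟨sub_nonneg.2 (by exact_mod_cast thickenedIndicator_le_one hδ C x),
      sub_le_self _ (NNReal.coe_nonneg _)⟩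
  have htL : LipschitzWith δ.toNNReal⁻¹ t := .of_dist_le_mul fun x y => by
    have := (lipschitzWith_thickenedIndicator hδ C).dist_le_mul x y
    rw [NNReal.dist_eq, abs_sub_comm] at this
    rw [Real.dist_eq]
    simpa [t] using this
  have hti : ∀ x, Integrable t (K n x) := fun x =>
    (integrable_const 1).sub (integrable_thickenedIndicator C hδ)
  have h1 := H n x₀ y _ _ _ (fun x => ⟨mul_nonneg hN0.le (ht x).1,
    mul_le_of_le_one_right hN0.le (ht x).2⟩) (htL.real_const_mul hN0.le) δ' hδ'
  have h2 := log_integral_exp_mul_le (hti x₀).1 hN0.le ht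
  have h3 : ∫ x, t x ∂(K n x₀) ≤ Real.exp (-N) := by
    have : ∫ x, t x ∂(K n x₀) ≤ ∫ x, indicator Cᶜ 1 x ∂(K n x₀) := by
      refine integral_mono (hti x₀) ((integrable_const 1).indicator hC.measurableSet.compl)
        fun x => ?_
      by_cases hx : x ∈ C
      · have : t x = 0 := by simp only [t]; rw [thickenedIndicator_one hδ C hx]; simp
        simp [this, hx]
      · simpa [hx] using (ht x).2
    rw [integral_indicator_one hC.measurableSet.compl] at this
    exact this.trans (ENNReal.toReal_le_of_le_ofReal (Real.exp_pos _).le (hCm _ rfl))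
  have h4 : (∫ x, t x ∂(K n x₀)) * Real.exp N ≤ 1 := by
    refine (mul_le_mul_of_nonneg_right h3 (Real.exp_pos _).le).trans_eq ?_
    rw [← Real.exp_add]; simp
  rw [integral_const_mul] at h1
  have hy2 : ‖x₀ - y‖ ^ 2 ≤ r ^ 2 := pow_le_pow_left₀ (norm_nonneg _) hy 2
  have h5 : κ * ‖x₀ - y‖ ^ 2 ≤ κ * r ^ 2 := mul_le_mul_of_nonneg_left hy2 hκ
  have h6 : Λ * (c * (δ' + e n * ‖x₀ - y‖ ^ 2 / δ')) ≤ 2 := by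
    have : Λ * (c * (e n * ‖x₀ - y‖ ^ 2 / δ')) ≤ Λ * (c * (e n * r ^ 2 / δ')) := by
      have := he n
      gcongr
    have h7 : Λ * (c * δ') ≤ 1 := by
      rw [← mul_assoc, mul_one_div]
      exact (div_le_one (by positivity)).2 (by linarith)
    rw [mul_add, mul_add]
    linarith
  have h8 : ∫ x, t x ∂(K n y) ≤ ε := by
    have : N * ∫ x, t x ∂(K n y) ≤ N * ε := by linarith
    exact le_of_mul_le_mul_left this hN0
  have hms : MeasurableSet (Metric.thickening δ C)ᶜ := Metric.isOpen_thickening.measurableSet.compl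
  have h9 : (K n y).real (Metric.thickening δ C)ᶜ ≤ ∫ x, t x ∂(K n y) := by
    rw [← integral_indicator_one hms]
    refine integral_mono ((integrable_const 1).indicator hms) (hti y) fun x => ?_
    by_cases hx : x ∈ Metric.thickening δ C
    · simpa [hx] using (ht x).1
    · have : t x = 1 := by simp only [t]; rw [thickenedIndicator_zero hδ C hx]; simp
      simp [this, hx]
  rw [← ENNReal.ofReal_toReal (measure_ne_top (K n y) _)]
  exact ENNReal.ofReal_le_ofReal (h9.trans h8)

lemma exists_compact_forall_measure_orbit_le (hκ : 0 ≤ κ) (hc : 0 ≤ c)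
    (he0 : Tendsto e atTop (𝓝 0)) (he : ∀ n, 0 ≤ e n) (H : ∀ n, LogHarnack (K n) κ c (e n))
    (hK : ∀ n k, K (n + k + 1) = K n ∘ₖ K k) (x₀ : E)
    (hR : ∀ ε : ℝ, 0 < ε → ∃ R, ∀ k, K k x₀ {x | R < ‖x‖} ≤ ENNReal.ofReal ε)
    {ε δ : ℝ} (hε : 0 < ε) (hδ : 0 < δ) :
    ∃ C : Set E, IsCompact C ∧ ∀ k, K k x₀ (Metric.thickening δ C)ᶜ ≤ ENNReal.ofReal ε := by
  obtain ⟨R, hR⟩ := hR (ε / 2) (half_pos hε)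
  obtain ⟨n, C, hC, hCn⟩ := exists_compact_forall_measure_thickening_le hκ hc he0 he H x₀
    (r := ‖x₀‖ + R) (half_pos hε) hδ
  have hex : ∀ k, ∃ D : Set E, IsCompact D ∧ K k x₀ Dᶜ ≤ ENNReal.ofReal ε := fun k => by
    obtain ⟨D, hD, h⟩ := isTightMeasureSet_iff_exists_isCompact_measure_compl_le.1
      (isTightMeasureSet_singleton (μ := K k x₀)) _ (ENNReal.ofReal_pos.2 hε)
    exact ⟨D, hD, h _ rfl⟩
  choose D hD hDk using hex
  refine ⟨C ∪ ⋃ k ∈ Finset.range (n + 1), D k, hC.union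
    ((Finset.range (n + 1)).isCompact_biUnion fun k _ => hD k), fun k => ?_⟩
  rcases lt_or_ge k (n + 1) with hk | hk
  · refine (measure_mono (compl_subset_compl.2 ?_)).trans (hDk k)
    refine (subset_union_of_subset_right ?_ _).trans (Metric.self_subset_thickening hδ _)
    exact subset_biUnion_of_mem (u := D) (by simpa using hk)
  · obtain ⟨j, rfl⟩ := Nat.exists_eq_add_of_le hk
    have hms : MeasurableSet (Metric.thickening δ C)ᶜ :=
      Metric.isOpen_thickening.measurableSet.compl
    refine (measure_mono (compl_subset_compl.2
      (Metric.thickening_subset_of_subset δ subset_union_left))).trans ?_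
    rw [show n + 1 + j = n + j + 1 by ring, hK, Kernel.comp_apply' _ _ _ hms]
    have hRm : MeasurableSet {x : E | R < ‖x‖} := measurableSet_lt measurable_const measurable_norm
    calc ∫⁻ y, K n y (Metric.thickening δ C)ᶜ ∂(K j x₀)
        ≤ ∫⁻ y, (ENNReal.ofReal (ε / 2) + indicator {x : E | R < ‖x‖} 1 y) ∂(K j x₀) := by
          refine lintegral_mono fun y => ?_
          by_cases hy : R < ‖y‖
          · exact prob_le_one.trans (by simp [hy])
          · refine (hCn y ?_).trans le_self_add
            exact (norm_sub_le _ _).trans (by linarith [not_lt.1 hy])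
      _ ≤ ENNReal.ofReal (ε / 2) + ENNReal.ofReal (ε / 2) := by
          rw [lintegral_add_left measurable_const, lintegral_indicator_one hRm]
          simpa using hR j
      _ = ENNReal.ofReal ε := by
          rw [← ENNReal.ofReal_add (by positivity) (by positivity), add_halves]

lemma isTightMeasureSet_orbit (hκ : 0 ≤ κ) (hc : 0 ≤ c)
    (he0 : Tendsto e atTop (𝓝 0)) (he : ∀ n, 0 ≤ e n) (H : ∀ n, LogHarnack (K n) κ c (e n))
    (hK : ∀ n k, K (n + k + 1) = K n ∘ₖ K k) (x₀ : E)
    (hR : ∀ ε : ℝ, 0 < ε → ∃ R, ∀ k, K k x₀ {x | R < ‖x‖} ≤ ENNReal.ofReal ε) :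
    IsTightMeasureSet (range fun k => K k x₀) := by
  rw [isTightMeasureSet_iff_exists_isCompact_measure_compl_le]
  intro ε hε
  obtain ⟨ε', hε', hsum⟩ := ENNReal.exists_pos_sum_of_countable hε.ne' ℕ
  have hδ : ∀ m : ℕ, (0:ℝ) < 1 / (m + 1) := fun m => by positivity
  choose C hC hCk using fun m => exists_compact_forall_measure_orbit_le hκ hc he0 he H hK x₀ hR
    (NNReal.coe_pos.2 (hε' m)) (hδ m)
  refine ⟨⋂ m : ℕ, Metric.cthickening (1 / ((m:ℝ) + 1)) (C m), ?_, ?_⟩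
  · refine TotallyBounded.isCompact_of_isClosed ?_
      (isClosed_iInter fun m => Metric.isClosed_cthickening)
    rw [Metric.totallyBounded_iff]
    intro ρ hρ
    obtain ⟨m, hm⟩ := exists_nat_one_div_lt (half_pos hρ)
    obtain ⟨F, hF, hFC⟩ := Metric.totallyBounded_iff.1 (hC m).totallyBounded (ρ / 2) (half_pos hρ)
    refine ⟨F, hF, fun x hx => ?_⟩
    have hx' := Metric.cthickening_subset_thickening' (half_pos hρ) hm (C m) (mem_iInter.1 hx m)
    obtain ⟨z, hz, hxz⟩ := Metric.mem_thickening_iff.1 hx'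
    obtain ⟨y, hy, hzy⟩ := mem_iUnion₂.1 (hFC hz)
    refine mem_iUnion₂.2 ⟨y, hy, ?_⟩
    rw [Metric.mem_ball] at hzy ⊢
    linarith [dist_triangle x z y]
  · rintro _ ⟨k, rfl⟩
    simp only
    rw [compl_iInter]
    refine (measure_iUnion_le _).trans ((ENNReal.tsum_le_tsum fun m => ?_).trans hsum.le)
    refine (measure_mono (compl_subset_compl.2
      (Metric.thickening_subset_cthickening _ _))).trans ((hCk m k).trans_eq ?_)
    simp

/-- The Krylov-Bogoliubov procedure. -/
lemma exists_invariant (hκ : 0 ≤ κ) (hc : 0 ≤ c)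
    (he0 : Tendsto e atTop (𝓝 0)) (he : ∀ n, 0 ≤ e n) (H : ∀ n, LogHarnack (K n) κ c (e n))
    (hK : ∀ n k, K (n + k + 1) = K n ∘ₖ K k) (x₀ : E)
    (hR : ∀ ε : ℝ, 0 < ε → ∃ R, ∀ k, K k x₀ {x | R < ‖x‖} ≤ ENNReal.ofReal ε) :
    ∃ μ : Measure E, IsProbabilityMeasure μ ∧ (K 0).Invariant μ := by
  set A : ℕ → Measure E := fun n => (n + 1 : ℝ≥0∞)⁻¹ • ∑ k ∈ Finset.range (n + 1), K k x₀ with hA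
  have hn0 : ∀ n : ℕ, ((n:ℝ≥0∞) + 1) ≠ 0 := fun n => by simp
  have hnt : ∀ n : ℕ, ((n:ℝ≥0∞) + 1) ≠ ∞ := fun n => by simp
  have hAle : ∀ n (s : Set E) (q : ℝ≥0∞), (∀ k, K k x₀ s ≤ q) → A n s ≤ q := by
    intro n s q h
    simp only [hA, Measure.smul_apply, Measure.finsetSum_apply, smul_eq_mul]
    refine (mul_le_mul_right (Finset.sum_le_sum fun k _ => h k) _).trans_eq ?_
    rw [Finset.sum_const, Finset.card_range, nsmul_eq_mul, ← mul_assoc, Nat.cast_add, Nat.cast_one,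
      ENNReal.inv_mul_cancel (hn0 n) (hnt n), one_mul]
  have hAp : ∀ n, IsProbabilityMeasure (A n) := fun n => ⟨by
    simp only [hA, Measure.smul_apply, Measure.finsetSum_apply, smul_eq_mul, measure_univ,
      Finset.sum_const, Finset.card_range, nsmul_eq_mul, mul_one, Nat.cast_add, Nat.cast_one]
    exact ENNReal.inv_mul_cancel (hn0 n) (hnt n)⟩
  have hAi : ∀ n (f : E → ℝ), (∀ k, Integrable f (K k x₀)) →
      ∫ x, f x ∂(A n) = (n + 1 : ℝ)⁻¹ * ∑ k ∈ Finset.range (n + 1), ∫ x, f x ∂(K k x₀) := by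
    intro n f hf
    rw [hA, integral_smul_measure, integral_finsetSum_measure fun k _ => hf k]
    simp [ENNReal.toReal_inv, ENNReal.toReal_add]
  let a : ℕ → ProbabilityMeasure E := fun n => ⟨A n, hAp n⟩
  have hcomp : IsCompact (closure (range a)) := by
    refine isCompact_closure_of_isTightMeasureSet ?_
    rw [isTightMeasureSet_iff_exists_isCompact_measure_compl_le]
    intro ε hε
    obtain ⟨C, hC, h⟩ := isTightMeasureSet_iff_exists_isCompact_measure_compl_le.1
      (isTightMeasureSet_orbit hκ hc he0 he H hK x₀ hR) ε hε
    refine ⟨C, hC, ?_⟩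
    rintro _ ⟨_, ⟨n, rfl⟩, rfl⟩
    exact hAle n _ _ fun k => h _ ⟨k, rfl⟩
  let U : Ultrafilter ℕ := hyperfilter ℕ
  have hU : (U : Filter ℕ) ≤ atTop := Nat.hyperfilter_le_atTop
  obtain ⟨μ, -, hμ⟩ := hcomp.ultrafilter_le_nhds (U.map a)
    (le_principal_iff.2 (mem_of_superset (range_mem_map) subset_closure))
  have hμ' : Tendsto a U (𝓝 μ) := hμ
  rw [ProbabilityMeasure.tendsto_iff_forall_integral_tendsto] at hμ'
  refine ⟨μ, inferInstance, ?_⟩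
  have key : ∀ (f : E → ℝ) (Λ : ℝ≥0), (∀ x, f x ∈ Icc (0:ℝ) 1) → LipschitzWith Λ f →
      ∫ x, f x ∂((μ : Measure E).bind (K 0)) = ∫ x, f x ∂(μ : Measure E) := by
    intro f Λ hf hL
    have hfi : ∀ m : Measure E, IsProbabilityMeasure m → Integrable f m := fun m _ =>
      .of_bound hL.continuous.aestronglyMeasurable 1 (.of_forall fun x => by
        rw [Real.norm_of_nonneg (hf x).1]; exact (hf x).2)
    have hQ : ∀ x, ∫ y, f y ∂(K 0 x) ∈ Icc (0:ℝ) 1 := fun x =>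
      ⟨integral_nonneg fun y => (hf y).1, by
        refine (integral_mono (hfi _ inferInstance) (integrable_const 1) fun y => (hf y).2).trans ?_
        simp⟩
    have hQc := (H 0).continuous_integral (fun x => inferInstance) hf hL
    have hQi : ∀ m : Measure E, IsProbabilityMeasure m → Integrable (fun x => ∫ y, f y ∂(K 0 x)) m :=
      fun m _ => .of_bound hQc.aestronglyMeasurable 1 (.of_forall fun x => by
        rw [Real.norm_of_nonneg (hQ x).1]; exact (hQ x).2)
    have h1 := hμ' (BoundedContinuousFunction.ofNormedAddCommGroup f hL.continuous 1 fun x => by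
      rw [Real.norm_of_nonneg (hf x).1]; exact (hf x).2)
    have h2 := hμ' (BoundedContinuousFunction.ofNormedAddCommGroup _ hQc 1 fun x => by
      rw [Real.norm_of_nonneg (hQ x).1]; exact (hQ x).2)
    have hstep : ∀ k, ∫ x, ∫ y, f y ∂(K 0 x) ∂(K k x₀) = ∫ x, f x ∂(K (k + 1) x₀) := by
      intro k
      have := hK 0 k
      rw [zero_add] at this
      rw [this, Kernel.integral_comp]
      rw [← this]; exact hfi _ inferInstance
    have h3 : Tendsto (fun n => ∫ x, ∫ y, f y ∂(K 0 x) ∂(A n) - ∫ x, f x ∂(A n)) atTop (𝓝 0) := by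
      have h0 : Tendsto (fun n : ℕ => (1:ℝ) / (n + 1)) atTop (𝓝 0) :=
        tendsto_one_div_add_atTop_nhds_zero_nat
      refine squeeze_zero_norm (fun n => ?_) h0
      rw [hAi n _ fun k => hQi _ inferInstance, hAi n _ fun k => hfi _ inferInstance, ← mul_sub,
        Finset.sum_congr rfl fun k _ => hstep k, ← Finset.sum_sub_distrib,
        Finset.sum_range_sub fun k => ∫ x, f x ∂(K k x₀), norm_mul, Real.norm_of_nonneg
        (by positivity), one_div]
      refine mul_le_of_le_one_right (by positivity) ?_
      have hb : ∀ k, ∫ x, f x ∂(K k x₀) ∈ Icc (0:ℝ) 1 := fun k =>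
        ⟨integral_nonneg fun y => (hf y).1, by
          refine (integral_mono (hfi _ inferInstance) (integrable_const 1)
            fun y => (hf y).2).trans ?_
          simp⟩
      rw [Real.norm_eq_abs, abs_le]
      constructor <;> linarith [(hb (n+1)).1, (hb (n+1)).2, (hb 0).1, (hb 0).2]
    have h4 := tendsto_nhds_unique (h3.mono_left hU) (h2.sub h1)
    have hbp : IsProbabilityMeasure ((μ : Measure E).bind (K 0)) := inferInstance
    rw [((K 0).integral_bind (hfi _ hbp)).2]
    exact (sub_eq_zero.1 h4.symm)
  refine ext_of_generate_finite _ (BorelSpace.measurable_eq.trans borel_eq_generateFrom_isClosed)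
    isPiSystem_isClosed (fun F hF => ?_) (by simp)
  have hδ : ∀ n : ℕ, (0:ℝ) < 1 / (n + 1) := fun n => by positivity
  have hlim := fun (m : Measure E) (_ : IsProbabilityMeasure m) =>
    tendsto_integral_thickenedIndicator_of_isClosed m hF hδ tendsto_one_div_add_atTop_nhds_zero_nat
  have h := tendsto_nhds_unique ((hlim μ inferInstance).congr fun n => (key _ _ (fun x =>
    ⟨NNReal.coe_nonneg _, by exact_mod_cast thickenedIndicator_le_one _ F x⟩)
    (lipschitzWith_thickenedIndicator (hδ n) F)).symm) (hlim _ inferInstance)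
  exact ((measureReal_eq_measureReal_iff).1 h).symm

end LogHarnack

namespace PathSDE

lemma exists_logHarnack (S : PathSDE d r₀ Ω P) : ∃ κ c : ℝ, 0 ≤ κ ∧ 0 ≤ c ∧ ∀ T : ℝ, 0 < T →
    LogHarnack (fun ξ => P.map (S.seg ξ T)) κ c (Real.exp (-(T / 2))) := by
  obtain ⟨κ, c, hκ, hc, H⟩ := S.exists_harnack
  refine ⟨κ, c, hκ, hc, fun T hT ξ η g B Λ hg hL δ hδ => ?_⟩
  have h := hL.continuous
  have h' : Continuous fun x => Real.exp (g x) := Real.continuous_exp.comp h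
  simp only
  rw [integral_map (S.stronglyMeasurable_seg' η T).measurable.aemeasurable
    h.aestronglyMeasurable, integral_map (S.stronglyMeasurable_seg' ξ T).measurable.aemeasurable
    h'.aestronglyMeasurable]
  exact H T hT ξ η g B Λ hg hL δ hδ

lemma isProbabilityMeasure_map_seg (S : PathSDE d r₀ Ω P) (t : ℝ) (ξ : Seg d r₀) :
    IsProbabilityMeasure (P.map (S.seg ξ t)) :=
  have := S.hP
  Measure.isProbabilityMeasure_map (S.stronglyMeasurable_seg' ξ t).measurable.aemeasurable

/-- The transition kernel of the segment process. -/
def ker (S : PathSDE d r₀ Ω P) (t : ℝ) : Kernel (Seg d r₀) (Seg d r₀) where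
  toFun ξ := P.map (S.seg ξ t)
  measurable' := by
    rcases lt_or_ge 0 t with ht | ht
    · obtain ⟨κ, c, -, -, H⟩ := S.exists_logHarnack
      exact (H t ht).measurable (S.isProbabilityMeasure_map_seg t)
    · have : (fun ξ => P.map (S.seg ξ t)) = Measure.dirac := by
        funext ξ
        have := S.hP
        have h : S.seg ξ t = fun _ => ξ := funext fun ω => by
          have := S.seg_zero ξ ω
          simp only [seg, max_self] at this
          simp only [seg, max_eq_right ht, this]
        rw [h, Measure.map_const]
        simp
      rw [this]
      exact Measure.measurable_dirac

lemma ker_apply (S : PathSDE d r₀ Ω P) (t : ℝ) (ξ : Seg d r₀) : S.ker t ξ = P.map (S.seg ξ t) := rfl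

instance (S : PathSDE d r₀ Ω P) (t : ℝ) : IsMarkovKernel (S.ker t) :=
  ⟨S.isProbabilityMeasure_map_seg t⟩

lemma integral_ker (S : PathSDE d r₀ Ω P) {t : ℝ} (ht : 0 ≤ t) (ξ : Seg d r₀) {f : Seg d r₀ → ℝ}
    (hf : Measurable f) : ∫ x, f x ∂(S.ker t ξ) = ∫ ω, f (S.X ξ t ω) ∂P := by
  rw [ker_apply, integral_map (S.stronglyMeasurable_seg' ξ t).measurable.aemeasurable
    hf.aestronglyMeasurable]
  exact integral_congr_ae (.of_forall fun ω => by simp only [S.seg_of_nonneg ξ ht])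

lemma ker_add (S : PathSDE d r₀ Ω P) {s t : ℝ} (hs : 0 ≤ s) (ht : 0 ≤ t) :
    S.ker (s + t) = S.ker t ∘ₖ S.ker s := by
  ext ξ A hA
  have hf : Measurable (A.indicator (1 : Seg d r₀ → ℝ)) := measurable_one.indicator hA
  have h := S.hMarkov _ hf ⟨1, fun ζ => by by_cases h : ζ ∈ A <;> simp [h]⟩ s hs t ht ξ
  have hi : ∀ m : Measure (Seg d r₀), IsProbabilityMeasure m →
      Integrable (A.indicator (1 : Seg d r₀ → ℝ)) m := fun m _ =>
    (integrable_const (1:ℝ)).indicator hA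
  rw [← S.integral_ker (add_nonneg hs ht) ξ hf] at h
  simp_rw [← S.integral_ker ht _ hf] at h
  rw [← S.integral_ker hs ξ (f := fun y => ∫ x, A.indicator (1 : Seg d r₀ → ℝ) x ∂(S.ker t y))
    (hf.stronglyMeasurable.integral_kernel).measurable, ← Kernel.integral_comp (hi _ inferInstance),
    integral_indicator_one hA, integral_indicator_one hA] at h
  exact (measureReal_eq_measureReal_iff).1 h

lemma invariant_iff_forall_ker (S : PathSDE d r₀ Ω P) (μ : Measure (Seg d r₀)) :
    S.Invariant μ ↔ IsProbabilityMeasure μ ∧ ∀ t, 0 ≤ t → (S.ker t).Invariant μ := by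
  have hPt : ∀ f : Seg d r₀ → ℝ, Measurable f → (∃ C, ∀ ζ, |f ζ| ≤ C) → IsProbabilityMeasure μ →
      ∀ t, 0 ≤ t → ∫ ξ, S.Pt t f ξ ∂μ = ∫ x, f x ∂(μ.bind (S.ker t)) := by
    rintro f hf ⟨C, hC⟩ _ t ht
    rw [((S.ker t).integral_bind (Integrable.of_bound hf.aestronglyMeasurable C
      (.of_forall hC))).2]
    exact integral_congr_ae (.of_forall fun ξ => (S.integral_ker ht ξ hf).symm)
  refine ⟨fun h => ⟨h.1, fun t ht => ?_⟩, fun h => ⟨h.1, fun f hf hC t ht => ?_⟩⟩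
  · have := h.1
    ext A hA
    have hf : Measurable (A.indicator (1 : Seg d r₀ → ℝ)) := measurable_one.indicator hA
    have hb : ∃ C, ∀ ζ, |A.indicator (1 : Seg d r₀ → ℝ) ζ| ≤ C :=
      ⟨1, fun ζ => by by_cases h : ζ ∈ A <;> simp [h]⟩
    have h2 := h.2 _ hf hb t ht
    rw [hPt _ hf hb h.1 t ht, integral_indicator_one hA, integral_indicator_one hA] at h2
    exact (measureReal_eq_measureReal_iff).1 h2
  · rw [hPt f hf hC h.1 t ht, (h.2 t ht).def]

lemma lintegral_norm_pow_ker_le (S : PathSDE d r₀ Ω P) (q : ℕ) : ∃ p : ℕ, q ≤ p ∧ 1 ≤ p ∧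
    ∃ (C : ℝ) (a : ℕ → ℝ≥0∞), Tendsto a atTop (𝓝 0) ∧ ∀ (n : ℕ) (ξ : Seg d r₀),
      ∫⁻ x, ENNReal.ofReal (‖x‖ ^ (2 * p)) ∂(S.ker (n + 1) ξ) ≤
        ENNReal.ofReal C * (1 + a n * ENNReal.ofReal (‖ξ‖ ^ (2 * p))) := by
  obtain ⟨p, hqp, hp, C, κ, hκ, hC, h⟩ := S.exists_moment_bound q
  refine ⟨p, hqp, hp, C, fun n => ENNReal.ofReal (Real.exp (-(κ * (n + 1)))), ?_, fun n ξ => ?_⟩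
  · rw [← ENNReal.ofReal_zero]
    refine ENNReal.tendsto_ofReal (Real.tendsto_exp_neg_atTop_nhds_zero.comp ?_)
    exact (tendsto_atTop_add_const_right _ _ tendsto_natCast_atTop_atTop).const_mul_atTop hκ
  · have hn : (0:ℝ) ≤ n + 1 := by positivity
    obtain ⟨h1, h2⟩ := h ξ (n + 1) hn
    rw [ker_apply, lintegral_map (by fun_prop) (S.stronglyMeasurable_seg' ξ _).measurable]
    simp_rw [S.seg_of_nonneg ξ hn]
    rw [← ofReal_integral_eq_lintegral_ofReal h1 (.of_forall fun ω => by positivity)]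
    refine (ENNReal.ofReal_le_ofReal h2).trans_eq ?_
    rw [ENNReal.ofReal_mul hC, ENNReal.ofReal_add zero_le_one (by positivity),
      ENNReal.ofReal_mul (Real.exp_pos _).le, ENNReal.ofReal_one]

lemma ker_invariant_nat (S : PathSDE d r₀ Ω P) {μ : Measure (Seg d r₀)}
    (h : (S.ker 1).Invariant μ) (n : ℕ) : (S.ker (n + 1)).Invariant μ := by
  induction n with
  | zero => simpa using h
  | succ n ih =>
    rw [S.ker_add (by positivity) zero_le_one]
    exact h.comp (by exact_mod_cast ih)

lemma integrable_norm_rpow (S : PathSDE d r₀ Ω P) {μ : Measure (Seg d r₀)} [IsProbabilityMeasure μ]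
    (h : (S.ker 1).Invariant μ) {r : ℝ} (hr : 0 ≤ r) : Integrable (fun x => ‖x‖ ^ r) μ := by
  obtain ⟨q, hq⟩ := exists_nat_ge r
  obtain ⟨p, hqp, hp, C, a, ha, hK⟩ := S.lintegral_norm_pow_ker_le q
  have h1 := integrable_of_forall_invariant (K := fun n : ℕ => S.ker (n + 1)) (μ := μ)
    (φ := fun x => ENNReal.ofReal (‖x‖ ^ (2 * p))) (by fun_prop) (fun x => ENNReal.ofReal_ne_top)
    ENNReal.ofReal_ne_top ha hK (S.ker_invariant_nat h)
  have h2 : Integrable (fun x : Seg d r₀ => ‖x‖ ^ (2 * p)) μ :=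
    ⟨by fun_prop, by
      rw [hasFiniteIntegral_iff_ofReal (.of_forall fun x => by positivity)]
      exact h1.trans_lt ENNReal.ofReal_lt_top⟩
  refine ((integrable_const (1:ℝ)).add h2).mono'
    ((Real.continuous_rpow_const hr).comp continuous_norm).aestronglyMeasurable
    (.of_forall fun x => ?_)
  rw [Real.norm_of_nonneg (Real.rpow_nonneg (norm_nonneg _) _)]
  simp only [Pi.add_apply]
  rcases le_total ‖x‖ 1 with hx | hx
  · have := Real.rpow_le_one (norm_nonneg x) hx hr
    have : 0 ≤ ‖x‖ ^ (2 * p) := by positivity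
    linarith
  · have h3 := Real.rpow_le_rpow_of_exponent_le hx (hq.trans (show (q:ℝ) ≤ ((2 * p : ℕ) : ℝ) by
      exact_mod_cast (by omega)))
    rw [Real.rpow_natCast] at h3
    linarith

lemma exists_forall_ker_norm_gt_le (S : PathSDE d r₀ Ω P) {ε : ℝ} (hε : 0 < ε) :
    ∃ R : ℝ, ∀ k : ℕ, S.ker (k + 1) 0 {x | R < ‖x‖} ≤ ENNReal.ofReal ε := by
  obtain ⟨p, -, hp, C, a, -, hK⟩ := S.lintegral_norm_pow_ker_le 0
  refine ⟨max 1 (C / ε), fun k => ?_⟩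
  set R := max 1 (C / ε)
  have hR0 : 0 < R := lt_of_lt_of_le one_pos (le_max_left _ _)
  have h1 := hK k 0
  rw [norm_zero, zero_pow (by omega), ENNReal.ofReal_zero, mul_zero, add_zero, mul_one] at h1
  have h2 := (mul_meas_ge_le_lintegral (μ := S.ker (k + 1) 0)
    (f := fun x : Seg d r₀ => ENNReal.ofReal (‖x‖ ^ (2 * p))) (by fun_prop)
    (ENNReal.ofReal R)).trans h1
  have hsub : {x : Seg d r₀ | R < ‖x‖} ⊆
      {x | ENNReal.ofReal R ≤ ENNReal.ofReal (‖x‖ ^ (2 * p))} := fun x hx =>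
    ENNReal.ofReal_le_ofReal (hx.le.trans
      (le_self_pow₀ ((le_max_left _ _).trans hx.le) (by omega)))
  have h3 : ENNReal.ofReal C ≤ ENNReal.ofReal R * ENNReal.ofReal ε := by
    rw [← ENNReal.ofReal_mul hR0.le]
    exact ENNReal.ofReal_le_ofReal ((div_le_iff₀ hε).1 (le_max_right _ _))
  refine (measure_mono hsub).trans ?_
  exact (ENNReal.mul_le_mul_iff_right (ENNReal.ofReal_pos.2 hR0).ne' ENNReal.ofReal_ne_top).1
    (h2.trans h3)

lemma tendsto_exp_neg_half : Tendsto (fun n : ℕ => Real.exp (-(((n:ℝ) + 1) / 2))) atTop (𝓝 0) :=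
  Real.tendsto_exp_neg_atTop_nhds_zero.comp
    ((tendsto_atTop_add_const_right _ _ tendsto_natCast_atTop_atTop).atTop_div_const two_pos)

lemma eq_of_ker_one_invariant (S : PathSDE d r₀ Ω P) {μ ν : Measure (Seg d r₀)}
    [IsProbabilityMeasure μ] [IsProbabilityMeasure ν] (hμ : (S.ker 1).Invariant μ)
    (hν : (S.ker 1).Invariant ν) : μ = ν := by
  obtain ⟨κ, c, hκ, hc, H⟩ := S.exists_logHarnack
  refine Kernel.Invariant.eq_of_forall_absolutelyContinuous (fun μ ν _ _ hμ hν => ?_) hμ hν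
  have h2 : ∀ m : Measure (Seg d r₀), IsProbabilityMeasure m → (S.ker 1).Invariant m →
      Integrable (fun x => ‖x‖ ^ 2) m := fun m _ h => by
    simpa using S.integrable_norm_rpow h zero_le_two
  exact LogHarnack.absolutelyContinuous_of_invariant (K := fun n : ℕ => S.ker (n + 1)) hκ hc
    (fun n => (Real.exp_pos _).le) tendsto_exp_neg_half (fun n => H (n + 1) (by positivity))
    (S.ker_invariant_nat hμ) (S.ker_invariant_nat hν) (h2 μ inferInstance hμ)
    (h2 ν inferInstance hν)

lemma exists_ker_one_invariant (S : PathSDE d r₀ Ω P) :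
    ∃ μ : Measure (Seg d r₀), IsProbabilityMeasure μ ∧ (S.ker 1).Invariant μ := by
  obtain ⟨κ, c, hκ, hc, H⟩ := S.exists_logHarnack
  have := LogHarnack.exists_invariant (K := fun n : ℕ => S.ker (n + 1)) hκ hc tendsto_exp_neg_half
    (fun n => (Real.exp_pos _).le) (fun n => H (n + 1) (by positivity))
    (fun n k => by
      rw [← S.ker_add (by positivity) (by positivity)]
      congr 1; push_cast; ring) 0 fun ε hε => S.exists_forall_ker_norm_gt_le hε
  simpa using this

end PathSDE

/-- **Lemma 3.1 (consequence).** Under (A1)–(A3), `P_t` has a unique invariant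
probability measure `μ∞`, and `μ∞(‖·‖_∞^p) < ∞` for every `p ≥ 1`. -/
theorem invariant_measure_polynomial_moments (S : PathSDE d r₀ Ω P) :
    ∃ μinf : Measure (Seg d r₀),
      S.Invariant μinf ∧
      (∀ ν : Measure (Seg d r₀), S.Invariant ν → ν = μinf) ∧
      ∀ p : ℝ, 1 ≤ p → Integrable (fun ξ : Seg d r₀ => ‖ξ‖ ^ p) μinf := by
  obtain ⟨μ, hμp, hμ⟩ := S.exists_ker_one_invariant
  refine ⟨μ, (S.invariant_iff_forall_ker μ).2 ⟨hμp, fun t ht => ?_⟩, fun ν hν => ?_, fun p hp =>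
    S.integrable_norm_rpow hμ (by linarith)⟩
  · refine S.eq_of_ker_one_invariant (μ := μ.bind (S.ker t)) ?_ hμ
    rw [Kernel.Invariant, Measure.comp_assoc, ← S.ker_add ht zero_le_one, add_comm,
      S.ker_add zero_le_one ht, ← Measure.comp_assoc, hμ.def]
  · obtain ⟨hνp, h⟩ := (S.invariant_iff_forall_ker ν).1 hν
    exact S.eq_of_ker_one_invariant (h 1 zero_le_one) hμ
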